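/- (Stable tensor product rule for O_n, i.e. O_n ⊂ O_n × O_n.) Let λ, μ, ν be non-negative integer partitions such that ℓ(λ) ≤ ⌊n/2⌋ and ℓ(μ) + ℓ(ν) ≤ ⌊n/2⌋. Then [E^μ_(n) ⊗ E^ν_(n), E^λ_(n)] = Σ c^λ_{αβ} c^μ_{αγ} c^ν_{βγ}, the sum over all triples of non-negative integer partitions (α, β, γ). -/

import Mathlib

open scoped BigOperators TensorProduct
open Matrix

noncomputable section

def IsPartition (f : ℕ → ℕ) : Prop :=
  (∀ ⦃i j : ℕ⦄, i ≤ j → f j ≤ f i) ∧ ∃ N, f N = 0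

def Ptn : Type := {f : ℕ → ℕ // IsPartition f}

def plen (f : ℕ → ℕ) : ℕ := sInf {k | f k = 0}

def conj (f : ℕ → ℕ) : ℕ → ℕ := fun i => Set.ncard {j | i < f j}

def double (f : ℕ → ℕ) : ℕ → ℕ := fun i => 2 * f i

def InSkew (l m : ℕ → ℕ) (i j : ℕ) : Prop := m i ≤ j ∧ j < l i

def IsLRTableau (l m nu : ℕ → ℕ) (T : ℕ → ℕ → ℕ) : Prop :=
  (∀ i, m i ≤ l i) ∧
  (∀ i j, T i j ≠ 0 ↔ InSkew l m i j) ∧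
  (∀ i j k, InSkew l m i j → InSkew l m i k → j ≤ k → T i j ≤ T i k) ∧
  (∀ i k j, InSkew l m i j → InSkew l m k j → i < k → T i j < T k j) ∧
  (∀ r, Set.ncard {p : ℕ × ℕ | T p.1 p.2 = r + 1} = nu r) ∧
  (∀ i j r, Set.ncard {p : ℕ × ℕ | (p.1 < i ∨ (p.1 = i ∧ j ≤ p.2)) ∧ T p.1 p.2 = r + 2}
          ≤ Set.ncard {p : ℕ × ℕ | (p.1 < i ∨ (p.1 = i ∧ j ≤ p.2)) ∧ T p.1 p.2 = r + 1})

def lrCoeff (l m nu : ℕ → ℕ) : ℕ := Set.ncard {T : ℕ → ℕ → ℕ | IsLRTableau l m nu T}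

section Reps

variable {G : Type*} [Group G] {V W : Type*}
  [AddCommGroup V] [Module ℂ V] [AddCommGroup W] [Module ℂ W]

def IsSubrep (ρ : Representation ℂ G V) (U : Submodule ℂ V) : Prop :=
  ∀ g : G, ∀ x ∈ U, ρ g x ∈ U

def IsIrreducibleRep (ρ : Representation ℂ G V) : Prop :=
  Nontrivial V ∧ ∀ U : Submodule ℂ V, IsSubrep ρ U → U = ⊥ ∨ U = ⊤

def equivariantMaps (π : Representation ℂ G W) (ρ : Representation ℂ G V) :
    Submodule ℂ (W →ₗ[ℂ] V) where
  carrier := {f | ∀ g : G, f ∘ₗ (π g) = (ρ g) ∘ₗ f}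
  add_mem' := by
    intro f h hf hh g
    simp only [Set.mem_setOf_eq] at *
    rw [LinearMap.add_comp, LinearMap.comp_add, hf g, hh g]
  zero_mem' := by
    intro g
    simp only [Set.mem_setOf_eq, LinearMap.zero_comp, LinearMap.comp_zero]
  smul_mem' := by
    intro c f hf g
    simp only [Set.mem_setOf_eq] at *
    rw [LinearMap.smul_comp, LinearMap.comp_smul, hf g]

def repMult (ρ : Representation ℂ G V) (π : Representation ℂ G W) : ℕ :=
  Module.finrank ℂ (equivariantMaps π ρ)

end Reps

def IsUpperUni {N : ℕ} (A : Matrix (Fin N) (Fin N) ℂ) : Prop :=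
  (∀ i, A i i = 1) ∧ ∀ i j : Fin N, (j : ℕ) < (i : ℕ) → A i j = 0

def IsGLHW (n : ℕ) (a : Fin n → ℤ) {V : Type*} [AddCommGroup V] [Module ℂ V]
    (ρ : Representation ℂ (GL (Fin n) ℂ) V) : Prop :=
  IsIrreducibleRep ρ ∧ FiniteDimensional ℂ V ∧
  ∃ v : V, v ≠ 0 ∧
    (∀ g : GL (Fin n) ℂ, IsUpperUni (g : Matrix (Fin n) (Fin n) ℂ) → ρ g v = v) ∧
    (∀ (g : GL (Fin n) ℂ) (d : Fin n → ℂ),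
      (g : Matrix (Fin n) (Fin n) ℂ) = Matrix.diagonal d →
      ρ g v = (∏ i, d i ^ (a i)) • v)

def polyWeight (n : ℕ) (lam : ℕ → ℕ) : Fin n → ℤ := fun i => (lam (i : ℕ) : ℤ)

def ratWeight (n : ℕ) (lp lm : ℕ → ℕ) : Fin n → ℤ :=
  fun i => (lp (i : ℕ) : ℤ) - (lm (n - 1 - (i : ℕ)) : ℤ)

def formGroup {ι : Type*} [Fintype ι] [DecidableEq ι] (S : Matrix ι ι ℂ) :
    Subgroup (GL ι ℂ) where
  carrier := {g | (g : Matrix ι ι ℂ)ᵀ * S * (g : Matrix ι ι ℂ) = S}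
  one_mem' := by
    simp [Matrix.transpose_one]
  mul_mem' := by
    intro a b ha hb
    set A : Matrix ι ι ℂ := (a : Matrix ι ι ℂ) with hA
    set B : Matrix ι ι ℂ := (b : Matrix ι ι ℂ) with hB
    have ha' : Aᵀ * S * A = S := ha
    have hb' : Bᵀ * S * B = S := hb
    show ((↑(a * b) : Matrix ι ι ℂ))ᵀ * S * (↑(a * b) : Matrix ι ι ℂ) = S
    have hab : (↑(a * b) : Matrix ι ι ℂ) = A * B := Units.val_mul a b
    rw [hab, Matrix.transpose_mul]
    calc Bᵀ * Aᵀ * S * (A * B) = Bᵀ * (Aᵀ * S * A) * B := by noncomm_ring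
    _ = S := by rw [ha', hb']
  inv_mem' := by
    intro a ha
    set A : Matrix ι ι ℂ := (a : Matrix ι ι ℂ) with hA
    have ha' : Aᵀ * S * A = S := ha
    set C : Matrix ι ι ℂ := ((a⁻¹ : GL ι ℂ) : Matrix ι ι ℂ) with hC
    show Cᵀ * S * C = S
    have hac : A * C = 1 := by
      rw [hA, hC, ← Units.val_mul, mul_inv_cancel, Units.val_one]
    calc Cᵀ * S * C = Cᵀ * (Aᵀ * S * A) * C := by rw [ha']
    _ = (A * C)ᵀ * S * (A * C) := by rw [Matrix.transpose_mul]; noncomm_ring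
    _ = S := by rw [hac]; simp [Matrix.transpose_one]

def symForm (n : ℕ) : Matrix (Fin n) (Fin n) ℂ :=
  Matrix.of fun i j => if (i : ℕ) + (j : ℕ) = n - 1 then 1 else 0

def sympForm (n : ℕ) : Matrix (Fin (2 * n)) (Fin (2 * n)) ℂ :=
  Matrix.of fun i j =>
    if (i : ℕ) + (j : ℕ) = 2 * n - 1 then (if (i : ℕ) < n then 1 else -1) else 0

def OGL (n : ℕ) : Subgroup (GL (Fin n) ℂ) := formGroup (symForm n)

def SpGL (n : ℕ) : Subgroup (GL (Fin (2 * n)) ℂ) := formGroup (sympForm n)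

/-- The matrix of a distinguished reflection (an element of `O_n(ℂ)` of determinant `-1`
fixing the highest weight vectors of the representations `E^mu_(n)` for
`ℓ(mu) < n/2`): for odd `n`, the reflection negating the middle basis vector; for even
`n`, the permutation swapping the two middle basis vectors. -/
def reflMatrix (n : ℕ) : Matrix (Fin n) (Fin n) ℂ :=
  Matrix.of fun i j =>
    if 2 * (i : ℕ) + 1 = n ∧ i = j then -1
    else if (2 * (i : ℕ) = n ∧ 2 * (j : ℕ) + 2 = n) ∨ (2 * (i : ℕ) + 2 = n ∧ 2 * (j : ℕ) = n)
      then 1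
    else if i = j ∧ ¬(2 * (i : ℕ) = n ∨ 2 * (i : ℕ) + 2 = n) then 1
    else 0

/-- The partition associated to `mu` (with `(mu')_1 + (mu')_2 ≤ n`): the first column
length `(mu')_1` is replaced by `n - (mu')_1`.  One has `E^{assoc n mu} = E^mu ⊗ det`. -/
def assocPtn (n : ℕ) (mu : ℕ → ℕ) : ℕ → ℕ :=
  conj (fun j => if j = 0 then n - conj mu 0 else conj mu j)

/-- `v` is a highest weight vector of weight `mu` for (the identity component of)
`O_n(ℂ)`: it is fixed by all upper triangular unipotent elements, and the diagonal
torus elements of determinant one act via the character attached to `mu`. -/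
def IsOHWvec (n : ℕ) (mu : ℕ → ℕ) {V : Type*} [AddCommGroup V] [Module ℂ V]
    (ρ : Representation ℂ (OGL n) V) (v : V) : Prop :=
  (∀ g : OGL n, IsUpperUni ((g : GL (Fin n) ℂ) : Matrix (Fin n) (Fin n) ℂ) → ρ g v = v) ∧
  (∀ (g : OGL n) (d : Fin n → ℂ),
    ((g : GL (Fin n) ℂ) : Matrix (Fin n) (Fin n) ℂ) = Matrix.diagonal d →
    (∏ i, d i) = 1 →
    ρ g v = (∏ i, d i ^ (mu (i : ℕ))) • v)

/-- `ρ` is the irreducible rational representation `E^mu_(n)` of the complex orthogonal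
group `O_n(ℂ)`, indexed by a partition `mu` with `(mu')_1 + (mu')_2 ≤ n`. -/
def IsOIrrep (n : ℕ) (mu : ℕ → ℕ) {V : Type*} [AddCommGroup V] [Module ℂ V]
    (ρ : Representation ℂ (OGL n) V) : Prop :=
  IsIrreducibleRep ρ ∧ FiniteDimensional ℂ V ∧
  (if 2 * conj mu 0 ≤ n then
    ∃ v : V, v ≠ 0 ∧ IsOHWvec n mu ρ v ∧
      (2 * conj mu 0 = n ∨
        ∀ g : OGL n, ((g : GL (Fin n) ℂ) : Matrix (Fin n) (Fin n) ℂ) = reflMatrix n →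
          ρ g v = v)
  else
    ∃ v : V, v ≠ 0 ∧ IsOHWvec n (assocPtn n mu) ρ v ∧
      (∀ g : OGL n, ((g : GL (Fin n) ℂ) : Matrix (Fin n) (Fin n) ℂ) = reflMatrix n →
        ρ g v = - v))

/-- `ρ` is the irreducible rational representation `V^mu_(2n)` of `Sp_{2n}(ℂ)` with
highest weight `mu` (a partition with at most `n` parts). -/
def IsSpHW (n : ℕ) (mu : ℕ → ℕ) {V : Type*} [AddCommGroup V] [Module ℂ V]
    (ρ : Representation ℂ (SpGL n) V) : Prop :=
  IsIrreducibleRep ρ ∧ FiniteDimensional ℂ V ∧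
  ∃ v : V, v ≠ 0 ∧
    (∀ g : SpGL n,
      IsUpperUni ((g : GL (Fin (2 * n)) ℂ) : Matrix (Fin (2 * n)) (Fin (2 * n)) ℂ) →
      ρ g v = v) ∧
    (∀ (g : SpGL n) (d : Fin (2 * n) → ℂ),
      ((g : GL (Fin (2 * n)) ℂ) : Matrix (Fin (2 * n)) (Fin (2 * n)) ℂ) = Matrix.diagonal d →
      ρ g v = (∏ i, d i ^ (mu (i : ℕ))) • v)

open Finset Submodule

local notation "Mat" m:max p:max => Matrix (Fin m) (Fin p) ℂ
local notation "Pol" m:max p:max => MvPolynomial (Fin m × Fin p) ℂ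
local notation "ORep" m:max U:max => Representation ℂ (OGL m) U
local notation "MP" s:max => MvPolynomial s ℂ
local notation "Arr" => ℕ → ℕ → ℕ
local notation "NVec" m:max => Fin m → ℕ
local notation "Vec" m:max => Fin m → ℂ
local notation "FinDim" U:max => FiniteDimensional ℂ U
local notation "δ" i:max => Pi.single i 1
local notation "Mon" m:max q:max => Fin m × Fin q →₀ ℕ
local notation "ZPol" q:max => MvPolynomial (Fin q) ℤ

/-! ### Interlacing matrices and the reflection of two adjacent columns -/

/-- Partial row sums of `e`, shifted by `al`. -/
def cum (al : ℕ → ℕ) (e : Arr) (a i : ℕ) : ℕ := al i + ∑ b ∈ range a, e i b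

/-- Semistandardness of the filling with inner shape `al` and `e i b` letters `b` in row `i`. -/
def Interl (al : ℕ → ℕ) (e : Arr) : Prop :=
  ∀ i a, cum al e (a + 1) (i + 1) ≤ cum al e a i

/-- `e` is supported in the first `m` rows and first `q` columns. -/
def SuppIn (m q : ℕ) (e : Arr) : Prop := ∀ i b, e i b ≠ 0 → i < m ∧ b < q

lemma cum_succ (al : ℕ → ℕ) (e : Arr) (a i : ℕ) : cum al e (a + 1) i = cum al e a i + e i a := by
  simp [cum, sum_range_succ, add_assoc]

lemma cum_zero (al : ℕ → ℕ) (e : Arr) (i : ℕ) : cum al e 0 i = al i := by simp [cum]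

def reflLo (al : ℕ → ℕ) (e : Arr) (k i : ℕ) : ℕ :=
  max (cum al e (k + 2) (i + 1)) (cum al e k i)

def reflHi (al : ℕ → ℕ) (e : Arr) (k i₀ x i : ℕ) : ℕ :=
  if i = i₀ then cum al e (k + 2) i - x else min (cum al e (k + 2) i) (cum al e k (i - 1))

def reflCum (al : ℕ → ℕ) (e : Arr) (k i₀ x i : ℕ) : ℕ :=
  if i < i₀ then cum al e (k + 1) i
  else reflLo al e k i + reflHi al e k i₀ x i - cum al e (k + 1) i

/-- Reflect the partial sums between columns `k` and `k + 1` in the rows from `i₀` on. -/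
def reflMat (al : ℕ → ℕ) (e : Arr) (k i₀ x : ℕ) : Arr := fun i b =>
  if b = k then reflCum al e k i₀ x i - cum al e k i
  else if b = k + 1 then cum al e (k + 2) i - reflCum al e k i₀ x i
  else e i b

/-- The condition for the reflection from row `i₀` on to be defined. -/
def ReflOK (al : ℕ → ℕ) (e : Arr) (k i₀ x : ℕ) : Prop :=
  cum al e (k + 1) i₀ + x ≤ cum al e (k + 2) i₀ ∧
    (0 < i₀ → cum al e (k + 2) i₀ ≤ x + cum al e k (i₀ - 1))

section
variable {al : ℕ → ℕ} {e : Arr} {k i₀ x : ℕ}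

local notation "cm" => cum al e
local notation "rm" => reflMat al e k i₀ x
local notation "rc" => reflCum al e k i₀ x

lemma reflCum_bounds (he : Interl al e) (h : ReflOK al e k i₀ x) (i : ℕ) :
    cm k i ≤ rc i ∧ rc i ≤ cm (k + 2) i ∧ cm (k + 2) (i + 1) ≤ rc i ∧ rc (i + 1) ≤ cm k i := by
  have a1 : cm (k + 2) (i + 1) ≤ cm (k + 1) i := he i (k + 1)
  have a2 := he i k
  have a1' : cm (k + 2) (i + 1 + 1) ≤ cm (k + 1) (i + 1) := he (i + 1) (k + 1)
  have a2' := he (i + 1) k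
  have b1 : cm (k + 2) i = _ := cum_succ al e (k + 1) i
  have b2 := cum_succ al e k i
  have b1' : cm (k + 2) (i + 1) = _ := cum_succ al e (k + 1) (i + 1)
  have b2' := cum_succ al e k (i + 1)
  obtain ⟨h1, h2⟩ := h
  have a3 : 0 < i → cm (k + 2) i ≤ cm (k + 1) (i - 1) ∧
      cm (k + 1) i ≤ cm k (i - 1) := by
    intro hi
    obtain ⟨j, rfl⟩ : ∃ j, i = j + 1 := ⟨i - 1, by omega⟩
    exact ⟨he j (k + 1), he j k⟩
  have key : ∀ j, j = i₀ → cm (k + 1) j + x ≤ cm (k + 2) j ∧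
    (0 < j → cm (k + 2) j ≤ x + cm k (j - 1)) := by rintro j rfl; exact ⟨h1, h2⟩
  have k1 := key i
  have k2 := key (i + 1)
  simp only [Nat.add_sub_cancel] at k2
  simp only [reflCum, reflLo, reflHi, Nat.add_sub_cancel]
  refine ⟨?_, ?_, ?_, ?_⟩ <;> split_ifs <;> omega

lemma cum_reflMat (he : Interl al e) (h : ReflOK al e k i₀ x) (a i : ℕ) : cum al rm a i =
      if a = k + 1 then rc i else cm a i := by
  have hb := reflCum_bounds he h i
  induction a with
  | zero => simp [cum]
  | succ a ih =>
    rw [cum_succ, ih]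
    have := cum_succ al e a i
    simp only [reflMat]
    grind

lemma interl_reflMat (he : Interl al e) (h : ReflOK al e k i₀ x) : Interl al rm := by
  intro i a
  have hb := reflCum_bounds he h i
  have := he i a
  rw [cum_reflMat he h, cum_reflMat he h]
  grind

lemma reflMat_add (he : Interl al e) (h : ReflOK al e k i₀ x) (i : ℕ) :
    rm i k + rm i (k + 1) = e i k + e i (k + 1) := by
  have hb := reflCum_bounds he h i
  have b1 : cm (k + 2) i = _ := cum_succ al e (k + 1) i
  have b2 := cum_succ al e k i
  simp [reflMat]; omega

lemma reflMat_of_lt (i b : ℕ) (hi : i < i₀) : rm i b = e i b := by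
  have b1 : cm (k + 2) i = _ := cum_succ al e (k + 1) i
  have b2 := cum_succ al e k i
  simp only [reflMat, reflCum, hi, if_true]
  grind

lemma reflMat_of_ne (i b : ℕ) (h1 : b ≠ k) (h2 : b ≠ k + 1) : rm i b = e i b := by
  simp [reflMat, h1, h2]

lemma reflOK_reflMat (he : Interl al e) (h : ReflOK al e k i₀ x) : ReflOK al rm k i₀ x := by
  have hb := reflCum_bounds he h i₀
  have a1 : cm (k + 2) (i₀ + 1) ≤ cm (k + 1) i₀ := he i₀ (k + 1)
  have b1 : cm (k + 2) i₀ = _ := cum_succ al e (k + 1) i₀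
  have b2 := cum_succ al e k i₀
  have b0 := he i₀ k
  refine ⟨?_, ?_⟩
  · rw [cum_reflMat he h, cum_reflMat he h]
    have := h.1
    simp [reflCum, reflLo, reflHi]; omega
  · intro h0
    rw [cum_reflMat he h, cum_reflMat he h]
    have := h.2 h0
    simp; omega

lemma reflMat_reflMat (he : Interl al e) (h : ReflOK al e k i₀ x) : reflMat al rm k i₀ x = e := by
  have key : ∀ i, reflCum al rm k i₀ x i = cm (k + 1) i := by
    intro i
    have hb := reflCum_bounds he h i
    have a1 : cm (k + 2) (i + 1) ≤ cm (k + 1) i := he i (k + 1)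
    have b1 : cm (k + 2) i = _ := cum_succ al e (k + 1) i
    have b2 := cum_succ al e k i
    have k1 : i = i₀ → cm (k + 1) i + x ≤ cm (k + 2) i := by rintro rfl; exact h.1
    have a3 : 0 < i → cm (k + 1) i ≤ cm k (i - 1) := by
      intro hi
      obtain ⟨j, rfl⟩ : ∃ j, i = j + 1 := ⟨i - 1, by omega⟩
      exact he j k
    have e1 : reflCum al rm k i₀ x i = if i < i₀ then rc i
      else reflLo al e k i + reflHi al e k i₀ x i - rc i := by
      simp [reflCum, reflLo, reflHi, cum_reflMat he h]
    rw [e1]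
    by_cases hi : i < i₀
    · simp [hi, reflCum]
    · simp only [hi, if_false, reflCum]
      have : cm (k + 1) i ≤ reflLo al e k i + reflHi al e k i₀ x i := by
        simp only [reflLo, reflHi]; split_ifs <;> omega
      omega
  funext i b
  have b1 : cm (k + 2) i = _ := cum_succ al e (k + 1) i
  have b2 := cum_succ al e k i
  simp only [reflMat, key]
  by_cases h1 : b = k
  · subst h1
    rw [if_pos rfl]
    have := cum_reflMat he h b i
    grind
  · by_cases h2 : b = k + 1
    · subst h2
      simp only [if_neg h1, if_true]
      have := cum_reflMat he h (k + 2) i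
      grind
    · simp [h1, h2]

lemma cum_of_le {m q : ℕ} (hs : SuppIn m q e) {i : ℕ} (hi : m ≤ i) (a : ℕ) : cm a i = al i := by
  have : ∀ b, e i b = 0 := fun b => by
    by_contra h; have := (hs i b h).1; omega
  simp [cum, this]

lemma suppIn_reflMat {m q : ℕ} (hs : SuppIn m q e) (he : Interl al e)
    (h : ReflOK al e k i₀ x) (hk : k + 1 < q) : SuppIn m q rm := by
  intro i b hb
  by_cases hi : i < m
  · refine ⟨hi, ?_⟩
    by_cases h1 : b = k
    · omega
    · by_cases h2 : b = k + 1
      · omega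
      · rw [reflMat_of_ne i b h1 h2] at hb; exact (hs i b hb).2
  · exfalso
    have hadd := reflMat_add he h i
    have z : ∀ b, e i b = 0 := fun b => by
      by_contra h; exact hi (hs i b h).1
    rw [z, z] at hadd
    by_cases h1 : b = k
    · subst h1; omega
    · by_cases h2 : b = k + 1
      · subst h2; omega
      · rw [reflMat_of_ne i b h1 h2] at hb; exact hb (z b)

lemma sum_reflMat {m q : ℕ} (hs : SuppIn m q e) (he : Interl al e)
    (h : ReflOK al e k i₀ x) (him : i₀ < m) :
    ∑ i ∈ range m, rm i k + x + ∑ i ∈ range i₀, e i (k + 1) =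
      ∑ i ∈ range m, e i (k + 1) + ∑ i ∈ range i₀, e i k := by
  have key : ∀ t, i₀ ≤ t → ∑ i ∈ range (t + 1), rm i k + x +
      ∑ i ∈ range i₀, e i (k + 1) + cm k t =
      ∑ i ∈ range (t + 1), e i (k + 1) + ∑ i ∈ range i₀, e i k +
        reflLo al e k t := by
    intro t ht
    induction t, ht using Nat.le_induction with
    | base =>
      rw [sum_range_succ, sum_range_succ (fun i => e i (k + 1)),
        sum_congr rfl (fun i hi => reflMat_of_lt i k (mem_range.1 hi))]
      have hb := reflCum_bounds he h i₀
      have b1 : cm (k + 2) i₀ = _ := cum_succ al e (k + 1) i₀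
      have b2 := cum_succ al e k i₀
      have h1 := h.1
      have : rm i₀ k = rc i₀ - cm k i₀ := by
        simp [reflMat]
      rw [this]
      have a1 : cm (k + 2) (i₀ + 1) ≤ cm (k + 1) i₀ := he i₀ (k + 1)
      simp only [reflCum, reflHi, lt_irrefl, if_false, if_true, reflLo] at hb ⊢
      omega
    | succ t ht ih =>
      rw [sum_range_succ, sum_range_succ (fun i => e i (k + 1)) (t + 1)]
      have hb := reflCum_bounds he h (t + 1)
      have b1 : cm (k + 2) (t + 1) = _ := cum_succ al e (k + 1) (t + 1)
      have b2 := cum_succ al e k (t + 1)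
      have : rm (t + 1) k = rc (t + 1) - cm k (t + 1) := by
        simp [reflMat]
      rw [this]
      have a1 : cm (k + 2) (t + 1 + 1) ≤ cm (k + 1) (t + 1) := he (t + 1) (k + 1)
      have a2 := he t k
      have c1 : ¬ (t + 1 < i₀) := by omega
      have c2 : ¬ (t + 1 = i₀) := by omega
      simp only [reflCum, reflHi, c1, c2, if_false, reflLo, Nat.add_sub_cancel] at hb ih ⊢
      omega
  obtain ⟨t, rfl⟩ : ∃ t, m = t + 1 := ⟨m - 1, by omega⟩
  have h1 := key t (by omega)
  have h2 : reflLo al e k t = cm k t := by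
    have := he t k
    have h3 := cum_of_le (al := al) hs (le_refl (t + 1)) (k + 2)
    have h4 := cum_of_le (al := al) hs (le_refl (t + 1)) (k + 1)
    simp only [reflLo]; omega
  omega

end

section

open Equiv Nat

/-! ### The sign-reversing involution -/

def tr (e : Arr) : Arr := fun b i => e i b

instance (al : ℕ → ℕ) (e : Arr) : Decidable (Interl al e) := Classical.propDecidable _

def Viol (be : ℕ → ℕ) (e : Arr) (i b : ℕ) : Prop :=
  cum be (tr e) i b < cum be (tr e) (i + 1) (b + 1)

def FirstViol (be : ℕ → ℕ) (e : Arr) (i b : ℕ) : Prop :=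
  Viol be e i b ∧ (∀ j < i, ∀ c, ¬ Viol be e j c) ∧ ∀ c, b < c → ¬ Viol be e i c

lemma FirstViol.unique {be : ℕ → ℕ} {e : Arr} {i b j c : ℕ}
    (h : FirstViol be e i b) (h' : FirstViol be e j c) : i = j ∧ b = c := by
  have hij : i = j := by
    rcases lt_trichotomy i j with h1 | h1 | h1
    · exact absurd h.1 (h'.2.1 i h1 b)
    · exact h1
    · exact absurd h'.1 (h.2.1 j h1 c)
  subst hij
  refine ⟨rfl, ?_⟩
  rcases lt_trichotomy b c with h1 | h1 | h1
  · exact absurd h'.1 (h.2.2 c h1)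
  · exact h1
  · exact absurd h.1 (h'.2.2 b h1)

section
variable {m q : ℕ} {al be : ℕ → ℕ} {e : Arr}

lemma SuppIn.eq_zero_col (hs : SuppIn m q e) {i b : ℕ} (hb : q ≤ b) : e i b = 0 := by
  by_contra h; have := (hs i b h).2; omega

lemma SuppIn.eq_zero_row (hs : SuppIn m q e) {i b : ℕ} (hb : m ≤ i) : e i b = 0 := by
  by_contra h; have := (hs i b h).1; omega

lemma Viol.lt (hbe : Antitone be) (hs : SuppIn m q e) {i b : ℕ} (h : Viol be e i b) :
    b + 1 < q := by
  by_contra hb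
  have : cum be (tr e) (i + 1) (b + 1) = be (b + 1) := by
    simp [cum, tr, fun i => hs.eq_zero_col (i := i) (b := b + 1) (by omega)]
  have h2 : be b ≤ cum be (tr e) i b := by simp [cum]
  have h3 := hbe (Nat.le_succ b)
  simp only [Viol, Nat.succ_eq_add_one] at *
  omega

lemma exists_firstViol (hbe : Antitone be) (hs : SuppIn m q e) (h : ¬ Interl be (tr e)) :
    ∃ i b, FirstViol be e i b := by
  classical
  have h1 : ∃ i, ∃ b, Viol be e i b := by
    unfold Interl at h
    push Not at h
    obtain ⟨b, i, h⟩ := h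
    exact ⟨i, b, h⟩
  let i := Nat.find h1
  obtain ⟨b, hb⟩ := Nat.find_spec h1
  refine ⟨i, findGreatest (Viol be e i) q, ?_, ?_, ?_⟩
  · exact findGreatest_spec (P := Viol be e i) (by have := hb.lt hbe hs; omega : b ≤ q) hb
  · intro j hj c hc
    exact Nat.find_min h1 hj ⟨c, hc⟩
  · intro c hc hv
    have := hv.lt hbe hs
    exact Nat.findGreatest_is_greatest hc (by omega) hv

lemma FirstViol.cum_le (hbe : Antitone be) {i b : ℕ} (h : FirstViol be e i b) :
    cum be (tr e) i (b + 1) ≤ cum be (tr e) i b := by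
  rcases Nat.eq_zero_or_pos i with rfl | hi
  · simpa [cum] using hbe (le_succ b)
  · obtain ⟨j, rfl⟩ : ∃ j, i = j + 1 := ⟨i - 1, by omega⟩
    have h1 := h.2.1 j (by omega) b
    have h2 := cum_succ be (tr e) j b
    simp only [Viol] at h1
    omega

lemma FirstViol.row_lt (hbe : Antitone be) (hs : SuppIn m q e) {i b : ℕ}
    (h : FirstViol be e i b) : i < m := by
  by_contra hi
  have h1 := h.cum_le hbe
  have h2 := h.1
  have h3 := cum_succ be (tr e) i (b + 1)
  have h4 : tr e (b + 1) i = 0 := hs.eq_zero_row (by omega)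
  simp only [Viol] at h2
  omega

def violShift (be : ℕ → ℕ) (e : Arr) (i b : ℕ) : ℕ :=
  cum be (tr e) i b + 1 - cum be (tr e) i (b + 1)

lemma FirstViol.reflOK (hbe : Antitone be) (he : Interl al e) {i b : ℕ}
    (h : FirstViol be e i b) : ReflOK al e b i (violShift be e i b) := by
  have h1 := h.cum_le hbe
  have h2 := h.1
  have h3 := cum_succ be (tr e) i (b + 1)
  have h4 : cum al e (b + 2) i = _ := cum_succ al e (b + 1) i
  simp only [Viol, tr] at h2 h3
  refine ⟨?_, ?_⟩
  · simp only [violShift]; omega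
  · intro hi
    obtain ⟨j, rfl⟩ : ∃ j, i = j + 1 := ⟨i - 1, by omega⟩
    have h5 : cum al e (b + 2) (j + 1) ≤ cum al e (b + 1) j := he j (b + 1)
    have h6 := cum_succ al e b j
    have h7 := h.2.1 j (by omega) b
    have h8 := cum_succ be (tr e) j b
    simp only [Viol, tr] at h7 h8
    simp only [violShift, Nat.add_sub_cancel]
    omega

lemma cum_tr_congr {e' : Arr} {i b : ℕ} (h : ∀ j < i, e' j b = e j b) :
    cum be (tr e') i b = cum be (tr e) i b := by
  simp only [cum, tr]
  rw [sum_congr rfl (fun j hj => h j (mem_range.1 hj))]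

lemma FirstViol.reflMat (hbe : Antitone be) (he : Interl al e) {i b : ℕ} (h : FirstViol be e i b) :
    FirstViol be (reflMat al e b i (violShift be e i b)) i b ∧
    violShift be (_root_.reflMat al e b i (violShift be e i b)) i b = violShift be e i b := by
  set x := violShift be e i b with hx
  have hok := h.reflOK hbe he
  have hok' := reflOK_reflMat he hok
  set e' := _root_.reflMat al e b i x with he'
  have hlt : ∀ j c, j < i → e' j c = e j c := fun j c hj => reflMat_of_lt j c hj
  have c1 : ∀ j c, j ≤ i → cum be (tr e') j c = cum be (tr e) j c := fun j c hj =>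
    cum_tr_congr fun t ht => hlt t c (by omega)
  have hx' : violShift be e' i b = x := by
    simp only [violShift, hx, c1 i _ le_rfl]
  refine ⟨⟨?_, ?_, ?_⟩, hx'⟩
  · have h1 := hok'.1
    have h3 := cum_succ be (tr e') i (b + 1)
    have h4 : cum al e' (b + 2) i = _ := cum_succ al e' (b + 1) i
    have h5 := h.cum_le hbe
    simp only [Viol]
    rw [h3, c1 i _ le_rfl, c1 i _ le_rfl]
    simp only [tr]
    simp only [violShift] at hx
    omega
  · intro j hj c
    simp only [Viol]
    rw [c1 j _ (by omega), c1 (j + 1) _ (by omega)]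
    exact h.2.1 j hj c
  · intro c hc
    have := h.2.2 c hc
    simp only [Viol] at this ⊢
    rw [c1 i _ le_rfl, cum_succ, c1 i _ le_rfl]
    rw [cum_succ] at this
    have h7 : tr e' (c + 1) i = tr e (c + 1) i := reflMat_of_ne i (c + 1) (by omega) (by omega)
    rw [h7]; exact this

lemma finite_mats (m q : ℕ) (rho : ℕ → ℕ) :
    {e : Arr | SuppIn m q e ∧ ∀ i, ∑ b ∈ range q, e i b = rho i}.Finite := by
  classical
  let f : (Fin m → NVec q) → (Arr) := fun g i b =>
    if h : i < m ∧ b < q then g ⟨i, h.1⟩ ⟨b, h.2⟩ else 0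
  refine Set.Finite.subset ((Set.Finite.pi' (fun i : Fin m => Set.Finite.pi' (fun _ : Fin q =>
    Set.finite_Iic (rho i)))).image f) ?_
  rintro e ⟨hs, hr⟩
  refine ⟨fun i b => e i b, ?_, ?_⟩
  · intro i b
    simp only [Set.mem_Iic]
    rw [← hr i]
    exact single_le_sum (f := fun b => e i b) (fun _ _ => zero_le _)
      (mem_range.2 b.2)
  · funext i b
    simp only [f]
    split_ifs with h
    · rfl
    · by_contra h'; exact h (hs i b (Ne.symm h'))

/-- Semistandard matrices with inner shape `al`, `m` rows, `q` columns and given row sums. -/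
def mats (m q : ℕ) (al rho : ℕ → ℕ) : Finset (Arr) :=
  ((finite_mats m q rho).subset (t := {e : Arr | SuppIn m q e ∧ Interl al e ∧
    ∀ i, ∑ b ∈ range q, e i b = rho i}) (fun _ h => ⟨h.1, h.2.2⟩)).toFinset

lemma mem_mats {rho : ℕ → ℕ} : e ∈ mats m q al rho ↔
    SuppIn m q e ∧ Interl al e ∧ ∀ i, ∑ b ∈ range q, e i b = rho i := by
  simp [mats]

def colSum (m : ℕ) (e : Arr) (b : ℕ) : ℕ := ∑ i ∈ range m, e i b

lemma reflMat_mem_mats {rho : ℕ → ℕ} {k i₀ x : ℕ} (he : e ∈ mats m q al rho)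
    (h : ReflOK al e k i₀ x) (hk : k + 1 < q) : reflMat al e k i₀ x ∈ mats m q al rho := by
  rw [mem_mats] at he ⊢
  refine ⟨suppIn_reflMat he.1 he.2.1 h hk, interl_reflMat he.2.1 h, fun i => ?_⟩
  have h1 := cum_reflMat he.2.1 h q i
  rw [if_neg (by omega)] at h1
  simp only [cum] at h1
  rw [← he.2.2 i]
  omega

lemma colSum_reflMat_add {k i₀ x : ℕ} (he : Interl al e) (h : ReflOK al e k i₀ x) :
    colSum m (reflMat al e k i₀ x) k + colSum m (reflMat al e k i₀ x) (k + 1) =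
      colSum m e k + colSum m e (k + 1) := by
  simp only [colSum, ← sum_add_distrib]
  exact sum_congr rfl fun i _ => reflMat_add he h i

lemma colSum_reflMat_of_ne {k i₀ x b : ℕ} (h1 : b ≠ k) (h2 : b ≠ k + 1) :
    colSum m (reflMat al e k i₀ x) b = colSum m e b :=
  sum_congr rfl fun i _ => reflMat_of_ne i b h1 h2

/-- Column exponent of a matrix. -/
def cols (m q : ℕ) (e : Arr) : NVec q := fun b => colSum m e b

def adjSwap {q : ℕ} (k : ℕ) (hk : k + 1 < q) : Perm (Fin q) :=
  swap ⟨k, by omega⟩ ⟨k + 1, hk⟩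

lemma comp_adjSwap {X : Type*} {k : ℕ} (hk : k + 1 < q) (f g : Fin q → X)
    (h1 : g ⟨k, by omega⟩ = f ⟨k + 1, hk⟩) (h2 : g ⟨k + 1, hk⟩ = f ⟨k, by omega⟩)
    (h3 : ∀ b : Fin q, (b : ℕ) ≠ k → (b : ℕ) ≠ k + 1 → g b = f b) : g = f ∘ adjSwap k hk := by
  funext b
  simp only [Function.comp, adjSwap]
  grind

/-- Bender-Knuth symmetry for an adjacent transposition. -/
lemma card_cols_adjSwap (rho : ℕ → ℕ) {k : ℕ} (hk : k + 1 < q) (c : NVec q) :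
    ((mats m q al rho).filter fun e => cols m q e = c).card =
    ((mats m q al rho).filter fun e => cols m q e = c ∘ adjSwap k hk).card := by
  classical
  have hok : ∀ e ∈ mats m q al rho, ReflOK al e k 0 0 := by
    intro e he
    have : cum al e (k + 2) 0 = _ := cum_succ al e (k + 1) 0
    exact ⟨by omega, fun h => absurd h (lt_irrefl _)⟩
  have hcol : ∀ e ∈ mats m q al rho,
      cols m q (reflMat al e k 0 0) = cols m q e ∘ adjSwap k hk := by
    intro e he
    have h1 := mem_mats.1 he
    have h2 := hok e he
    have h3 := colSum_reflMat_add (m := m) h1.2.1 h2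
    have h4 : colSum m (reflMat al e k 0 0) k = colSum m e (k + 1) := by
      rcases Nat.eq_zero_or_pos m with rfl | hm
      · simp [colSum]
      · have := sum_reflMat h1.1 h1.2.1 h2 hm
        simpa [colSum] using this
    apply comp_adjSwap hk
    · exact h4
    · simp only [cols]; omega
    · intro b hb hb'
      exact colSum_reflMat_of_ne hb hb'
  have hss : ∀ c : NVec q, (c ∘ adjSwap k hk) ∘ adjSwap k hk = c := by
    intro c; funext b; simp [adjSwap]
  refine card_bij' (fun e _ => reflMat al e k 0 0) (fun e _ => reflMat al e k 0 0)
    ?_ ?_ ?_ ?_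
  · intro e he
    rw [mem_filter] at he ⊢
    exact ⟨reflMat_mem_mats he.1 (hok e he.1) hk, by rw [hcol e he.1, he.2]⟩
  · intro e he
    rw [mem_filter] at he ⊢
    exact ⟨reflMat_mem_mats he.1 (hok e he.1) hk, by rw [hcol e he.1, he.2, hss]⟩
  · intro e he
    rw [mem_filter] at he
    exact reflMat_reflMat (mem_mats.1 he.1).2.1 (hok e he.1)
  · intro e he
    rw [mem_filter] at he
    exact reflMat_reflMat (mem_mats.1 he.1).2.1 (hok e he.1)

lemma card_cols_perm (rho : ℕ → ℕ) (w : Perm (Fin q)) (c : NVec q) :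
    ((mats m q al rho).filter fun e => cols m q e = c ∘ w).card =
    ((mats m q al rho).filter fun e => cols m q e = c).card := by
  rcases q with _ | q
  · rw [Subsingleton.elim (c ∘ w) c]
  have hw : w ∈ Submonoid.closure (Set.range fun i : Fin q =>
      swap i.castSucc i.succ) := by
    rw [Perm.mclosure_swap_castSucc_succ]; trivial
  induction hw using Submonoid.closure_induction generalizing c with
  | mem x hx =>
    obtain ⟨i, rfl⟩ := hx
    exact (card_cols_adjSwap rho (k := i) (by omega) c).symm
  | one => rfl
  | mul x y _ _ hx hy =>
    have : c ∘ (x * y : Perm _) = (c ∘ x) ∘ y := rfl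
    rw [this, hy, hx]

def stair (q : ℕ) : NVec q := fun b => q - 1 - b

lemma strictAnti_eq_of_comp {f g : NVec q} (hf : StrictAnti f) (hg : StrictAnti g)
    (w : Perm (Fin q)) (h : f = g ∘ w) : w = 1 := by
  have hw : StrictMono w := by
    intro a b hab
    have := hf hab
    rw [h] at this
    exact hg.lt_iff_gt.1 this
  have : (hw.orderIsoOfSurjective w w.surjective) = OrderIso.refl _ := Subsingleton.elim _ _
  ext1 b
  have := congrArg (fun g => g b) this
  simpa using this

/-- Stembridge's involution: the alternating sum over all permutations reduces to matrices
satisfying the lattice condition shifted by `be`. -/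
theorem sum_sign_card (rho : ℕ → ℕ) (hbe : Antitone be) (nu : NVec q) (hnu : Antitone nu) :
    ∑ w : Perm (Fin q), (Perm.sign w : ℤ) *
      ((mats m q al rho).filter fun e => (fun b : Fin q => be b) + cols m q e + stair q =
        (nu + stair q) ∘ w).card =
    (((mats m q al rho).filter fun e => Interl be (tr e) ∧
      (fun b : Fin q => be b) + cols m q e = nu).card : ℤ) := by
  classical
  have hst : StrictAnti (stair q) := fun a b hab => by simp only [stair]; omega
  have hnus : StrictAnti (nu + stair q) := fun a b hab => by
    have h1 := hnu hab.le; have h2 := hst hab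
    simp only [Pi.add_apply]; omega
  set S : Finset (Perm (Fin q) × (Arr)) :=
    (univ ×ˢ mats m q al rho).filter fun p =>
      (fun b : Fin q => be b) + cols m q p.2 + stair q = (nu + stair q) ∘ p.1 with hS
  have h1 : ∑ w : Perm (Fin q), (Perm.sign w : ℤ) *
      ((mats m q al rho).filter fun e => (fun b : Fin q => be b) + cols m q e + stair q =
        (nu + stair q) ∘ w).card = ∑ p ∈ S, (Perm.sign p.1 : ℤ) := by
    rw [hS, sum_filter, sum_product]
    refine sum_congr rfl fun w _ => ?_
    rw [← sum_filter]
    simp only [sum_const, nsmul_eq_mul]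
    rw [mul_comm]
  rw [h1, ← sum_filter_add_sum_filter_not S (fun p => Interl be (tr p.2))]
  have h2 : ∑ p ∈ S with ¬ Interl be (tr p.2), (Perm.sign p.1 : ℤ) = 0 := by
    have hex : ∀ p ∈ S.filter (fun p => ¬ Interl be (tr p.2)),
        ∃ t : ℕ × ℕ, FirstViol be p.2 t.1 t.2 := by
      intro p hp
      rw [mem_filter, hS, mem_filter, mem_product, mem_mats] at hp
      obtain ⟨i, b, h⟩ := exists_firstViol hbe hp.1.1.2.1 hp.2
      exact ⟨(i, b), h⟩
    let T : (Perm (Fin q) × (Arr)) → ℕ × ℕ := fun p =>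
      if h : ∃ t : ℕ × ℕ, FirstViol be p.2 t.1 t.2 then h.choose else 0
    have hT : ∀ p ∈ S.filter (fun p => ¬ Interl be (tr p.2)),
        FirstViol be p.2 (T p).1 (T p).2 := by
      intro p hp
      simp only [T, dif_pos (hex p hp)]
      exact (hex p hp).choose_spec
    let g : (Perm (Fin q) × (Arr)) → (Perm (Fin q) × (Arr)) := fun p =>
      (p.1 * (if hk : (T p).2 + 1 < q then adjSwap (T p).2 hk else 1),
        reflMat al p.2 (T p).2 (T p).1 (violShift be p.2 (T p).1 (T p).2))
    have hg : ∀ p ∈ S.filter (fun p => ¬ Interl be (tr p.2)),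
        g p ∈ S.filter (fun p => ¬ Interl be (tr p.2)) ∧ T (g p) = T p ∧
          (T p).2 + 1 < q := by
      intro p hp
      have hv := hT p hp
      have hp' := hp
      rw [mem_filter, hS, mem_filter, mem_product] at hp'
      have hm := mem_mats.1 hp'.1.1.2
      have hk := hv.1.lt hbe hm.1
      have hi := hv.row_lt hbe hm.1
      have hok := hv.reflOK hbe hm.2.1
      have hv' := (hv.reflMat hbe hm.2.1).1
      have hmem : g p ∈ S.filter (fun p => ¬ Interl be (tr p.2)) := by
        rw [mem_filter, hS, mem_filter, mem_product]
        refine ⟨⟨⟨mem_univ _, reflMat_mem_mats hp'.1.1.2 hok hk⟩, ?_⟩, ?_⟩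
        · have e1 : (nu + stair q) ∘ (g p).1 = ((nu + stair q) ∘ p.1) ∘ adjSwap (T p).2 hk := by
            simp only [g, dif_pos hk]; rfl
          rw [e1, ← hp'.1.2]
          have s1 := sum_reflMat hm.1 hm.2.1 hok hi
          have s2 := colSum_reflMat_add (m := m) hm.2.1 hok
          have s3 := hv.cum_le hbe
          simp only [violShift] at s1 s2
          simp only [cum, tr] at s1 s3
          have key : colSum m (g p).2 (T p).2 + be (T p).2 + 1 =
              colSum m p.2 ((T p).2 + 1) + be ((T p).2 + 1) := by
            simp only [g, colSum, violShift, cum, tr]; omega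
          have key2 : colSum m (g p).2 (T p).2 + colSum m (g p).2 ((T p).2 + 1) =
              colSum m p.2 (T p).2 + colSum m p.2 ((T p).2 + 1) := s2
          apply comp_adjSwap hk
          · simp only [Pi.add_apply, cols, stair]; omega
          · simp only [Pi.add_apply, cols, stair]; omega
          · intro b hb hb'
            simp only [Pi.add_apply, cols]
            rw [show colSum m (g p).2 b = colSum m p.2 b from colSum_reflMat_of_ne hb hb']
        · intro hI
          exact absurd (hI (T p).2 (T p).1) (not_le.2 hv'.1)
      have huniq := (hT (g p) hmem).unique hv'
      exact ⟨hmem, Prod.ext huniq.1 huniq.2, hk⟩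
    refine sum_involution (fun p _ => g p) ?_ ?_ (fun p hp => (hg p hp).1) ?_
    · intro p hp
      have hk := (hg p hp).2.2
      have : (Perm.sign (g p).1 : ℤ) = - Perm.sign p.1 := by
        simp only [g, dif_pos hk, adjSwap, Perm.sign_mul]
        rw [Perm.sign_swap (by simp)]
        simp
      rw [this]; ring
    · intro p hp _ heq
      have hk := (hg p hp).2.2
      have h5 := congrArg Prod.fst heq
      simp only [g, dif_pos hk, adjSwap] at h5
      simp at h5
    · intro p hp
      have h6 := hg p hp
      have hv := hT p hp
      have hp' := hp
      rw [mem_filter, hS, mem_filter, mem_product] at hp'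
      have hm := mem_mats.1 hp'.1.1.2
      have hok := hv.reflOK hbe hm.2.1
      have e2 : g (g p) = ((g p).1 * (if hk : (T p).2 + 1 < q then adjSwap (T p).2 hk else 1),
        reflMat al (g p).2 (T p).2 (T p).1 (violShift be (g p).2 (T p).1 (T p).2)) := by
        rw [← h6.2.1]
      rw [e2]
      apply Prod.ext
      · simp only [g, dif_pos h6.2.2, mul_assoc, adjSwap, Equiv.swap_mul_self, mul_one]
      · show reflMat al (reflMat al _ _ _ _) _ _ (violShift be (reflMat al _ _ _ _) _ _) = _
        rw [(hv.reflMat hbe hm.2.1).2, reflMat_reflMat hm.2.1 hok]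
  rw [h2, add_zero]
  have h3 : ∀ p ∈ S.filter (fun p => Interl be (tr p.2)), p.1 = 1 := by
    intro p hp
    rw [mem_filter, hS, mem_filter, mem_product] at hp
    refine strictAnti_eq_of_comp ?_ hnus p.1 hp.1.2
    have hanti : Antitone ((fun b : Fin q => be b) + cols m q p.2) := by
      have : Antitone fun b => cum be (tr p.2) m b := antitone_nat_of_succ_le fun b => by
        have := hp.2 b m
        rw [cum_succ] at this; omega
      intro a b hab
      exact this hab
    intro a b hab
    have h1 := hanti hab.le; have h2 := hst hab
    simp only [Pi.add_apply] at *; omega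
  rw [sum_congr rfl (g := fun _ => (1 : ℤ)) (fun p hp => by rw [h3 p hp]; simp)]
  rw [sum_const, nsmul_eq_mul, mul_one]
  congr 1
  refine card_bij' (fun p _ => p.2) (fun e _ => (1, e)) ?_ ?_ ?_ ?_
  · intro p hp
    have := h3 p hp
    rw [mem_filter, hS, mem_filter, mem_product] at hp
    rw [mem_filter]
    refine ⟨hp.1.1.2, hp.2, ?_⟩
    have h4 := hp.1.2
    rw [this] at h4
    exact add_right_cancel (b := stair q) (by simpa using h4)
  · intro e he
    rw [mem_filter] at he
    rw [mem_filter, hS, mem_filter, mem_product]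
    refine ⟨⟨⟨mem_univ _, he.1⟩, ?_⟩, he.2.1⟩
    simp [he.2.2]
  · intro p hp
    exact Prod.ext (h3 p hp).symm rfl
  · intro e _; rfl

end

end

section

open MvPolynomial Equiv

/-! ### Alternants and Schur polynomials -/

section
variable {q : ℕ}

def ex (c : NVec q) : Fin q →₀ ℕ := Finsupp.equivFunOnFinite.symm c

@[simp] lemma ex_apply (c : NVec q) (b : Fin q) : ex c b = c b := rfl

lemma ex_inj {c d : NVec q} : ex c = ex d ↔ c = d :=
  Finsupp.equivFunOnFinite.symm.injective.eq_iff

lemma ex_le {c d : NVec q} : ex c ≤ ex d ↔ c ≤ d := Iff.rfl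

lemma ex_sub (c d : NVec q) : ex c - ex d = ex (c - d) := by ext b; rfl

/-- The skew Schur polynomial with inner rows `al` and row lengths `rho`. -/
def skewPoly (m q : ℕ) (al rho : ℕ → ℕ) : ZPol q :=
  ∑ e ∈ mats m q al rho, monomial (ex (cols m q e)) 1

lemma coeff_skewPoly (m : ℕ) (al rho : ℕ → ℕ) (c : NVec q) : (skewPoly m q al rho).coeff (ex c) =
      ((mats m q al rho).filter fun e => cols m q e = c).card := by
  classical
  simp only [skewPoly, coeff_sum, coeff_monomial, ex_inj]
  rw [sum_boole]

def SymmCoeff (G : ZPol q) : Prop :=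
  ∀ (w : Perm (Fin q)) (c : NVec q), G.coeff (ex (c ∘ w)) = G.coeff (ex c)

lemma symmCoeff_skewPoly (m : ℕ) (al rho : ℕ → ℕ) : SymmCoeff (skewPoly m q al rho) := by
  intro w c
  rw [coeff_skewPoly, coeff_skewPoly, card_cols_perm]

lemma symmCoeff_one : SymmCoeff (1 : ZPol q) := by
  intro w c
  simp only [coeff_one]
  have : (0 : Fin q →₀ ℕ) = ex 0 := by ext; rfl
  have h2 : (0 = c ∘ w) ↔ (0 = c) := by
    constructor
    · intro h
      funext b
      have := congrFun h (w.symm b)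
      simpa using this
    · intro h; rw [← h]; rfl
  simp only [this, ex_inj, h2]

lemma SymmCoeff.sum {ι : Type*} (s : Finset ι) (f : ι → ZPol q) (a : ι → ℤ)
    (h : ∀ i ∈ s, SymmCoeff (f i)) : SymmCoeff (∑ i ∈ s, a i • f i) := by
  intro w c
  simp only [coeff_sum, coeff_smul]
  exact sum_congr rfl fun i hi => by rw [h i hi]

lemma SymmCoeff.sub {G H : ZPol q} (hG : SymmCoeff G) (hH : SymmCoeff H) :
    SymmCoeff (G - H) := fun w c => by
  rw [coeff_sub, coeff_sub, hG, hH]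

/-- The alternant with exponent `c`. -/
def altp (c : NVec q) : ZPol q :=
  ∑ w : Perm (Fin q), monomial (ex (c ∘ w)) (Perm.sign w : ℤ)

open Classical in
lemma coeff_altp_mul (d c : NVec q) (G : ZPol q) :
    (altp d * G).coeff (ex c) = ∑ w : Perm (Fin q), (Perm.sign w : ℤ) *
      (if d ∘ w ≤ c then G.coeff (ex (c - d ∘ w)) else 0) := by
  classical
  rw [altp, sum_mul, coeff_sum]
  refine sum_congr rfl fun w _ => ?_
  rw [coeff_monomial_mul']
  simp only [ex_le, ex_sub]
  split_ifs <;> simp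

lemma comp_le_comp (w : Perm (Fin q)) {c d : NVec q} : d ∘ w ≤ c ∘ w ↔ d ≤ c := by
  constructor
  · intro h b
    have := h (w.symm b)
    simpa using this
  · intro h b; exact h _

lemma coeff_altp_mul_comp (d c : NVec q) {G : ZPol q} (hG : SymmCoeff G) (v : Perm (Fin q)) :
    (altp d * G).coeff (ex (c ∘ v)) = (Equiv.Perm.sign v : ℤ) * (altp d * G).coeff (ex c) := by
  rw [coeff_altp_mul, coeff_altp_mul, mul_sum]
  rw [← Equiv.sum_comp (Equiv.mulRight v)]
  refine sum_congr rfl fun w _ => ?_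
  have h1 : d ∘ (Equiv.mulRight v w) = (d ∘ w) ∘ v := rfl
  have h2 : c ∘ v - (d ∘ w) ∘ v = (c - d ∘ w) ∘ v := rfl
  rw [h1, comp_le_comp, h2, hG]
  simp only [coe_mulRight, Perm.sign_mul, Units.val_mul]
  ring

lemma exists_comp_strictAnti (c : NVec q) (hc : Function.Injective c) :
    ∃ w : Perm (Fin q), StrictAnti (c ∘ w) := by
  refine ⟨(Fin.revPerm).trans (Tuple.sort c), ?_⟩
  have h1 : Monotone (c ∘ Tuple.sort c) := Tuple.monotone_sort c
  have h2 : StrictMono (c ∘ Tuple.sort c) :=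
    h1.strictMono_of_injective (hc.comp (Tuple.sort c).injective)
  intro a b hab
  exact h2 (Fin.rev_lt_rev.2 hab)

lemma exists_eq_add_stair {c : NVec q} (hc : StrictAnti c) :
    ∃ nu : NVec q, Antitone nu ∧ c = nu + stair q := by
  have key : ∀ (t : ℕ) (a b : Fin q), (b : ℕ) = a + t → c b + t ≤ c a := by
    intro t
    induction t with
    | zero => intro a b h; obtain rfl : b = a := Fin.ext (by omega); simp
    | succ t ih =>
      intro a b h
      have hb : (a : ℕ) + t < q := by have := b.2; omega
      have h1 := ih a ⟨a + t, hb⟩ rfl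
      have h2 : c b < c ⟨a + t, hb⟩ := hc (Fin.lt_def.2 (show (a : ℕ) + t < (b : ℕ) by omega))
      omega
  have hge : ∀ b : Fin q, stair q b ≤ c b := by
    intro b
    have hb := b.2
    have := key (q - 1 - b) b ⟨q - 1, by omega⟩ (by simp; omega)
    simp only [stair]; omega
  refine ⟨fun b => c b - stair q b, ?_, ?_⟩
  · intro a b hab
    have h1 := key (b - a) a b (by have : (a : ℕ) ≤ b := hab; omega)
    have h2 := hge a
    have h3 := hge b
    have h4 : (a : ℕ) ≤ b := hab
    simp only [stair] at *
    omega
  · funext b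
    have := hge b
    simp only [Pi.add_apply]; omega

lemma eq_zero_of_antisymm {P : ZPol q} (h : ∀ (v : Perm (Fin q)) (c : NVec q),
      P.coeff (ex (c ∘ v)) = (Perm.sign v : ℤ) * P.coeff (ex c))
    (h0 : ∀ nu : NVec q, Antitone nu → P.coeff (ex (nu + stair q)) = 0) : P = 0 := by
  ext c
  obtain ⟨c, rfl⟩ : ∃ d, c = ex d := ⟨c, by ext; rfl⟩
  rw [coeff_zero]
  by_cases hc : Function.Injective c
  · obtain ⟨w, hw⟩ := exists_comp_strictAnti c hc
    obtain ⟨nu, hnu, hcw⟩ := exists_eq_add_stair hw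
    have h1 := h w c
    simp_all
  · simp only [Function.Injective, not_forall] at hc
    obtain ⟨a, b, hab, hne⟩ := hc
    have h1 := h (swap a b) c
    have h2 : c ∘ swap a b = c := by
      grind
    rw [h2, Perm.sign_swap hne] at h1
    simp at h1
    omega

lemma strictAnti_add_stair {nu : NVec q} (hnu : Antitone nu) : StrictAnti (nu + stair q) := by
  intro a b hab
  have h1 := hnu hab.le
  simp only [Pi.add_apply, stair]
  omega

lemma coeff_altp (al nu : NVec q) (hal : Antitone al) (hnu : Antitone nu) :
    (altp (al + stair q)).coeff (ex (nu + stair q)) = if al = nu then 1 else 0 := by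
  classical
  simp only [altp, coeff_sum, coeff_monomial, ex_inj]
  by_cases h : al = nu
  · subst h
    rw [if_pos rfl, sum_eq_single 1]
    · simp
    · intro w _ hw
      rw [if_neg]
      intro h
      exact hw (strictAnti_eq_of_comp (strictAnti_add_stair hal) (strictAnti_add_stair hal) w h.symm)
    · simp
  · rw [if_neg h]
    refine sum_eq_zero fun w _ => if_neg fun h' => h ?_
    have := strictAnti_eq_of_comp (strictAnti_add_stair hnu) (strictAnti_add_stair hal) w h'.symm
    simp_all

lemma coeff_altp_mul_skewPoly (m : ℕ) (al rho be : ℕ → ℕ) (hbe : Antitone be) (nu : NVec q)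
    (hnu : Antitone nu) :
    (altp ((fun b : Fin q => be b) + stair q) * skewPoly m q al rho).coeff (ex (nu + stair q)) =
    (((mats m q al rho).filter fun e => Interl be (tr e) ∧
      (fun b : Fin q => be b) + cols m q e = nu).card : ℤ) := by
  classical
  rw [← sum_sign_card rho hbe nu hnu, coeff_altp_mul, ← Equiv.sum_comp (Equiv.inv _)]
  refine sum_congr rfl fun w _ => ?_
  simp only [inv_apply, Perm.sign_inv]
  congr 1
  set d : NVec q := (fun b : Fin q => be b) + stair q with hd
  set c := nu + stair q
  have hdw : d ∘ ⇑w⁻¹ ≤ c ↔ d ≤ c ∘ w := by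
    rw [← comp_le_comp w]
    have : (d ∘ ⇑w⁻¹) ∘ ⇑w = d := by funext b; simp
    rw [this]
  have hs : (skewPoly m q al rho).coeff (ex (c - d ∘ ⇑w⁻¹)) =
      (skewPoly m q al rho).coeff (ex (c ∘ w - d)) := by
    rw [← symmCoeff_skewPoly m al rho w]
    congr 2
    funext b; simp
  rw [hs]
  by_cases h : d ≤ c ∘ w
  · rw [if_pos (hdw.2 h), coeff_skewPoly]
    congr 2
    ext e
    simp only [mem_filter, and_congr_right_iff]
    intro _
    rw [funext_iff, funext_iff]
    refine forall_congr' fun b => ?_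
    have := h b
    simp only [hd, Pi.sub_apply, Pi.add_apply, Function.comp] at *
    omega
  · rw [if_neg (fun h' => h (hdw.1 h'))]
    symm
    simp only [Nat.cast_eq_zero, card_eq_zero, filter_eq_empty_iff]
    intro e _ he
    apply h
    intro b
    have := congrFun he b
    simp only [hd, Pi.add_apply] at *
    omega

lemma altp_stair_ne_zero : altp (stair q) ≠ 0 := by
  intro h
  have := coeff_altp (0 : NVec q) 0 (fun _ _ _ => le_rfl) (fun _ _ _ => le_rfl)
  rw [zero_add, h] at this
  simp at this

lemma eq_of_coeff_altp {G H : ZPol q} (hG : SymmCoeff G) (hH : SymmCoeff H)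
    (h : ∀ nu : NVec q, Antitone nu → (altp (stair q) * G).coeff (ex (nu + stair q)) =
      (altp (stair q) * H).coeff (ex (nu + stair q))) : G = H := by
  have : altp (stair q) * (G - H) = 0 := by
    refine eq_zero_of_antisymm (fun v c => coeff_altp_mul_comp _ c (hG.sub hH) v) fun nu hnu => ?_
    rw [mul_sub, coeff_sub, h nu hnu, sub_self]
  have := (mul_eq_zero.1 this).resolve_left altp_stair_ne_zero
  exact sub_eq_zero.1 this

/-- A matrix satisfying both conditions with empty inner shape is diagonal. -/
lemma Interl.zero_of_lt {e : Arr} (h : Interl 0 e) {i b : ℕ} (hb : b < i) : e i b = 0 := by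
  have key : ∀ a i, a ≤ i → cum 0 e a i = 0 := by
    intro a
    induction a with
    | zero => intro i _; simp [cum]
    | succ a ih =>
      intro i hi
      obtain ⟨j, rfl⟩ : ∃ j, i = j + 1 := ⟨i - 1, by omega⟩
      have := h j a
      rw [ih j (by omega)] at this
      omega
  have h1 := key (b + 1) i hb
  rw [cum_succ] at h1
  omega

def diagMat (f : ℕ → ℕ) : Arr := fun i b => if i = b then f i else 0

lemma cum_diagMat (f : ℕ → ℕ) (a i : ℕ) : cum 0 (diagMat f) a i = if i < a then f i else 0 := by
  simp [cum, diagMat]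

lemma interl_diagMat {f : ℕ → ℕ} (hf : Antitone f) : Interl 0 (diagMat f) := by
  intro i a
  rw [cum_diagMat, cum_diagMat]
  have := hf (Nat.le_succ i)
  simp only [Nat.succ_eq_add_one] at this
  split_ifs <;> omega

lemma tr_diagMat (f : ℕ → ℕ) : tr (diagMat f) = diagMat f := by
  funext i b
  simp only [tr, diagMat]
  by_cases h : i = b
  · subst h; simp
  · simp [h, Ne.symm h]

lemma card_lattice_schur {m : ℕ} {al : ℕ → ℕ} (hal : Antitone al) (hm : ∀ i, m ≤ i → al i = 0)
    (hq : ∀ i, q ≤ i → al i = 0) (nu : NVec q) :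
    ((mats m q 0 al).filter fun e => Interl 0 (tr e) ∧ cols m q e = nu).card =
      if (fun b : Fin q => al b) = nu then 1 else 0 := by
  classical
  have hdiag : ∀ e ∈ mats m q 0 al, Interl 0 (tr e) → e = diagMat al := by
    intro e he h
    rw [mem_mats] at he
    have hz : ∀ i b, i ≠ b → e i b = 0 := by
      intro i b hib
      rcases lt_or_gt_of_ne hib with h1 | h1
      · exact h.zero_of_lt h1
      · exact he.2.1.zero_of_lt h1
    funext i b
    by_cases hib : i = b
    · subst hib
      simp only [diagMat, if_true]
      rw [← he.2.2 i]
      by_cases hi : i < q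
      · rw [sum_eq_single i (fun b _ hb => hz i b (Ne.symm hb))]
        intro h; exact absurd (mem_range.2 hi) h
      · rw [he.1.eq_zero_col (by omega), sum_eq_zero]
        grind
    · rw [hz i b hib]; simp [diagMat, hib]
  have hcol : cols m q (diagMat al) = fun b : Fin q => al b := by
    funext b
    simp only [cols, colSum, diagMat]
    simp_all
  have hmem : diagMat al ∈ mats m q 0 al := by
    rw [mem_mats]
    refine ⟨fun i b h => ?_, interl_diagMat hal, fun i => ?_⟩
    · simp only [diagMat] at h
      grind
    · simp only [diagMat]
      simp_all
  by_cases h : (fun b : Fin q => al b) = nu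
  · rw [if_pos h, card_eq_one]
    refine ⟨diagMat al, ?_⟩
    ext e
    simp only [mem_filter, mem_singleton]
    constructor
    · rintro ⟨h1, h2, _⟩; exact hdiag e h1 h2
    · rintro rfl
      exact ⟨hmem, by rw [tr_diagMat]; exact interl_diagMat hal, by rw [hcol, h]⟩
  · rw [if_neg h, card_eq_zero, filter_eq_empty_iff]
    grind

lemma zero_add_fun (c : NVec q) : (fun b : Fin q => (0 : ℕ → ℕ) b) + c = c := by
  funext b; simp

lemma coeff_altp_stair_mul_skewPoly (m : ℕ) (al rho : ℕ → ℕ) (nu : NVec q) (hnu : Antitone nu) :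
    (altp (stair q) * skewPoly m q al rho).coeff (ex (nu + stair q)) =
    (((mats m q al rho).filter fun e => Interl 0 (tr e) ∧ cols m q e = nu).card : ℤ) := by
  have := coeff_altp_mul_skewPoly m al rho 0 (fun _ _ _ => le_rfl) nu hnu
  simpa only [zero_add_fun] using this

lemma altp_stair_mul_schur {m : ℕ} {al : ℕ → ℕ} (hal : Antitone al) (hm : ∀ i, m ≤ i → al i = 0)
    (hq : ∀ i, q ≤ i → al i = 0) :
    altp (stair q) * skewPoly m q 0 al = altp ((fun b : Fin q => al b) + stair q) := by
  rw [← sub_eq_zero]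
  refine eq_zero_of_antisymm (fun v c => ?_) fun nu hnu => ?_
  · rw [coeff_sub, coeff_sub, coeff_altp_mul_comp _ _ (symmCoeff_skewPoly m 0 al), mul_sub]
    congr 1
    have := coeff_altp_mul_comp ((fun b : Fin q => al b) + stair q) c symmCoeff_one v
    simpa using this
  · rw [coeff_sub, coeff_altp_stair_mul_skewPoly _ _ _ _ hnu,
      card_lattice_schur hal hm hq, coeff_altp _ _ (fun a b hab => hal hab) hnu]
    simp

end

end

section

open MvPolynomial

/-! ### Schur expansions, the Cauchy identity and branching -/

lemma mem_mats_rows_le {m q : ℕ} {al rho : ℕ → ℕ} {e : Arr} (he : e ∈ mats m q al rho)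
    (i b : ℕ) : e i b ≤ rho i := by
  rw [mem_mats] at he
  by_cases hb : b < q
  · rw [← he.2.2 i]
    exact single_le_sum (f := fun b => e i b) (fun _ _ => Nat.zero_le _)
      (mem_range.2 hb)
  · rw [he.1.eq_zero_col (by omega)]; omega

lemma mats_congr {m m' q : ℕ} {al rho : ℕ → ℕ} (h : ∀ i, m ≤ i → rho i = 0)
    (h' : ∀ i, m' ≤ i → rho i = 0) : mats m q al rho = mats m' q al rho := by
  have key : ∀ {m m' : ℕ}, (∀ i, m' ≤ i → rho i = 0) →
      mats m q al rho ⊆ mats m' q al rho := by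
    intro m m' h' e he
    have h1 := mem_mats_rows_le he
    rw [mem_mats] at he ⊢
    refine ⟨fun i b hib => ⟨?_, (he.1 i b hib).2⟩, he.2⟩
    grind
  exact Finset.Subset.antisymm (key h') (key h)

lemma colSum_congr {m m' q : ℕ} {al rho : ℕ → ℕ} (h : ∀ i, m ≤ i → rho i = 0)
    (h' : ∀ i, m' ≤ i → rho i = 0) {n : ℕ} {e : Arr} (he : e ∈ mats n q al rho) (b : ℕ) :
    colSum m e b = colSum m' e b := by
  have key : ∀ {m m' : ℕ}, m ≤ m' → (∀ i, m ≤ i → rho i = 0) → colSum m e b = colSum m' e b := by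
    intro m m' hm h
    unfold colSum
    refine sum_subset (range_subset_range.2 hm) fun i _ hi => ?_
    have := mem_mats_rows_le he i b
    rw [h i (by simpa using hi)] at this
    omega
  grind

lemma skewPoly_congr {m m' q : ℕ} {al rho : ℕ → ℕ} (h : ∀ i, m ≤ i → rho i = 0)
    (h' : ∀ i, m' ≤ i → rho i = 0) : skewPoly m q al rho = skewPoly m' q al rho := by
  unfold skewPoly
  rw [mats_congr h h']
  refine sum_congr rfl fun e he => ?_
  have : cols m q e = cols m' q e := by
    funext b
    exact colSum_congr h h' he b
  rw [this]

/-- Restriction of a sequence to its first `q` entries. -/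
def rs (q : ℕ) (f : ℕ → ℕ) : NVec q := fun b => f b

lemma finite_ptns (q B : ℕ) : {f : Ptn | (∀ i, q ≤ i → f.1 i = 0) ∧ f.1 0 ≤ B}.Finite := by
  refine Set.Finite.of_finite_image (f := fun f : Ptn => rs q f.1) ?_ ?_
  · refine (Set.Finite.pi' (t := fun _ : Fin q => Set.Iic B) fun _ => Set.finite_Iic B).subset ?_
    rintro _ ⟨f, hf, rfl⟩ b
    exact (f.2.1 (Nat.zero_le _)).trans hf.2
  · intro f hf g hg h
    refine Subtype.ext (funext fun i => ?_)
    by_cases hi : i < q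
    · exact congrFun h ⟨i, hi⟩
    · rw [hf.1 i (by omega), hg.1 i (by omega)]

/-- Partitions with at most `q` parts, all at most `B`. -/
def ptns (q B : ℕ) : Finset Ptn := (finite_ptns q B).toFinset

lemma mem_ptns {q B : ℕ} {f : Ptn} : f ∈ ptns q B ↔ (∀ i, q ≤ i → f.1 i = 0) ∧ f.1 0 ≤ B := by
  simp [ptns]

lemma rs_inj {q B : ℕ} {f g : Ptn} (hf : f ∈ ptns q B) (hg : g ∈ ptns q B)
    (h : rs q f.1 = rs q g.1) : f = g := by
  rw [mem_ptns] at hf hg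
  refine Subtype.ext (funext fun i => ?_)
  by_cases hi : i < q
  · exact congrFun h ⟨i, hi⟩
  · rw [hf.1 i (by omega), hg.1 i (by omega)]

lemma Ptn.antitone (f : Ptn) : Antitone f.1 := fun _ _ h => f.2.1 h

/-- Extension of a finite sequence by zero. -/
def extz {q : ℕ} (c : NVec q) : ℕ → ℕ := fun i => if h : i < q then c ⟨i, h⟩ else 0

lemma extz_of_le {q : ℕ} (c : NVec q) {i : ℕ} (h : q ≤ i) : extz c i = 0 :=
  dif_neg (by omega)

lemma extz_fin {q : ℕ} (c : NVec q) (i : Fin q) : extz c i = c i := by simp [extz]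

lemma isPartition_extz {q : ℕ} {c : NVec q} (hc : Antitone c) : IsPartition (extz c) := by
  refine ⟨fun i j hij => ?_, q, extz_of_le c le_rfl⟩
  by_cases hj : j < q
  · have hi : i < q := by omega
    simp only [extz, hi, hj, dif_pos]
    exact hc hij
  · rw [extz_of_le c (by omega)]; omega

lemma rs_extz {q : ℕ} (c : NVec q) : rs q (extz c) = c := funext fun i => extz_fin c i

def mkPtn {f : ℕ → ℕ} (h : IsPartition f) : Ptn := ⟨f, h⟩

/-- The Schur polynomial of `f` in `q` variables. -/
abbrev schurP (m q : ℕ) (f : Ptn) : ZPol q := skewPoly m q 0 f.1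

/-- Number of lattice fillings. -/
def lrNum (m q : ℕ) (al rho : ℕ → ℕ) (be nu : ℕ → ℕ) : ℕ :=
  ((mats m q al rho).filter fun e => Interl be (tr e) ∧ cols m q e = rs q nu).card

lemma colSum_le_sum {m q : ℕ} {al rho : ℕ → ℕ} {e : Arr} (he : e ∈ mats m q al rho)
    (b : ℕ) : colSum m e b ≤ ∑ i ∈ range m, rho i :=
  sum_le_sum fun i _ => mem_mats_rows_le he i b

theorem skewPoly_eq_sum_schurP {m q B M : ℕ} (al rho : ℕ → ℕ)
    (hB : ∑ i ∈ range m, rho i ≤ B) (hM : q ≤ M) :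
    skewPoly m q al rho = ∑ f ∈ ptns q B, (lrNum m q al rho 0 f.1 : ℤ) • schurP M q f := by
  refine eq_of_coeff_altp (symmCoeff_skewPoly _ _ _)
    (SymmCoeff.sum _ _ _ fun f _ => symmCoeff_skewPoly _ _ _) fun nu hnu => ?_
  rw [coeff_altp_stair_mul_skewPoly _ _ _ _ hnu, mul_sum, coeff_sum]
  have h1 : ∀ f ∈ ptns q B, (altp (stair q) * ((lrNum m q al rho 0 f.1 : ℤ) • schurP M q f)).coeff
      (ex (nu + stair q)) = if rs q f.1 = nu then (lrNum m q al rho 0 f.1 : ℤ) else 0 := by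
    intro f hf
    rw [mem_ptns] at hf
    rw [mul_smul_comm, coeff_smul,
      altp_stair_mul_schur f.antitone (fun i hi => hf.1 i (by omega)) hf.1,
      coeff_altp _ _ (fun a b hab => f.antitone hab) hnu]
    simp only [smul_eq_mul, mul_ite, mul_one, mul_zero]
    rfl
  rw [sum_congr rfl h1]
  by_cases hb : ∀ b, nu b ≤ B
  · have hmem : mkPtn (isPartition_extz hnu) ∈ ptns q B := by
      rw [mem_ptns]
      refine ⟨fun i hi => extz_of_le _ hi, ?_⟩
      simp only [mkPtn, extz]
      split_ifs
      · exact hb _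
      · omega
    rw [sum_eq_single_of_mem _ hmem]
    · rw [if_pos (by exact rs_extz nu)]
      simp only [lrNum, mkPtn, rs_extz]
    · intro f hf hne
      rw [if_neg]
      intro h
      exact hne (rs_inj hf hmem (by rw [h]; exact (rs_extz nu).symm))
  · rw [sum_eq_zero]
    · simp only [Nat.cast_eq_zero, card_eq_zero, filter_eq_empty_iff]
      rintro e he ⟨_, h⟩
      apply hb
      intro b
      rw [← h]
      exact (colSum_le_sum he b).trans hB
    · intro f hf
      rw [if_neg]
      rintro rfl
      rw [mem_ptns] at hf
      exact hb fun b => (f.antitone (Nat.zero_le _)).trans hf.2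

lemma lrNum_tr {m q : ℕ} {al rho be sig : ℕ → ℕ} (hr : ∀ i, m ≤ i → rho i = 0)
    (hs : ∀ i, q ≤ i → sig i = 0) : lrNum m q al rho be sig = lrNum q m be sig al rho := by
  have key : ∀ {m q : ℕ} {al rho be sig : ℕ → ℕ}, (∀ i, m ≤ i → rho i = 0) →
      (∀ i, q ≤ i → sig i = 0) → ∀ e, e ∈ ((mats m q al rho).filter fun e =>
        Interl be (tr e) ∧ cols m q e = rs q sig) → tr e ∈ ((mats q m be sig).filter fun e =>
        Interl al (tr e) ∧ cols q m e = rs m rho) := by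
    intro m q al rho be sig hr hs e he
    rw [mem_filter, mem_mats] at he ⊢
    obtain ⟨⟨h1, h2, h3⟩, h4, h5⟩ := he
    refine ⟨⟨fun i b h => (h1 b i h).symm, h4, fun i => ?_⟩, h2, ?_⟩
    · by_cases hi : i < q
      · exact congrFun h5 ⟨i, hi⟩
      · rw [hs i (by omega)]
        exact sum_eq_zero fun b _ => h1.eq_zero_col (by omega)
    · funext b
      exact h3 b
  exact card_bij' (fun e _ => tr e) (fun e _ => tr e) (key hr hs) (key hs hr)
    (fun _ _ => rfl) (fun _ _ => rfl)

lemma lrNum_congr {m m' q : ℕ} {al rho be nu : ℕ → ℕ} (h : ∀ i, m ≤ i → rho i = 0)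
    (h' : ∀ i, m' ≤ i → rho i = 0) : lrNum m q al rho be nu = lrNum m' q al rho be nu := by
  unfold lrNum
  rw [mats_congr h h']
  congr 1
  refine filter_congr fun e he => ?_
  have : cols m q e = cols m' q e := by
    funext b
    exact colSum_congr h h' he b
  rw [this]

/-- Coefficients of Schur polynomials. -/
def gtNum (m q : ℕ) (al rho : ℕ → ℕ) (c : NVec q) : ℕ :=
  ((mats m q al rho).filter fun e => cols m q e = c).card

/-- An inner shape so steep that the semistandardness condition is vacuous. -/
def steep (p H : ℕ) : ℕ → ℕ := fun i => H * (p - i)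

lemma interl_steep {p q H : ℕ} {rho : ℕ → ℕ} {e : Arr}
    (hs : SuppIn p q e) (he : ∀ i, ∑ b ∈ range q, e i b = rho i) (hH : ∀ i, rho i ≤ H) :
    Interl (steep p H) e := by
  intro i a
  simp only [cum]
  by_cases hi : i + 1 < p
  · have h1 : ∑ b ∈ range (a + 1), e (i + 1) b ≤ H := by
      refine le_trans ?_ (hH (i + 1))
      rw [← he (i + 1)]
      refine (sum_le_sum_of_ne_zero fun b hb hne => ?_)
      exact mem_range.2 (hs _ _ hne).2
    have h2 : steep p H i = steep p H (i + 1) + H := by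
      simp only [steep]
      obtain ⟨d, hd⟩ : ∃ d, p = i + 1 + d := ⟨p - (i + 1), by omega⟩
      rw [show p - i = p - (i + 1) + 1 by omega]
      ring
    omega
  · have h1 : ∑ b ∈ range (a + 1), e (i + 1) b = 0 :=
      sum_eq_zero fun b _ => hs.eq_zero_row (by omega)
    have h2 : steep p H (i + 1) = 0 := by
      simp only [steep]
      rw [show p - (i + 1) = 0 by omega, mul_zero]
    omega

/-- Matrices with entries at most `H`. -/
def boxMat (p q H : ℕ) : Finset (Fin p × Fin q → ℕ) :=
  Fintype.piFinset fun _ => range (H + 1)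

variable {p q : ℕ} (j : Fin p × Fin q → ℕ)

def rsum : NVec p := fun a => ∑ b, j (a, b)

def csum : NVec q := fun b => ∑ a, j (a, b)

lemma le_rsum (a : Fin p) (b : Fin q) : j (a, b) ≤ rsum j a :=
  single_le_sum (f := fun b => j (a, b)) (fun _ _ => Nat.zero_le _) (mem_univ b)

lemma mem_boxMat_of_rsum {p q H : ℕ} {j : Fin p × Fin q → ℕ} (h : ∀ a, rsum j a ≤ H) :
    j ∈ boxMat p q H := by
  rw [boxMat, Fintype.mem_piFinset]
  rintro ⟨a, b⟩
  have := (le_rsum j a b).trans (h a)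
  simp only [mem_range]; omega

/-- Number of matrices with prescribed row and column sums. -/
def ctNum (p q H : ℕ) (c : NVec p) (d : NVec q) : ℕ :=
  ((boxMat p q H).filter fun j => rsum j = c ∧ csum j = d).card

/-- Extension of a finite matrix by zero. -/
def extM : Arr := fun i b =>
  if h : i < p ∧ b < q then j (⟨i, h.1⟩, ⟨b, h.2⟩) else 0

lemma suppIn_extM : SuppIn p q (extM j) := by
  intro i b h
  by_contra h'
  exact h (dif_neg h')

lemma extM_fin (a : Fin p) (b : Fin q) : extM j a b = j (a, b) := by simp [extM]

lemma sum_extM (i : ℕ) : ∑ b ∈ range q, extM j i b = extz (rsum j) i := by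
  by_cases hi : i < p
  · rw [sum_range]
    simp only [extz, hi, dif_pos, rsum]
    exact sum_congr rfl fun b _ => extM_fin j ⟨i, hi⟩ b
  · rw [extz_of_le _ (by omega)]
    exact sum_eq_zero fun b _ => (suppIn_extM j).eq_zero_row (by omega)

lemma cols_extM : cols p q (extM j) = csum j := by
  funext b
  simp only [cols, colSum, csum]
  rw [sum_range]
  exact sum_congr rfl fun a _ => extM_fin j a b

lemma extM_restrict {p q : ℕ} {e : Arr} (he : SuppIn p q e) :
    extM (fun x : Fin p × Fin q => e x.1 x.2) = e := by
  funext i b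
  simp only [extM]
  split_ifs with h
  · rfl
  · by_contra h'
    exact h (he i b (Ne.symm h'))

lemma extz_inj {q : ℕ} {c d : NVec q} (h : extz c = extz d) : c = d := by
  rw [← rs_extz c, h, rs_extz]

lemma ctNum_eq {p q H : ℕ} (c : NVec p) (d : NVec q) (hH : ∀ i, c i ≤ H) :
    ctNum p q H c d = gtNum p q (steep p H) (extz c) d := by
  have hH' : ∀ i, extz c i ≤ H := by
    intro i
    simp only [extz]
    split_ifs
    · exact hH _
    · omega
  refine card_bij' (fun j _ => extM j) (fun e _ x => e x.1 x.2) ?_ ?_ ?_ ?_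
  · intro j hj
    rw [mem_filter] at hj
    rw [mem_filter, mem_mats, cols_extM]
    have h1 : ∀ i, ∑ b ∈ range q, extM j i b = extz c i := by
      intro i; rw [sum_extM, hj.2.1]
    exact ⟨⟨suppIn_extM j, interl_steep (suppIn_extM j) h1 hH', h1⟩, hj.2.2⟩
  · intro e he
    rw [mem_filter, mem_mats] at he
    have h0 := extM_restrict he.1.1
    have h1 : rsum (fun x : Fin p × Fin q => e x.1 x.2) = c := by
      apply extz_inj
      funext i
      rw [← sum_extM, h0, he.1.2.2]
    rw [mem_filter]
    refine ⟨mem_boxMat_of_rsum fun a => by rw [h1]; exact hH a, h1, ?_⟩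
    rw [← cols_extM, h0, he.2]
  · intro j _
    funext x
    exact extM_fin j x.1 x.2
  · intro e he
    rw [mem_filter, mem_mats] at he
    exact extM_restrict he.1.1

lemma gtNum_cast {m q : ℕ} (al rho : ℕ → ℕ) (c : NVec q) :
    (gtNum m q al rho c : ℤ) = (skewPoly m q al rho).coeff (ex c) := (coeff_skewPoly _ _ _ _).symm

lemma sum_extz {p : ℕ} (c : NVec p) : ∑ i ∈ range p, extz c i = ∑ i, c i := by
  rw [sum_range]
  exact sum_congr rfl fun i _ => extz_fin c i

lemma lrNum_steep {p q M H : ℕ} (c : NVec p) (hH : ∀ i, c i ≤ H) {f : Ptn}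
    (hf : ∀ i, q ≤ i → f.1 i = 0) (hq : q ≤ M) :
    lrNum p q (steep p H) (extz c) 0 f.1 = gtNum M p 0 f.1 c := by
  have hH' : ∀ i, extz c i ≤ H := by
    intro i
    simp only [extz]
    split_ifs
    · exact hH _
    · omega
  rw [lrNum_tr (fun i hi => extz_of_le c hi) hf,
    lrNum_congr (m' := M) hf (fun i hi => hf i (by omega)), lrNum, gtNum, rs_extz]
  congr 1
  refine filter_congr fun e he => ?_
  rw [and_iff_right_iff_imp]
  intro hc
  rw [mem_mats] at he
  refine interl_steep (q := M) (rho := extz c) (fun b i h => (he.1 i b h).symm) ?_ hH'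
  intro b
  by_cases hb : b < p
  · have := congrFun hc ⟨b, hb⟩
    simp only [extz, hb, dif_pos]
    exact this
  · rw [extz_of_le _ (by omega)]
    exact sum_eq_zero fun i _ => he.1.eq_zero_col (by omega)

/-- The Cauchy identity. -/
theorem cauchy {p q B M : ℕ} (c : NVec p) (d : NVec q) (hB : ∑ i, c i ≤ B) (hM : q ≤ M) :
    (ctNum p q B c d : ℤ) =
      ∑ f ∈ ptns q B, (schurP M p f).coeff (ex c) * (schurP M q f).coeff (ex d) := by
  have hH : ∀ i, c i ≤ B := fun i =>
    (single_le_sum (fun _ _ => Nat.zero_le _) (mem_univ i)).trans hB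
  rw [ctNum_eq c d hH, gtNum_cast, skewPoly_eq_sum_schurP (B := B) (M := M) _ _
    (by rw [sum_extz]; exact hB) hM, coeff_sum]
  refine sum_congr rfl fun f hf => ?_
  rw [mem_ptns] at hf
  rw [coeff_smul, lrNum_steep c hH hf.1 hM, gtNum_cast, smul_eq_mul]

end

section

open Nat

/-! ### Littlewood-Richardson tableaux as lattice fillings -/

lemma cum_mono (m : ℕ → ℕ) (e : Arr) (i : ℕ) : Monotone fun a => cum m e a i :=
  monotone_nat_of_le_succ fun a => by rw [cum_succ]; omega

lemma Interl.cum_antitone {m : ℕ → ℕ} {e : Arr} (h : Interl m e) (a : ℕ) :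
    Antitone fun i => cum m e a i :=
  antitone_nat_of_succ_le fun i => (cum_mono m e (i + 1) (le_succ a)).trans (h i a)

/-- The letters of `T` are distributed in the rows according to `e`. -/
def Fills (m : ℕ → ℕ) (e : Arr) (T : Arr) : Prop :=
  ∀ i j r, T i j = r + 1 ↔ cum m e r i ≤ j ∧ j < cum m e (r + 1) i

/-- The tableau filled according to `e`. -/
def tabOf (m : ℕ → ℕ) (e : Arr) (i j : ℕ) : ℕ :=
  if m i ≤ j then sInf {a | j < cum m e a i} else 0

lemma fills_tabOf (m : ℕ → ℕ) (e : Arr) : Fills m e (tabOf m e) := by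
  intro i j r
  have h0 : cum m e 0 i = m i := cum_zero m e i
  have hmono := cum_mono m e i
  by_cases hm : m i ≤ j
  · rw [tabOf, if_pos hm]
    constructor
    · intro h
      have hmem : r + 1 ∈ {a | j < cum m e a i} := h ▸ sInf_mem (nonempty_of_pos_sInf
        (by omega))
      have hn : r ∉ {a | j < cum m e a i} := notMem_of_lt_sInf (by omega)
      simp only [Set.mem_ofPred_eq] at hmem hn
      omega
    · rintro ⟨h1, h2⟩
      apply le_antisymm
      · exact Nat.sInf_le h2
      · have hmem : sInf {a | j < cum m e a i} ∈ {a | j < cum m e a i} := sInf_mem ⟨r + 1, h2⟩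
        by_contra h
        have h3 : sInf {a | j < cum m e a i} ≤ r := by omega
        have h4 := hmono h3
        simp only [Set.mem_ofPred_eq] at hmem h4
        omega
  · rw [tabOf, if_neg hm]
    have := hmono (zero_le r)
    simp only at this
    omega

lemma Fills.ncard_row {m : ℕ → ℕ} {e T : Arr} (h : Fills m e T) (i b : ℕ) :
    {j | T i j = b + 1}.ncard = e i b := by
  have : {j | T i j = b + 1} = ↑(Finset.Ico (cum m e b i) (cum m e (b + 1) i)) := by
    ext j
    simp [h i j b]
  rw [this, Set.ncard_coe_finset, card_Ico, cum_succ]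
  omega

lemma Fills.ncard_read {m : ℕ → ℕ} {e T : Arr} (h : Fills m e T) (i j r : ℕ) :
    {p : ℕ × ℕ | (p.1 < i ∨ (p.1 = i ∧ j ≤ p.2)) ∧ T p.1 p.2 = r + 1}.ncard =
      (∑ k ∈ range i, e k r) + (cum m e (r + 1) i - max j (cum m e r i)) := by
  have : {p : ℕ × ℕ | (p.1 < i ∨ (p.1 = i ∧ j ≤ p.2)) ∧ T p.1 p.2 = r + 1} =
      ↑((range (i + 1)).biUnion fun k => (({k} : Finset ℕ) ×ˢ
        (Finset.Ico (if k = i then max j (cum m e r k) else cum m e r k)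
          (cum m e (r + 1) k)))) := by
    ext ⟨k, x⟩
    simp only [Set.mem_ofPred_eq, h k x r, coe_biUnion, Set.mem_iUnion, mem_coe,
      mem_range, mem_product, mem_singleton, mem_Ico]
    grind
  rw [this, Set.ncard_coe_finset, card_biUnion]
  · rw [sum_range_succ]
    simp only [card_product, card_singleton, one_mul, card_Ico, if_true]
    congr 1
    refine sum_congr rfl fun k hk => ?_
    have := mem_range.1 hk
    rw [if_neg (by omega), cum_succ]
    omega
  · intro a _ b _ hab
    rw [Function.onFun, disjoint_left]
    grind

lemma Fills.ncard_all {m : ℕ → ℕ} {e T : Arr} (h : Fills m e T) {K Q : ℕ}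
    (hs : SuppIn K Q e) (r : ℕ) : {p : ℕ × ℕ | T p.1 p.2 = r + 1}.ncard = colSum K e r := by
  have h1 := h.ncard_read K 0 r
  have h2 : {p : ℕ × ℕ | (p.1 < K ∨ (p.1 = K ∧ 0 ≤ p.2)) ∧ T p.1 p.2 = r + 1} =
      {p : ℕ × ℕ | T p.1 p.2 = r + 1} := by
    ext ⟨k, x⟩
    simp only [Set.mem_ofPred_eq, and_iff_right_iff_imp]
    intro h3
    by_contra h4
    have h5 := (h k x r).1 h3
    rw [cum_succ, hs.eq_zero_row (i := k) (by omega)] at h5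
    omega
  rw [h2] at h1
  rw [h1, cum_succ, hs.eq_zero_row (i := K) le_rfl]
  simp [colSum]

lemma isLRTableau_iff {l m nu : ℕ → ℕ} (hl : Antitone l) (hm : Antitone m) {K Q : ℕ}
    (hnu : ∀ i, Q ≤ i → nu i = 0) {e T : Arr} (hs : SuppIn K Q e)
    (hrow : ∀ i, cum m e Q i = l i) (h : Fills m e T) :
    IsLRTableau l m nu T ↔ Interl m e ∧ Interl 0 (tr e) ∧ cols K Q e = rs Q nu := by
  have hml : ∀ i, m i ≤ l i := by
    intro i
    rw [← hrow i]
    exact le_add_right _ _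
  have hcl : ∀ a i, cum m e a i ≤ l i := by
    intro a i
    rw [← hrow i]
    rcases le_total a Q with ha | ha
    · exact cum_mono m e i ha
    · refine le_of_eq ?_
      unfold cum
      congr 1
      symm
      refine sum_subset (range_subset_range.2 ha) fun b _ hb => ?_
      exact hs.eq_zero_col (by simpa using hb)
  have hml' : ∀ a i, m i ≤ cum m e a i := fun a i => le_add_right _ _
  have hskew : ∀ i j, T i j ≠ 0 ↔ InSkew l m i j := by
    intro i j
    constructor
    · intro h1
      obtain ⟨r, hr⟩ := exists_eq_succ_of_ne_zero h1
      have h2 := (h i j r).1 hr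
      have := hml' r i
      have := hcl (r + 1) i
      exact ⟨by omega, by omega⟩
    · rintro ⟨h1, h2⟩ h3
      have key : ∀ a, cum m e a i ≤ j := by
        intro a
        induction a with
        | zero => rw [cum_zero]; exact h1
        | succ a ih =>
          by_contra h4
          have := (h i j a).2 ⟨ih, by omega⟩
          omega
      have := key Q
      rw [hrow] at this
      omega
  have hle : ∀ i j a, InSkew l m i j → (T i j ≤ a ↔ j < cum m e a i) := by
    intro i j a hij
    obtain ⟨r, hr⟩ := exists_eq_succ_of_ne_zero ((hskew i j).2 hij)
    have h2 := (h i j r).1 hr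
    rw [hr]
    constructor
    · intro h3
      have := cum_mono m e i h3
      simp only at this
      exact lt_of_lt_of_le h2.2 this
    · intro h3
      by_contra h4
      have := cum_mono m e i (show a ≤ r by omega)
      simp only at this
      omega
  constructor
  · rintro ⟨-, -, -, hcol, hcont, hread⟩
    refine ⟨?_, ?_, ?_⟩
    · intro i a
      by_contra hlt
      rw [not_le] at hlt
      have g1 : InSkew l m (i + 1) (cum m e a i) :=
        ⟨(hm (le_succ i)).trans (hml' a i), lt_of_lt_of_le hlt (hcl _ _)⟩
      have g2 : InSkew l m i (cum m e a i) :=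
        ⟨hml' a i, lt_of_lt_of_le g1.2 (hl (le_succ i))⟩
      have g3 := hcol i (i + 1) _ g2 g1 (lt_succ_self i)
      have g4 := (hle _ _ (a + 1) g1).2 hlt
      have g5 : ¬ T i (cum m e a i) ≤ a := fun g => lt_irrefl _ ((hle _ _ a g2).1 g)
      omega
    · intro b i
      have := hread i (cum m e (b + 1) i) b
      rw [h.ncard_read i _ b, h.ncard_read i _ (b + 1)] at this
      have e1 : cum m e (b + 1 + 1) i = _ := cum_succ m e (b + 1) i
      have e2 := cum_succ m e b i
      rw [max_self, max_eq_left (by omega)] at this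
      simp only [cum, tr, sum_range_succ, Pi.zero_apply, zero_add]
      omega
    · funext b
      have := hcont b
      rw [h.ncard_all hs] at this
      exact this
  · rintro ⟨g1, g2, g3⟩
    refine ⟨hml, hskew, ?_, ?_, ?_, ?_⟩
    · intro i j k hj hk hjk
      rw [hle i j _ hj]
      exact lt_of_le_of_lt hjk ((hle i k _ hk).1 le_rfl)
    · intro i k j hi hk hik
      obtain ⟨r, hr⟩ := exists_eq_succ_of_ne_zero ((hskew k j).2 hk)
      have h2 := (h k j r).1 hr
      obtain ⟨k', rfl⟩ : ∃ k', k = k' + 1 := ⟨k - 1, by omega⟩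
      have h3 := g1 k' r
      have h4 := g1.cum_antitone r (show i ≤ k' by omega)
      simp only at h4
      have := (hle i j r hi).2 (by omega)
      omega
    · intro r
      rw [h.ncard_all hs]
      by_cases hr : r < Q
      · exact congrFun g3 ⟨r, hr⟩
      · rw [hnu r (by omega)]
        exact sum_eq_zero fun i _ => hs.eq_zero_col (by omega)
    · intro i j r
      rw [h.ncard_read i j r, h.ncard_read i j (r + 1)]
      have := g2 r i
      simp only [cum, tr, sum_range_succ, Pi.zero_apply, zero_add] at this
      have e1 : cum m e (r + 1 + 1) i = _ := cum_succ m e (r + 1) i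
      omega

lemma eq_Ico_of_downClosed {A : Set ℕ} (hf : A.Finite) {c : ℕ} (h1 : ∀ j ∈ A, c ≤ j)
    (h2 : ∀ j ∈ A, ∀ j', c ≤ j' → j' ≤ j → j' ∈ A) (j : ℕ) : j ∈ A ↔ c ≤ j ∧ j < c + A.ncard := by
  classical
  have hex : ∃ N, c ≤ N ∧ N ∉ A := by
    obtain ⟨N, hN⟩ := hf.bddAbove
    refine ⟨max c (N + 1), le_max_left _ _, fun h => ?_⟩
    have := hN h
    have := le_max_right c (N + 1)
    omega
  obtain ⟨g1, g2⟩ := Nat.find_spec hex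
  set N := Nat.find hex
  have g3 : ∀ j, c ≤ j → j < N → j ∈ A := by
    intro j hj hjN
    by_contra h
    exact Nat.find_min hex hjN ⟨hj, h⟩
  have hA : A = ↑(Finset.Ico c N) := by
    grind
  have hc : A.ncard = N - c := by rw [hA, Set.ncard_coe_finset, card_Ico]
  grind

lemma IsLRTableau.fills {l m nu : ℕ → ℕ} {T : Arr} (hT : IsLRTableau l m nu T) :
    Fills m (fun i b => {j | T i j = b + 1}.ncard) T := by
  obtain ⟨hml, hskew, hrow, -, -, -⟩ := hT
  set e : Arr := fun i b => {j | T i j = b + 1}.ncard with he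
  have hstep : ∀ i a, (∀ j, InSkew l m i j → (T i j ≤ a ↔ j < cum m e a i)) →
      ∀ j, T i j = a + 1 ↔ cum m e a i ≤ j ∧ j < cum m e (a + 1) i := by
    intro i a ih j
    have hsk : ∀ j, T i j = a + 1 → InSkew l m i j := fun j h => (hskew i j).1 (by omega)
    have hfin : {j | T i j = a + 1}.Finite :=
      (Set.finite_Iio (l i)).subset fun j hj => (hsk j hj).2
    rw [cum_succ]
    refine eq_Ico_of_downClosed hfin (fun j hj => ?_) (fun j hj j' h1 h2 => ?_) j
    · grind
    · have hj' : InSkew l m i j' :=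
        ⟨(le_add_right _ _).trans h1, lt_of_le_of_lt h2 (hsk j hj).2⟩
      grind
  have key : ∀ a i j, InSkew l m i j → (T i j ≤ a ↔ j < cum m e a i) := by
    intro a
    induction a with
    | zero =>
      intro i j hij
      have := (hskew i j).2 hij
      have := hij.1
      rw [cum_zero]
      omega
    | succ a ih =>
      intro i j hij
      have h1 := hstep i a (ih i) j
      have h2 := ih i j hij
      have h3 := cum_succ m e a i
      omega
  intro i j r
  exact hstep i r (key r i) j

lemma Fills.unique {m : ℕ → ℕ} {e T T' : Arr} (h : Fills m e T) (h' : Fills m e T') : T = T' := by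
  funext i j
  rcases hn : T i j with _ | r
  · rcases hn' : T' i j with _ | r
    · rfl
    · have := (h i j r).2 ((h' i j r).1 hn')
      omega
  · have := (h' i j r).2 ((h i j r).1 hn)
    omega

theorem lrCoeff_eq {l m nu : ℕ → ℕ} (hl : Antitone l) (hm : Antitone m) {K Q : ℕ}
    (hK : ∀ i, K ≤ i → l i = 0) (hnu : ∀ i, Q ≤ i → nu i = 0) (hml : ∀ i, m i ≤ l i) :
    lrCoeff l m nu = lrNum K Q m (l - m) 0 nu := by
  classical
  rw [lrCoeff, lrNum, ← Set.ncard_coe_finset]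
  symm
  have hmem : ∀ e, e ∈ ((mats K Q m (l - m)).filter fun e =>
      Interl 0 (tr e) ∧ cols K Q e = rs Q nu) ↔ SuppIn K Q e ∧ (∀ i, cum m e Q i = l i) ∧
      Interl m e ∧ Interl 0 (tr e) ∧ cols K Q e = rs Q nu := by
    intro e
    rw [mem_filter, mem_mats]
    have : (∀ i, ∑ b ∈ range Q, e i b = (l - m) i) ↔ ∀ i, cum m e Q i = l i := by
      refine forall_congr' fun i => ?_
      simp only [cum, Pi.sub_apply]
      have := hml i
      omega
    rw [this]
    tauto
  refine Set.ncard_congr (fun e _ => tabOf m e) ?_ ?_ ?_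
  · intro e he
    obtain ⟨h1, h2, h3⟩ := (hmem e).1 he
    exact (isLRTableau_iff hl hm hnu h1 h2 (fills_tabOf m e)).2 h3
  · intro e e' _ _ h
    funext i b
    rw [← (fills_tabOf m e).ncard_row i b, ← (fills_tabOf m e').ncard_row i b, h]
  · intro T hT
    have hT : IsLRTableau l m nu T := hT
    have hf := hT.fills
    set e : Arr := fun i b => {j | T i j = b + 1}.ncard with he
    have hfin : {p : ℕ × ℕ | T p.1 p.2 ≠ 0}.Finite := by
      refine (((range K) ×ˢ (range (l 0))).finite_toSet).subset ?_
      rintro ⟨i, j⟩ hij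
      have h1 := ((hT.2.1 i j).1 hij).2
      have h2 : i < K := by
        by_contra h; rw [hK i (by omega)] at h1; omega
      have h3 := hl (zero_le i)
      simp; omega
    have hlt : ∀ i j b, T i j = b + 1 → i < K ∧ b < Q := by
      intro i j b h
      constructor
      · have h1 := ((hT.2.1 i j).1 (by omega)).2
        by_contra h; rw [hK i (by omega)] at h1; omega
      · by_contra hb
        have h1 := hT.2.2.2.2.1 b
        rw [hnu b (by omega), Set.ncard_eq_zero
          (hfin.subset fun p hp => by simp only [Set.mem_ofPred_eq] at hp ⊢; omega)] at h1
        have : (i, j) ∈ {p : ℕ × ℕ | T p.1 p.2 = b + 1} := h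
        rw [h1] at this
        exact this
    have hs : SuppIn K Q e := by
      intro i b h
      obtain ⟨j, hj⟩ := Set.nonempty_of_ncard_ne_zero h
      exact hlt i j b hj
    have hrow : ∀ i, cum m e Q i = l i := by
      intro i
      have hle : ∀ j, T i j ≠ 0 ↔ m i ≤ j ∧ j < cum m e Q i := by
        intro j
        constructor
        · intro h
          obtain ⟨r, hr⟩ := exists_eq_succ_of_ne_zero h
          have h1 := (hf i j r).1 hr
          have h2 := cum_mono m e i (show r + 1 ≤ Q from (hlt i j r hr).2)
          have h3 : m i ≤ cum m e r i := le_add_right _ _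
          simp only at h2
          omega
        · rintro ⟨h1, h2⟩ h3
          have key : ∀ a, cum m e a i ≤ j := by
            intro a
            induction a with
            | zero => rw [cum_zero]; exact h1
            | succ a ih =>
              by_contra h4
              have := (hf i j a).2 ⟨ih, by omega⟩
              omega
          have := key Q
          omega
      have h4 : m i ≤ cum m e Q i := le_add_right _ _
      have h5 := hml i
      rcases lt_trichotomy (cum m e Q i) (l i) with h | h | h
      · have := (hle (cum m e Q i)).1 ((hT.2.1 i _).2 ⟨h4, h⟩)
        omega
      · exact h
      · have := ((hT.2.1 i _).1 ((hle (l i)).2 ⟨h5, h⟩)).2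
        omega
    refine ⟨e, (hmem e).2 ⟨hs, hrow, (isLRTableau_iff hl hm hnu hs hrow hf).1 hT⟩, ?_⟩
    exact (fills_tabOf m e).unique hf

lemma lrCoeff_of_not_le {l m nu : ℕ → ℕ} (h : ¬ ∀ i, m i ≤ l i) : lrCoeff l m nu = 0 := by
  have : {T : Arr | IsLRTableau l m nu T} = ∅ :=
    Set.eq_empty_of_forall_notMem fun T hT => h hT.1
  rw [lrCoeff, this, Set.ncard_empty]

end

section

open Fin

/-! ### Branching -/

def leftPart (p : ℕ) (e : Arr) : Arr := fun i b => if b < p then e i b else 0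

def rightPart (p : ℕ) (e : Arr) : Arr := fun i b => e i (p + b)

def gluePart (p : ℕ) (e₁ e₂ : Arr) : Arr := fun i b =>
  if b < p then e₁ i b else e₂ i (b - p)

lemma cum_gluePart_of_le {p : ℕ} {e₁ e₂ : Arr} {a : ℕ} (ha : a ≤ p) (i : ℕ) :
    cum 0 (gluePart p e₁ e₂) a i = cum 0 e₁ a i := by
  unfold cum
  congr 1
  refine sum_congr rfl fun b hb => ?_
  have := mem_range.1 hb
  rw [gluePart, if_pos (by omega)]

lemma cum_gluePart_add {p : ℕ} {e₁ e₂ : Arr} {al : ℕ → ℕ}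
    (hal : ∀ i, ∑ b ∈ range p, e₁ i b = al i) (a i : ℕ) :
    cum 0 (gluePart p e₁ e₂) (p + a) i = cum al e₂ a i := by
  unfold cum
  rw [sum_range_add, ← hal, Pi.zero_apply, zero_add]
  congr 1
  · refine sum_congr rfl fun b hb => ?_
    rw [gluePart, if_pos (mem_range.1 hb)]
  · refine sum_congr rfl fun b _ => ?_
    rw [gluePart, if_neg (by omega), Nat.add_sub_cancel_left]

lemma interl_gluePart {K p : ℕ} {e₁ e₂ : Arr} {al : ℕ → ℕ} (hs : SuppIn K p e₁)
    (hal : ∀ i, ∑ b ∈ range p, e₁ i b = al i) :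
    Interl 0 (gluePart p e₁ e₂) ↔ Interl 0 e₁ ∧ Interl al e₂ := by
  constructor
  · intro h
    refine ⟨fun i a => ?_, fun i a => ?_⟩
    · by_cases ha : a < p
      · have := h i a
        rwa [cum_gluePart_of_le (by omega), cum_gluePart_of_le ha.le] at this
      · have h1 : ∀ a i, p ≤ a → cum 0 e₁ a i = cum 0 e₁ p i := by
          intro a i ha
          unfold cum
          congr 1
          symm
          refine sum_subset (range_subset_range.2 ha) fun b _ hb => ?_
          exact hs.eq_zero_col (by simpa using hb)
        have h2 := h.cum_antitone p (Nat.le_succ i)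
        simp only [cum_gluePart_of_le le_rfl] at h2
        rw [h1 _ _ (by omega), h1 a _ (by omega)]
        exact h2
    · rw [← cum_gluePart_add hal, ← cum_gluePart_add hal]
      exact h i (p + a)
  · rintro ⟨h1, h2⟩ i a
    by_cases ha : a < p
    · rw [cum_gluePart_of_le (by omega), cum_gluePart_of_le ha.le]
      exact h1 i a
    · obtain ⟨c, rfl⟩ : ∃ c, a = p + c := ⟨a - p, by omega⟩
      rw [add_assoc, cum_gluePart_add hal, cum_gluePart_add hal]
      exact h2 i c

lemma gluePart_left_right (p : ℕ) (e : Arr) : gluePart p (leftPart p e) (rightPart p e) = e := by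
  funext i b
  simp only [gluePart, leftPart, rightPart]
  split_ifs with h
  · rfl
  · rw [show p + (b - p) = b by omega]

lemma cols_gluePart {K p q : ℕ} (e₁ e₂ : Arr) :
    cols K (p + q) (gluePart p e₁ e₂) = append (cols K p e₁) (cols K q e₂) := by
  funext b
  refine addCases (fun b => ?_) (fun b => ?_) b
  · rw [append_left]
    simp [cols, colSum, gluePart]
  · rw [append_right]
    simp [cols, colSum, gluePart]

lemma append_inj {p q : ℕ} {c c' : NVec p} {d d' : NVec q} :
    append c d = append c' d' ↔ c = c' ∧ d = d' := by
  constructor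
  · intro h
    constructor
    · funext b
      have := congrFun h (castAdd q b)
      simpa using this
    · funext b
      have := congrFun h (natAdd p b)
      simpa using this
  · rintro ⟨rfl, rfl⟩; rfl

open Classical in
def ptnsLE (p B : ℕ) (lam : Ptn) : Finset Ptn := (ptns p B).filter fun al => ∀ i, al.1 i ≤ lam.1 i

lemma mem_ptnsLE {p B : ℕ} {lam al : Ptn} :
    al ∈ ptnsLE p B lam ↔ al ∈ ptns p B ∧ ∀ i, al.1 i ≤ lam.1 i := by
  simp [ptnsLE]

theorem gtNum_append {p q K B : ℕ} {lam : Ptn} (hlam : lam.1 0 ≤ B) (c : NVec p)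
    (d : NVec q) : gtNum K (p + q) 0 lam.1 (append c d) =
      ∑ al ∈ ptnsLE p B lam, gtNum K p 0 al.1 c * gtNum K q al.1 (lam.1 - al.1) d := by
  classical
  simp only [gtNum, ← card_product]
  rw [← card_sigma]
  symm
  have hgl : ∀ (al : Ptn) e₁ e₂, e₁ ∈ mats K p 0 al.1 → e₂ ∈ mats K q al.1 (lam.1 - al.1) →
      (∀ i, al.1 i ≤ lam.1 i) → gluePart p e₁ e₂ ∈ mats K (p + q) 0 lam.1 := by
    intro al e₁ e₂ h1 h2 h3
    rw [mem_mats] at h1 h2 ⊢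
    refine ⟨?_, (interl_gluePart h1.1 h1.2.2).2 ⟨h1.2.1, h2.2.1⟩, fun i => ?_⟩
    · intro i b h
      simp only [gluePart] at h
      split_ifs at h with hb
      · have := h1.1 _ _ h; omega
      · have := h2.1 _ _ h; omega
    · have := cum_gluePart_add (e₂ := e₂) h1.2.2 q i
      have h4 := h2.2.2 i
      have h5 := h3 i
      simp only [cum, Pi.zero_apply, zero_add, Pi.sub_apply] at this h4
      omega
  refine card_bij (fun x _ => gluePart p x.2.1 x.2.2) ?_ ?_ ?_
  · rintro ⟨al, e₁, e₂⟩ hx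
    simp only [mem_sigma, mem_product, mem_filter, mem_ptnsLE] at hx ⊢
    refine ⟨hgl al e₁ e₂ hx.2.1.1 hx.2.2.1 hx.1.2, ?_⟩
    rw [cols_gluePart, hx.2.1.2, hx.2.2.2]
  · rintro ⟨al, e₁, e₂⟩ hx ⟨al', e₁', e₂'⟩ hx' h
    simp only [mem_sigma, mem_product, mem_filter, mem_ptnsLE, mem_mats] at hx hx' h
    have g1 : e₁ = e₁' := by
      funext i b
      by_cases hb : b < p
      · have := congrFun (congrFun h i) b
        simpa [gluePart, hb] using this
      · rw [hx.2.1.1.1.eq_zero_col (by omega), hx'.2.1.1.1.eq_zero_col (by omega)]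
    have g2 : e₂ = e₂' := by
      funext i b
      have := congrFun (congrFun h i) (p + b)
      simpa [gluePart] using this
    have g3 : al = al' := by
      refine Subtype.ext (funext fun i => ?_)
      rw [← hx.2.1.1.2.2 i, ← hx'.2.1.1.2.2 i, g1]
    subst g1 g2 g3
    rfl
  · intro e he
    rw [mem_filter, mem_mats] at he
    obtain ⟨⟨h1, h2, h3⟩, h4⟩ := he
    have hs1 : SuppIn K p (leftPart p e) := by
      intro i b h
      simp only [leftPart] at h
      split_ifs at h with hb
      · exact ⟨(h1 _ _ h).1, hb⟩
      · exact absurd rfl h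
    have hs2 : SuppIn K q (rightPart p e) := by
      intro i b h
      have := h1 _ _ h
      omega
    set al : ℕ → ℕ := fun i => ∑ b ∈ range p, leftPart p e i b with hal
    have h2' := h2
    rw [← gluePart_left_right p e, interl_gluePart hs1 (al := al) (fun _ => rfl)] at h2'
    have hpart : IsPartition al := by
      constructor
      · intro i j hij
        have := h2'.1.cum_antitone p hij
        simpa [cum] using this
      · refine ⟨p, sum_eq_zero fun b hb => h2'.1.zero_of_lt (mem_range.1 hb)⟩
    have hsum : ∀ i, al i + ∑ b ∈ range q, rightPart p e i b = lam.1 i := by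
      intro i
      rw [← h3 i, sum_range_add]
      congr 1
      refine sum_congr rfl fun b hb => ?_
      rw [leftPart, if_pos (mem_range.1 hb)]
    have hle : ∀ i, al i ≤ lam.1 i := fun i => by rw [← hsum i]; exact Nat.le_add_right _ _
    have hc : cols K p (leftPart p e) = c ∧ cols K q (rightPart p e) = d := by
      rw [← append_inj, ← cols_gluePart, gluePart_left_right, h4]
    refine ⟨⟨mkPtn hpart, leftPart p e, rightPart p e⟩, ?_, gluePart_left_right p e⟩
    simp only [mem_sigma, mem_product, mem_filter, mem_ptnsLE, mem_mats, mem_ptns]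
    refine ⟨⟨⟨fun i hi => ?_, (hle 0).trans hlam⟩, hle⟩, ⟨⟨hs1, h2'.1, fun _ => rfl⟩, hc.1⟩,
      ⟨hs2, h2'.2, fun i => ?_⟩, hc.2⟩
    · exact sum_eq_zero fun b hb => h2'.1.zero_of_lt
        (lt_of_lt_of_le (mem_range.1 hb) hi)
    · have := hsum i
      simp only [mkPtn, Pi.sub_apply]
      omega

/-! ### The functional extracting a Schur coefficient -/

/-- The coefficient of a Schur polynomial. -/
def schurCoeff (q : ℕ) (nu : ℕ → ℕ) : ZPol q →ₗ[ℤ] ℤ :=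
  (MvPolynomial.lcoeff ℤ (ex (rs q nu + stair q))) ∘ₗ LinearMap.mulLeft ℤ (altp (stair q))

lemma schurCoeff_apply (q : ℕ) (nu : ℕ → ℕ) (G : ZPol q) :
    schurCoeff q nu G = (altp (stair q) * G).coeff (ex (rs q nu + stair q)) := rfl

lemma schurCoeff_congr {q B : ℕ} {nu : ℕ → ℕ} (hB : ∑ i, rs q nu i ≤ B) {G H : ZPol q}
    (h : ∀ c : NVec q, ∑ i, c i ≤ B → G.coeff (ex c) = H.coeff (ex c)) :
    schurCoeff q nu G = schurCoeff q nu H := by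
  rw [schurCoeff_apply, schurCoeff_apply, coeff_altp_mul, coeff_altp_mul]
  refine sum_congr rfl fun w _ => ?_
  congr 1
  split_ifs with hw
  · apply h
    refine le_trans (le_of_eq ?_) hB
    have h1 : ∑ i, (rs q nu + stair q - stair q ∘ ⇑w) i + ∑ i, (stair q ∘ w) i =
        ∑ i, rs q nu i + ∑ i, stair q i := by
      rw [← sum_add_distrib, ← sum_add_distrib]
      refine sum_congr rfl fun i _ => ?_
      have := hw i
      simp only [Pi.sub_apply, Pi.add_apply] at this ⊢
      omega
    have h2 : ∑ i, (stair q ∘ w) i = ∑ i, stair q i := Equiv.sum_comp w (stair q)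
    omega
  · rfl

open Classical in
lemma schurCoeff_schurP {q B M : ℕ} {f g : Ptn} (hf : f ∈ ptns q B) (hg : g ∈ ptns q B)
    (hM : q ≤ M) : schurCoeff q g.1 (schurP M q f) = if f = g then 1 else 0 := by
  have hf' := mem_ptns.1 hf
  rw [schurCoeff_apply, altp_stair_mul_schur f.antitone (fun i hi => hf'.1 i (by omega)) hf'.1]
  refine (coeff_altp (rs q f.1) (rs q g.1) (fun a b hab => f.antitone hab)
    (fun a b hab => g.antitone hab)).trans ?_
  by_cases h : f = g
  · subst h
    rw [if_pos rfl, if_pos rfl]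
  · rw [if_neg h, if_neg fun h' => h (rs_inj hf hg h')]

lemma schurCoeff_schurP_mul {q B M : ℕ} {al ga nu : Ptn} (hal : al ∈ ptns q B)
    (hga : ∀ i, M ≤ i → ga.1 i = 0) (hnu : nu ∈ ptns q B) (hM : q ≤ M) :
    schurCoeff q nu.1 (schurP M q ga * schurP M q al) = lrCoeff nu.1 al.1 ga.1 := by
  have hal' := mem_ptns.1 hal
  have hnu' := mem_ptns.1 hnu
  rw [schurCoeff_apply, mul_comm (schurP M q ga), ← mul_assoc,
    altp_stair_mul_schur al.antitone (fun i hi => hal'.1 i (by omega)) hal'.1]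
  refine (coeff_altp_mul_skewPoly M 0 ga.1 al.1 al.antitone (rs q nu.1)
    (fun a b hab => nu.antitone hab)).trans ?_
  by_cases h : ∀ i, al.1 i ≤ nu.1 i
  · rw [lrCoeff_eq nu.antitone al.antitone hnu'.1 hga h, lrNum_tr (fun i hi => by simp [hnu'.1 i hi])
      hga, lrNum]
    congr 2
    refine filter_congr fun e _ => and_congr_right fun _ => ?_
    rw [funext_iff, funext_iff]
    refine forall_congr' fun b => ?_
    have := h b
    change al.1 b + cols M q e b = nu.1 b ↔ cols M q e b = nu.1 b - al.1 b
    omega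
  · rw [lrCoeff_of_not_le h]
    refine congrArg Nat.cast (card_eq_zero.2 (filter_eq_empty_iff.2 ?_))
    rintro e _ ⟨_, he⟩
    apply h
    intro i
    by_cases hi : i < q
    · have : al.1 i + cols M q e ⟨i, hi⟩ = nu.1 i := congrFun he ⟨i, hi⟩
      omega
    · rw [hal'.1 i (by omega)]; omega

end

section

open Sum Equiv

/-! ### Multisets of pairs of columns -/

/-- Unordered pairs of columns. -/
abbrev PairIdx (k : ℕ) : Type := {x : Fin k × Fin k // x.1 ≤ x.2}

/-- The degree in the column `b` of the pair `t`. -/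
def pairDeg {k : ℕ} (t : PairIdx k) (b : Fin k) : ℕ :=
  (if t.1.1 = b then 1 else 0) + if t.1.2 = b then 1 else 0

def pdeg {k : ℕ} (j : PairIdx k → ℕ) : NVec k := fun b => ∑ t, j t * pairDeg t b

open Classical in
/-- The multisets of pairs of degree at most `c`. -/
def pairSet (k : ℕ) (c : NVec k) : Finset (PairIdx k → ℕ) :=
  (Fintype.piFinset fun _ => range (∑ b, c b + 1)).filter fun j => pdeg j ≤ c

lemma le_pdeg {k : ℕ} (j : PairIdx k → ℕ) (t : PairIdx k) : j t ≤ pdeg j t.1.1 := by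
  have h1 : j t * pairDeg t t.1.1 ≤ pdeg j t.1.1 :=
    single_le_sum (f := fun t' => j t' * pairDeg t' t.1.1) (fun _ _ => Nat.zero_le _)
      (mem_univ t)
  have h2 : 1 ≤ pairDeg t t.1.1 := by simp [pairDeg]
  nlinarith

lemma mem_pairSet {k : ℕ} {c : NVec k} {j : PairIdx k → ℕ} : j ∈ pairSet k c ↔ pdeg j ≤ c := by
  simp only [pairSet, mem_filter, Fintype.mem_piFinset, mem_range, and_iff_right_iff_imp]
  intro h t
  have h1 := le_pdeg j t
  have h2 : pdeg j t.1.1 ≤ c t.1.1 := h _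
  have h3 : c t.1.1 ≤ ∑ b, c b := single_le_sum (fun _ _ => Nat.zero_le _)
    (mem_univ _)
  omega

/-- The number of highest weight vectors of multidegree `c`. -/
def oNum (k : ℕ) (lam : ℕ → ℕ) (c : NVec k) : ℕ :=
  ∑ j ∈ pairSet k c, gtNum k k 0 lam (c - pdeg j)

open Classical in
def rectSet (p q : ℕ) (c : NVec p) (d : NVec q) : Finset (Fin p × Fin q → ℕ) :=
  (boxMat p q (∑ b, c b)).filter fun j => rsum j ≤ c ∧ csum j ≤ d

lemma mem_rectSet {p q : ℕ} {c : NVec p} {d : NVec q} {j : Fin p × Fin q → ℕ} :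
    j ∈ rectSet p q c d ↔ rsum j ≤ c ∧ csum j ≤ d := by
  simp only [rectSet, mem_filter, and_iff_right_iff_imp]
  intro h
  exact mem_boxMat_of_rsum fun a => (h.1 a).trans
    (single_le_sum (fun _ _ => Nat.zero_le _) (mem_univ _))

section split
variable {p q : ℕ}

def pairSplitFun : (PairIdx p ⊕ PairIdx q) ⊕ (Fin p × Fin q) → PairIdx (p + q)
  | inl (inl t) => ⟨(Fin.castAdd q t.1.1, Fin.castAdd q t.1.2), t.2⟩
  | inl (inr t) => ⟨(Fin.natAdd p t.1.1, Fin.natAdd p t.1.2), by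
      grind⟩
  | inr x => ⟨(Fin.castAdd q x.1, Fin.natAdd p x.2), by
      grind⟩

lemma pairSplitFun_bijective : Function.Bijective (pairSplitFun (p := p) (q := q)) := by
  constructor
  · rintro ((⟨⟨a, b⟩, h⟩ | ⟨⟨a, b⟩, h⟩) | ⟨a, b⟩) ((⟨⟨c, d⟩, h'⟩ | ⟨⟨c, d⟩, h'⟩) | ⟨c, d⟩) e <;>
      simp only [pairSplitFun, Subtype.mk.injEq, Prod.mk.injEq, Fin.ext_iff, Fin.val_natAdd,
        Fin.val_castAdd] at e <;>
      simp only [inl.injEq, inr.injEq, reduceCtorEq, Subtype.mk.injEq, Prod.mk.injEq,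
        Fin.ext_iff] <;> omega
  · rintro ⟨⟨a, b⟩, h⟩
    refine Fin.addCases (fun a h => ?_) (fun a h => ?_) a h <;> revert h <;>
    refine Fin.addCases (fun b h => ?_) (fun b h => ?_) b
    · exact ⟨inl (inl ⟨(a, b), h⟩), rfl⟩
    · exact ⟨inr (a, b), rfl⟩
    · simp only [Fin.le_def, Fin.val_natAdd, Fin.val_castAdd] at h
      omega
    · refine ⟨inl (inr ⟨(a, b), ?_⟩), rfl⟩
      simp only [Fin.le_def, Fin.val_natAdd] at h ⊢
      omega

def pairSplit : (PairIdx p ⊕ PairIdx q) ⊕ (Fin p × Fin q) ≃ PairIdx (p + q) :=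
  ofBijective _ pairSplitFun_bijective

def pairGlue (j₁ : PairIdx p → ℕ) (j₂ : PairIdx q → ℕ) (j₃ : Fin p × Fin q → ℕ) :
    PairIdx (p + q) → ℕ := Sum.elim (Sum.elim j₁ j₂) j₃ ∘ pairSplit.symm

lemma pdeg_pairGlue (j₁ : PairIdx p → ℕ) (j₂ : PairIdx q → ℕ) (j₃ : Fin p × Fin q → ℕ) :
    pdeg (pairGlue j₁ j₂ j₃) = Fin.append (pdeg j₁ + rsum j₃) (pdeg j₂ + csum j₃) := by
  have hne : ∀ (a : Fin p) (b : Fin q), Fin.castAdd q a ≠ Fin.natAdd p b := by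
    intro a b h
    have := congrArg Fin.val h
    simp at this
    omega
  funext b
  simp only [pdeg]
  rw [← sum_comp pairSplit, Fintype.sum_sum_type, Fintype.sum_sum_type, Fintype.sum_prod_type]
  simp only [pairGlue, Function.comp, symm_apply_apply, Sum.elim_inl, Sum.elim_inr]
  refine Fin.addCases (fun b => ?_) (fun b => ?_) b
  · rw [Fin.append_left]
    simp only [pairSplit, ofBijective_apply, pairSplitFun, pairDeg, Pi.add_apply, pdeg, rsum,
      Fin.castAdd_inj, (hne _ _).symm, if_false, add_zero, mul_zero, sum_const_zero]
    congr 1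
    rw [sum_eq_single b]
    · simp
    · intro a _ hab; simp [hab]
    · simp
  · rw [Fin.append_right]
    simp only [pairSplit, ofBijective_apply, pairSplitFun, pairDeg, Pi.add_apply, pdeg, csum,
      Fin.natAdd_inj, hne, if_false, add_zero, mul_zero, sum_const_zero, zero_add]
    congr 1
    refine sum_congr rfl fun a _ => ?_
    rw [sum_eq_single b]
    · simp
    · intro a _ hab; simp [hab]
    · simp

lemma append_le_append {c c' : NVec p} {d d' : NVec q} :
    Fin.append c d ≤ Fin.append c' d' ↔ c ≤ c' ∧ d ≤ d' := by
  constructor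
  · intro h
    constructor
    · intro b
      have := h (Fin.castAdd q b)
      simpa using this
    · intro b
      have := h (Fin.natAdd p b)
      simpa using this
  · rintro ⟨h1, h2⟩ b
    refine Fin.addCases (fun b => ?_) (fun b => ?_) b
    · simpa using h1 b
    · simpa using h2 b

lemma append_sub_append (c c' : NVec p) (d d' : NVec q) :
    Fin.append c d - Fin.append c' d' = Fin.append (c - c') (d - d') := by
  funext b
  refine Fin.addCases (fun b => ?_) (fun b => ?_) b <;> simp

lemma sum_pairSet_append (G : (NVec (p + q)) → ℕ) (c : NVec p) (d : NVec q) :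
    ∑ j ∈ pairSet (p + q) (Fin.append c d), G (Fin.append c d - pdeg j) =
      ∑ j₁ ∈ pairSet p c, ∑ j₂ ∈ pairSet q d, ∑ j₃ ∈ rectSet p q (c - pdeg j₁) (d - pdeg j₂),
        G (Fin.append (c - pdeg j₁ - rsum j₃) (d - pdeg j₂ - csum j₃)) := by
  have h1 : ∀ j₁ ∈ pairSet p c, ∑ j₂ ∈ pairSet q d,
      ∑ j₃ ∈ rectSet p q (c - pdeg j₁) (d - pdeg j₂),
        G (Fin.append (c - pdeg j₁ - rsum j₃) (d - pdeg j₂ - csum j₃)) = ∑ x ∈ (pairSet q d).sigma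
          (fun j₂ => rectSet p q (c - pdeg j₁) (d - pdeg j₂)),
        G (Fin.append (c - pdeg j₁ - rsum x.2) (d - pdeg x.1 - csum x.2)) :=
    fun j₁ _ => by rw [sum_sigma]
  rw [sum_congr rfl h1, sum_sigma']
  symm
  have hg : ∀ j : PairIdx (p + q) → ℕ, pairGlue (p := p) (q := q) (fun t => j (pairSplit (inl (inl t))))
      (fun t => j (pairSplit (inl (inr t)))) (fun t => j (pairSplit (inr t))) = j := by
    intro j
    funext t
    obtain ⟨s, rfl⟩ := (pairSplit (p := p) (q := q)).surjective t
    simp only [pairGlue, Function.comp, symm_apply_apply]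
    rcases s with (s | s) | s <;> rfl
  have hmem : ∀ j₁ j₂ j₃, pairGlue j₁ j₂ j₃ ∈ pairSet (p + q) (Fin.append c d) ↔
      pdeg j₁ ≤ c ∧ pdeg j₂ ≤ d ∧ rsum j₃ ≤ c - pdeg j₁ ∧ csum j₃ ≤ d - pdeg j₂ := by
    intro j₁ j₂ j₃
    rw [mem_pairSet, pdeg_pairGlue, append_le_append]
    constructor
    · rintro ⟨h1, h2⟩
      refine ⟨fun b => ?_, fun b => ?_, fun b => ?_, fun b => ?_⟩
      · exact (Nat.le_add_right _ _).trans (h1 b)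
      · exact (Nat.le_add_right _ _).trans (h2 b)
      · have := Pi.le_def.1 h1 b
        simp only [Pi.add_apply, Pi.sub_apply] at this ⊢
        omega
      · have := Pi.le_def.1 h2 b
        simp only [Pi.add_apply, Pi.sub_apply] at this ⊢
        omega
    · rintro ⟨h1, h2, h3, h4⟩
      refine ⟨fun b => ?_, fun b => ?_⟩
      · have := Pi.le_def.1 h1 b
        have := Pi.le_def.1 h3 b
        simp only [Pi.add_apply, Pi.sub_apply] at this ⊢
        omega
      · have := Pi.le_def.1 h2 b
        have := Pi.le_def.1 h4 b
        simp only [Pi.add_apply, Pi.sub_apply] at this ⊢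
        omega
  refine sum_bij' (fun x _ => pairGlue x.1 x.2.1 x.2.2)
    (fun j _ => ⟨fun t => j (pairSplit (inl (inl t))),
      fun t => j (pairSplit (inl (inr t))), fun t => j (pairSplit (inr t))⟩)
    ?_ ?_ ?_ ?_ ?_
  · rintro ⟨j₁, j₂, j₃⟩ hx
    simp only [mem_sigma, mem_pairSet, mem_rectSet] at hx
    exact (hmem _ _ _).2 ⟨hx.1, hx.2.1, hx.2.2⟩
  · intro j hj
    rw [← hg j, hmem] at hj
    simp only [mem_sigma, mem_pairSet, mem_rectSet]
    exact ⟨hj.1, hj.2.1, hj.2.2⟩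
  · rintro ⟨j₁, j₂, j₃⟩ _
    simp only [pairGlue, Function.comp, symm_apply_apply]
    rfl
  · intro j _
    exact hg j
  · rintro ⟨j₁, j₂, j₃⟩ _
    simp only
    rw [pdeg_pairGlue, append_sub_append]
    congr 2 <;> funext b <;> exact Nat.sub_sub _ _ _

lemma pdeg_zero {k : ℕ} : pdeg (0 : PairIdx k → ℕ) = 0 := by
  funext b; simp [pdeg]

lemma sum_sub_pdeg_lt {k : ℕ} {c : NVec k} {j : PairIdx k → ℕ} (hj : pdeg j ≤ c) (h0 : j ≠ 0) :
    ∑ b, (c - pdeg j) b < ∑ b, c b := by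
  obtain ⟨t, ht⟩ := Function.ne_iff.1 h0
  refine sum_lt_sum (fun _ _ => Nat.sub_le _ _) ⟨t.1.1, mem_univ _, ?_⟩
  have h1 := le_pdeg j t
  have h2 := hj t.1.1
  simp only [Pi.sub_apply, Pi.zero_apply] at *
  omega

lemma sum_sub_pdeg_le {k : ℕ} (c : NVec k) (j : PairIdx k → ℕ) :
    ∑ b, (c - pdeg j) b ≤ ∑ b, c b := sum_le_sum fun _ _ => Nat.sub_le _ _

theorem eq_of_sum_pairSet_eq {B : ℕ} (f g : (NVec p) → (NVec q) → ℕ)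
    (h : ∀ c d, ∑ b, c b ≤ B → ∑ b, d b ≤ B →
      ∑ j₁ ∈ pairSet p c, ∑ j₂ ∈ pairSet q d, f (c - pdeg j₁) (d - pdeg j₂) =
      ∑ j₁ ∈ pairSet p c, ∑ j₂ ∈ pairSet q d, g (c - pdeg j₁) (d - pdeg j₂))
    (c : NVec p) (d : NVec q) (hc : ∑ b, c b ≤ B) (hd : ∑ b, d b ≤ B) : f c d = g c d := by
  classical
  induction hN : ∑ b, c b + ∑ b, d b using Nat.strong_induction_on generalizing c d with
  | _ N ih =>
  have h1 := h c d hc hd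
  rw [← sum_product', ← sum_product'] at h1
  have hmem : ((0, 0) : (PairIdx p → ℕ) × (PairIdx q → ℕ)) ∈ pairSet p c ×ˢ pairSet q d := by
    rw [mem_product, mem_pairSet, mem_pairSet, pdeg_zero, pdeg_zero]
    exact ⟨fun _ => Nat.zero_le _, fun _ => Nat.zero_le _⟩
  rw [← add_sum_erase _ _ hmem, ← add_sum_erase _ _ hmem] at h1
  have h2 : ∀ x ∈ (pairSet p c ×ˢ pairSet q d).erase (0, 0),
      f (c - pdeg x.1) (d - pdeg x.2) = g (c - pdeg x.1) (d - pdeg x.2) := by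
    rintro ⟨j₁, j₂⟩ hx
    rw [mem_erase, mem_product, mem_pairSet, mem_pairSet] at hx
    have h3 := sum_sub_pdeg_le c j₁
    have h4 := sum_sub_pdeg_le d j₂
    refine ih _ ?_ _ _ (h3.trans hc) (h4.trans hd) rfl
    rw [← hN]
    by_cases h5 : j₁ = 0
    · have h6 : j₂ ≠ 0 := fun h6 => hx.1 (by rw [h5, h6])
      exact add_lt_add_of_le_of_lt h3 (sum_sub_pdeg_lt hx.2.2 h6)
    · exact add_lt_add_of_lt_of_le (sum_sub_pdeg_lt hx.2.1 h5) h4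
  rw [sum_congr rfl h2] at h1
  simpa [pdeg_zero] using h1

lemma sum_rectSet {B : ℕ} (φ : (NVec p) → (NVec q) → ℤ) (c : NVec p) (d : NVec q)
    (hB : ∑ b, c b ≤ B) : ∑ j ∈ rectSet p q c d, φ (c - rsum j) (d - csum j) =
      ∑ x ∈ Finset.HasAntidiagonal.antidiagonal (ex c), ∑ y ∈ Finset.HasAntidiagonal.antidiagonal (ex d),
        (ctNum p q B x.1 y.1 : ℤ) * φ x.2 y.2 := by
  classical
  rw [← sum_product', ← sum_fiberwise_of_maps_to (s := rectSet p q c d)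
    (t := Finset.HasAntidiagonal.antidiagonal (ex c) ×ˢ Finset.HasAntidiagonal.antidiagonal (ex d))
    (g := fun j => ((ex (rsum j), ex (c - rsum j)), (ex (csum j), ex (d - csum j))))]
  · refine sum_congr rfl ?_
    rintro ⟨⟨x₁, x₂⟩, ⟨y₁, y₂⟩⟩ hx
    simp only [mem_product, Finset.HasAntidiagonal.mem_antidiagonal] at hx
    have hx1 : ∀ b, x₁ b + x₂ b = c b := fun b => DFunLike.congr_fun hx.1 b
    have hy1 : ∀ b, y₁ b + y₂ b = d b := fun b => DFunLike.congr_fun hx.2 b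
    rw [ctNum, ← nsmul_eq_mul, ← sum_const]
    refine sum_congr ?_ ?_
    · ext j
      simp only [mem_filter, mem_rectSet, Prod.mk.injEq]
      constructor
      · rintro ⟨⟨h1, h2⟩, ⟨h3, -⟩, h4, -⟩
        refine ⟨mem_boxMat_of_rsum fun a => ?_, ?_, ?_⟩
        · refine (h1 a).trans (le_trans ?_ hB)
          exact single_le_sum (fun _ _ => Nat.zero_le _) (mem_univ _)
        · rw [← h3]; rfl
        · rw [← h4]; rfl
      · rintro ⟨-, h1, h2⟩
        refine ⟨⟨fun b => ?_, fun b => ?_⟩, ⟨?_, ?_⟩, ?_, ?_⟩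
        · rw [h1, ← hx1]; exact Nat.le_add_right _ _
        · rw [h2, ← hy1]; exact Nat.le_add_right _ _
        · ext b; rw [ex_apply, h1]
        · ext b; rw [ex_apply, Pi.sub_apply, h1, ← hx1]; simp
        · ext b; rw [ex_apply, h2]
        · ext b; rw [ex_apply, Pi.sub_apply, h2, ← hy1]; simp
    · intro j hj
      simp only [mem_filter] at hj
      congr 1
      · funext b
        rw [Pi.sub_apply, hj.2.1, ← hx1, Nat.add_sub_cancel_left]
      · funext b
        rw [Pi.sub_apply, hj.2.2, ← hy1, Nat.add_sub_cancel_left]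
  · intro j hj
    rw [mem_rectSet] at hj
    rw [mem_product, Finset.HasAntidiagonal.mem_antidiagonal, Finset.HasAntidiagonal.mem_antidiagonal]
    constructor
    · ext b
      have := Pi.le_def.1 hj.1 b
      simp only [Finsupp.add_apply, ex_apply, Pi.sub_apply]; omega
    · ext b
      have := Pi.le_def.1 hj.2 b
      simp only [Finsupp.add_apply, ex_apply, Pi.sub_apply]; omega

end split

end

section

open Nat MvPolynomial Fin

/-! ### The combinatorial form of the multiplicity formula -/

lemma ex_coe {q : ℕ} (x : Fin q →₀ ℕ) : ex (x : NVec q) = x := by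
  ext b; rw [ex_apply]

lemma gtNum_eq_coeff {k K : ℕ} {f : Ptn} (hf : ∀ i, k ≤ i → f.1 i = 0) (hk : k ≤ K)
    (c : NVec k) : (gtNum k k 0 f.1 c : ℤ) = (schurP K k f).coeff (ex c) := by
  rw [gtNum_cast, skewPoly_congr (m' := K) hf (fun i hi => hf i (by omega))]

lemma cum_tr_eq_zero {e : Arr} (h : Interl 0 (tr e)) (b i : ℕ) (hi : b ≤ i) :
    cum 0 (tr e) b i = 0 := by
  induction b generalizing i with
  | zero => simp [cum]
  | succ b ih =>
    obtain ⟨i, rfl⟩ : ∃ i', i = i' + 1 := ⟨i - 1, by omega⟩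
    have := h i b
    have := ih i (by omega)
    omega

lemma lrCoeff_ne_zero {l m nu : Ptn} {q B : ℕ} (hq : ∀ i, q ≤ i → l.1 i = 0)
    (hB : ∑ i ∈ range q, l.1 i ≤ B) (h : lrCoeff l.1 m.1 nu.1 ≠ 0) : nu ∈ ptns q B := by
  have hle : ∀ i, m.1 i ≤ l.1 i := by
    by_contra hc
    exact h (lrCoeff_of_not_le hc)
  obtain ⟨Q, hQ⟩ := nu.2.2
  have hQ' : ∀ i, Q ≤ i → nu.1 i = 0 := fun i hi =>
    le_zero.1 ((nu.antitone hi).trans hQ.le)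
  rw [lrCoeff_eq l.antitone m.antitone hq hQ' hle, lrNum] at h
  obtain ⟨e, he⟩ := card_ne_zero.1 h
  rw [mem_filter] at he
  have hcol : ∀ b, b < Q → colSum q e b = nu.1 b := fun b hb =>
    congrFun he.2.2 ⟨b, hb⟩
  rw [mem_ptns]
  constructor
  · intro i hi
    by_cases hiQ : i < Q
    · rw [← hcol i hiQ]
      have := cum_tr_eq_zero he.2.1 q i hi
      simpa [cum, tr, colSum] using this
    · exact hQ' i (by omega)
  · by_cases h0 : 0 < Q
    · rw [← hcol 0 h0]
      refine (colSum_le_sum he.1 0).trans (le_trans ?_ hB)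
      exact sum_le_sum fun i _ => sub_le _ _
    · rw [hQ' 0 (by omega)]; exact zero_le _

lemma sum_comm_reverse {α β γ : Type*} (s : Finset α) (t : Finset β) (u : Finset γ)
    (F : α → β → γ → ℕ) : ∑ a ∈ s, ∑ b ∈ t, ∑ c ∈ u, F a b c = ∑ c ∈ u, ∑ b ∈ t, ∑ a ∈ s, F a b c := by
  rw [sum_comm, sum_congr rfl fun b _ => sum_comm, sum_comm]

section main
variable {p q B : ℕ} {lam : Ptn}

local notation "schurSkew" ga:max al:max => schurP (p + q) q ga * skewPoly (p + q) q (Subtype.val al) (Subtype.val lam - Subtype.val al)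

lemma sum_rectSet_eq (M : Ptn → Ptn → ℕ)
    (h : ∀ (c : NVec p) (d : NVec q), ∑ b, c b ≤ B → ∑ b, d b ≤ B →
      oNum (p + q) lam.1 (append c d) =
        ∑ m ∈ ptns p B, ∑ v ∈ ptns q B, M m v * oNum p m.1 c * oNum q v.1 d)
    (c : NVec p) (d : NVec q) (hc : ∑ b, c b ≤ B) (hd : ∑ b, d b ≤ B) : ∑ j ∈ rectSet p q c d,
      gtNum (p + q) (p + q) 0 lam.1 (append (c - rsum j) (d - csum j)) =
      ∑ m ∈ ptns p B, ∑ v ∈ ptns q B, M m v * gtNum p p 0 m.1 c * gtNum q q 0 v.1 d := by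
  refine eq_of_sum_pairSet_eq (fun c d => ∑ j ∈ rectSet p q c d,
      gtNum (p + q) (p + q) 0 lam.1 (append (c - rsum j) (d - csum j)))
    (fun c d => ∑ m ∈ ptns p B, ∑ v ∈ ptns q B, M m v * gtNum p p 0 m.1 c * gtNum q q 0 v.1 d)
    ?_ c d hc hd
  intro c d hc hd
  rw [← sum_pairSet_append (fun x => gtNum (p + q) (p + q) 0 lam.1 x)]
  refine (h c d hc hd).trans ?_
  simp only [oNum, mul_sum, sum_mul]
  have e1 : ∀ m ∈ ptns p B, ∑ v ∈ ptns q B, ∑ j₂ ∈ pairSet q d, ∑ j₁ ∈ pairSet p c,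
      M m v * gtNum p p 0 m.1 (c - pdeg j₁) * gtNum q q 0 v.1 (d - pdeg j₂) =
      ∑ j₁ ∈ pairSet p c, ∑ j₂ ∈ pairSet q d, ∑ v ∈ ptns q B,
      M m v * gtNum p p 0 m.1 (c - pdeg j₁) * gtNum q q 0 v.1 (d - pdeg j₂) := by
    intro m _
    exact sum_comm_reverse _ _ _ _
  rw [sum_congr rfl e1, sum_comm]
  refine sum_congr rfl fun j₁ _ => ?_
  rw [sum_comm]

lemma sum_rectSet_eq_coeff (hlam : lam.1 0 ≤ B) (c : NVec p) (d : NVec q) (hc : ∑ b, c b ≤ B) :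
    (∑ j ∈ rectSet p q c d, gtNum (p + q) (p + q) 0 lam.1 (append (c - rsum j) (d - csum j)) : ℤ) =
    ∑ al ∈ ptnsLE p B lam, ∑ ga ∈ ptns q B,
      (schurP (p + q) p ga * schurP (p + q) p al).coeff (ex c) *
      (schurSkew ga al).coeff (ex d) := by
  rw [sum_rectSet (fun x y => (gtNum (p + q) (p + q) 0 lam.1 (append x y) : ℤ)) c d hc]
  have h1 : ∀ x ∈ Finset.HasAntidiagonal.antidiagonal (ex c),
      ∀ y ∈ Finset.HasAntidiagonal.antidiagonal (ex d),
      (ctNum p q B x.1 y.1 : ℤ) * (gtNum (p + q) (p + q) 0 lam.1 (append x.2 y.2) : ℤ) =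
      ∑ al ∈ ptnsLE p B lam, ∑ ga ∈ ptns q B,
        ((schurP (p + q) p ga).coeff x.1 * (schurP (p + q) p al).coeff x.2) *
        ((schurP (p + q) q ga).coeff y.1 *
          (skewPoly (p + q) q al.1 (lam.1 - al.1)).coeff y.2) := by
    intro x hx y hy
    rw [Finset.HasAntidiagonal.mem_antidiagonal] at hx
    have hx1 : ∑ b, x.1 b ≤ B := by
      refine (sum_le_sum fun b _ => ?_).trans hc
      have := DFunLike.congr_fun hx b
      rw [ex_apply, Finsupp.add_apply] at this
      omega
    rw [cauchy (M := p + q) _ _ hx1 (by omega), gtNum_append hlam, cast_sum, sum_mul_sum, sum_comm]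
    refine sum_congr rfl fun al _ => sum_congr rfl fun ga _ => ?_
    rw [cast_mul, gtNum_cast, gtNum_cast, ex_coe, ex_coe, ex_coe, ex_coe]
    ring
  rw [sum_congr rfl fun x hx => sum_congr rfl (h1 x hx)]
  simp only [coeff_mul, sum_mul_sum]
  rw [sum_congr rfl fun x _ => sum_comm, sum_comm]
  refine sum_congr rfl fun al _ => ?_
  rw [sum_congr rfl fun x _ => sum_comm, sum_comm]

theorem eq_sum_lrCoeff {mu nu : Ptn} (hlamK : ∀ i, p + q ≤ i → lam.1 i = 0)
    (hlamB : ∑ i ∈ range (p + q), lam.1 i ≤ B)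
    (hlam : lam.1 0 ≤ B) (hmu : mu ∈ ptns p B) (hnu : nu ∈ ptns q B)
    (hmuB : ∑ i, rs p mu.1 i ≤ B) (hnuB : ∑ i, rs q nu.1 i ≤ B) (M : Ptn → Ptn → ℕ)
    (h : ∀ (c : NVec p) (d : NVec q), ∑ b, c b ≤ B → ∑ b, d b ≤ B →
      oNum (p + q) lam.1 (append c d) =
        ∑ m ∈ ptns p B, ∑ v ∈ ptns q B, M m v * oNum p m.1 c * oNum q v.1 d) :
    M mu nu = ∑ al ∈ ptnsLE p B lam, ∑ be ∈ ptns q B, ∑ ga ∈ ptns q B,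
      lrCoeff lam.1 al.1 be.1 * lrCoeff mu.1 al.1 ga.1 * lrCoeff nu.1 be.1 ga.1 := by
  classical
  have key : ∀ (c : NVec p) (d : NVec q), ∑ b, c b ≤ B → ∑ b, d b ≤ B →
      ∑ al ∈ ptnsLE p B lam, ∑ ga ∈ ptns q B,
        (schurP (p + q) p ga * schurP (p + q) p al).coeff (ex c) *
        (schurSkew ga al).coeff (ex d) =
      ∑ m ∈ ptns p B, ∑ v ∈ ptns q B,
        (M m v : ℤ) * (schurP (p + q) p m).coeff (ex c) * (schurP (p + q) q v).coeff (ex d) := by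
    intro c d hc hd
    rw [← sum_rectSet_eq_coeff hlam c d hc]
    have := sum_rectSet_eq M h c d hc hd
    have h2 := congrArg (Nat.cast : ℕ → ℤ) this
    rw [cast_sum] at h2
    rw [h2, cast_sum]
    refine sum_congr rfl fun m hm => ?_
    rw [cast_sum]
    refine sum_congr rfl fun v hv => ?_
    rw [cast_mul, cast_mul, gtNum_eq_coeff (mem_ptns.1 hm).1 (le_add_right p q),
      gtNum_eq_coeff (mem_ptns.1 hv).1 (le_add_left q p)]
  have key2 : ∀ d : NVec q, ∑ b, d b ≤ B →
      ∑ al ∈ ptnsLE p B lam, ∑ ga ∈ ptns q B, (lrCoeff mu.1 al.1 ga.1 : ℤ) *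
        (schurSkew ga al).coeff (ex d) =
      ∑ v ∈ ptns q B, (M mu v : ℤ) * (schurP (p + q) q v).coeff (ex d) := by
    intro d hd
    have h3 := schurCoeff_congr (nu := mu.1) hmuB
      (G := ∑ al ∈ ptnsLE p B lam, ∑ ga ∈ ptns q B,
        (schurSkew ga al).coeff (ex d) •
        (schurP (p + q) p ga * schurP (p + q) p al))
      (H := ∑ m ∈ ptns p B, ∑ v ∈ ptns q B,
        ((M m v : ℤ) * (schurP (p + q) q v).coeff (ex d)) • schurP (p + q) p m) (by
        intro c hc
        simp only [coeff_sum, coeff_smul, smul_eq_mul]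
        refine Eq.trans ?_ ((key c d hc hd).trans ?_)
        · exact sum_congr rfl fun al _ => sum_congr rfl fun ga _ => mul_comm _ _
        · refine sum_congr rfl fun al _ => sum_congr rfl fun ga _ => ?_
          ring)
    simp only [map_sum, map_smul, smul_eq_mul] at h3
    refine Eq.trans ?_ (h3.trans ?_)
    · refine sum_congr rfl fun al hal => sum_congr rfl fun ga hga => ?_
      rw [schurCoeff_schurP_mul (mem_ptnsLE.1 hal).1
        (fun i hi => (mem_ptns.1 hga).1 i (by omega)) hmu (le_add_right p q)]
      ring
    · rw [sum_eq_single_of_mem mu hmu]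
      · refine sum_congr rfl fun v _ => ?_
        rw [schurCoeff_schurP hmu hmu (le_add_right p q), if_pos rfl, mul_one]
      · intro m hm hne
        refine sum_eq_zero fun v _ => ?_
        rw [schurCoeff_schurP hm hmu (le_add_right p q), if_neg hne, mul_zero]
  have h4 := schurCoeff_congr (nu := nu.1) hnuB
    (G := ∑ al ∈ ptnsLE p B lam, ∑ ga ∈ ptns q B, (lrCoeff mu.1 al.1 ga.1 : ℤ) •
      (schurSkew ga al))
    (H := ∑ v ∈ ptns q B, (M mu v : ℤ) • schurP (p + q) q v) (by
      intro d hd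
      simp only [coeff_sum, coeff_smul, smul_eq_mul]
      exact key2 d hd)
  simp only [map_sum, map_smul, smul_eq_mul] at h4
  rw [sum_eq_single_of_mem (s := ptns q B) nu hnu] at h4
  · rw [schurCoeff_schurP hnu hnu (le_add_left q p), if_pos rfl, mul_one] at h4
    rw [← cast_inj (R := ℤ), ← h4]
    push_cast
    refine sum_congr rfl fun al hal => ?_
    have hal' := mem_ptnsLE.1 hal
    rw [sum_comm]
    refine sum_congr rfl fun ga hga => ?_
    rw [skewPoly_eq_sum_schurP (B := B) (M := p + q) al.1 (lam.1 - al.1)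
      ((sum_le_sum fun i _ => sub_le _ _).trans hlamB) (le_add_left q p),
      mul_sum, map_sum, mul_sum]
    refine sum_congr rfl fun be hbe => ?_
    rw [mul_smul_comm, map_smul, smul_eq_mul, schurCoeff_schurP_mul hbe
      (fun i hi => (mem_ptns.1 hga).1 i (by omega)) hnu (le_add_left q p),
      ← lrCoeff_eq lam.antitone al.antitone hlamK (mem_ptns.1 hbe).1 hal'.2]
    ring
  · intro v hv hne
    rw [schurCoeff_schurP hv hnu (le_add_left q p), if_neg hne, mul_zero]

theorem finsum_lrCoeff {mu nu : Ptn} (hmu : mu ∈ ptns p B) (hnu : nu ∈ ptns q B)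
    (hnuB : ∑ i ∈ range q, nu.1 i ≤ B) : ∑ᶠ (a : Ptn) (b : Ptn) (c : Ptn),
      lrCoeff lam.1 a.1 b.1 * lrCoeff mu.1 a.1 c.1 * lrCoeff nu.1 b.1 c.1 =
    ∑ al ∈ ptnsLE p B lam, ∑ be ∈ ptns q B, ∑ ga ∈ ptns q B,
      lrCoeff lam.1 al.1 be.1 * lrCoeff mu.1 al.1 ga.1 * lrCoeff nu.1 be.1 ga.1 := by
  have hmu' := mem_ptns.1 hmu
  have hnu' := mem_ptns.1 hnu
  have hle : ∀ {l m v : ℕ → ℕ}, lrCoeff l m v ≠ 0 → ∀ i, m i ≤ l i := by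
    intro l m v h
    by_contra hc
    exact h (lrCoeff_of_not_le hc)
  have h1 : ∀ a b : Ptn, ∑ᶠ c : Ptn,
      lrCoeff lam.1 a.1 b.1 * lrCoeff mu.1 a.1 c.1 * lrCoeff nu.1 b.1 c.1 =
      ∑ ga ∈ ptns q B,
        lrCoeff lam.1 a.1 b.1 * lrCoeff mu.1 a.1 ga.1 * lrCoeff nu.1 b.1 ga.1 := by
    intro a b
    refine finsum_eq_sum_of_support_subset _ fun c hc => ?_
    exact lrCoeff_ne_zero hnu'.1 hnuB (right_ne_zero_of_mul hc)
  have h2 : ∀ a : Ptn, ∑ᶠ b : Ptn, ∑ ga ∈ ptns q B,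
        lrCoeff lam.1 a.1 b.1 * lrCoeff mu.1 a.1 ga.1 * lrCoeff nu.1 b.1 ga.1 =
      ∑ be ∈ ptns q B, ∑ ga ∈ ptns q B,
        lrCoeff lam.1 a.1 be.1 * lrCoeff mu.1 a.1 ga.1 * lrCoeff nu.1 be.1 ga.1 := by
    intro a
    refine finsum_eq_sum_of_support_subset _ fun b hb => ?_
    obtain ⟨ga, -, hga⟩ := exists_ne_zero_of_sum_ne_zero hb
    have h3 := hle (right_ne_zero_of_mul hga)
    refine mem_ptns.2 ⟨fun i hi => ?_, (h3 0).trans hnu'.2⟩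
    exact le_zero.1 ((h3 i).trans (hnu'.1 i hi).le)
  simp only [h1, h2]
  refine finsum_eq_sum_of_support_subset _ fun a ha => ?_
  obtain ⟨be, -, hbe⟩ := exists_ne_zero_of_sum_ne_zero ha
  obtain ⟨ga, -, hga⟩ := exists_ne_zero_of_sum_ne_zero hbe
  have h3 := hle (right_ne_zero_of_mul (left_ne_zero_of_mul hga))
  have h4 := hle (left_ne_zero_of_mul (left_ne_zero_of_mul hga))
  refine mem_ptnsLE.2 ⟨mem_ptns.2 ⟨fun i hi => ?_, (h3 0).trans hmu'.2⟩, h4⟩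
  exact le_zero.1 ((h3 i).trans (hmu'.1 i hi).le)

end main

end

section Fischer

open MvPolynomial

variable {σ : Type*} [Fintype σ]

/-- The product of the factorials of the exponents. -/
def mfact (m : σ →₀ ℕ) : ℂ := ∏ s, ((m s).factorial : ℂ)

/-- The Fischer inner product on polynomials, linear in the first argument. -/
def fis (f h : MP σ) : ℂ :=
  ∑ m ∈ f.support, mfact m * coeff m f * star (coeff m h)

lemma mfact_add_single [DecidableEq σ] (m : σ →₀ ℕ) (i : σ) :
    mfact (m + Finsupp.single i 1) = mfact m * (m i + 1) := by
  unfold mfact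
  rw [← mul_prod_erase _ _ (mem_univ i),
    ← mul_prod_erase (univ) (fun s => ((m s).factorial : ℂ)) (mem_univ i)]
  have : ∏ s ∈ univ.erase i, (((m + Finsupp.single i 1 : σ →₀ ℕ) s).factorial : ℂ)
      = ∏ s ∈ univ.erase i, ((m s).factorial : ℂ) := by
    refine prod_congr rfl fun s hs => ?_
    have : s ≠ i := ne_of_mem_erase hs
    simp [this.symm]
  rw [this]
  simp [Nat.factorial_succ]
  ring

lemma mfact_pos (m : σ →₀ ℕ) : ∃ k : ℕ, 0 < k ∧ mfact m = k :=
  ⟨∏ s, (m s).factorial, prod_pos fun _ _ => Nat.factorial_pos _, by simp [mfact]⟩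

lemma fis_eq_sum (f h : MP σ) {S : Finset (σ →₀ ℕ)} (hS : f.support ⊆ S) :
    fis f h = ∑ m ∈ S, mfact m * coeff m f * star (coeff m h) := by
  refine sum_subset hS fun m _ hm => ?_
  rw [notMem_support_iff.1 hm]
  simp

lemma fis_eq_sum_right (f h : MP σ) {S : Finset (σ →₀ ℕ)} (hS : h.support ⊆ S) :
    fis f h = ∑ m ∈ S, mfact m * coeff m f * star (coeff m h) := by
  classical
  rw [fis_eq_sum f h (subset_union_left (s₂ := S))]
  refine (sum_subset subset_union_right fun m _ hm => ?_).symm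
  rw [notMem_support_iff.1 fun h' => hm (hS h')]
  simp

lemma fis_add_left (f g h : MP σ) : fis (f + g) h = fis f h + fis g h := by
  rw [fis_eq_sum_right _ h subset_rfl, fis_eq_sum_right _ h subset_rfl,
    fis_eq_sum_right _ h subset_rfl, ← sum_add_distrib]
  refine sum_congr rfl fun m _ => ?_
  rw [coeff_add]; ring

lemma fis_smul_left (a : ℂ) (f h : MP σ) : fis (a • f) h = a * fis f h := by
  rw [fis_eq_sum_right _ h subset_rfl, fis_eq_sum_right _ h subset_rfl, mul_sum]
  refine sum_congr rfl fun m _ => ?_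
  rw [coeff_smul, smul_eq_mul]; ring

lemma star_mfact (m : σ →₀ ℕ) : star (mfact m) = mfact m := by
  obtain ⟨k, -, hk⟩ := mfact_pos m
  rw [hk]; simp

lemma fis_star (f h : MP σ) : star (fis f h) = fis h f := by
  rw [fis_eq_sum_right h f subset_rfl, fis, star_sum]
  refine sum_congr rfl fun m _ => ?_
  rw [star_mul', star_mul', star_star, star_mfact]; ring

lemma fis_self_pos {f : MP σ} (hf : f ≠ 0) : ∃ r : ℝ, 0 < r ∧ fis f f = r := by
  refine ⟨∑ m ∈ f.support, (∏ s, ((m s).factorial : ℝ)) * Complex.normSq (coeff m f),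
    sum_pos (fun m hm => mul_pos (prod_pos fun s _ => by positivity)
      (Complex.normSq_pos.2 (mem_support_iff.1 hm))) (support_nonempty.2 hf), ?_⟩
  rw [fis, Complex.ofReal_sum]
  refine sum_congr rfl fun m _ => ?_
  have : star (coeff m f) = (starRingEnd ℂ) (coeff m f) := rfl
  rw [mul_assoc, this, Complex.mul_conj]
  simp [mfact]

lemma fis_self_ne_zero {f : MP σ} (hf : f ≠ 0) : fis f f ≠ 0 := by
  obtain ⟨r, hr, h⟩ := fis_self_pos hf
  rw [h]
  exact_mod_cast hr.ne'

lemma fis_add_right (f g h : MP σ) : fis f (g + h) = fis f g + fis f h := by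
  rw [← fis_star, fis_add_left, star_add, fis_star, fis_star]

lemma fis_smul_right (a : ℂ) (f h : MP σ) : fis f (a • h) = star a * fis f h := by
  rw [← fis_star, fis_smul_left, star_mul', fis_star]

lemma fis_zero_left (h : MP σ) : fis 0 h = 0 := by simp [fis]

lemma fis_zero_right (h : MP σ) : fis h 0 = 0 := by simp [fis]

lemma fis_sum_left {ι : Type*} (s : Finset ι) (f : ι → MP σ)
    (h : MP σ) : fis (∑ i ∈ s, f i) h = ∑ i ∈ s, fis (f i) h := by
  classical
  induction s using Finset.induction_on with
  | empty => simp [fis_zero_left]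
  | insert a s ha ih => rw [sum_insert ha, sum_insert ha, fis_add_left, ih]

lemma fis_sum_right {ι : Type*} (s : Finset ι) (f : ι → MP σ)
    (h : MP σ) : fis h (∑ i ∈ s, f i) = ∑ i ∈ s, fis h (f i) := by
  classical
  induction s using Finset.induction_on with
  | empty => simp [fis_zero_right]
  | insert a s ha ih => rw [sum_insert ha, sum_insert ha, fis_add_right, ih]

lemma fis_monomial_left (m : σ →₀ ℕ) (a : ℂ) (h : MP σ) :
    fis (monomial m a) h = mfact m * a * star (coeff m h) := by
  classical
  rw [fis_eq_sum _ h support_monomial_subset]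
  simp

lemma fis_X_mul (i : σ) (f h : MP σ) : fis (X i * f) h = fis f (pderiv i h) := by
  classical
  induction f using MvPolynomial.induction_on' with
  | add p q hp hq => rw [mul_add, fis_add_left, fis_add_left, hp, hq]
  | monomial m a =>
    rw [X, monomial_mul, fis_monomial_left, fis_monomial_left, coeff_pderiv, one_mul, add_comm,
      mfact_add_single]
    simp
    ring

lemma fis_mul_X (i : σ) (f h : MP σ) : fis (pderiv i f) h = fis f (X i * h) := by
  rw [← fis_star, ← fis_X_mul, fis_star]

lemma fis_one_left (h : MP σ) : fis 1 h = star (constantCoeff h) := by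
  rw [← C_1, C_apply, fis_monomial_left]
  simp [mfact, constantCoeff_eq]

/-- Linear substitution `X s ↦ ∑ t, A t s X t`. -/
def lsub (A : Matrix σ σ ℂ) : MP σ →ₐ[ℂ] MP σ :=
  aeval fun s => ∑ t, A t s • X t

lemma lsub_X (A : Matrix σ σ ℂ) (s : σ) : lsub A (X s) = ∑ t, A t s • X t := by
  simp [lsub]

lemma lsub_lsub (A B : Matrix σ σ ℂ) (f : MP σ) : lsub A (lsub B f) = lsub (A * B) f := by
  have : (lsub A).comp (lsub B) = lsub (A * B) := by
    refine algHom_ext fun s => ?_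
    rw [AlgHom.comp_apply, lsub_X, lsub_X, map_sum]
    simp only [map_smul, lsub_X, mul_apply, sum_smul, smul_sum]
    rw [sum_comm]
    simp only [smul_smul, mul_comm]
  rw [← this]; rfl

lemma lsub_one [DecidableEq σ] (f : MP σ) : lsub 1 f = f := by
  have : lsub (1 : Matrix σ σ ℂ) = AlgHom.id ℂ _ := by
    refine algHom_ext fun s => ?_
    rw [lsub_X]
    simp [one_apply]
  rw [this]; rfl

lemma eval_lsub (A : Matrix σ σ ℂ) (x : σ → ℂ) (f : MP σ) :
    eval x (lsub A f) = eval (fun s => ∑ t, A t s * x t) f := by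
  have : (aeval x).comp (lsub A) = aeval fun s => ∑ t, A t s * x t := by
    refine algHom_ext fun s => ?_
    rw [AlgHom.comp_apply, lsub_X]
    simp
  have := DFunLike.congr_fun this f
  simpa [aeval_eq_eval] using this

lemma pderiv_lsub (A : Matrix σ σ ℂ) (t : σ) (f : MP σ) :
    pderiv t (lsub A f) = ∑ s, A t s • lsub A (pderiv s f) := by
  classical
  induction f using induction_on with
  | C a => simp [lsub]
  | add p q hp hq => simp [hp, hq, sum_add_distrib]
  | mul_X p i hp =>
    rw [map_mul, pderiv_mul, hp]
    have h1 : pderiv t (lsub A (X i)) = C (A t i) := by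
      rw [lsub_X, map_sum]
      simp [Pi.single_apply, smul_eq_C_mul]
    rw [h1]
    have h2 : ∀ s, A t s • lsub A (pderiv s (p * X i))
        = A t s • lsub A (pderiv s p) * lsub A (X i)
          + (if s = i then lsub A p * C (A t i) else 0) := by
      intro s
      rw [pderiv_mul, map_add, map_mul, map_mul, smul_add, smul_mul_assoc]
      congr 1
      by_cases h : s = i
      · subst h; simp [smul_eq_C_mul, mul_comm]
      · simp [h, pderiv_X_of_ne (Ne.symm h)]
    simp only [h2, sum_add_distrib, sum_ite_eq', mem_univ, if_true, sum_mul]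

lemma constantCoeff_lsub (A : Matrix σ σ ℂ) (f : MP σ) :
    constantCoeff (lsub A f) = constantCoeff f := by
  have := eval_lsub A 0 f
  simpa [← constantCoeff_eq, eval_zero] using this

lemma fis_lsub (A : Matrix σ σ ℂ) (f h : MP σ) : fis (lsub A f) h = fis f (lsub Aᴴ h) := by
  induction f using induction_on generalizing h with
  | C a =>
    have : (C a : MP σ) = a • 1 := by rw [smul_eq_C_mul, mul_one]
    rw [this, map_smul, map_one, fis_smul_left, fis_smul_left, fis_one_left, fis_one_left,
      constantCoeff_lsub]
  | add p q hp hq => simp [fis_add_left, hp, hq]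
  | mul_X p i hp =>
    rw [map_mul, mul_comm, mul_comm p, fis_X_mul, pderiv_lsub, lsub_X, sum_mul,
      fis_sum_left, fis_sum_right]
    refine sum_congr rfl fun s _ => ?_
    rw [smul_mul_assoc, fis_smul_left, fis_X_mul, hp, fis_smul_right, conjTranspose_apply,
      star_star]

end Fischer

section Polarization

open Module.End Module MvPolynomial

variable {σ : Type*}

/-- The polarization operator `X s * ∂ t`. -/
def polz (s t : σ) : End ℂ (MP σ) :=
  LinearMap.mulLeft ℂ (X s) ∘ₗ (pderiv t).toLinearMap

lemma polz_apply (s t : σ) (f : MP σ) : polz s t f = X s * pderiv t f := rfl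

lemma fis_polz [Fintype σ] (s t : σ) (f h : MP σ) : fis (polz s t f) h = fis f (polz t s h) := by
  rw [polz_apply, fis_X_mul, fis_mul_X, polz_apply]

lemma coeff_polz_add {s t : σ} (u : σ →₀ ℕ) (f : MP σ) : coeff (u + Finsupp.single s 1) (polz s t f)
      = coeff (u + Finsupp.single t 1) f * (u t + 1) := by
  rw [polz_apply, add_comm u, coeff_X_mul, coeff_pderiv]

lemma coeff_polz_of_zero {s t : σ} {u : σ →₀ ℕ} (hu : u s = 0) (f : MP σ) :
    coeff u (polz s t f) = 0 := by
  classical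
  rw [polz_apply, coeff_X_mul', if_neg]
  simpa using hu

lemma coeff_polz_self (s : σ) (u : σ →₀ ℕ) (f : MP σ) : coeff u (polz s s f) = coeff u f * u s := by
  classical
  by_cases hu : u s = 0
  · rw [coeff_polz_of_zero hu, hu]; simp
  · have : u - Finsupp.single s 1 + Finsupp.single s 1 = u :=
      tsub_add_cancel_of_le (Finsupp.single_le_iff.2 (by omega))
    rw [← this, coeff_polz_add]
    simp

lemma polz_comm [DecidableEq σ] (s t u v : σ) : polz s t * polz u v - polz u v * polz s t
      = (if t = u then polz s v else 0) - (if v = s then polz u t else 0) := by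
  have hc : ∀ f : MP σ, pderiv t (pderiv v f) = pderiv v (pderiv t f) := by
    intro f
    ext m
    rw [coeff_pderiv, coeff_pderiv, coeff_pderiv, coeff_pderiv, add_right_comm]
    simp only [Finsupp.add_apply, Finsupp.single_apply]
    by_cases h : t = v
    · subst h; simp
    · simp [h, Ne.symm h]; ring
  refine LinearMap.ext fun f => ?_
  simp only [LinearMap.sub_apply, End.mul_apply, polz_apply, pderiv_mul, pderiv_X, hc]
  have e1 : ((if t = u then polz s v else 0) : End ℂ (MP σ)) f
      = if t = u then X s * pderiv v f else 0 := by split_ifs <;> rfl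
  have e2 : ((if v = s then polz u t else 0) : End ℂ (MP σ)) f
      = if v = s then X u * pderiv t f else 0 := by split_ifs <;> rfl
  rw [e1, e2]
  simp only [Pi.single_apply]
  by_cases h1 : t = u <;> by_cases h2 : v = s <;>
    simp [h1, h2, eq_comm (a := u), eq_comm (a := s)] <;> ring

/-- A vector killed by the raising operator and in the image of `D ^ N` has weight at least `N`. -/
lemma le_weight_of_sl2 [Fintype σ] (D F H : End ℂ (MP σ))
    (hDF : D * F = F * D + H) (hHF : H * F = F * H - 2 • F)
    (hadj : ∀ f h, fis (D f) h = fis f (F h)) {h h' : MP σ} {N : ℕ} {w : ℤ}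
    (hN : (D ^ N) h' = h) (h0 : h ≠ 0) (hD : D h = 0) (hH : H h = (w : ℂ) • h) : (N : ℤ) ≤ w := by
  have hadjN : ∀ (N : ℕ) (f g : MP σ), fis ((D ^ N) f) g = fis f ((F ^ N) g) := by
    intro N
    induction N with
    | zero => intros; rfl
    | succ k ih =>
      intro f g
      rw [pow_succ', End.mul_apply, hadj, ih, ← End.mul_apply, ← pow_succ]
  have hF : (F ^ N) h ≠ 0 := by
    intro h1
    have := hadjN N h' h
    rw [hN, h1, fis_zero_right] at this
    exact fis_self_ne_zero h0 this
  have hHj : ∀ j : ℕ, H ((F ^ j) h) = ((w : ℂ) - 2 * j) • (F ^ j) h := by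
    intro j
    induction j with
    | zero => simpa using hH
    | succ j ih =>
      rw [pow_succ', End.mul_apply, ← End.mul_apply H F, hHF, LinearMap.sub_apply,
        End.mul_apply, ih, map_smul, LinearMap.smul_apply, ← Nat.cast_smul_eq_nsmul ℂ,
        ← sub_smul]
      congr 1; push_cast; ring
  have hDj : ∀ j : ℕ, D ((F ^ (j + 1)) h) = (((j : ℂ) + 1) * (w - j)) • (F ^ j) h := by
    intro j
    induction j with
    | zero =>
      have : D (F h) = F (D h) + H h := by
        rw [← mul_apply D F, hDF]; rfl
      simp [this, hD, hH]
    | succ j ih =>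
      have : D (F ((F ^ (j + 1)) h)) = F (D ((F ^ (j + 1)) h)) + H ((F ^ (j + 1)) h) := by
        rw [← mul_apply D F, hDF]; rfl
      rw [pow_succ' F (j + 1), End.mul_apply, this, ih, hHj, map_smul,
        ← mul_apply F, ← pow_succ', ← add_smul]
      congr 1; push_cast; ring
  obtain ⟨r, hr, hr'⟩ := fis_self_pos hF
  have e1 : fis ((F ^ (N + 1)) h) ((F ^ (N + 1)) h)
      = (((N : ℂ) + 1) * (w - N)) * fis ((F ^ N) h) ((F ^ N) h) := by
    rw [← fis_smul_left, ← hDj, hadj, ← mul_apply F, ← pow_succ']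
  have e2 : ∃ r2 : ℝ, 0 ≤ r2 ∧ fis ((F ^ (N + 1)) h) ((F ^ (N + 1)) h) = r2 := by
    by_cases hz : (F ^ (N + 1)) h = 0
    · exact ⟨0, le_rfl, by rw [hz, fis_zero_left]; simp⟩
    · obtain ⟨r2, hr2, hr2'⟩ := fis_self_pos hz
      exact ⟨r2, hr2.le, hr2'⟩
  obtain ⟨r2, hr2, hr2'⟩ := e2
  rw [hr', hr2'] at e1
  have e4 : r2 = ((N : ℝ) + 1) * (w - N) * r := by exact_mod_cast e1
  have : (0 : ℝ) ≤ w - N := by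
    by_contra hc
    push Not at hc
    have : 0 < ((N : ℝ) + 1) * (N - w) * r :=
      mul_pos (mul_pos (by positivity) (by linarith)) hr
    nlinarith
  have : ((N : ℤ) : ℝ) ≤ w := by push_cast; linarith
  exact_mod_cast this

end Polarization

section Leading

open MvPolynomial

variable {m q : ℕ}

/-- The lexicographic order on exponents, last column first, each column from the bottom. -/
def lexLt (e e' : Mon m q) : Prop :=
  ∃ s : Fin m × Fin q, e s < e' s ∧
    ∀ t : Fin m × Fin q, (s.2 < t.2 ∨ (s.2 = t.2 ∧ s.1 < t.1)) → e t = e' t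

/-- The raising operator from row `i'` to row `i` on a set of columns. -/
def raise (S : Finset (Fin q)) (i i' : Fin m) : Module.End ℂ (Pol m q) :=
  ∑ b ∈ S, polz (i, b) (i', b)

lemma raise_sl2 (S : Finset (Fin q)) {i i' : Fin m} (h : i ≠ i') :
    raise S i i' * raise S i' i - raise S i' i * raise S i i' = (raise S i i - raise S i' i') ∧
    (raise S i i - raise S i' i') * raise S i' i - raise S i' i * (raise S i i - raise S i' i')
      = - (2 • raise S i' i) := by
  classical
  have key : ∀ j j' k k' : Fin m, raise S j j' * raise S k k' - raise S k k' * raise S j j'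
      = (if j' = k then raise S j k' else 0) - (if k' = j then raise S k j' else 0) := by
    intro j j' k k'
    unfold raise
    rw [sum_mul_sum, sum_mul_sum]
    rw [sum_comm (s := S) (t := S) (f := fun b c => polz (k, b) (k', b) * polz (j, c) (j', c)),
      ← sum_sub_distrib]
    simp only [← sum_sub_distrib, polz_comm, Prod.mk.injEq]
    have : ∀ b ∈ S, ∑ c ∈ S, (((if j' = k ∧ b = c then polz (j, b) (k', c) else 0) :
        Module.End ℂ (Pol m q))
          - (if k' = j ∧ c = b then polz (k, c) (j', b) else 0))
        = (if j' = k then polz (j, b) (k', b) else 0)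
          - (if k' = j then polz (k, b) (j', b) else 0) := by
      intro b hb
      rw [sum_sub_distrib]
      congr 1
      · split_ifs with h1 <;> simp [h1, hb]
      · split_ifs with h1 <;> simp [h1, hb]
    simp_all
  constructor
  · rw [key]; simp
  · have e1 := key i i i' i
    have e2 := key i' i' i' i
    simp only [h, if_true, if_false] at e1 e2
    rw [sub_mul, mul_sub]
    have : raise S i i * raise S i' i - raise S i' i' * raise S i' i -
        (raise S i' i * raise S i i - raise S i' i * raise S i' i')
        = (raise S i i * raise S i' i - raise S i' i * raise S i i)
          - (raise S i' i' * raise S i' i - raise S i' i * raise S i' i') := by abel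
    rw [this, e1, e2]
    abel

lemma fis_raise (S : Finset (Fin q)) (i i' : Fin m) (f h : Pol m q) :
    fis (raise S i i' f) h = fis f (raise S i' i h) := by
  simp only [raise, LinearMap.sum_apply, fis_sum_left, fis_sum_right, fis_polz]

lemma coeff_raise_self (S : Finset (Fin q)) (i : Fin m) (u : Mon m q) (f : Pol m q) :
    coeff u (raise S i i f) = coeff u f * ((∑ b ∈ S, u (i, b) : ℕ) : ℂ) := by
  simp only [raise, LinearMap.sum_apply, coeff_sum, coeff_polz_self, Nat.cast_sum, mul_sum]

/-- The part of a polynomial with exponents satisfying `P`. -/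
def part {σ : Type*} (P : (σ →₀ ℕ) → Prop) (f : MP σ) : MP σ := by
  classical exact ∑ u ∈ f.support.filter P, monomial u (coeff u f)

open Classical in
lemma coeff_part {σ : Type*} (P : (σ →₀ ℕ) → Prop) (f : MP σ) (u : σ →₀ ℕ) :
    coeff u (part P f) = if P u then coeff u f else 0 := by
  unfold part
  simp only [coeff_sum, coeff_monomial, sum_ite_eq', mem_filter, mem_support_iff]
  by_cases h : P u <;> by_cases h2 : coeff u f = 0 <;> simp [h, h2]

lemma exists_of_coeff_polz_pow {σ : Type*} {s t : σ} {N : ℕ} {u : σ →₀ ℕ}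
    {g : MP σ} (h : coeff u ((polz s t ^ N) g) ≠ 0) :
    ∃ v, coeff v g ≠ 0 ∧ v + Finsupp.single s N = u + Finsupp.single t N := by
  induction N generalizing u with
  | zero => exact ⟨u, by simpa using h, by simp⟩
  | succ N ih =>
    rw [pow_succ', Module.End.mul_apply] at h
    have hu : u s ≠ 0 := fun hu => h (coeff_polz_of_zero hu _)
    obtain ⟨u', rfl⟩ : ∃ u', u = u' + Finsupp.single s 1 :=
      ⟨u - Finsupp.single s 1, (tsub_add_cancel_of_le (Finsupp.single_le_iff.2 (by omega))).symm⟩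
    rw [coeff_polz_add] at h
    obtain ⟨v, hv, hv'⟩ := ih (left_ne_zero_of_mul h)
    refine ⟨v, hv, ?_⟩
    rw [Finsupp.single_add, ← add_assoc, hv', Finsupp.single_add]
    abel

lemma coeff_polz_pow_ne_zero {σ : Type*} {s t : σ} {N : ℕ} {u : σ →₀ ℕ}
    {g : MP σ} (h : coeff (u + Finsupp.single t N) g ≠ 0) :
    coeff (u + Finsupp.single s N) ((polz s t ^ N) g) ≠ 0 := by
  induction N generalizing u with
  | zero => simpa using h
  | succ N ih =>
    rw [pow_succ', Module.End.mul_apply, Finsupp.single_add, ← add_assoc, coeff_polz_add,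
      add_right_comm]
    refine mul_ne_zero (ih ?_) (by norm_cast)
    rw [add_assoc, add_comm (Finsupp.single t 1), ← Finsupp.single_add]
    exact h

open Classical in
lemma coeff_polz_part {σ : Type*} {s t : σ} {P Q : (σ →₀ ℕ) → Prop}
    (hPQ : ∀ w, P (w + Finsupp.single t 1) ↔ Q (w + Finsupp.single s 1)) (f : MP σ) (u : σ →₀ ℕ) :
    coeff u (polz s t (part P f)) = if Q u then coeff u (polz s t f) else 0 := by
  by_cases hu : u s = 0
  · rw [coeff_polz_of_zero hu, coeff_polz_of_zero hu, ite_self]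
  · obtain ⟨u', rfl⟩ : ∃ u', u = u' + Finsupp.single s 1 :=
      ⟨u - Finsupp.single s 1, (tsub_add_cancel_of_le (Finsupp.single_le_iff.2 (by omega))).symm⟩
    rw [coeff_polz_add, coeff_polz_add, coeff_part]
    grind

/-- The exponents agreeing with `e` outside of `(i, a)`, `(i', a)` and the columns left of `a`,
with entry `s` in `(i', a)`. -/
def Pat (e : Mon m q) (i i' : Fin m) (a : Fin q) (s : ℕ) (u : Mon m q) : Prop :=
  (∀ j b, a < b → u (j, b) = e (j, b)) ∧ (∀ j, j ≠ i → j ≠ i' → u (j, a) = e (j, a)) ∧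
    u (i', a) = s ∧ u (i, a) + s = e (i', a) + e (i, a)

lemma pat_add_left {e : Mon m q} {i i' : Fin m} {a b : Fin q} (hb : b < a) {s : ℕ}
    (w : Mon m q) (j j' : Fin m) :
    Pat e i i' a s (w + Finsupp.single (j, b) 1) ↔ Pat e i i' a s (w + Finsupp.single (j', b) 1) := by
  have : ∀ (j k : Fin m) (c : Fin q), a ≤ c →
      (w + Finsupp.single (j, b) 1 : Mon m q) (k, c) = w (k, c) := by
    intro j k c hc
    have : (j, b) ≠ (k, c) := fun h => absurd (Prod.ext_iff.1 h).2 (hb.trans_le hc).ne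
    simp [this.symm]
  simp only [Pat]
  grind

lemma pat_add_mid {e : Mon m q} {i i' : Fin m} (hi : i ≠ i') {a : Fin q} {s : ℕ} (w : Mon m q) :
    Pat e i i' a (s + 1) (w + Finsupp.single (i', a) 1) ↔
      Pat e i i' a s (w + Finsupp.single (i, a) 1) := by
  have h1 : ∀ (j k : Fin m) (c : Fin q), (j, a) ≠ (k, c) →
      (w + Finsupp.single (j, a) 1 : Mon m q) (k, c) = w (k, c) := by
    intro j k c hc
    simp [hc.symm]
  have h2 : ∀ (j : Fin m),
      (w + Finsupp.single (j, a) 1 : Mon m q) (j, a) = w (j, a) + 1 := by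
    intro j; simp
  simp only [Pat, h2]
  rw [h1 i' i a (by simp [hi.symm]), h1 i i' a (by simp [hi])]
  refine and_congr ⟨fun h k c hc => ?_, fun h k c hc => ?_⟩
    (and_congr ⟨fun h k hk1 hk2 => ?_, fun h k hk1 hk2 => ?_⟩ (by omega))
  · rw [← h k c hc, h1 _ _ _ (by simp [hc.ne]), h1 _ _ _ (by simp [hc.ne])]
  · rw [← h k c hc, h1 _ _ _ (by simp [hc.ne]), h1 _ _ _ (by simp [hc.ne])]
  · rw [← h k hk1 hk2, h1 _ _ _ (by simp [Ne.symm hk1]), h1 _ _ _ (by simp [Ne.symm hk2])]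
  · rw [← h k hk1 hk2, h1 _ _ _ (by simp [Ne.symm hk2]), h1 _ _ _ (by simp [Ne.symm hk1])]

lemma raise_part {f : Pol m q} {e : Mon m q}
    (hmax : ∀ e', coeff e' f ≠ 0 → ¬ lexLt e e') {i i' : Fin m} (hi : (i : ℕ) + 1 = i')
    (hf : raise univ i i' f = 0) (a : Fin q) (s : ℕ) :
    raise (univ.filter (· < a)) i i' (part (Pat e i i' a s) f)
      = - polz (i, a) (i', a) (part (Pat e i i' a (s + 1)) f) := by
  classical
  have hne : i ≠ i' := fun h => by rw [h] at hi; omega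
  ext u
  rw [coeff_neg, coeff_polz_part (pat_add_mid hne), raise, LinearMap.sum_apply, coeff_sum]
  rw [sum_congr rfl fun b hb => coeff_polz_part
    (pat_add_left (by simpa using hb : b < a) · i' i) f u]
  by_cases h : Pat e i i' a s u
  · simp only [if_pos h]
    have h0 : coeff u (raise univ i i' f) = 0 := by rw [hf, coeff_zero]
    rw [raise, LinearMap.sum_apply, coeff_sum, ← sum_filter_add_sum_filter_not _ (· < a)] at h0
    rw [eq_neg_iff_add_eq_zero, ← h0]
    congr 1
    symm
    refine sum_eq_single a (fun b hb hba => ?_) (fun h => absurd h (by simp))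
    have hab : a < b := lt_of_le_of_ne (by simpa using hb) hba.symm
    by_cases hu : u (i, b) = 0
    · exact coeff_polz_of_zero hu f
    · obtain ⟨u', rfl⟩ : ∃ u', u = u' + Finsupp.single (i, b) 1 :=
        ⟨u - Finsupp.single (i, b) 1,
          (tsub_add_cancel_of_le (Finsupp.single_le_iff.2 (by omega))).symm⟩
      rw [coeff_polz_add]
      by_contra hc
      refine hmax _ (left_ne_zero_of_mul hc) ⟨(i', b), ?_, ?_⟩
      · rw [← h.1 i' b hab]
        simp [hne.symm]
      · rintro ⟨j, c⟩ hjc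
        have hac : a < c := by
          rcases hjc with h | ⟨h, -⟩
          · exact hab.trans h
          · exact hab.trans_eq h
        rw [← h.1 j c hac]
        have e1 : (i', b) ≠ (j, c) := by
          rintro h
          obtain ⟨rfl, rfl⟩ := Prod.ext_iff.1 h
          simp at hjc
        have e2 : (i, b) ≠ (j, c) := by
          rintro h
          obtain ⟨rfl, rfl⟩ := Prod.ext_iff.1 h
          simp only [lt_self_iff_false, true_and, false_or] at hjc
          have : (i' : ℕ) < i := hjc
          omega
        simp [e1.symm, e2.symm]
  · simp [if_neg h]

lemma leading_le {f : Pol m q} {e : Mon m q}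
    (he : coeff e f ≠ 0) (hmax : ∀ e', coeff e' f ≠ 0 → ¬ lexLt e e') {i i' : Fin m}
    (hi : (i : ℕ) + 1 = i') (hf : raise univ i i' f = 0) {lam : NVec m}
    (hrow : ∀ u, coeff u f ≠ 0 → ∀ i, ∑ b, u (i, b) = lam i) (a : Fin q) :
    ∑ b ∈ univ.filter (· < a), e (i', b) + e (i', a) ≤ ∑ b ∈ univ.filter (· < a), e (i, b) := by
  classical
  have hne : i ≠ i' := fun h => by rw [h] at hi; omega
  set S := univ.filter (· < a) with hS
  set g := fun s => part (Pat e i i' a s) f with hg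
  set N := e (i', a) with hN
  have hcomm : raise S i i' * polz (i, a) (i', a) = polz (i, a) (i', a) * raise S i i' := by
    unfold raise
    rw [sum_mul, mul_sum]
    refine sum_congr rfl fun b hb => ?_
    have h1 : b ≠ a := (mem_filter.1 hb).2.ne
    rw [← sub_eq_zero, polz_comm]
    simp [h1, h1.symm]
  have hk : ∀ k s, (raise S i i' ^ k) (g s) = (-1 : ℂ) ^ k • (polz (i, a) (i', a) ^ k) (g (s + k)) := by
    intro k
    induction k with
    | zero => intro s; simp
    | succ k ih =>
      intro s
      have h1 : raise S i i' ((polz (i, a) (i', a) ^ k) (g (s + k)))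
          = (polz (i, a) (i', a) ^ k) (raise S i i' (g (s + k))) := by
        have := (Commute.pow_right (show Commute _ _ from hcomm) k).eq
        exact LinearMap.congr_fun this _
      rw [pow_succ', Module.End.mul_apply, ih, map_smul, h1, hg, raise_part hmax hi hf, map_neg,
        ← Module.End.mul_apply, ← pow_succ, smul_neg, pow_succ (-1 : ℂ),
        mul_neg_one, neg_smul, add_assoc]
  have hgN : g (N + 1) = 0 := by
    ext u
    rw [hg, coeff_part, coeff_zero]
    split_ifs with h
    · by_contra hc
      refine hmax u hc ⟨(i', a), by rw [h.2.2.1]; omega, ?_⟩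
      rintro ⟨j, c⟩ hjc
      rcases hjc with hjc | ⟨hjc, hjc'⟩
      · exact (h.1 j c hjc).symm
      · simp only at hjc hjc'
        subst hjc
        have : (i' : ℕ) < j := hjc'
        exact (h.2.1 j (fun h => by rw [h] at this; omega) (fun h => by rw [h] at this; omega)).symm
    · rfl
  have hE0 : (polz (i, a) (i', a) ^ N) (g N) ≠ 0 := by
    intro h0
    have hle : Finsupp.single (i', a) N ≤ e := Finsupp.single_le_iff.2 le_rfl
    have := coeff_polz_pow_ne_zero (s := (i, a)) (t := (i', a)) (N := N)
      (u := e - Finsupp.single (i', a) N) (g := g N) (by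
        rw [tsub_add_cancel_of_le hle, hg, coeff_part, if_pos]
        · exact he
        · exact ⟨fun _ _ _ => rfl, fun _ _ _ => rfl, rfl, by rw [add_comm]⟩)
    rw [h0, coeff_zero] at this
    exact this rfl
  have h1 := hk N 0
  have h2 := hk (N + 1) 0
  rw [zero_add] at h1 h2
  obtain ⟨sl1, sl2⟩ := raise_sl2 S hne
  have hfin := le_weight_of_sl2 (raise S i i') (raise S i' i) (raise S i i - raise S i' i')
    (by rw [← sl1]; abel) (by rw [sub_eq_iff_eq_add] at sl2; rw [sl2]; abel)
    (fun f h => fis_raise S i i' f h) (h := (raise S i i' ^ N) (g 0)) (h' := g 0) (N := N)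
    (w := (∑ b ∈ S, e (i, b) : ℕ) - (∑ b ∈ S, e (i', b) : ℕ)) rfl ?_ ?_ ?_
  · omega
  · rw [h1]
    exact smul_ne_zero (pow_ne_zero _ (by norm_num)) hE0
  · rw [← Module.End.mul_apply, ← pow_succ', h2, hgN, map_zero, smul_zero]
  · rw [h1]
    ext u
    rw [LinearMap.sub_apply, coeff_sub, coeff_raise_self, coeff_raise_self, coeff_smul, coeff_smul,
      coeff_smul, ← mul_sub]
    by_cases hc : coeff u ((polz (i, a) (i', a) ^ N) (g N)) = 0
    · rw [hc]; simp
    rw [smul_eq_mul, mul_comm]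
    congr 1
    obtain ⟨v, hv, hv'⟩ := exists_of_coeff_polz_pow hc
    rw [hg, coeff_part] at hv
    have hP : Pat e i i' a N v := by
      by_contra h
      simp [h] at hv
    rw [if_pos hP] at hv
    have hsum : ∀ j : Fin m, (j = i ∨ j = i') →
        ∑ b ∈ S, u (j, b) = ∑ b ∈ S, e (j, b) := by
      intro j hj
      have t1 := hrow v hv j
      rw [← hrow e he j, ← sum_filter_add_sum_filter_not _ (· < a),
        ← sum_filter_add_sum_filter_not univ (· < a) (fun b => e (j, b))] at t1
      have t2 : ∑ b ∈ univ.filter (fun b => ¬ b < a), v (j, b)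
          = ∑ b ∈ univ.filter (fun b => ¬ b < a), e (j, b) := by
        refine sum_congr rfl fun b hb => ?_
        rcases (not_lt.1 (mem_filter.1 hb).2).lt_or_eq with h | rfl
        · exact hP.1 j b h
        · rcases hj with rfl | rfl
          · have := hP.2.2.2; omega
          · exact hP.2.2.1
      have t3 : ∑ b ∈ S, u (j, b) = ∑ b ∈ S, v (j, b) := by
        refine sum_congr rfl fun b hb => ?_
        have hb' : b ≠ a := (mem_filter.1 hb).2.ne
        have := DFunLike.congr_fun hv' (j, b)
        simpa [hb'] using this.symm
      rw [t3]
      simp only [hS] at t1 t2 ⊢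
      omega
    rw [hsum i (Or.inl rfl), hsum i' (Or.inr rfl)]
    push_cast
    rfl

end Leading

section

open OrderDual Fin Equiv

section GTBound

open MvPolynomial

variable {m q : ℕ}

/-- The order on cells, last column first, each column from the bottom. -/
abbrev cellOrder (m q : ℕ) : LinearOrder (Fin m × Fin q) :=
  LinearOrder.lift' (fun s => toLex (toDual s.2, toDual s.1))
    (fun s t h => by
      have := Prod.ext_iff.1 (toLex.injective h)
      exact Prod.ext this.2 this.1)

/-- The corresponding monomial order. -/
def mo (m q : ℕ) : MonomialOrder (Fin m × Fin q) :=
  @MonomialOrder.lex (Fin m × Fin q) (cellOrder m q)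
    (@Finite.to_wellFoundedGT _ _ (cellOrder m q).toPreorder)

lemma lex_toSyn_lt_iff {σ : Type*} [LinearOrder σ] [WellFoundedGT σ] (e e' : σ →₀ ℕ) :
    (MonomialOrder.lex (σ := σ)).toSyn e < MonomialOrder.lex.toSyn e' ↔
      ∃ s, (∀ t < s, e t = e' t) ∧ e s < e' s :=
  MonomialOrder.lex_lt_iff.trans Finsupp.Lex.lt_iff

lemma cellOrder_lt_iff (s t : Fin m × Fin q) :
    (cellOrder m q).lt t s ↔ s.2 < t.2 ∨ (s.2 = t.2 ∧ s.1 < t.1) := by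
  change toLex (toDual t.2, toDual t.1)
    < toLex (toDual s.2, toDual s.1) ↔ _
  rw [Prod.Lex.toLex_lt_toLex]
  simp only [toDual_lt_toDual, toDual_inj]
  exact or_congr Iff.rfl (and_congr eq_comm Iff.rfl)

lemma mo_lt_iff (e e' : Mon m q) : (mo m q).toSyn e < (mo m q).toSyn e' ↔ lexLt e e' := by
  refine (@lex_toSyn_lt_iff _ (cellOrder m q)
    (@Finite.to_wellFoundedGT _ _ (cellOrder m q).toPreorder) e e').trans ?_
  refine exists_congr fun s => ?_
  rw [and_comm]
  exact and_congr Iff.rfl (forall_congr' fun t => imp_congr (cellOrder_lt_iff s t) Iff.rfl)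

/-- The exponent attached to a matrix. -/
def fsM (m q : ℕ) (e : Arr) : Mon m q :=
  Finsupp.equivFunOnFinite.symm fun s => e s.1 s.2

lemma fsM_apply (e : Arr) (s : Fin m × Fin q) : fsM m q e s = e s.1 s.2 := rfl

lemma fsM_extM (u : Mon m q) : fsM m q (extM u) = u := by
  ext s
  rw [fsM_apply, extM_fin]

lemma cum_extM (u : Fin m × Fin q → ℕ) (i : Fin m) (a : ℕ) :
    cum 0 (extM u) a i = ∑ b ∈ univ.filter (fun b : Fin q => (b : ℕ) < a), u (i, b) := by
  simp only [cum, Pi.zero_apply, zero_add]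
  rw [sum_filter, sum_fin_eq_sum_range]
  have : ∀ b, b ∈ range q → (if h : b < q then
      (if ((⟨b, h⟩ : Fin q) : ℕ) < a then u (i, ⟨b, h⟩) else 0) else 0)
      = if b < a then extM u i b else 0 := by
    intro b hb
    rw [dif_pos (mem_range.1 hb)]
    have := extM_fin u i ⟨b, mem_range.1 hb⟩
    simp only at this
    rw [this]
  rw [sum_congr rfl this, ← sum_filter]
  symm
  refine sum_subset (fun b hb => ?_) (fun b hb hb' => ?_)
  · simp at hb ⊢; omega
  · by_contra h
    have := (suppIn_extM u i b h).2
    simp at hb hb'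
    omega

lemma exists_gt {f : Pol m q} (hf : f ≠ 0)
    (hr : ∀ i i' : Fin m, (i : ℕ) + 1 = i' → raise univ i i' f = 0) {rho : NVec m}
    (hrow : ∀ u, coeff u f ≠ 0 → ∀ i, ∑ b, u (i, b) = rho i) {c : NVec q}
    (hcol : ∀ u, coeff u f ≠ 0 → ∀ b, ∑ i, u (i, b) = c b) :
    ∃ e ∈ (mats m q 0 (extz rho)).filter (fun e => cols m q e = c), coeff (fsM m q e) f ≠ 0 := by
  set u := (mo m q).degree f with hu
  have hu0 : coeff u f ≠ 0 := (mo m q).coeff_degree_ne_zero_iff.2 hf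
  have hmax : ∀ e', coeff e' f ≠ 0 → ¬ lexLt u e' := by
    intro e' he' hlt
    rw [← mo_lt_iff] at hlt
    exact he' ((mo m q).coeff_eq_zero_of_lt hlt)
  refine ⟨extM u, ?_, by rw [fsM_extM]; exact hu0⟩
  rw [mem_filter, mem_mats, cols_extM]
  refine ⟨⟨suppIn_extM _, ?_, fun i => ?_⟩, funext fun b => hcol u hu0 b⟩
  · intro i a
    by_cases hi : i + 1 < m
    · have key := fun a => leading_le (i := ⟨i, by omega⟩) (i' := ⟨i + 1, hi⟩) hu0 hmax rfl
        (hr _ _ rfl) hrow a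
      have e1 := cum_extM u ⟨i + 1, hi⟩
      have e2 := cum_extM u ⟨i, by omega⟩
      simp only at e1 e2
      have hmono : Monotone fun a => cum 0 (extM u) a i :=
        monotone_nat_of_le_succ fun a => by simp only [cum_succ]; omega
      have hlt : ∀ a, a < q → cum 0 (extM u) (a + 1) (i + 1) ≤ cum 0 (extM u) a i := by
        intro a ha
        have := key ⟨a, ha⟩
        rw [cum_succ, e1, e2]
        rw [← extM_fin u] at this
        exact this
      by_cases ha : a < q
      · exact hlt a ha
      · have hz : ∀ j b, q ≤ b → extM u j b = 0 := fun j b hb => by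
          by_contra h
          have := (suppIn_extM u j b h).2
          omega
        have hst : cum 0 (extM u) (a + 1) (i + 1) = cum 0 (extM u) q (i + 1) := by
          simp only [cum]
          congr 1
          symm
          refine sum_subset (fun b hb => ?_) (fun b hb hb' => hz _ _ ?_)
          · simp at hb ⊢; omega
          · simpa using hb'
        rw [hst]
        rcases q with _ | q
        · simp [cum]
        · exact (hlt q (by omega)).trans (hmono (by omega))
    · have : cum 0 (extM u) (a + 1) (i + 1) = 0 := by
        simp only [cum, Pi.zero_apply, zero_add]
        refine sum_eq_zero fun b _ => ?_
        by_contra h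
        exact hi (suppIn_extM u _ b h).1
      omega
  · have := congrArg (fun g => extz g i) (funext fun j => hrow u hu0 j : rsum u = rho)
    rw [sum_extM]
    exact this

end GTBound

section MinorProducts

open MvPolynomial

variable {m q : ℕ}

/-- Evaluation of a polynomial in matrix entries at a matrix. -/
def ev (A : Mat m q) : Pol m q →+* ℂ :=
  eval fun s => A s.1 s.2

lemma ev_X (A : Mat m q) (s : Fin m × Fin q) : ev A (X s) = A s.1 s.2 := by
  simp [ev]

lemma ev_smul (A : Mat m q) (c : ℂ) (f : Pol m q) : ev A (c • f) = c * ev A f := by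
  simp [ev]

lemma ev_ext {f g : Pol m q} (h : ∀ A, ev A f = ev A g) : f = g :=
  MvPolynomial.funext fun x => h (of fun i j => x (i, j))

def IsLowerUni {N : ℕ} (L : Mat N N) : Prop :=
  (∀ i, L i i = 1) ∧ ∀ i j : Fin N, (i : ℕ) < (j : ℕ) → L i j = 0

/-- Polynomials invariant under lower unitriangular row operations, of row weight `rho` and
column weight `c`, depending only on rows of positive weight. -/
structure IsRowHW (rho : NVec m) (c : NVec q) (f : Pol m q) :
    Prop where
  lower : ∀ (L : Mat m m) A, IsLowerUni L → ev (L * A) f = ev A f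
  row : ∀ (t : Vec m) A, ev (diagonal t * A) f = (∏ i, t i ^ rho i) * ev A f
  col : ∀ (s : Vec q) A, ev (A * diagonal s) f = (∏ b, s b ^ c b) * ev A f
  dep : ∀ A A', (∀ i, rho i ≠ 0 → A i = A' i) → ev A f = ev A' f

lemma IsRowHW.mul {rho rho' : NVec m} {c c' : NVec q}
    {f f' : Pol m q} (h : IsRowHW rho c f) (h' : IsRowHW rho' c' f') :
    IsRowHW (rho + rho') (c + c') (f * f') where
  lower L A hL := by rw [map_mul, map_mul, h.lower L A hL, h'.lower L A hL]
  row t A := by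
    rw [map_mul, map_mul, h.row, h'.row]
    simp only [Pi.add_apply, pow_add, prod_mul_distrib]
    ring
  col t A := by
    rw [map_mul, map_mul, h.col, h'.col]
    simp only [Pi.add_apply, pow_add, prod_mul_distrib]
    ring
  dep A A' hA := by
    rw [map_mul, map_mul, h.dep A A' fun i hi => hA i (by simp [hi]),
      h'.dep A A' fun i hi => hA i (by simp [hi])]

lemma isRowHW_one : IsRowHW (0 : NVec m) (0 : NVec q) 1 where
  lower _ _ _ := by simp
  row _ _ := by simp
  col _ _ := by simp
  dep _ _ _ := by simp

/-- The minor on the first `h` rows and the columns `T`. -/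
def topMinor {h : ℕ} (hm : h ≤ m) (T : Fin h → Fin q) : Pol m q :=
  (of fun i j : Fin h => (X (castLE hm i, T j) : Pol m q)).det

lemma ev_topMinor {h : ℕ} (hm : h ≤ m) (T : Fin h → Fin q) (A : Mat m q) :
    ev A (topMinor hm T) = (A.submatrix (castLE hm) T).det := by
  rw [topMinor, RingHom.map_det]
  congr 1
  ext i j
  simp [ev_X]

lemma prod_castLE {h : ℕ} (hm : h ≤ m) (t : Vec m) :
    ∏ i, t i ^ (if (i : ℕ) < h then 1 else 0) = ∏ j : Fin h, t (castLE hm j) := by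
  have : ∀ i, t i ^ (if (i : ℕ) < h then 1 else 0) = if (i : ℕ) < h then t i else 1 := by
    intro i; split_ifs <;> simp
  simp only [this]
  rw [← prod_filter]
  symm
  refine prod_bij (fun j _ => castLE hm j) (by simp) (by simp) ?_ (by simp)
  intro i hi
  exact ⟨⟨i, by simpa using hi⟩, by simp, by ext; simp⟩

lemma prod_pow_card {h : ℕ} (T : Fin h → Fin q) (s : Vec q) :
    ∏ b, s b ^ (∑ j, if T j = b then 1 else 0) = ∏ j : Fin h, s (T j) := by
  simp only [← prod_pow_eq_pow_sum]
  rw [prod_comm]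
  simp_all

lemma isRowHW_topMinor {h : ℕ} (hm : h ≤ m) (T : Fin h → Fin q) :
    IsRowHW (fun i : Fin m => if (i : ℕ) < h then 1 else 0)
      (fun b => ∑ j, if T j = b then 1 else 0) (topMinor hm T) where
  lower L A hL := by
    rw [ev_topMinor, ev_topMinor]
    have : (L * A).submatrix (castLE hm) T
        = L.submatrix (castLE hm) (castLE hm) * A.submatrix (castLE hm) T := by
      ext i j
      simp only [submatrix_apply, mul_apply]
      symm
      refine sum_of_injOn (castLE hm) (by simp [Function.Injective.injOn, castLE_injective hm]) (by simp) ?_ (by simp)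
      intro k _ hk
      rw [hL.2, zero_mul]
      simp only [coe_univ, Set.image_univ, Set.mem_range, not_exists] at hk
      by_contra hlt
      refine hk ⟨k, ?_⟩ (by ext; simp)
      simp only [val_castLE] at hlt
      omega
    rw [this, det_mul, det_of_isLowerTriangular]
    · simp [hL.1]
    · intro i j hij
      exact hL.2 _ _ (by simpa using hij)
  row t A := by
    rw [ev_topMinor, ev_topMinor, prod_castLE hm, ← det_diagonal, ← det_mul]
    congr 1
    ext i j
    simp [diagonal_mul]
  col s A := by
    rw [ev_topMinor, ev_topMinor, prod_pow_card, ← det_diagonal, mul_comm, ← det_mul]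
    congr 1
    ext i j
    simp [mul_diagonal]
  dep A A' hA := by
    rw [ev_topMinor, ev_topMinor]
    congr 1
    ext i j
    simp_all

open Classical in
/-- The exponent of the diagonal term of a permuted minor. -/
lemma degree_topMinor {h : ℕ} (hm : h ≤ m) {T : Fin h → Fin q} (hT : StrictMono T) :
    (mo m q).degree (topMinor hm T) = ∑ j, Finsupp.single (castLE hm j, T j) 1 ∧
      topMinor hm T ≠ 0 := by
  set d : Perm (Fin h) → Mon m q :=
    fun w => ∑ j, Finsupp.single (castLE hm (w j), T j) 1 with hd
  have hexp : topMinor hm T = ∑ w : Perm (Fin h),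
      monomial (d w) ((Perm.sign w : ℤ) : ℂ) := by
    rw [topMinor, det_apply']
    refine sum_congr rfl fun w _ => ?_
    have : monomial (d w) ((Perm.sign w : ℤ) : ℂ)
        = C ((Perm.sign w : ℤ) : ℂ) * ∏ j, X (castLE hm (w j), T j) := by
      rw [hd, ← mul_one (((Perm.sign w : ℤ) : ℂ)), ← C_mul_monomial, monomial_sum_one]
      simp [X]
    rw [this]
    simp
  have hdv : ∀ w (s : Fin m × Fin q), d w s = ∑ j, if (castLE hm (w j), T j) = s then 1 else 0 := by
    intro w s
    simp only [hd, Finsupp.finsetSum_apply, Finsupp.single_apply]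
  have hlt : ∀ w, w ≠ 1 → lexLt (d w) (d 1) := by
    intro w hw
    have hne : (univ.filter fun j => w j ≠ j).Nonempty := by
      by_contra h
      rw [not_nonempty_iff_eq_empty, filter_eq_empty_iff] at h
      exact hw (ext fun j => not_not.1 (h (mem_univ j)))
    obtain ⟨j, hj, hmax⟩ := exists_max_image _ id hne
    simp only [mem_filter, mem_univ, true_and, ne_eq, id_eq] at hj hmax
    have hfix : ∀ k, j < k → w k = k := fun k hk => by
      by_contra h
      exact absurd (hmax k h) (not_le.2 hk)
    have hwj : w j < j := by
      refine lt_of_le_of_ne (not_lt.1 fun h => ?_) hj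
      exact hj (w.injective (hfix _ h))
    refine ⟨(castLE hm j, T j), ?_, ?_⟩
    · rw [hdv, hdv, sum_eq_zero, sum_eq_single j] <;> simp
      · exact fun k h1 h2 => absurd h2 h1
      · intro k h1 h2
        have := hT.injective h2
        subst this
        exact hj h1
    · rintro ⟨i, b⟩ hib
      rw [hdv, hdv]
      refine sum_congr rfl fun k _ => ?_
      simp only [Perm.coe_one, id_eq, Prod.mk.injEq] at hib ⊢
      by_cases hk : T k = b
      · subst hk
        rcases hib with h | ⟨h, h'⟩
        · rw [hfix k (hT.lt_iff_lt.1 h)]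
        · have := hT.injective h
          subst this
          have h1 : (j : ℕ) < i := h'
          have h2 : (w j : ℕ) < j := hwj
          rw [if_neg, if_neg]
          · rintro ⟨h, -⟩
            rw [← h] at h1; simp at h1
          · rintro ⟨h, -⟩
            rw [← h] at h1; simp at h1; omega
      · simp [hk]
  have hc : coeff (d 1) (topMinor hm T) = 1 := by
    rw [hexp, coeff_sum, sum_eq_single 1]
    · simp
    · intro w _ hw
      rw [coeff_monomial, if_neg]
      intro h
      have := (mo_lt_iff _ _).2 (hlt w hw)
      rw [h] at this
      exact lt_irrefl _ this
    · simp
  have h0 : topMinor hm T ≠ 0 := fun h => by rw [h] at hc; simp at hc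
  refine ⟨?_, h0⟩
  change _ = d 1
  refine (mo m q).toSyn.injective (le_antisymm ?_ ((mo m q).le_degree (by rw [mem_support_iff, hc]; simp)))
  rw [(mo m q).degree_le_iff]
  intro u hu
  rw [mem_support_iff, hexp, coeff_sum] at hu
  obtain ⟨w, -, hw⟩ := exists_ne_zero_of_sum_ne_zero hu
  rw [coeff_monomial] at hw
  have hwu : d w = u := by
    by_contra h
    simp [h] at hw
  rw [← hwu]
  by_cases h1 : w = 1
  · rw [h1]
  · exact ((mo_lt_iff _ _).2 (hlt w h1)).le

end MinorProducts

end

section GTBasis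

open MvPolynomial

variable {m q : ℕ}

/-- Remove the first letter of every row. -/
def dropFirst (e : Arr) : Arr := fun i b => (cum 0 e (b + 1) i - 1) - (cum 0 e b i - 1)

lemma cum_dropFirst (e : Arr) (a i : ℕ) : cum 0 (dropFirst e) a i = cum 0 e a i - 1 := by
  induction a with
  | zero => simp [cum]
  | succ a ih =>
    rw [cum_succ, ih, dropFirst, cum_succ]
    omega

lemma interl_dropFirst {e : Arr} (he : Interl 0 e) : Interl 0 (dropFirst e) := by
  intro i a
  rw [cum_dropFirst, cum_dropFirst]
  have := he i a
  omega

lemma dropFirst_le (e : Arr) (i b : ℕ) : dropFirst e i b ≤ e i b := by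
  rw [dropFirst, cum_succ]; omega

/-- The positions of the first letters of the rows. -/
def firstInd (e : Arr) (i b : ℕ) : ℕ := if cum 0 e b i = 0 ∧ e i b ≠ 0 then 1 else 0

lemma dropFirst_add (e : Arr) (i b : ℕ) : e i b = dropFirst e i b + firstInd e i b := by
  rw [dropFirst, firstInd, cum_succ]
  split_ifs with h <;> omega

lemma exists_first {e : Arr} (hs : SuppIn m q e) (he : Interl 0 e) :
    ∃ (h : ℕ) (_ : h ≤ m) (T : Fin h → Fin q), StrictMono T ∧
      (∀ i b, firstInd e i b = ∑ j : Fin h, if (j : ℕ) = i ∧ (T j : ℕ) = b then 1 else 0) ∧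
      (h = 0 → e = 0) := by
  classical
  have hex : ∃ i, ∀ b, e i b = 0 := ⟨m, fun b => by
    by_contra h
    have := (hs m b h).1
    omega⟩
  set h := Nat.find hex with hh
  have hm : h ≤ m := Nat.find_le fun b => by
    by_contra h
    have := (hs m b h).1
    omega
  have hz : ∀ i, h ≤ i → ∀ b, e i b = 0 := by
    intro i hi
    induction i, hi using Nat.le_induction with
    | base => exact Nat.find_spec hex
    | succ i hi ih =>
      intro b
      have h1 := he i b
      have h2 : cum 0 e b i = 0 := by simp [cum, ih]
      rw [cum_succ] at h1
      omega
  have hT : ∀ i, i < h → ∃ b, e i b ≠ 0 := by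
    intro i hi
    have := Nat.find_min hex hi
    push Not at this
    exact this
  set T : NVec h := fun i => Nat.find (hT i i.2) with hTd
  have hT0 : ∀ i : Fin h, e i (T i) ≠ 0 := fun i => Nat.find_spec (hT i i.2)
  have hTz : ∀ (i : Fin h) b, b < T i → e i b = 0 := fun i b hb => not_not.1 (Nat.find_min (hT i i.2) hb)
  have hchar : ∀ (i : Fin h) b, (cum 0 e b i = 0 ∧ e i b ≠ 0) ↔ T i = b := by
    intro i b
    constructor
    · rintro ⟨h1, h2⟩
      by_contra hne
      have hle : T i ≤ b := Nat.find_min' _ h2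
      simp only [cum, Pi.zero_apply, zero_add] at h1
      exact hT0 i (sum_eq_zero_iff.1 h1 (T i) (mem_range.2 (by omega)))
    · rintro rfl
      refine ⟨?_, hT0 i⟩
      simp only [cum, Pi.zero_apply, zero_add]
      exact sum_eq_zero fun b hb => hTz i b (mem_range.1 hb)
  have hstep : ∀ i (hi : i + 1 < h), T ⟨i, by omega⟩ < T ⟨i + 1, hi⟩ := by
    intro i hi
    have h1 := he i (T ⟨i + 1, hi⟩)
    have h2 := hT0 ⟨i + 1, hi⟩
    rw [cum_succ] at h1
    simp only at h2
    have h3 : cum 0 e (T ⟨i + 1, hi⟩) i ≠ 0 := by omega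
    simp only [cum, Pi.zero_apply, zero_add] at h3
    obtain ⟨b, hb, hb'⟩ := exists_ne_zero_of_sum_ne_zero h3
    refine lt_of_le_of_lt (Nat.find_min' _ hb') (mem_range.1 hb)
  have hmono : StrictMono T := by
    intro i j hij
    obtain ⟨i, hi⟩ := i
    obtain ⟨j, hj⟩ := j
    have hij : i + 1 ≤ j := hij
    induction j, hij using Nat.le_induction with
    | base => exact hstep i hj
    | succ j hij' ih => exact (ih (by omega) (show i < j by omega)).trans (hstep j hj)
  refine ⟨h, hm, fun i => ⟨T i, (hs i _ (hT0 i)).2⟩, fun i j hij => hmono hij, ?_, ?_⟩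
  · intro i b
    unfold firstInd
    by_cases hi : i < h
    · rw [sum_eq_single ⟨i, hi⟩]
      · have := hchar ⟨i, hi⟩ b
        simp only at this
        simp only [this, true_and]
      · intro j _ hj
        rw [if_neg]
        rintro ⟨h, -⟩
        exact hj (Fin.ext h)
      · simp
    · rw [if_neg (fun h' => h'.2 (hz i (by omega) b)), sum_eq_zero]
      intro j _
      rw [if_neg]
      rintro ⟨h, -⟩
      have := j.2
      omega
  · intro h0
    funext i b
    exact hz i (by omega) b

theorem exists_isRowHW {e : Arr} (hs : SuppIn m q e) (he : Interl 0 e) :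
    ∃ f : Pol m q, f ≠ 0 ∧ (mo m q).degree f = fsM m q e ∧
      IsRowHW (fun i : Fin m => ∑ b : Fin q, e i b) (cols m q e) f := by
  induction hN : ∑ i : Fin m, ∑ b : Fin q, e i b using Nat.strong_induction_on generalizing e with
  | _ N ih =>
  obtain ⟨h, hm, T, hT, hfi, h0⟩ := exists_first hs he
  rcases Nat.eq_zero_or_pos h with rfl | hpos
  · obtain rfl := h0 rfl
    refine ⟨1, one_ne_zero, ?_, ?_⟩
    · rw [MonomialOrder.degree_one]
      ext; simp [fsM_apply]
    · convert isRowHW_one (m := m) (q := q) using 1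
      · funext i; simp
      · funext i; simp [cols, colSum]
  · have hs' : SuppIn m q (dropFirst e) := fun i b hib =>
      hs i b (by have := dropFirst_le e i b; omega)
    have hsplit := dropFirst_add e
    have hfirst : fsM m q (firstInd e) = ∑ j, Finsupp.single (Fin.castLE hm j, T j) 1 := by
      ext s
      rw [fsM_apply, hfi, Finsupp.finsetSum_apply]
      refine sum_congr rfl fun j _ => ?_
      rw [Finsupp.single_apply]
      refine if_congr ?_ rfl rfl
      rw [Prod.ext_iff, Fin.ext_iff, Fin.ext_iff]
      rfl
    have hlt : ∑ i : Fin m, ∑ b : Fin q, dropFirst e i b < N := by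
      rw [← hN]
      refine sum_lt_sum (fun i _ => sum_le_sum fun b _ => dropFirst_le e i b)
        ⟨⟨0, by omega⟩, mem_univ _, sum_lt_sum (fun b _ => dropFirst_le e _ b)
          ⟨T ⟨0, hpos⟩, mem_univ _, ?_⟩⟩
      rw [hsplit 0 (T ⟨0, hpos⟩), hfi, sum_eq_single ⟨0, hpos⟩]
      · simp
      · intro j _ hj
        rw [if_neg]
        rintro ⟨h, -⟩
        exact hj (Fin.ext h)
      · simp
    obtain ⟨f, hf0, hfd, hf⟩ := ih _ hlt hs' (interl_dropFirst he) rfl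
    obtain ⟨hd, hd0⟩ := degree_topMinor hm hT
    refine ⟨topMinor hm T * f, mul_ne_zero hd0 hf0, ?_, ?_⟩
    · rw [MonomialOrder.degree_mul hd0 hf0, hd, hfd, ← hfirst]
      ext s
      rw [Finsupp.add_apply, fsM_apply, fsM_apply, fsM_apply, hsplit s.1 s.2, add_comm]
    · convert (isRowHW_topMinor hm T).mul hf using 1
      · funext i
        rw [Pi.add_apply, sum_congr rfl fun (b : Fin q) _ => hsplit i b, sum_add_distrib, add_comm]
        congr 1
        rw [sum_congr rfl fun (b : Fin q) _ => hfi i b, sum_comm]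
        split_ifs with hi
        · rw [sum_eq_single ⟨i, hi⟩]
          · rw [sum_eq_single (T ⟨i, hi⟩)]
            · simp
            · intro b _ hb
              rw [if_neg]
              rintro ⟨-, h⟩
              exact hb (Fin.ext h.symm)
            · simp
          · intro j _ hj
            refine sum_eq_zero fun b _ => if_neg ?_
            rintro ⟨h, -⟩
            exact hj (Fin.ext h)
          · simp
        · refine sum_eq_zero fun j _ => sum_eq_zero fun b _ => if_neg ?_
          rintro ⟨h, -⟩
          have := j.2
          omega
      · funext b
        rw [Pi.add_apply, cols, cols, colSum, colSum, sum_congr rfl fun i _ => hsplit i b,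
          sum_add_distrib, add_comm]
        congr 1
        rw [sum_congr rfl fun i _ => hfi i b, sum_comm]
        refine sum_congr rfl fun j _ => ?_
        rw [sum_eq_single (j : ℕ)]
        · simp [Fin.ext_iff]
        · intro i _ hi
          rw [if_neg]
          rintro ⟨h, -⟩
          exact hi h.symm
        · intro hj
          have := j.2
          simp at hj
          omega

lemma linearIndependent_of_degree {ι σ : Type*} (o : MonomialOrder σ) (f : ι → MP σ)
    (h0 : ∀ i, f i ≠ 0) (hinj : Function.Injective fun i => o.degree (f i)) :
    LinearIndependent ℂ f := by
  classical
  rw [linearIndependent_iff']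
  intro s g hg
  by_contra hne
  push Not at hne
  have hne' : (s.filter fun i => g i ≠ 0).Nonempty := by
    obtain ⟨i, hi, hi'⟩ := hne
    exact ⟨i, mem_filter.2 ⟨hi, hi'⟩⟩
  obtain ⟨i, hi, hmax⟩ := exists_max_image _ (fun i => o.toSyn (o.degree (f i))) hne'
  rw [mem_filter] at hi
  have hc := congrArg (coeff (o.degree (f i))) hg
  rw [coeff_sum, sum_eq_single i, coeff_smul, coeff_zero, smul_eq_mul] at hc
  · simp_all
  · intro j hj hji
    rw [coeff_smul]
    by_cases hgj : g j = 0
    · rw [hgj, zero_smul]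
    · rw [o.coeff_eq_zero_of_lt, smul_zero]
      refine lt_of_le_of_ne (hmax j (mem_filter.2 ⟨hj, hgj⟩)) fun h => hji ?_
      exact hinj (o.toSyn.injective h)
  · exact fun h => absurd hi.1 h

end GTBasis

section OrthMatrices

variable {n p : ℕ}

/-- The inclusion of the first `p` coordinates. -/
def topM (n p : ℕ) : Mat n p := of fun i k => if (i : ℕ) = k then 1 else 0

/-- The inclusion of the last `p` coordinates in reversed order. -/
def botM (n p : ℕ) : Mat n p :=
  of fun i k => if (i : ℕ) + k = n - 1 then 1 else 0

lemma symForm_transpose (n : ℕ) : (symForm n)ᵀ = symForm n := by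
  ext i j; simp [symForm, add_comm]

lemma symForm_mul_apply {q : ℕ} (X : Mat n q) (i : Fin n) (b : Fin q) :
    (symForm n * X) i b = X i.rev b := by
  rw [mul_apply, sum_eq_single i.rev]
  · have : (i : ℕ) + (i.rev : ℕ) = n - 1 := by rw [Fin.val_rev]; omega
    simp only [symForm, of_apply, if_pos this, one_mul]
  · intro j _ hj
    have : ¬ (i : ℕ) + (j : ℕ) = n - 1 := fun h => hj (Fin.ext (by rw [Fin.val_rev]; omega))
    simp only [symForm, of_apply, if_neg this, zero_mul]
  · simp

lemma symForm_mul_self (n : ℕ) : symForm n * symForm n = 1 := by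
  ext i j
  rw [symForm_mul_apply]
  have : (((i.rev : Fin n) : ℕ) + (j : ℕ) = n - 1) ↔ i = j := by
    rw [Fin.val_rev, Fin.ext_iff]; omega
  simp only [symForm, of_apply, this, one_apply]

lemma symForm_mul_symForm_mul {q : ℕ} (X : Mat n q) : symForm n * (symForm n * X) = X := by
  rw [← Matrix.mul_assoc, symForm_mul_self, Matrix.one_mul]

lemma symForm_mul_botM (hp : p ≤ n) : symForm n * botM n p = topM n p := by
  ext i k
  rw [symForm_mul_apply]
  have : (((i.rev : Fin n) : ℕ) + (k : ℕ) = n - 1) ↔ (i : ℕ) = k := by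
    rw [Fin.val_rev]; omega
  simp only [botM, topM, of_apply, this]

lemma symForm_mul_topM (hp : p ≤ n) : symForm n * topM n p = botM n p := by
  rw [← symForm_mul_botM hp, symForm_mul_symForm_mul]

lemma topM_mul (hp : p ≤ n) {q : ℕ} (X : Mat n q) (k : Fin p) (b : Fin q) :
    ((topM n p)ᵀ * X) k b = X (Fin.castLE hp k) b := by
  rw [mul_apply, sum_eq_single (Fin.castLE hp k)]
  · simp [topM]
  · intro j _ hj
    have : ¬ (j : ℕ) = k := fun h => hj (Fin.ext h)
    simp [topM, this]
  · simp

lemma botM_mul (hp : p ≤ n) {q : ℕ} (X : Mat n q) (k : Fin p) (b : Fin q) :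
    ((botM n p)ᵀ * X) k b = X (Fin.castLE hp k).rev b := by
  rw [← symForm_mul_topM hp, transpose_mul, symForm_transpose, Matrix.mul_assoc, topM_mul hp,
    symForm_mul_apply]

lemma topM_topM (hp : p ≤ n) : (topM n p)ᵀ * topM n p = 1 := by
  ext i k
  rw [topM_mul hp]
  simp [topM, one_apply, Fin.ext_iff]

lemma botM_botM (hp : p ≤ n) : (botM n p)ᵀ * botM n p = 1 := by
  rw [← symForm_mul_topM hp, transpose_mul, symForm_transpose, Matrix.mul_assoc,
    symForm_mul_symForm_mul, topM_topM hp]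

lemma topM_botM (hp : 2 * p ≤ n) : (topM n p)ᵀ * botM n p = 0 := by
  ext i k
  rw [topM_mul (by omega)]
  simp [botM]
  omega

lemma botM_topM (hp : 2 * p ≤ n) : (botM n p)ᵀ * topM n p = 0 := by
  have := congrArg transpose (topM_botM hp)
  simpa using this

lemma topM_symForm (hp : p ≤ n) : (topM n p)ᵀ * symForm n = (botM n p)ᵀ := by
  rw [← symForm_mul_topM hp, transpose_mul, symForm_transpose]

lemma botM_symForm (hp : p ≤ n) : (botM n p)ᵀ * symForm n = (topM n p)ᵀ := by
  rw [← symForm_mul_botM hp, transpose_mul, symForm_transpose]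

/-- Orthogonality of a matrix for the antidiagonal form. -/
def IsOrth (w : Mat n n) : Prop := wᵀ * symForm n * w = symForm n

lemma IsOrth.transpose {w : Mat n n} (h : IsOrth w) : IsOrth wᵀ := by
  have h1 : (symForm n * wᵀ * symForm n) * w = 1 := by
    rw [Matrix.mul_assoc, Matrix.mul_assoc, ← Matrix.mul_assoc wᵀ, h, symForm_mul_self]
  have h2 := mul_eq_one_comm.1 h1
  rw [IsOrth, transpose_transpose]
  calc w * symForm n * wᵀ = (w * (symForm n * wᵀ * symForm n)) * symForm n := by
        simp only [Matrix.mul_assoc, symForm_mul_self, Matrix.mul_one]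
    _ = symForm n := by rw [h2, Matrix.one_mul]

lemma IsOrth.mul {w v : Mat n n} (h : IsOrth w) (h' : IsOrth v) : IsOrth (w * v) := by
  rw [IsOrth, transpose_mul]
  calc vᵀ * wᵀ * symForm n * (w * v) = vᵀ * (wᵀ * symForm n * w) * v := by
        simp only [Matrix.mul_assoc]
    _ = symForm n := by rw [h, h']

lemma IsOrth.inv_mul {w : Mat n n} (h : IsOrth w) : symForm n * wᵀ * symForm n * w = 1 := by
  rw [Matrix.mul_assoc, Matrix.mul_assoc, ← Matrix.mul_assoc wᵀ, h, symForm_mul_self]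

lemma IsOrth.mul_inv {w : Mat n n} (h : IsOrth w) :
    w * (symForm n * wᵀ * symForm n) = 1 := mul_eq_one_comm.1 h.inv_mul

/-- The element of the orthogonal group with a given matrix. -/
def mkO (w : Mat n n) (h : IsOrth w) : OGL n :=
  ⟨⟨w, symForm n * wᵀ * symForm n, h.mul_inv, h.inv_mul⟩, h⟩

/-- The matrix of an element of the orthogonal group. -/
def toM (g : OGL n) : Mat n n := ((g : GL (Fin n) ℂ) : Mat n n)

lemma toM_mkO (w : Mat n n) (h : IsOrth w) : toM (mkO w h) = w := rfl

lemma toM_isOrth (g : OGL n) : IsOrth (toM g) := g.2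

lemma toM_mul (g h : OGL n) : toM (g * h) = toM g * toM h := rfl

lemma toM_one : toM (1 : OGL n) = 1 := rfl

lemma toM_inj {g h : OGL n} (e : toM g = toM h) : g = h := Subtype.ext (Units.ext e)

/-- Block Eichler transformations. -/
lemma isOrth_eich {q : ℕ} {P Q : Mat n q} {M : Mat q q}
    (hP : Pᵀ * symForm n * P = 0) (hPQ : Pᵀ * symForm n * Q = 0)
    (hM : M + Mᵀ = Qᵀ * symForm n * Q) :
    IsOrth (1 + Q * (Pᵀ * symForm n) - P * (Qᵀ * symForm n) - P * M * (Pᵀ * symForm n)) := by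
  have hQP : Qᵀ * symForm n * P = 0 := by
    have := congrArg transpose hPQ
    simpa [symForm_transpose, Matrix.mul_assoc] using this
  have z1 : ∀ Y : Mat q n, Pᵀ * (symForm n * (P * Y)) = 0 := fun Y => by
    simp only [← Matrix.mul_assoc, hP, Matrix.zero_mul]
  have z2 : ∀ Y : Mat q n, Pᵀ * (symForm n * (Q * Y)) = 0 := fun Y => by
    simp only [← Matrix.mul_assoc, hPQ, Matrix.zero_mul]
  have z3 : ∀ Y : Mat q n, Qᵀ * (symForm n * (P * Y)) = 0 := fun Y => by
    simp only [← Matrix.mul_assoc, hQP, Matrix.zero_mul]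
  have z4 : ∀ Y : Mat q n, Qᵀ * (symForm n * (Q * Y)) = M * Y + Mᵀ * Y := fun Y => by
    rw [← Matrix.add_mul, hM]
    simp only [Matrix.mul_assoc]
  unfold IsOrth
  simp only [transpose_add, transpose_sub, transpose_mul, transpose_transpose, symForm_transpose,
    transpose_one, Matrix.add_mul, Matrix.sub_mul, Matrix.mul_add, Matrix.mul_sub, Matrix.one_mul,
    Matrix.mul_one, Matrix.mul_assoc, z1, z2, z3, z4, Matrix.mul_zero]
  abel

/-- The slice for the unipotent group: matrices with prescribed first rows and Gram matrix. -/
def sliceM (n : ℕ) (A B : Mat p p) : Mat n p :=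
  topM n p * A + botM n p * B

lemma top_sliceM (hp : 2 * p ≤ n) (A B : Mat p p) : (topM n p)ᵀ * sliceM n A B = A := by
  rw [sliceM, Matrix.mul_add, ← Matrix.mul_assoc, ← Matrix.mul_assoc, topM_topM (by omega),
    topM_botM hp]
  simp

lemma bot_sliceM (hp : 2 * p ≤ n) (A B : Mat p p) : (botM n p)ᵀ * sliceM n A B = B := by
  rw [sliceM, Matrix.mul_add, ← Matrix.mul_assoc, ← Matrix.mul_assoc, botM_botM (by omega),
    botM_topM hp]
  simp

lemma gram_sliceM (hp : 2 * p ≤ n) (A B : Mat p p) :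
    (sliceM n A B)ᵀ * symForm n * sliceM n A B = Aᵀ * B + Bᵀ * A := by
  have h : (sliceM n A B)ᵀ * symForm n = Aᵀ * (botM n p)ᵀ + Bᵀ * (topM n p)ᵀ := by
    rw [sliceM, transpose_add, transpose_mul, transpose_mul, Matrix.add_mul, Matrix.mul_assoc,
      Matrix.mul_assoc, topM_symForm (by omega), botM_symForm (by omega)]
  rw [h, Matrix.add_mul, Matrix.mul_assoc, Matrix.mul_assoc, top_sliceM hp, bot_sliceM hp]

theorem exists_slice (hp : 2 * p ≤ n) (X : Mat n p)
    (A : Mat p p) (hA : (topM n p)ᵀ * X = A) (A' : Mat p p) (hA' : A' * A = 1) :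
    ∃ w : Mat n n, IsOrth w ∧ IsLowerUni w ∧
      w * X = sliceM n A ((1 / 2 : ℂ) • (A'ᵀ * (Xᵀ * symForm n * X))) := by
  have hp' : p ≤ n := by omega
  have hAA' : A * A' = 1 := mul_eq_one_comm.1 hA'
  set J := symForm n with hJ
  set T := topM n p with hT
  set P := botM n p with hP
  set Z := Pᵀ * X with hZ
  set Y := X - T * A - P * Z with hY
  set R := Xᵀ * J * X with hR
  have tT : Tᵀ * T = 1 := topM_topM hp'
  have pP : Pᵀ * P = 1 := botM_botM hp'
  have tP : Tᵀ * P = 0 := topM_botM hp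
  have pT : Pᵀ * T = 0 := botM_topM hp
  have tJ : Tᵀ * J = Pᵀ := topM_symForm hp'
  have pJ : Pᵀ * J = Tᵀ := botM_symForm hp'
  have jT : J * T = P := symForm_mul_topM hp'
  have jP : J * P = T := symForm_mul_botM hp'
  have jt : Jᵀ = J := symForm_transpose n
  have tY : Tᵀ * Y = 0 := by
    rw [hY, Matrix.mul_sub, Matrix.mul_sub, ← Matrix.mul_assoc, ← Matrix.mul_assoc, tT, tP, hA]
    simp
  have pY : Pᵀ * Y = 0 := by
    rw [hY, Matrix.mul_sub, Matrix.mul_sub, ← Matrix.mul_assoc, ← Matrix.mul_assoc, pT, pP]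
    simp [hZ]
  have yT : Yᵀ * T = 0 := by simpa using congrArg Matrix.transpose tY
  have yP : Yᵀ * P = 0 := by simpa using congrArg Matrix.transpose pY
  have hX : X = Y + T * A + P * Z := by rw [hY]; abel
  have hYX : Yᵀ * J * X = Yᵀ * J * Y := by
    have h1 : Yᵀ * J * T = 0 := by rw [Matrix.mul_assoc, jT, yP]
    have h2 : Yᵀ * J * P = 0 := by rw [Matrix.mul_assoc, jP, yT]
    conv_lhs => rw [hX]
    rw [Matrix.mul_add, Matrix.mul_add, ← Matrix.mul_assoc _ T, ← Matrix.mul_assoc _ P, h1, h2,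
      Matrix.zero_mul, Matrix.zero_mul, add_zero, add_zero]
  have hR' : R = Yᵀ * J * Y + Aᵀ * Z + Zᵀ * A := by
    have e : Xᵀ * J = Yᵀ * J + Aᵀ * Pᵀ + Zᵀ * Tᵀ := by
      rw [hX, transpose_add, transpose_add, transpose_mul, transpose_mul, Matrix.add_mul,
        Matrix.add_mul, Matrix.mul_assoc Aᵀ, Matrix.mul_assoc Zᵀ, tJ, pJ]
    rw [hR, e, Matrix.add_mul, Matrix.add_mul, hYX, Matrix.mul_assoc Aᵀ, Matrix.mul_assoc Zᵀ, hA]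
  set Q := -(Y * A') with hQ
  have qY : Qᵀ = -(A'ᵀ * Yᵀ) := by rw [hQ, transpose_neg, transpose_mul]
  have qA : Q * A = -Y := by rw [hQ, Matrix.neg_mul, Matrix.mul_assoc, hA', Matrix.mul_one]
  have aat : Aᵀ * A'ᵀ = 1 := by rw [← transpose_mul, hA', transpose_one]
  have aat' : A'ᵀ * Aᵀ = 1 := by rw [← transpose_mul, hAA', transpose_one]
  set M := (Z - Qᵀ * J * X - (1 / 2 : ℂ) • (A'ᵀ * R)) * A' with hM
  have mA : M * A = Z - Qᵀ * J * X - (1 / 2 : ℂ) • (A'ᵀ * R) := by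
    rw [hM, Matrix.mul_assoc, hA', Matrix.mul_one]
  have e1 : Aᵀ * M * A = Aᵀ * Z + Yᵀ * J * Y - (1 / 2 : ℂ) • R := by
    rw [Matrix.mul_assoc, mA, qY, Matrix.mul_sub, Matrix.mul_sub, Matrix.mul_smul,
      ← Matrix.mul_assoc Aᵀ A'ᵀ, aat, Matrix.one_mul, ← hYX]
    simp only [Matrix.neg_mul, Matrix.mul_neg, ← Matrix.mul_assoc, aat, Matrix.one_mul]
    abel
  have rt : Rᵀ = R := by
    rw [hR, transpose_mul, transpose_mul, transpose_transpose, jt, Matrix.mul_assoc]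
  have e2 : Aᵀ * Mᵀ * A = Zᵀ * A + Yᵀ * J * Y - (1 / 2 : ℂ) • R := by
    have := congrArg Matrix.transpose e1
    simp only [transpose_mul, transpose_add, transpose_sub, transpose_smul, transpose_transpose,
      rt, jt, ← Matrix.mul_assoc] at this
    exact this
  have hMM : M + Mᵀ = Qᵀ * J * Q := by
    have e3 : Aᵀ * (M + Mᵀ) * A = Aᵀ * (Qᵀ * J * Q) * A := by
      have e4 : Aᵀ * (Qᵀ * J * Q) * A = Yᵀ * J * Y := by
        have : Aᵀ * Qᵀ = -Yᵀ := by rw [← transpose_mul, qA, transpose_neg]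
        calc Aᵀ * (Qᵀ * J * Q) * A = (Aᵀ * Qᵀ) * J * (Q * A) := by simp only [Matrix.mul_assoc]
          _ = _ := by rw [this, qA]; simp
      rw [e4, Matrix.mul_add, Matrix.add_mul, e1, e2]
      have : (1 / 2 : ℂ) • R + (1 / 2 : ℂ) • R = R := by rw [← add_smul]; norm_num
      calc _ = (Yᵀ * J * Y + Aᵀ * Z + Zᵀ * A) + Yᵀ * J * Y
            - ((1 / 2 : ℂ) • R + (1 / 2 : ℂ) • R) := by abel
        _ = _ := by rw [this, ← hR']; abel
    have := congrArg (fun W => A'ᵀ * (W * A')) e3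
    simpa only [Matrix.mul_assoc, hAA', Matrix.mul_one, ← Matrix.mul_assoc A'ᵀ Aᵀ, aat',
      Matrix.one_mul] using this
  have hPP : Pᵀ * J * P = 0 := by rw [pJ, tP]
  have hPQ : Pᵀ * J * Q = 0 := by
    rw [pJ, hQ, Matrix.mul_neg, ← Matrix.mul_assoc, tY]; simp
  refine ⟨_, isOrth_eich hPP hPQ hMM, ?_, ?_⟩
  · have hq1 : ∀ i k, Q i k ≠ 0 → p ≤ (i : ℕ) ∧ (i : ℕ) + p < n := by
      intro i k hik
      have hrow : ∀ i : Fin n, (∀ b, Y i b = 0) → Q i k = 0 := fun i h => by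
        simp [hQ, mul_apply, h]
      by_contra hcon
      by_cases hi : (i : ℕ) < p
      · refine hik (hrow i fun b => ?_)
        have := congrFun (congrFun tY ⟨i, hi⟩) b
        rw [topM_mul hp'] at this
        exact this
      · refine hik (hrow i fun b => ?_)
        have hi' : (i.rev : ℕ) < p := by rw [Fin.val_rev]; omega
        have h0 : (Pᵀ * Y) ⟨i.rev, hi'⟩ b = 0 := congrFun (congrFun pY _) b
        rw [botM_mul hp'] at h0
        have hr : (Fin.castLE hp' ⟨i.rev, hi'⟩).rev = i := Fin.rev_rev i
        rwa [hr] at h0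
    have hT1 : ∀ i k, T i k ≠ 0 → (i : ℕ) = k := by
      intro i k h
      by_contra hne
      simp [hT, topM, hne] at h
    have hP1 : ∀ i k, P i k ≠ 0 → (i : ℕ) + k = n - 1 := by
      intro i k h
      by_contra hne
      simp [hP, botM, hne] at h
    rw [pJ]
    have key : ∀ i j : Fin n, (i : ℕ) ≤ j → (Q * Tᵀ) i j = 0 ∧ (P * (Qᵀ * J)) i j = 0 ∧
        (P * M * Tᵀ) i j = 0 := by
      intro i j hij
      refine ⟨?_, ?_, ?_⟩
      · rw [mul_apply]
        refine sum_eq_zero fun k _ => ?_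
        by_contra h
        have h1 := hq1 i k (left_ne_zero_of_mul h)
        have h2 := hT1 j k (right_ne_zero_of_mul h)
        omega
      · rw [mul_apply]
        refine sum_eq_zero fun k _ => ?_
        by_contra h
        have h1 := hP1 i k (left_ne_zero_of_mul h)
        have h2 := right_ne_zero_of_mul h
        have h3 : (Qᵀ * J) k j = Q j.rev k := by
          rw [← transpose_apply (Qᵀ * J), transpose_mul, jt, transpose_transpose, symForm_mul_apply]
        rw [h3] at h2
        have h4 := hq1 _ _ h2
        rw [Fin.val_rev] at h4
        omega
      · rw [mul_apply]
        refine sum_eq_zero fun k _ => ?_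
        by_contra h
        have h2 := hT1 j k (right_ne_zero_of_mul h)
        have h1 := left_ne_zero_of_mul h
        rw [mul_apply] at h1
        obtain ⟨l, -, hl⟩ := exists_ne_zero_of_sum_ne_zero h1
        have h3 := hP1 i l (left_ne_zero_of_mul hl)
        omega
    constructor
    · intro i
      obtain ⟨h1, h2, h3⟩ := key i i le_rfl
      simp only [Matrix.sub_apply, Matrix.add_apply, h1, h3]
      simpa using h2
    · intro i j hij
      obtain ⟨h1, h2, h3⟩ := key i j hij.le
      simp only [Matrix.sub_apply, Matrix.add_apply, h1, h3]
      rw [one_apply_ne (fun h => by rw [h] at hij; omega)]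
      simpa using h2
  · rw [pJ, Matrix.sub_mul, Matrix.sub_mul, Matrix.add_mul, Matrix.mul_assoc _ Tᵀ X,
      Matrix.mul_assoc _ Tᵀ X, Matrix.mul_assoc _ _ X, hA, qA, Matrix.mul_assoc P M, mA,
      Matrix.mul_sub, Matrix.mul_sub, sliceM, Matrix.one_mul]
    have : T * A = X - Y - P * Z := by rw [hY]; abel
    rw [this]
    abel

end OrthMatrices

section Scaling

open MvPolynomial

variable {m q : ℕ}

lemma coeff_lsub_diagonal {σ : Type*} [Fintype σ] [DecidableEq σ] (w : σ → ℂ)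
    (f : MP σ) (u : σ →₀ ℕ) : coeff u (lsub (diagonal w) f) = (∏ s, w s ^ u s) * coeff u f := by
  have hX : ∀ s, lsub (diagonal w) (X s) = w s • X s := by
    intro s
    rw [lsub_X, sum_eq_single s]
    · simp
    · intro t _ ht
      simp [ht]
    · simp
  induction f using induction_on generalizing u with
  | C a =>
    simp only [lsub, algHom_C, algebraMap_eq, coeff_C]
    split_ifs with h
    · subst h; simp
    · simp
  | add f g hf hg => rw [map_add, coeff_add, coeff_add, hf, hg, mul_add]
  | mul_X f s hf =>
    rw [map_mul, hX, mul_smul_comm, coeff_smul, coeff_mul_X', coeff_mul_X']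
    split_ifs with h
    · have hs : u s ≠ 0 := by simpa using h
      rw [hf, smul_eq_mul, ← mul_assoc]
      congr 1
      have e : u = (u - Finsupp.single s 1) + Finsupp.single s 1 := by
        ext t
        simp only [Finsupp.add_apply, Finsupp.tsub_apply, Finsupp.single_apply]
        split_ifs with ht
        · subst ht; omega
        · omega
      conv_rhs => rw [e]
      simp only [Finsupp.add_apply, pow_add, prod_mul_distrib]
      rw [mul_comm]
      congr 1
      rw [prod_eq_single s]
      · simp
      · intro t _ ht
        simp [Ne.symm ht]
      · simp
    · simp

lemma ev_diagonal_mul (t : Vec m) (A : Mat m q) (f : Pol m q) :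
    ev (diagonal t * A) f = ev A (lsub (diagonal fun s => t s.1) f) := by
  rw [ev, ev, eval_lsub]
  congr 2
  ext s
  rw [sum_eq_single s]
  · simp [diagonal_mul]
  · intro s' _ h
    simp [h]
  · simp

lemma ev_mul_diagonal (t : Vec q) (A : Mat m q) (f : Pol m q) :
    ev (A * diagonal t) f = ev A (lsub (diagonal fun s => t s.2) f) := by
  rw [ev, ev, eval_lsub]
  congr 2
  ext s
  rw [sum_eq_single s]
  · simp [mul_diagonal, mul_comm]
  · intro s' _ h
    simp [h]
  · simp

lemma two_zpow_injective {a b : ℤ} (h : (2 : ℂ) ^ a = 2 ^ b) : a = b := by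
  have h2 : (2 : ℝ) ^ a = 2 ^ b := Complex.ofReal_injective (by push_cast; exact h)
  exact zpow_right_injective₀ (by norm_num) (by norm_num) h2

/-- The tuple with one entry two and all other entries one. -/
def twoAt (i : Fin m) : Vec m := fun j => if j = i then 2 else 1

lemma twoAt_ne_zero (i j : Fin m) : twoAt i j ≠ 0 := by
  unfold twoAt
  split_ifs <;> norm_num

lemma prod_twoAt_pow (i : Fin m) (a : NVec m) : ∏ j, twoAt i j ^ a j = 2 ^ a i := by
  rw [prod_eq_single i]
  · simp [twoAt]
  · intro j _ h
    simp [twoAt, h]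
  · simp

lemma prod_twoAt_zpow (i : Fin m) (a : Fin m → ℤ) : ∏ j, twoAt i j ^ a j = 2 ^ a i := by
  rw [prod_eq_single i]
  · simp [twoAt]
  · intro j _ h
    simp [twoAt, h]
  · simp

lemma row_of_diagonal {g : Pol m q} {z : Fin m → ℤ}
    (h : ∀ t : Vec m, (∀ i, t i ≠ 0) → ∀ A, ev (diagonal t * A) g = (∏ i, t i ^ z i) * ev A g)
    {u : Mon m q} (hu : coeff u g ≠ 0) (i : Fin m) : ((∑ b, u (i, b) : ℕ) : ℤ) = z i := by
  have h1 : lsub (diagonal fun s : Fin m × Fin q => twoAt i s.1) g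
      = (∏ j, twoAt i j ^ z j) • g := by
    refine ev_ext fun A => ?_
    rw [← ev_diagonal_mul, ev_smul, h _ (twoAt_ne_zero i)]
  have h2 := congrArg (coeff u) h1
  rw [coeff_lsub_diagonal, coeff_smul, smul_eq_mul, prod_twoAt_zpow, Fintype.prod_prod_type] at h2
  have h3 : ∏ j, ∏ b, twoAt i j ^ u (j, b) = (2 : ℂ) ^ (∑ b, u (i, b)) := by
    rw [← prod_twoAt_pow i fun j => ∑ b, u (j, b)]
    simp only [prod_pow_eq_pow_sum]
  rw [h3] at h2
  refine two_zpow_injective ?_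
  rw [zpow_natCast]
  exact mul_right_cancel₀ hu h2

lemma col_of_diagonal {g : Pol m q} {a c : NVec q}
    (h : ∀ t : Vec q, (∀ i, t i ≠ 0) → ∀ A, (∏ b, t b ^ a b) * ev (A * diagonal t) g
      = (∏ i, t i ^ c i) * ev A g) {u : Mon m q} (hu : coeff u g ≠ 0) (b : Fin q) :
    ∑ i, u (i, b) + a b = c b := by
  have h1 : (∏ j, twoAt b j ^ a j) • lsub (diagonal fun s : Fin m × Fin q => twoAt b s.2) g
      = (∏ j, twoAt b j ^ c j) • g := by
    refine ev_ext fun A => ?_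
    rw [ev_smul, ← ev_mul_diagonal, ev_smul, h _ (twoAt_ne_zero b)]
  have h2 := congrArg (coeff u) h1
  rw [coeff_smul, smul_eq_mul, coeff_lsub_diagonal, coeff_smul, smul_eq_mul, prod_twoAt_pow,
    prod_twoAt_pow, Fintype.prod_prod_type_right] at h2
  have h3 : ∏ j, ∏ i, twoAt b j ^ u (i, j) = (2 : ℂ) ^ (∑ i, u (i, b)) := by
    rw [← prod_twoAt_pow b fun j => ∑ i, u (i, j)]
    simp only [prod_pow_eq_pow_sum]
  rw [h3, ← mul_assoc, ← pow_add] at h2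
  have h4 := mul_right_cancel₀ hu h2
  have h5 := two_zpow_injective (a := ((a b + ∑ i, u (i, b) : ℕ) : ℤ)) (b := (c b : ℤ))
    (by rw [zpow_natCast, zpow_natCast]; exact h4)
  have h6 : a b + ∑ i, u (i, b) = c b := by exact_mod_cast h5
  omega

lemma coeff_col_iff {g : Pol m q} {c : NVec q} : (∀ u, coeff u g ≠ 0 → ∀ b, ∑ i, u (i, b) = c b) ↔
      ∀ (t : Vec q) A, ev (A * diagonal t) g = (∏ i, t i ^ c i) * ev A g := by
  constructor
  · intro h t A
    rw [ev_mul_diagonal, ← ev_smul]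
    congr 1
    ext u
    rw [coeff_lsub_diagonal, coeff_smul, smul_eq_mul]
    by_cases hu : coeff u g = 0
    · simp [hu]
    · congr 1
      rw [Fintype.prod_prod_type_right]
      refine prod_congr rfl fun b _ => ?_
      change ∏ i, t b ^ u (i, b) = _
      rw [prod_pow_eq_pow_sum, h u hu b]
  · intro h u hu b
    have := col_of_diagonal (a := 0) (c := c) (fun t _ A => by simpa using h t A) hu b
    simpa using this

lemma derivative_aeval {σ : Type*} [Fintype σ] (γ : σ → Polynomial ℂ) (g : MP σ) :
    Polynomial.derivative (aeval γ g)
      = ∑ s, aeval γ (pderiv s g) * Polynomial.derivative (γ s) := by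
  classical
  induction g using induction_on with
  | C a => simp
  | add f g hf hg =>
    rw [map_add, Polynomial.derivative_add, hf, hg, ← sum_add_distrib]
    refine sum_congr rfl fun s _ => ?_
    rw [map_add (pderiv s), map_add, add_mul]
  | mul_X f i hf =>
    have e : ∀ s, aeval γ (pderiv s (f * X i)) * Polynomial.derivative (γ s)
        = (aeval γ (pderiv s f) * Polynomial.derivative (γ s)) * γ i
          + if s = i then aeval γ f * Polynomial.derivative (γ i) else 0 := by
      intro s
      rw [pderiv_mul, map_add, map_mul, map_mul, aeval_X]
      split_ifs with h
      · rw [h, pderiv_X_self, map_one]; ring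
      · rw [pderiv_X_of_ne (Ne.symm h), map_zero]; ring
    rw [map_mul, Polynomial.derivative_mul, hf, aeval_X, sum_congr rfl fun s _ => e s,
      sum_add_distrib, sum_mul, sum_ite_eq' univ i]
    simp

lemma raise_eq_zero_of_lower {g : Pol m q}
    (h : ∀ (L : Mat m m) A, IsLowerUni L → ev (L * A) g = ev A g)
    {i i' : Fin m} (hi : (i : ℕ) + 1 = i') : raise univ i i' g = 0 := by
  refine ev_ext fun A => ?_
  set B : Fin m × Fin q → ℂ := fun s => if s.1 = i' then A i s.2 else 0 with hB
  set γ : Fin m × Fin q → Polynomial ℂ := fun s =>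
    Polynomial.C (A s.1 s.2) + Polynomial.X * Polynomial.C (B s) with hγ
  have heval : ∀ x f, Polynomial.eval x (aeval γ f) = eval (fun s => A s.1 s.2 + x * B s) f := by
    intro x f
    induction f using induction_on with
    | C a => simp
    | add f g hf hg => simp [hf, hg]
    | mul_X f s hf =>
      rw [map_mul, Polynomial.eval_mul, hf, aeval_X, map_mul, eval_X]
      congr 1
      simp only [hγ, Polynomial.eval_add, Polynomial.eval_mul, Polynomial.eval_C, Polynomial.eval_X]
  have hconst : aeval γ g = Polynomial.C (ev A g) := by
    refine Polynomial.funext fun x => ?_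
    rw [heval, Polynomial.eval_C]
    set L : Mat m m := 1 + single i' i x with hL
    rw [← h L A]
    · rw [ev]
      congr 2
      ext s
      rw [hL, Matrix.add_mul, Matrix.add_apply, Matrix.one_mul]
      congr 1
      by_cases hs : s.1 = i'
      · rw [← hs, single_mul_apply_same]
        simp [hB, hs]
      · simp_all
    · constructor
      · intro a
        rw [hL, Matrix.add_apply, Matrix.single_apply_of_ne]
        · simp
        · grind
      · intro a b hab
        rw [hL, Matrix.add_apply, Matrix.single_apply_of_ne, one_apply_ne]
        · simp
        · intro h; rw [h] at hab; omega
        · grind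
  have h1 := derivative_aeval γ g
  rw [hconst, Polynomial.derivative_C] at h1
  have h2 := congrArg (Polynomial.eval 0) h1
  rw [Polynomial.eval_zero, Polynomial.eval_finsetSum] at h2
  simp only [Polynomial.eval_mul, heval] at h2
  rw [map_zero, raise, LinearMap.sum_apply, map_sum]
  simp only [polz_apply, map_mul, ev_X]
  rw [h2, Fintype.sum_prod_type, sum_eq_single i']
  · refine sum_congr rfl fun b _ => ?_
    rw [mul_comm (A i b)]
    have e1 : Polynomial.eval 0 (Polynomial.derivative (γ (i', b))) = A i b := by
      simp [hγ, hB]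
    rw [e1]
    simp [ev]
  · intro a _ ha
    simp [hγ, hB, ha]
  · simp

end Scaling

section Levi

variable {n p : ℕ}

/-- The matrix acting by `L` on the first and by `L'` on the last coordinates. -/
def lev (n : ℕ) (L L' : Mat p p) : Mat n n :=
  1 + topM n p * (L - 1) * (topM n p)ᵀ + botM n p * (L' - 1) * (botM n p)ᵀ

lemma lev_mul_sliceM (hp : 2 * p ≤ n) (L L' A B : Mat p p) :
    lev n L L' * sliceM n A B = sliceM n (L * A) (L' * B) := by
  rw [lev, Matrix.add_mul, Matrix.add_mul, Matrix.mul_assoc _ (topM n p)ᵀ,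
    Matrix.mul_assoc _ (botM n p)ᵀ, top_sliceM hp, bot_sliceM hp, Matrix.one_mul, sliceM, sliceM,
    Matrix.mul_sub, Matrix.mul_sub, Matrix.sub_mul, Matrix.sub_mul]
  simp only [Matrix.mul_one, Matrix.mul_assoc]
  abel

lemma isOrth_lev (hp : 2 * p ≤ n) {L L' : Mat p p} (h : Lᵀ * L' = 1) : IsOrth (lev n L L') := by
  have hp' : p ≤ n := by omega
  have h' : L'ᵀ * L = 1 := by simpa using congrArg transpose h
  have j1 : symForm n * lev n L L' = symForm n + botM n p * (L - 1) * (topM n p)ᵀ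
      + topM n p * (L' - 1) * (botM n p)ᵀ := by
    rw [lev, Matrix.mul_add, Matrix.mul_add, Matrix.mul_one, ← Matrix.mul_assoc,
      ← Matrix.mul_assoc, ← Matrix.mul_assoc, ← Matrix.mul_assoc, symForm_mul_topM hp',
      symForm_mul_botM hp']
  have j2 : (lev n L L')ᵀ = 1 + topM n p * (Lᵀ - 1) * (topM n p)ᵀ
      + botM n p * (L'ᵀ - 1) * (botM n p)ᵀ := by
    simp [lev, Matrix.mul_assoc]
  have a1 : ∀ Y : Mat p n, (topM n p)ᵀ * (topM n p * Y) = Y := fun Y => by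
    rw [← Matrix.mul_assoc, topM_topM hp', Matrix.one_mul]
  have a2 : ∀ Y : Mat p n, (botM n p)ᵀ * (botM n p * Y) = Y := fun Y => by
    rw [← Matrix.mul_assoc, botM_botM hp', Matrix.one_mul]
  have a3 : ∀ Y : Mat p n, (topM n p)ᵀ * (botM n p * Y) = 0 := fun Y => by
    rw [← Matrix.mul_assoc, topM_botM hp, Matrix.zero_mul]
  have a4 : ∀ Y : Mat p n, (botM n p)ᵀ * (topM n p * Y) = 0 := fun Y => by
    rw [← Matrix.mul_assoc, botM_topM hp, Matrix.zero_mul]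
  have b1 : ∀ Y : Mat p n, Lᵀ * (L' * Y) = Y := fun Y => by
    rw [← Matrix.mul_assoc, h, Matrix.one_mul]
  have b2 : ∀ Y : Mat p n, L'ᵀ * (L * Y) = Y := fun Y => by
    rw [← Matrix.mul_assoc, h', Matrix.one_mul]
  rw [IsOrth, Matrix.mul_assoc, j1, j2]
  simp only [Matrix.add_mul, Matrix.mul_add, Matrix.sub_mul, Matrix.mul_sub, Matrix.one_mul,
    Matrix.mul_one, Matrix.mul_assoc, a1, a2, a3, a4, b1, b2, topM_symForm hp', botM_symForm hp',
    Matrix.mul_zero]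
  abel

lemma sliceM_apply (hp : 2 * p ≤ n) (A B : Mat p p) (i : Fin n) (b : Fin p) :
    sliceM n A B i b = if h : (i : ℕ) < p then A ⟨i, h⟩ b else
      if h : n - 1 - (i : ℕ) < p then B ⟨n - 1 - (i : ℕ), h⟩ b else 0 := by
  rw [sliceM, Matrix.add_apply, mul_apply, mul_apply]
  have h1 : ∑ j, topM n p i j * A j b = if h : (i : ℕ) < p then A ⟨i, h⟩ b else 0 := by
    split_ifs with h
    · rw [sum_eq_single ⟨i, h⟩]
      · simp [topM]
      · intro j _ hj
        have : ¬ (i : ℕ) = j := fun h' => hj (Fin.ext h'.symm)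
        simp [topM, this]
      · simp
    · refine sum_eq_zero fun j _ => ?_
      have : ¬ (i : ℕ) = j := by omega
      simp [topM, this]
  have h2 : ∑ j, botM n p i j * B j b
      = if h : n - 1 - (i : ℕ) < p then B ⟨n - 1 - (i : ℕ), h⟩ b else 0 := by
    split_ifs with h
    · rw [sum_eq_single ⟨n - 1 - i, h⟩]
      · have : (i : ℕ) + (n - 1 - i) = n - 1 := by omega
        simp [botM, this]
      · intro j _ hj
        have : ¬ (i : ℕ) + j = n - 1 := fun h' => hj (Fin.ext (by simp only; omega))
        simp [botM, this]
      · simp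
    · refine sum_eq_zero fun j _ => ?_
      have : ¬ (i : ℕ) + j = n - 1 := by omega
      simp [botM, this]
  rw [h1, h2]
  split_ifs with h3 h4
  · omega
  · simp
  · simp
  · simp

/-- The diagonal of a block diagonal torus element. -/
def levD (n : ℕ) (t t' : Vec p) (i : Fin n) : ℂ :=
  if h : (i : ℕ) < p then t ⟨i, h⟩ else
    if h : n - 1 - (i : ℕ) < p then t' ⟨n - 1 - (i : ℕ), h⟩ else 1

lemma lev_diagonal (hp : 2 * p ≤ n) (t t' : Vec p) :
    lev n (diagonal t) (diagonal t') = diagonal (levD n t t') := by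
  have key : ∀ s : Vec p, diagonal s - 1 = diagonal fun i => s i - 1 := fun s => by
    rw [← diagonal_one, diagonal_sub]
  ext i j
  have e1 : ∀ s : Vec p, (topM n p * diagonal s * (topM n p)ᵀ) i j
      = if i = j then (if h : (i : ℕ) < p then s ⟨i, h⟩ else 0) else 0 := by
    intro s
    rw [mul_apply]
    simp only [mul_diagonal, transpose_apply]
    split_ifs with h h'
    · subst h
      rw [sum_eq_single ⟨i, h'⟩]
      · simp [topM]
      · intro k _ hk
        have : ¬ (i : ℕ) = k := fun h' => hk (Fin.ext h'.symm)
        simp [topM, this]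
      · simp
    · refine sum_eq_zero fun k _ => ?_
      have : ¬ (i : ℕ) = k := by omega
      simp [topM, this]
    · refine sum_eq_zero fun k _ => ?_
      by_cases h1 : (i : ℕ) = k
      · have : ¬ (j : ℕ) = k := fun h2 => h (Fin.ext (h1.trans h2.symm))
        simp [topM, this]
      · simp [topM, h1]
  have e2 : ∀ s : Vec p, (botM n p * diagonal s * (botM n p)ᵀ) i j
      = if i = j then (if h : n - 1 - (i : ℕ) < p then s ⟨n - 1 - (i : ℕ), h⟩ else 0) else 0 := by
    intro s
    rw [mul_apply]
    simp only [mul_diagonal, transpose_apply]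
    split_ifs with h h'
    · subst h
      rw [sum_eq_single ⟨n - 1 - (i : ℕ), h'⟩]
      · have : (i : ℕ) + (n - 1 - i) = n - 1 := by omega
        simp [botM, this]
      · intro k _ hk
        have : ¬ (i : ℕ) + k = n - 1 := fun h' => hk (Fin.ext (by simp only; omega))
        simp [botM, this]
      · simp
    · refine sum_eq_zero fun k _ => ?_
      have : ¬ (i : ℕ) + k = n - 1 := by omega
      simp [botM, this]
    · refine sum_eq_zero fun k _ => ?_
      by_cases h1 : (i : ℕ) + k = n - 1
      · have : ¬ (j : ℕ) + k = n - 1 := fun h2 => h (Fin.ext (by omega))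
        simp [botM, this]
      · simp [botM, h1]
  rw [lev, key, key, Matrix.add_apply, Matrix.add_apply, e1, e2, diagonal_apply, one_apply, levD]
  split_ifs with h1 h2 h3
  all_goals first | omega | simp

lemma isLowerUni_lev {L L' : Mat p p} (hL : IsLowerUni L)
    (hL' : IsUpperUni L') : IsLowerUni (lev n L L') := by
  have key : ∀ i j : Fin n, (i : ℕ) ≤ j →
      (topM n p * (L - 1) * (topM n p)ᵀ : Mat n n) i j = 0 ∧
      (botM n p * (L' - 1) * (botM n p)ᵀ : Mat n n) i j = 0 := by
    intro i j hij
    constructor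
    · rw [mul_apply]
      refine sum_eq_zero fun k _ => ?_
      by_contra h
      have h1 := left_ne_zero_of_mul h
      have h2 := right_ne_zero_of_mul h
      rw [mul_apply] at h1
      obtain ⟨l, -, hl⟩ := exists_ne_zero_of_sum_ne_zero h1
      have h3 := left_ne_zero_of_mul hl
      have h4 := right_ne_zero_of_mul hl
      have h5 : (j : ℕ) = k := by by_contra hn; simp [topM, hn] at h2
      have h6 : (i : ℕ) = l := by by_contra hn; simp [topM, hn] at h3
      rw [Matrix.sub_apply] at h4
      rcases eq_or_ne l k with h7 | h7
      · rw [h7, hL.1, one_apply_eq, sub_self] at h4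
        exact h4 rfl
      · rw [one_apply_ne h7, hL.2 l k, sub_zero] at h4
        · exact h4 rfl
        · grind
    · rw [mul_apply]
      refine sum_eq_zero fun k _ => ?_
      by_contra h
      have h1 := left_ne_zero_of_mul h
      have h2 := right_ne_zero_of_mul h
      rw [mul_apply] at h1
      obtain ⟨l, -, hl⟩ := exists_ne_zero_of_sum_ne_zero h1
      have h3 := left_ne_zero_of_mul hl
      have h4 := right_ne_zero_of_mul hl
      have h5 : (j : ℕ) + k = n - 1 := by by_contra hn; simp [botM, hn] at h2
      have h6 : (i : ℕ) + l = n - 1 := by by_contra hn; simp [botM, hn] at h3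
      rw [Matrix.sub_apply] at h4
      rcases eq_or_ne l k with h7 | h7
      · rw [h7, hL'.1, one_apply_eq, sub_self] at h4
        exact h4 rfl
      · rw [one_apply_ne h7, hL'.2 l k, sub_zero] at h4
        · exact h4 rfl
        · grind
  constructor
  · intro i
    obtain ⟨h1, h2⟩ := key i i le_rfl
    simp only [lev, Matrix.add_apply, h1, h2, one_apply_eq, add_zero]
  · intro i j hij
    obtain ⟨h1, h2⟩ := key i j hij.le
    simp only [lev, Matrix.add_apply, h1, h2, add_zero]
    exact one_apply_ne (fun h => by rw [h] at hij; omega)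

end Levi

section SlicePolynomial

open MvPolynomial

variable {n p : ℕ}

/-- The unordered pair of two indices. -/
def sp (a b : Fin p) : PairIdx p := if h : a ≤ b then ⟨(a, b), h⟩ else ⟨(b, a), (not_le.1 h).le⟩

/-- The symmetric matrix with given upper triangle. -/
def symMat {α : Type*} (r : PairIdx p → α) : Matrix (Fin p) (Fin p) α := of fun a b => r (sp a b)

local notation "slc" A:max r:max => sliceM n (det A • A) ((1 / 2 : ℂ) • ((adjugate A)ᵀ * symMat r))

/-- The Gram matrix of the columns, as a function on unordered pairs. -/
def gramF (X : Mat n p) : PairIdx p → ℂ := fun t =>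
  (Xᵀ * symForm n * X) t.1.1 t.1.2

lemma symMat_gram (X : Mat n p) : symMat (gramF X) = Xᵀ * symForm n * X := by
  have h : (Xᵀ * symForm n * X)ᵀ = Xᵀ * symForm n * X := by
    simp [symForm_transpose, Matrix.mul_assoc]
  ext a b
  simp only [symMat, of_apply, gramF, sp]
  split_ifs with hab
  · rfl
  · conv_rhs => rw [← h]
    rfl

lemma symMat_mul (r : PairIdx p → ℂ) (s : Vec p) :
    symMat (fun t => s t.1.1 * s t.1.2 * r t) = diagonal s * symMat r * diagonal s := by
  ext a b
  rw [mul_diagonal, diagonal_mul]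
  simp only [symMat, of_apply, sp]
  split_ifs <;> ring

lemma gram_mul_left {w : Mat n n} (hw : IsOrth w) (X : Mat n p) : gramF (w * X) = gramF X := by
  have : (w * X)ᵀ * symForm n * (w * X) = Xᵀ * symForm n * X := by
    rw [transpose_mul]
    calc Xᵀ * wᵀ * symForm n * (w * X) = Xᵀ * (wᵀ * symForm n * w) * X := by
          simp only [Matrix.mul_assoc]
      _ = _ := by rw [hw]
  funext t
  exact congrFun (congrFun this t.1.1) t.1.2

/-- Restriction of a polynomial to the slice, with denominators cleared. -/
def slp : Pol n p →ₐ[ℂ] MvPolynomial (PairIdx p) (Pol p p) :=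
  aeval fun s => if h : (s.1 : ℕ) < p
    then C ((mvPolynomialX (Fin p) (Fin p) ℂ).det * X (⟨s.1, h⟩, s.2))
    else if h : n - 1 - (s.1 : ℕ) < p
    then C (C (1 / 2)) * ∑ a, C ((mvPolynomialX (Fin p) (Fin p) ℂ).adjugate a ⟨n - 1 - s.1, h⟩)
      * X (sp a s.2)
    else 0

lemma map_mvPolynomialX (A : Mat p p) : (ev A).mapMatrix (mvPolynomialX (Fin p) (Fin p) ℂ) = A := by
  ext i j
  simp [ev, mvPolynomialX]

lemma ev_det (A : Mat p p) : ev A (mvPolynomialX (Fin p) (Fin p) ℂ).det = A.det := by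
  rw [RingHom.map_det, map_mvPolynomialX]

lemma ev_adjugate (A : Mat p p) (i j : Fin p) :
    ev A ((mvPolynomialX (Fin p) (Fin p) ℂ).adjugate i j) = A.adjugate i j := by
  have := congrFun (congrFun ((ev A).map_adjugate (mvPolynomialX (Fin p) (Fin p) ℂ)) i) j
  rw [map_mvPolynomialX] at this
  exact this

lemma eval_map_slp (hp : 2 * p ≤ n) (A : Mat p p) (r : PairIdx p → ℂ) (f : Pol n p) :
    eval r (map (ev A) (slp f)) = ev (slc A r) f := by
  have : (((eval r).comp (map (ev A))).comp (slp (n := n) (p := p)).toRingHom)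
      = ev (slc A r) := by
    refine ringHom_ext (fun a => ?_) (fun s => ?_)
    · change eval r (map (ev A) (slp (C a))) = ev _ (C a)
      rw [slp, algHom_C]
      change eval r (map (ev A) (C (C a))) = _
      simp [ev]
    · change eval r (map (ev A) (slp (X s))) = _
      rw [ev_X, sliceM_apply hp, slp, aeval_X]
      split_ifs with h h'
      · rw [map_C, eval_C, map_mul, ev_det, ev_X]
        simp
      · rw [map_mul, map_mul, map_C, eval_C, map_sum, map_sum]
        simp only [map_mul, map_C, eval_C, map_X, eval_X, ev_adjugate]
        simp [ev, mul_apply, symMat]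
      · simp
  exact DFunLike.congr_fun this f

/-- Lower unitriangular invariants of given torus weight and column degrees. -/
structure IsPHW (n p : ℕ) (z : Fin p → ℤ) (c : NVec p) (f : Pol n p) :
    Prop where
  uni : ∀ w : Mat n n, IsOrth w → IsLowerUni w → ∀ X : Mat n p, ev (w * X) f = ev X f
  tor : ∀ t : Vec p, (∀ i, t i ≠ 0) → ∀ X : Mat n p,
    ev (lev n (diagonal t) (diagonal t⁻¹) * X) f = (∏ i, t i ^ z i) * ev X f
  col : ∀ (s : Vec p) (X : Mat n p),
    ev (X * diagonal s) f = (∏ b, s b ^ c b) * ev X f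

variable {z : Fin p → ℤ} {c : NVec p} {f : Pol n p}

lemma ev_smul_mat (hc : ∀ (s : Vec p) (X : Mat n p),
    ev (X * diagonal s) f = (∏ b, s b ^ c b) * ev X f)
    (a : ℂ) (X : Mat n p) : ev (a • X) f = a ^ (∑ b, c b) * ev X f := by
  have := hc (fun _ => a) X
  rw [prod_pow_eq_pow_sum] at this
  rw [← this]
  congr 2
  ext i b
  rw [mul_diagonal, Matrix.smul_apply, smul_eq_mul, mul_comm]

lemma IsPHW.eval_slp (hp : 2 * p ≤ n) (h : IsPHW n p z c f) (X : Mat n p)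
    (hX : ((topM n p)ᵀ * X).det ≠ 0) : eval (gramF X) (map (ev ((topM n p)ᵀ * X)) (slp f))
      = ((topM n p)ᵀ * X).det ^ (∑ b, c b) * ev X f := by
  set A := (topM n p)ᵀ * X with hA
  have hu : IsUnit A.det := isUnit_iff_ne_zero.2 hX
  obtain ⟨w, hw, hwl, e⟩ := exists_slice hp X A rfl A⁻¹ (nonsing_inv_mul A hu)
  rw [eval_map_slp hp, ← h.uni w hw hwl X, ← ev_smul_mat h.col, e, symMat_gram]
  congr 2
  have h1 : A.adjugateᵀ = A.det • (A⁻¹)ᵀ := by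
    rw [Matrix.inv_def, Ring.inverse_eq_inv', transpose_smul, smul_smul, mul_inv_cancel₀ hX,
      one_smul]
  rw [h1, sliceM, sliceM, smul_add, Matrix.mul_smul]
  congr 1
  simp only [Matrix.mul_smul, Matrix.smul_mul, smul_smul]
  rw [mul_comm]

lemma exists_det_ne_zero (hp : 2 * p ≤ n) (hf : f ≠ 0) :
    ∃ X : Mat n p, ((topM n p)ᵀ * X).det ≠ 0 ∧ ev X f ≠ 0 := by
  by_contra hcon
  push Not at hcon
  set D : Pol n p :=
    (of fun k b : Fin p => (X (Fin.castLE (by omega) k, b) : Pol n p)).det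
    with hD
  have hDev : ∀ Y : Mat n p, ev Y D = ((topM n p)ᵀ * Y).det := by
    intro Y
    rw [hD, RingHom.map_det]
    congr 1
    ext k b
    rw [topM_mul (by omega)]
    exact ev_X Y _
  have h0 : D * f = 0 := by
    refine ev_ext fun Y => ?_
    rw [map_mul, map_zero, hDev]
    by_cases hY : ((topM n p)ᵀ * Y).det = 0
    · rw [hY, zero_mul]
    · rw [hcon Y hY, mul_zero]
  have hD0 : D ≠ 0 := by
    intro h
    have := hDev (topM n p)
    rw [h, map_zero, topM_topM (by omega), det_one] at this
    exact zero_ne_one this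
  exact (mul_ne_zero hD0 hf) h0

lemma IsPHW.slp_ne_zero (hp : 2 * p ≤ n) (h : IsPHW n p z c f) (hf : f ≠ 0) : slp f ≠ 0 := by
  obtain ⟨X, hX, hfX⟩ := exists_det_ne_zero hp hf
  intro h0
  have := h.eval_slp hp X hX
  rw [h0, map_zero, map_zero] at this
  exact (mul_ne_zero (pow_ne_zero _ hX) hfX) this.symm

lemma det_of_isLowerUni {L : Mat p p} (hL : IsLowerUni L) : L.det = 1 := by
  rw [det_of_isLowerTriangular]
  · simp [hL.1]
  · intro i j hij
    exact hL.2 i j hij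

lemma isLowerUni_inv {L : Mat p p} (hL : IsLowerUni L) : IsLowerUni L⁻¹ := by
  have hu : IsUnit L.det := by rw [det_of_isLowerUni hL]; exact isUnit_one
  have h1 : L.BlockTriangular OrderDual.toDual := fun i j hij => hL.2 i j hij
  have := invertibleOfIsUnitDet L hu
  have h2 : L⁻¹.BlockTriangular OrderDual.toDual := blockTriangular_inv_of_blockTriangular h1
  have h3 : ∀ i j : Fin p, (i : ℕ) < (j : ℕ) → L⁻¹ i j = 0 := fun i j hij => h2 hij
  refine ⟨fun i => ?_, h3⟩
  have h4 := congrFun (congrFun (nonsing_inv_mul L hu) i) i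
  rw [mul_apply, sum_eq_single i, hL.1, mul_one, one_apply_eq] at h4
  · exact h4
  · intro k _ hk
    rcases lt_or_gt_of_ne (fun h => hk (Fin.ext h) : (k : ℕ) ≠ i) with h | h
    · rw [hL.2 k i h, mul_zero]
    · rw [h3 i k h, zero_mul]
  · simp

lemma isUpperUni_transpose {L : Mat p p} (hL : IsLowerUni L) :
    IsUpperUni Lᵀ := ⟨fun i => hL.1 i, fun i j hij => hL.2 j i hij⟩

lemma ev_coeff_congr {A A' : Mat p p} {w : PairIdx p → ℂ} {a : ℂ}
    {Φ : MvPolynomial (PairIdx p) (Pol p p)}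
    (h : ∀ r : PairIdx p → ℂ, eval (fun t => w t * r t) (map (ev A) Φ) = a * eval r (map (ev A') Φ))
    (j : PairIdx p →₀ ℕ) : (∏ t, w t ^ j t) * ev A (coeff j Φ) = a * ev A' (coeff j Φ) := by
  have h1 : lsub (diagonal w) (map (ev A) Φ) = a • map (ev A') Φ := by
    refine funext fun r => ?_
    rw [eval_lsub, smul_eval, ← h r]
    congr 2
    ext t
    rw [sum_eq_single t]
    · simp
    · intro t' _ h'
      simp [h']
    · simp
  have h2 := congrArg (coeff j) h1
  rw [coeff_lsub_diagonal, coeff_smul, coeff_map, coeff_map] at h2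
  exact h2

lemma IsPHW.coeff_lower (hp : 2 * p ≤ n) (h : IsPHW n p z c f) (j : PairIdx p →₀ ℕ)
    (L A : Mat p p) (hL : IsLowerUni L) :
    ev (L * A) (coeff j (slp f)) = ev A (coeff j (slp f)) := by
  have key := ev_coeff_congr (A := L * A) (A' := A) (w := 1) (a := 1) (Φ := slp f) (fun r => ?_) j
  · simpa using key
  · have hd := det_of_isLowerUni hL
    have hu : IsUnit L.det := by rw [hd]; exact isUnit_one
    have hLL : Lᵀ * (L⁻¹)ᵀ = 1 := by rw [← transpose_mul, nonsing_inv_mul L hu, transpose_one]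
    have hadj : L.adjugate = L⁻¹ := by
      rw [Matrix.inv_def, hd, Ring.inverse_one, one_smul]
    have e := h.uni _ (isOrth_lev hp hLL)
      (isLowerUni_lev hL (isUpperUni_transpose (isLowerUni_inv hL)))
      (slc A r)
    rw [lev_mul_sliceM hp] at e
    simp only [Pi.one_apply, one_mul]
    rw [eval_map_slp hp, eval_map_slp hp, ← e, det_mul, hd, one_mul, adjugate_mul_distrib, hadj,
      transpose_mul, Matrix.mul_smul, Matrix.mul_smul, Matrix.mul_assoc]

lemma adjugate_diagonal_mul (t : Vec p) :
    (diagonal t).adjugate * diagonal t = (∏ i, t i) • (1 : Mat p p) := by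
  rw [adjugate_mul, det_diagonal]

lemma IsPHW.coeff_row (hp : 2 * p ≤ n) (h : IsPHW n p z c f) (j : PairIdx p →₀ ℕ)
    (t : Vec p) (ht : ∀ i, t i ≠ 0) (A : Mat p p) : ev (diagonal t * A) (coeff j (slp f))
      = (∏ i, t i ^ (z i + (∑ b, c b : ℕ))) * ev A (coeff j (slp f)) := by
  have key := ev_coeff_congr (A := diagonal t * A) (A' := A) (w := 1)
    (a := ∏ i, t i ^ (z i + (∑ b, c b : ℕ))) (Φ := slp f) (fun r => ?_) j
  · simpa using key
  · have htt : diagonal t * diagonal t⁻¹ = (1 : Mat p p) := by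
      simp_all
    have hadj : (diagonal t).adjugate = (∏ i, t i) • diagonal t⁻¹ := by
      calc (diagonal t).adjugate = (diagonal t).adjugate * (diagonal t * diagonal t⁻¹) := by
            rw [htt, Matrix.mul_one]
        _ = _ := by rw [← Matrix.mul_assoc, adjugate_diagonal_mul, Matrix.smul_mul, Matrix.one_mul]
    have e := h.tor t ht (slc A r)
    rw [lev_mul_sliceM hp] at e
    have e2 := ev_smul_mat h.col (∏ i, t i) (sliceM n (diagonal t * A.det • A)
      (diagonal t⁻¹ * (1 / 2 : ℂ) • (A.adjugateᵀ * symMat r)))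
    have e3 : (∏ i, t i) • (sliceM n (diagonal t * A.det • A)
        (diagonal t⁻¹ * (1 / 2 : ℂ) • (A.adjugateᵀ * symMat r)))
        = sliceM n ((diagonal t * A).det • (diagonal t * A))
          ((1 / 2 : ℂ) • ((diagonal t * A).adjugateᵀ * symMat r)) := by
      rw [sliceM, sliceM, smul_add, det_mul, det_diagonal, adjugate_mul_distrib, hadj,
        transpose_mul, transpose_smul, diagonal_transpose]
      congr 1
      · simp only [Matrix.mul_smul, smul_smul]
      · simp only [Matrix.mul_smul, Matrix.smul_mul, Matrix.mul_assoc, smul_smul]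
        rw [mul_comm]
    rw [e3, e] at e2
    simp only [Pi.one_apply, one_mul]
    rw [eval_map_slp hp, eval_map_slp hp, e2, ← mul_assoc]
    congr 1
    rw [← prod_pow, ← prod_mul_distrib]
    refine prod_congr rfl fun i _ => ?_
    rw [zpow_add₀ (ht i), zpow_natCast, mul_comm]

lemma IsPHW.coeff_col (hp : 2 * p ≤ n) (h : IsPHW n p z c f) (j : PairIdx p →₀ ℕ)
    (s : Vec p) (A : Mat p p) : (∏ b, s b ^ pdeg j b) * ev (A * diagonal s) (coeff j (slp f))
      = (∏ b, s b ^ (c b + ∑ b, c b)) * ev A (coeff j (slp f)) := by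
  have key := ev_coeff_congr (A := A * diagonal s) (A' := A) (w := fun t => s t.1.1 * s t.1.2)
    (a := ∏ b, s b ^ (c b + ∑ b, c b)) (Φ := slp f) (fun r => ?_) j
  · rw [← key]
    congr 1
    have h1 : ∀ t : PairIdx p, (s t.1.1 * s t.1.2) ^ j t = ∏ b, s b ^ (j t * pairDeg t b) := by
      intro t
      have : ∀ b0 : Fin p, s b0 ^ j t = ∏ b, s b ^ (j t * if b0 = b then 1 else 0) := by
        intro b0
        rw [prod_eq_single b0]
        · simp
        · intro b _ hb
          simp [Ne.symm hb]
        · simp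
      rw [mul_pow, this, this, ← prod_mul_distrib]
      refine prod_congr rfl fun b _ => ?_
      rw [← pow_add, ← mul_add, pairDeg]
    simp only [h1]
    rw [prod_comm]
    refine prod_congr rfl fun b _ => ?_
    rw [prod_pow_eq_pow_sum, pdeg]
  · have e := h.col s (slc A r)
    have e2 := ev_smul_mat h.col (∏ i, s i)
      (slc A r * diagonal s)
    have e3 : (∏ i, s i) • (slc A r
          * diagonal s)
        = sliceM n ((A * diagonal s).det • (A * diagonal s))
          ((1 / 2 : ℂ) • ((A * diagonal s).adjugateᵀ * symMat fun t => s t.1.1 * s t.1.2 * r t)) := by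
      have h2 : (A * diagonal s).adjugateᵀ * (diagonal s * symMat r * diagonal s)
          = (∏ i, s i) • (A.adjugateᵀ * symMat r * diagonal s) := by
        have h3 : (diagonal s).adjugateᵀ * diagonal s
            = (∏ i, s i) • (1 : Mat p p) := by
          have := congrArg transpose (mul_adjugate (diagonal s))
          rw [transpose_mul, diagonal_transpose, det_diagonal, transpose_smul, transpose_one] at this
          exact this
        rw [adjugate_mul_distrib, transpose_mul]
        calc A.adjugateᵀ * (diagonal s).adjugateᵀ * (diagonal s * symMat r * diagonal s)
            = A.adjugateᵀ * ((diagonal s).adjugateᵀ * diagonal s) * symMat r * diagonal s := by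
              simp only [Matrix.mul_assoc]
          _ = _ := by
              simp_all
      rw [symMat_mul, h2, sliceM, sliceM, Matrix.add_mul, smul_add, det_mul, det_diagonal]
      congr 1
      · simp only [Matrix.mul_smul, Matrix.smul_mul, Matrix.mul_assoc, smul_smul]
        rw [mul_comm]
      · simp only [Matrix.mul_smul, Matrix.smul_mul, Matrix.mul_assoc, smul_smul]
        rw [mul_comm]
    rw [e3, e] at e2
    rw [eval_map_slp hp, eval_map_slp hp, e2, ← mul_assoc]
    congr 1
    rw [← prod_pow, ← prod_mul_distrib]
    refine prod_congr rfl fun i _ => ?_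
    rw [← pow_add, add_comm]

theorem IsPHW.exists_gt (hp : 2 * p ≤ n) (h : IsPHW n p z c f) (hf : f ≠ 0) :
    ∃ (j : PairIdx p →₀ ℕ) (rho : NVec p) (e : Arr), e ∈ mats p p 0 (extz rho) ∧
      (∀ i, (rho i : ℤ) = z i + (∑ b, c b : ℕ)) ∧ (∀ b, cols p p e b + pdeg j b = c b + ∑ b, c b) ∧
      coeff (fsM p p e) (coeff j (slp f)) ≠ 0 := by
  obtain ⟨j, hj⟩ := ne_zero_iff.1 (h.slp_ne_zero hp hf)
  set g := coeff j (slp f) with hg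
  obtain ⟨u, hu⟩ := ne_zero_iff.1 hj
  have hrow := fun u (hu : coeff u g ≠ 0) => row_of_diagonal (h.coeff_row hp j) hu
  have hcol := fun u (hu : coeff u g ≠ 0) => col_of_diagonal
    (fun t _ A => h.coeff_col hp j t A) hu
  obtain ⟨e, he, hc⟩ := _root_.exists_gt (rho := fun i => ∑ b, u (i, b))
    (c := fun b => ∑ i, u (i, b)) hj
    (fun i i' hi => raise_eq_zero_of_lower (h.coeff_lower hp j) hi)
    (fun u' hu' i => by
      have h1 := hrow u' hu' i
      rw [← hrow u hu i] at h1
      exact_mod_cast h1)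
    (fun u' hu' b => by
      have h1 := hcol u' hu' b
      rw [← hcol u hu b] at h1
      omega)
  rw [mem_filter] at he
  refine ⟨j, _, e, he.1, fun i => hrow u hu i, fun b => ?_, hc⟩
  rw [he.2]
  exact hcol u hu b

end SlicePolynomial

section OrthogonalReps

open MvPolynomial Fin

variable {n p : ℕ}

lemma reflMatrix_mul_apply {q : ℕ} (X : Mat n q) (i : Fin n) (b : Fin q) :
    (reflMatrix n * X : Mat n q) i b = if 2 * (i : ℕ) + 1 = n then -X i b
      else if 2 * (i : ℕ) = n ∨ 2 * (i : ℕ) + 2 = n then X i.rev b else X i b := by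
  have hr : (i.rev : ℕ) = n - (i + 1) := val_rev i
  have hi := i.isLt
  rw [mul_apply]
  simp only [reflMatrix, of_apply]
  split_ifs with h1 h2
  · rw [sum_eq_single i]
    · simp [h1]
    · intro j _ hj
      rw [if_neg (by tauto), if_neg (by omega), if_neg (by tauto), zero_mul]
    · simp
  · rw [sum_eq_single i.rev]
    · rw [if_neg (by tauto), if_pos (by omega), one_mul]
    · intro j _ hj
      have : (j : ℕ) ≠ i.rev := fun h => hj (Fin.ext h)
      rw [if_neg (by tauto), if_neg (by omega), if_neg (by tauto), zero_mul]
    · simp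
  · rw [sum_eq_single i]
    · rw [if_neg (by tauto), if_neg (by omega), if_pos (by tauto), one_mul]
    · intro j _ hj
      rw [if_neg (by tauto), if_neg (by omega), if_neg (by tauto), zero_mul]
    · simp

lemma reflMatrix_transpose (n : ℕ) : (reflMatrix n)ᵀ = reflMatrix n := by
  ext i j
  simp only [transpose_apply, reflMatrix, of_apply]
  grind

lemma reflMatrix_symForm (n : ℕ) : reflMatrix n * symForm n = symForm n * reflMatrix n := by
  ext i j
  rw [reflMatrix_mul_apply, symForm_mul_apply]
  have h := reflMatrix_mul_apply (1 : Mat n n) i.rev j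
  have h2 : ∀ i : Fin n, symForm n i j = (1 : Mat n n) i.rev j := fun i => by
    have := symForm_mul_apply (1 : Mat n n) i j
    rwa [mul_one] at this
  have hr : (i.rev : ℕ) = n - (i + 1) := val_rev i
  have hi := i.isLt
  rw [mul_one] at h
  rw [h, h2, h2, rev_rev]
  split_ifs <;> first | rfl | omega

lemma reflMatrix_mul_self (n : ℕ) : reflMatrix n * reflMatrix n = 1 := by
  ext i j
  have h := reflMatrix_mul_apply (1 : Mat n n)
  simp only [mul_one] at h
  have hr : (i.rev : ℕ) = n - (i + 1) := val_rev i
  have hi := i.isLt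
  rw [reflMatrix_mul_apply, h, h, rev_rev]
  split_ifs <;> first | rfl | omega | simp

lemma isOrth_reflMatrix (n : ℕ) : IsOrth (reflMatrix n) := by
  rw [IsOrth, reflMatrix_transpose, reflMatrix_symForm, mul_assoc, reflMatrix_mul_self,
    Matrix.mul_one]

lemma symForm_conjTranspose (n : ℕ) : (symForm n)ᴴ = symForm n := by
  ext i j
  simp only [conjTranspose_apply, symForm, of_apply, add_comm]
  split_ifs <;> simp

lemma IsOrth.conjTranspose {w : Mat n n} (h : IsOrth w) : IsOrth wᴴ := by
  have h2 := congrArg Matrix.conjTranspose h.transpose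
  rw [conjTranspose_mul, conjTranspose_mul, symForm_conjTranspose, transpose_transpose] at h2
  have h3 : (wᴴ)ᵀ = wᵀᴴ := by ext i j; simp
  rw [IsOrth, h3, mul_assoc]
  exact h2

/-- Conjugate transposition on the orthogonal group. -/
def stO (g : OGL n) : OGL n := mkO (toM g)ᴴ (toM_isOrth g).conjTranspose

lemma toM_stO (g : OGL n) : toM (stO g) = (toM g)ᴴ := rfl

lemma stO_stO (g : OGL n) : stO (stO g) = g := toM_inj (by simp [toM_stO])

/-- The distinguished reflection. -/
def rO (n : ℕ) : OGL n := mkO (reflMatrix n) (isOrth_reflMatrix n)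

lemma rO_mul_self (n : ℕ) : rO n * rO n = 1 := toM_inj (reflMatrix_mul_self n)

variable {V : Type*} [AddCommGroup V] [Module ℂ V]

/-- The highest weight vectors of weight `mu`, as in `IsOIrrep`. -/
def hwSub (n : ℕ) (mu : ℕ → ℕ) (ρ : ORep n V) : Submodule ℂ V where
  carrier := {v | (∀ g : OGL n, IsUpperUni (toM g) → ρ g v = v) ∧
    (∀ (g : OGL n) (d : Vec n), toM g = diagonal d → (∏ i, d i) = 1 →
      ρ g v = (∏ i, d i ^ (mu (i : ℕ))) • v) ∧
    (2 * conj mu 0 = n ∨ ρ (rO n) v = v)}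
  add_mem' := by
    rintro a b ⟨h1, h2, h3⟩ ⟨k1, k2, k3⟩
    refine ⟨fun g hg => ?_, fun g d hg hd => ?_, ?_⟩
    · rw [map_add, h1 g hg, k1 g hg]
    · rw [map_add, h2 g d hg hd, k2 g d hg hd, smul_add]
    · rcases h3 with h3 | h3
      · exact Or.inl h3
      · rcases k3 with k3 | k3
        · exact Or.inl k3
        · exact Or.inr (by rw [map_add, h3, k3])
  zero_mem' := ⟨fun g _ => map_zero _, fun g d _ _ => by rw [map_zero, smul_zero],
    Or.inr (map_zero _)⟩
  smul_mem' := by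
    rintro c a ⟨h1, h2, h3⟩
    refine ⟨fun g hg => ?_, fun g d hg hd => ?_, ?_⟩
    · rw [map_smul, h1 g hg]
    · rw [map_smul, h2 g d hg hd, smul_comm]
    · rcases h3 with h3 | h3
      · exact Or.inl h3
      · exact Or.inr (by rw [map_smul, h3])

lemma mem_hwSub {mu : ℕ → ℕ} {ρ : ORep n V} {v : V} :
    v ∈ hwSub n mu ρ ↔ (∀ g : OGL n, IsUpperUni (toM g) → ρ g v = v) ∧
      (∀ (g : OGL n) (d : Vec n), toM g = diagonal d → (∏ i, d i) = 1 →
        ρ g v = (∏ i, d i ^ (mu (i : ℕ))) • v) ∧ (2 * conj mu 0 = n ∨ ρ (rO n) v = v) := Iff.rfl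

lemma isOHWvec_iff {mu : ℕ → ℕ} {ρ : ORep n V} {v : V} : (IsOHWvec n mu ρ v ∧ (2 * conj mu 0 = n ∨
        ∀ g : OGL n, ((g : GL (Fin n) ℂ) : Mat n n) = reflMatrix n →
          ρ g v = v)) ↔ v ∈ hwSub n mu ρ := by
  rw [mem_hwSub, IsOHWvec, and_assoc]
  refine and_congr_right fun _ => and_congr_right fun _ => or_congr_right ?_
  refine ⟨fun h => h (rO n) rfl, fun h g hg => ?_⟩
  have : g = rO n := toM_inj hg
  rw [this, h]

/-- The action on polynomial functions of `n × p` matrices. -/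
def polyRep (n p : ℕ) : Representation ℂ (OGL n) (Pol n p) where
  toFun g := (lsub (kroneckerMap (· * ·) (toM g) (1 : Mat p p))).toLinearMap
  map_one' := by
    refine LinearMap.ext fun f => ?_
    change lsub (kroneckerMap (· * ·) _ _) f = f
    rw [toM_one, one_kronecker_one, lsub_one]
  map_mul' g h := by
    refine LinearMap.ext fun f => ?_
    change lsub (kroneckerMap (· * ·) _ _) f = lsub (kroneckerMap (· * ·) _ _)
      (lsub (kroneckerMap (· * ·) _ _) f)
    rw [lsub_lsub, ← mul_kronecker_mul, one_mul, toM_mul]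

lemma ev_polyRep (g : OGL n) (f : Pol n p) (X : Mat n p) :
    ev X (polyRep n p g f) = ev ((toM g)ᵀ * X) f := by
  change eval _ (lsub (kroneckerMap (· * ·) _ _) f) = _
  rw [eval_lsub, ev]
  congr 1
  congr 1
  funext s
  rw [Fintype.sum_prod_type, mul_apply]
  refine sum_congr rfl fun i _ => ?_
  rw [sum_eq_single s.2]
  · simp [kroneckerMap_apply]
  · intro b _ hb
    simp [kroneckerMap_apply, one_apply, hb]
  · simp

lemma fis_polyRep (g : OGL n) (f h : Pol n p) :
    fis (polyRep n p g f) h = fis f (polyRep n p (stO g) h) := by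
  change fis (lsub (kroneckerMap (· * ·) _ _) f) h
    = fis f (lsub (kroneckerMap (· * ·) _ _) h)
  rw [fis_lsub, conjTranspose_kronecker, conjTranspose_one, toM_stO]

/-- Polynomials homogeneous in each column. -/
def colHom (n p : ℕ) (c : NVec p) : Submodule ℂ (Pol n p) where
  carrier := {f | ∀ (t : Vec p) (A : Mat n p),
    ev (A * diagonal t) f = (∏ i, t i ^ c i) * ev A f}
  add_mem' := by
    intro f g hf hg t A
    rw [map_add, map_add, hf, hg, mul_add]
  zero_mem' := by
    intro t A
    rw [map_zero, map_zero, mul_zero]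
  smul_mem' := by
    intro a f hf t A
    rw [ev_smul, ev_smul, hf]
    ring

lemma isSubrep_colHom (c : NVec p) : IsSubrep (polyRep n p) (colHom n p c) := by
  intro g f hf t A
  rw [ev_polyRep, ev_polyRep, ← Matrix.mul_assoc, hf]

instance finiteDimensional_colHom (c : NVec p) : FinDim (colHom n p c) := by
  have hle : colHom n p c ≤ restrictTotalDegree (Fin n × Fin p) ℂ (∑ b, c b) := by
    intro f hf
    rw [mem_restrictTotalDegree, totalDegree, Finset.sup_le_iff]
    intro u hu
    have h := coeff_col_iff.2 hf u (mem_support_iff.1 hu)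
    rw [Finsupp.sum_fintype _ _ (fun _ => rfl), Fintype.sum_prod_type_right]
    exact (sum_congr rfl fun b _ => h b).le
  have : FiniteDimensional ℂ (restrictTotalDegree (Fin n × Fin p) ℂ (∑ b, c b)) :=
    inferInstance
  exact finiteDimensional_of_le hle

lemma prod_pow_castLE (hp : p ≤ n) {mu : ℕ → ℕ} (hmu : ∀ i, p ≤ i → mu i = 0) (d : Vec n) :
    ∏ i : Fin n, d i ^ mu (i : ℕ) = ∏ i : Fin p, d (castLE hp i) ^ mu (i : ℕ) := by
  have h1 : ∀ i : Fin n, i ∉ univ.map (castLEEmb hp) → d i ^ mu (i : ℕ) = 1 := by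
    intro i hi
    rw [hmu i, pow_zero]
    by_contra hlt
    exact hi (mem_map.2 ⟨⟨i, by omega⟩, mem_univ _, rfl⟩)
  rw [← prod_subset (subset_univ _) fun i _ hi => h1 i hi, prod_map]
  rfl

end OrthogonalReps

section Dimension

open LinearMap MvPolynomial

variable {n p : ℕ}

lemma prod_levD (hp : 2 * p ≤ n) {t : Vec p} (ht : ∀ i, t i ≠ 0) : ∏ i, levD n t t⁻¹ i = 1 := by
  refine prod_involution (fun i _ => i.rev) (fun i _ => ?_) (fun i _ h1 h2 => h1 ?_)
    (fun _ _ => mem_univ _) (fun i _ => Fin.rev_rev i)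
  · have hr : (i.rev : ℕ) = n - (i + 1) := Fin.val_rev i
    have hi := i.isLt
    simp only [levD]
    by_cases h : (i : ℕ) < p
    · have e : (⟨n - 1 - (i.rev : ℕ), by omega⟩ : Fin p) = ⟨i, h⟩ := Fin.ext (by simp only; omega)
      rw [dif_pos h, dif_neg (by omega), dif_pos (by omega), e]
      exact mul_inv_cancel₀ (ht _)
    · by_cases h' : n - 1 - (i : ℕ) < p
      · have e : (⟨(i.rev : ℕ), by omega⟩ : Fin p) = ⟨n - 1 - (i : ℕ), h'⟩ :=
          Fin.ext (by simp only; omega)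
        rw [dif_neg h, dif_pos h', dif_pos (by omega), e]
        exact inv_mul_cancel₀ (ht _)
      · rw [dif_neg h, dif_neg h', dif_neg (by omega), dif_neg (by omega), mul_one]
  · have hr : (i.rev : ℕ) = n - (i + 1) := Fin.val_rev i
    have hi := i.isLt
    have h3 := congrArg Fin.val h2
    rw [levD, dif_neg (by omega), dif_neg (by omega)]

lemma isPHW_of_mem_hwSub (hp : 2 * p ≤ n) {mu : ℕ → ℕ} (hmu : ∀ i, p ≤ i → mu i = 0)
    {c : NVec p} {f : Pol n p} (h : f ∈ hwSub n mu (polyRep n p))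
    (hc : f ∈ colHom n p c) : IsPHW n p (fun i => (mu i : ℤ)) c f where
  uni w hw hl X := by
    have := congrArg (ev X) (h.1 (mkO wᵀ hw.transpose) (isUpperUni_transpose hl))
    rwa [ev_polyRep, toM_mkO, transpose_transpose] at this
  tor t ht X := by
    have hd : diagonal t * diagonal t⁻¹ = (1 : Mat p p) := by
      simp_all
    have ho : IsOrth (lev n (diagonal t) (diagonal t⁻¹)) :=
      isOrth_lev hp (by rwa [diagonal_transpose])
    have := congrArg (ev X) (h.2.1 (mkO _ ho) _ (lev_diagonal hp t t⁻¹) (prod_levD hp ht))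
    rw [ev_polyRep, toM_mkO, ev_smul, prod_pow_castLE (show p ≤ n by omega) hmu] at this
    have e : (lev n (diagonal t) (diagonal t⁻¹))ᵀ = lev n (diagonal t) (diagonal t⁻¹) := by
      rw [lev_diagonal hp, diagonal_transpose]
    rw [e] at this
    rw [this]
    congr 1
    refine prod_congr rfl fun i _ => ?_
    simp [levD]
  col := hc

lemma cum_zero_of_le {e : Arr} (he : Interl 0 e) {a i : ℕ} (h : a ≤ i) : cum 0 e a i = 0 := by
  induction a generalizing i with
  | zero => simp [cum]
  | succ a ih =>
    obtain ⟨i, rfl⟩ : ∃ i', i = i' + 1 := ⟨i - 1, by omega⟩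
    exact Nat.le_zero.1 ((he i a).trans (ih (by omega)).le)

lemma exists_shift {lam : ℕ → ℕ} {d : ℕ} {rho : NVec p} {e : Arr}
    (he : e ∈ mats p p 0 (extz rho)) (hrho : ∀ i : Fin p, rho i = lam i + d)
    (hlam : ∀ i, p ≤ i → lam i = 0) :
    ∃ e' ∈ mats p p 0 lam, ∀ i b, e i b = e' i b + if i = b ∧ i < p then d else 0 := by
  obtain ⟨hs, hi, hr⟩ := mem_mats.1 he
  have h2 : ∀ i, e i i = cum 0 e (i + 1) i := fun i => by
    rw [cum_succ, cum_zero_of_le hi le_rfl, zero_add]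
  have h3 : ∀ k i, i + k + 1 = p → d ≤ cum 0 e (i + 1) i := by
    intro k
    induction k with
    | zero =>
      intro i hip
      have h4 := hr i
      have h5 : cum 0 e (i + 1) i = ∑ b ∈ range p, e i b := by
        simp only [cum, Pi.zero_apply, zero_add]
        rw [show i + 1 = p by omega]
      rw [h5, h4, extz, dif_pos (by omega), hrho]
      omega
    | succ k ih =>
      intro i hip
      exact (ih (i + 1) (by omega)).trans (hi i (i + 1))
  have hd : ∀ i, i < p → d ≤ e i i := fun i hip => by
    rw [h2]
    exact h3 (p - 1 - i) i (by omega)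
  set e' : Arr := fun i b => e i b - if i = b ∧ i < p then d else 0 with he'
  have key : ∀ i b, e i b = e' i b + if i = b ∧ i < p then d else 0 := by
    grind
  have hcum : ∀ a i, cum 0 e a i = cum 0 e' a i + if i < a ∧ i < p then d else 0 := by
    intro a i
    induction a with
    | zero => simp [cum]
    | succ a ih =>
      rw [cum_succ, cum_succ, ih, key i a]
      by_cases hip : i < p
      · rcases lt_trichotomy i a with h | h | h
        · simp only [hip, and_true, h, h.ne, if_true, if_false, show i < a + 1 by omega]
          omega
        · subst h
          simp only [hip, and_true, lt_irrefl, if_true, if_false, show i < i + 1 by omega]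
          omega
        · simp only [hip, and_true, h.ne', if_false, show ¬ i < a by omega,
            show ¬ i < a + 1 by omega]
          omega
      · simp only [hip, and_false, if_false]
        omega
  have hz : ∀ i b, p ≤ i → e' i b = 0 := fun i b hip => by
    have h4 := key i b
    have h5 : e i b = 0 := by
      by_contra h
      have := (hs i b h).1
      omega
    omega
  refine ⟨e', mem_mats.2 ⟨fun i b h => hs i b ?_, fun i a => ?_, fun i => ?_⟩, key⟩
  · have := key i b
    omega
  · have h4 := hi i a
    rw [hcum, hcum] at h4
    by_cases hip : i + 1 < p
    · simp only [hip, show i < p by omega, and_true, add_lt_add_iff_right] at h4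
      omega
    · have h6 : ∀ a, cum 0 e' a (i + 1) = 0 := by
        intro a
        simp only [cum, Pi.zero_apply, zero_add]
        exact sum_eq_zero fun b _ => hz _ b (by omega)
      rw [h6]
      omega
  · have h4 := hr i
    by_cases hip : i < p
    · rw [extz, dif_pos hip, hrho] at h4
      simp only [key] at h4
      rw [sum_add_distrib, sum_eq_single (f := fun b => if i = b ∧ i < p then d else 0) i
        (fun b _ hb => if_neg fun h => hb h.1.symm) (fun h => absurd (mem_range.2 hip) h),
        if_pos ⟨rfl, hip⟩] at h4
      omega
    · rw [hlam i (by omega)]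
      exact sum_eq_zero fun b _ => hz _ b (by omega)

lemma cols_shift {d : ℕ} {e e' : Arr}
    (h : ∀ i b, e i b = e' i b + if i = b ∧ i < p then d else 0) (b : Fin p) :
    cols p p e b = cols p p e' b + d := by
  simp only [cols, colSum, h]
  rw [sum_add_distrib, sum_eq_single (f := fun i => if i = (b : ℕ) ∧ i < p then d else 0)
    (b : ℕ) (fun i _ hi => if_neg fun h => hi h.1)
    (fun h => absurd (mem_range.2 b.2) h), if_pos ⟨rfl, b.2⟩]

theorem IsPHW.antitone (hp : 2 * p ≤ n) {z : Fin p → ℤ} {c : NVec p}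
    {f : Pol n p} (h : IsPHW n p z c f) (hf : f ≠ 0) {i j : Fin p}
    (hij : (i : ℕ) + 1 = j) : z j ≤ z i := by
  obtain ⟨_, rho, e, he, hrho, -, -⟩ := h.exists_gt hp hf
  obtain ⟨-, hi, hr⟩ := mem_mats.1 he
  have h1 : ∀ i : Fin p, cum 0 e p i = rho i := fun i => by
    have := hr i
    rw [extz, dif_pos i.2] at this
    simpa [cum] using this
  have h2 : cum 0 e p j ≤ cum 0 e (p + 1) j := by
    rw [cum_succ]
    omega
  have h3 := hi i p
  grind

lemma finrank_le_card_of_functionals {W ι : Type*} [AddCommGroup W] [Module ℂ W]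
    (U : Submodule ℂ W) (S : Finset ι) (φ : ι → W →ₗ[ℂ] ℂ)
    (h : ∀ f ∈ U, (∀ i ∈ S, φ i f = 0) → f = 0) : Module.finrank ℂ U ≤ S.card := by
  have hinj : Function.Injective ((pi fun i : S => φ i) ∘ₗ U.subtype) := by
    rw [← ker_eq_bot, ker_eq_bot']
    intro f hf
    refine Subtype.ext (h f f.2 fun i hi => ?_)
    exact congrFun hf ⟨i, hi⟩
  have := finrank_le_finrank_of_injective hinj
  rwa [Module.finrank_fintype_fun_eq_card, Fintype.card_coe] at this

/-- The set indexing highest weight vectors in a space of polynomials. -/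
def oSet (p : ℕ) (lam : ℕ → ℕ) (c : NVec p) : Finset (Σ _ : PairIdx p → ℕ, Arr) :=
  (pairSet p c).sigma fun j => (mats p p 0 lam).filter fun e => cols p p e = c - pdeg j

lemma card_oSet (lam : ℕ → ℕ) (c : NVec p) : (oSet p lam c).card = oNum p lam c := by
  rw [oSet, card_sigma, oNum]
  rfl

theorem finrank_hwSub_le (hp : 2 * p ≤ n) {lam : ℕ → ℕ} (hlam : ∀ i, p ≤ i → lam i = 0)
    (c : NVec p) :
    Module.finrank ℂ (hwSub n lam (polyRep n p) ⊓ colHom n p c : Submodule ℂ _) ≤ oNum p lam c := by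
  rw [← card_oSet]
  refine finrank_le_card_of_functionals _ _ (fun s =>
    lcoeff ℂ (fsM p p fun i b => s.2 i b + if i = b ∧ i < p then ∑ b, c b else 0) ∘ₗ
      (lcoeff (Pol p p)
        (Finsupp.equivFunOnFinite.symm s.1)).restrictScalars ℂ ∘ₗ slp.toLinearMap) ?_
  rintro f ⟨hf, hc⟩ h0
  by_contra hne
  obtain ⟨j, rho, e, he, hrho, hcol, hcoe⟩ :=
    (isPHW_of_mem_hwSub hp hlam hf hc).exists_gt hp hne
  obtain ⟨e', he', hs⟩ := exists_shift (lam := lam) (d := ∑ b, c b) he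
    (fun i => by exact_mod_cast hrho i) hlam
  have hcs : ∀ b, cols p p e' b + pdeg j b = c b := fun b => by
    have h1 := hcol b
    rw [cols_shift hs] at h1
    omega
  refine hcoe ?_
  have hee : e = fun i b => e' i b + if i = b ∧ i < p then ∑ b, c b else 0 := by
    funext i b
    exact hs i b
  have := h0 ⟨j, e'⟩ (by
    rw [oSet, mem_sigma, mem_pairSet, mem_filter]
    refine ⟨fun b => ?_, he', funext fun b => ?_⟩
    · have := hcs b
      simp only
      omega
    · have := hcs b
      simp only [Pi.sub_apply]
      omega)
  rw [hee]
  have hj : Finsupp.equivFunOnFinite.symm (j : PairIdx p → ℕ) = j := by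
    ext t
    rfl
  simp only [comp_apply, restrictScalars_apply] at this
  rw [hj] at this
  exact this

end Dimension

section LowerBound

open Fin MvPolynomial

variable {n p : ℕ}

lemma IsPartition.eq_zero_iff {lam : ℕ → ℕ} (h : IsPartition lam) (i : ℕ) :
    lam i = 0 ↔ plen lam ≤ i := by
  constructor
  · intro hi
    exact Nat.sInf_le hi
  · intro hi
    have h1 : lam (plen lam) = 0 := Nat.sInf_mem (s := {k | lam k = 0}) h.2
    have := h.1 hi
    omega

lemma IsPartition.conj_zero {lam : ℕ → ℕ} (h : IsPartition lam) : conj lam 0 = plen lam := by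
  have : {j | 0 < lam j} = ((range (plen lam) : Finset ℕ) : Set ℕ) := by
    ext j
    rw [mem_coe, mem_range]
    have := h.eq_zero_iff j
    change 0 < lam j ↔ _
    omega
  rw [conj, this, Set.ncard_coe_finset, card_range]

/-- The Gram pairing of two columns, as a polynomial. -/
def gramP (n : ℕ) (t : PairIdx p) : Pol n p :=
  ∑ i : Fin n, X (i, t.1.1) * X (i.rev, t.1.2)

lemma ev_gramP (Y : Mat n p) (t : PairIdx p) : ev Y (gramP n t) = gramF Y t := by
  rw [gramP, map_sum, gramF, Matrix.mul_assoc, mul_apply]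
  refine sum_congr rfl fun i _ => ?_
  rw [map_mul, ev_X, ev_X, symForm_mul_apply, transpose_apply]

/-- The highest weight vectors in the polynomial representation. -/
def hwF (hp : p ≤ n) (f : Pol p p) (j : PairIdx p → ℕ) : Pol n p :=
  aeval (fun s : Fin p × Fin p => X (castLE hp s.1, s.2)) f * ∏ t, gramP n t ^ j t

lemma ev_hwF (hp : p ≤ n) (f : Pol p p) (j : PairIdx p → ℕ) (Y : Mat n p) :
    ev Y (hwF hp f j) = ev ((topM n p)ᵀ * Y) f * ∏ t, gramF Y t ^ j t := by
  rw [hwF, map_mul, map_prod]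
  congr 1
  · rw [ev, ev, ← coe_aeval_eq_eval, RingHom.coe_coe, ← coe_aeval_eq_eval, RingHom.coe_coe,
      ← AlgHom.comp_apply, comp_aeval]
    congr 2
    funext s
    rw [aeval_X, topM_mul hp]
  · simp only [map_pow, ev_gramP]

lemma gramF_mul_diagonal (Y : Mat n p) (s : Vec p) (t : PairIdx p) :
    gramF (Y * diagonal s) t = s t.1.1 * s t.1.2 * gramF Y t := by
  rw [gramF, gramF, transpose_mul, diagonal_transpose]
  have : diagonal s * Yᵀ * symForm n * (Y * diagonal s)
      = diagonal s * (Yᵀ * symForm n * Y) * diagonal s := by simp only [Matrix.mul_assoc]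
  rw [this, mul_diagonal, diagonal_mul]
  ring

lemma prod_gram_weight (s : Vec p) (j : PairIdx p → ℕ) :
    ∏ t : PairIdx p, (s t.1.1 * s t.1.2) ^ j t = ∏ b, s b ^ pdeg j b := by
  have h : ∀ t : PairIdx p, s t.1.1 * s t.1.2 = ∏ b, s b ^ pairDeg t b := by
    intro t
    simp only [pairDeg, pow_add, prod_mul_distrib, pow_ite, pow_one, pow_zero]
    simp
  simp only [h, pdeg, ← prod_pow_eq_pow_sum, ← prod_pow, ← pow_mul]
  rw [prod_comm]
  refine prod_congr rfl fun b _ => prod_congr rfl fun t _ => ?_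
  rw [mul_comm]

lemma hwF_mem (hp : 2 * p ≤ n) {lam : ℕ → ℕ} (hlam : IsPartition lam) (hl : ∀ i, p ≤ i → lam i = 0)
    {f : Pol p p} {c d : NVec p} {j : PairIdx p → ℕ}
    (hf : IsRowHW (fun i : Fin p => lam i) d f) (hc : ∀ b, d b + pdeg j b = c b) :
    hwF (by omega) f j ∈ (hwSub n lam (polyRep n p) ⊓ colHom n p c : Submodule ℂ _) := by
  have hp' : p ≤ n := by omega
  refine ⟨⟨fun g hg => ?_, fun g D hg hD => ?_, ?_⟩, fun t A => ?_⟩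
  · refine ev_ext fun Y => ?_
    rw [ev_polyRep, ev_hwF, ev_hwF, gram_mul_left (toM_isOrth g).transpose]
    congr 1
    have e : ∀ i k : Fin p, ((topM n p)ᵀ * (toM g)ᵀ * topM n p : Mat p p) i k
        = toM g (castLE hp' k) (castLE hp' i) := by
      intro i k
      rw [Matrix.mul_assoc, topM_mul hp', ← transpose_transpose ((toM g)ᵀ * topM n p),
        transpose_mul, transpose_transpose, transpose_apply, topM_mul hp']
    have hL : IsLowerUni ((topM n p)ᵀ * (toM g)ᵀ * topM n p) := by
      refine ⟨fun i => ?_, fun i k hik => ?_⟩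
      · rw [e, hg.1]
      · rw [e, hg.2 _ _ hik]
    have e2 : (topM n p)ᵀ * ((toM g)ᵀ * Y)
        = ((topM n p)ᵀ * (toM g)ᵀ * topM n p) * ((topM n p)ᵀ * Y) := by
      ext i b
      rw [topM_mul hp', mul_apply, mul_apply, ← sum_subset (subset_univ (univ.map (castLEEmb hp'))),
        sum_map]
      · refine sum_congr rfl fun k _ => ?_
        rw [topM_mul hp', e]
        rfl
      · intro k _ hk
        have hk' : p ≤ (k : ℕ) := by
          by_contra hlt
          exact hk (mem_map.2 ⟨⟨k, by omega⟩, mem_univ _, rfl⟩)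
        rw [transpose_apply, hg.2 _ _ (by simp only [val_castLE]; omega), zero_mul]
    rw [e2, hf.lower _ _ hL]
  · refine ev_ext fun Y => ?_
    rw [ev_smul, ev_polyRep, ev_hwF, ev_hwF, gram_mul_left (toM_isOrth g).transpose, ← mul_assoc]
    congr 1
    rw [hg, diagonal_transpose, prod_pow_castLE hp' hl, ← hf.row (fun i => D (castLE hp' i))]
    congr 2
    ext i b
    rw [topM_mul hp', diagonal_mul, diagonal_mul, topM_mul hp']
  · by_cases hn : 2 * conj lam 0 = n
    · exact Or.inl hn
    · refine Or.inr (ev_ext fun Y => ?_)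
      rw [ev_polyRep, ev_hwF, ev_hwF, gram_mul_left (toM_isOrth _).transpose]
      congr 1
      refine hf.dep _ _ fun i hi => ?_
      funext b
      have h1 : (i : ℕ) < conj lam 0 := by
        rw [hlam.conj_zero]
        have := hlam.eq_zero_iff i
        omega
      have h2 : conj lam 0 ≤ p := by
        rw [hlam.conj_zero, ← hlam.eq_zero_iff]
        exact hl p le_rfl
      have h3 : (i : ℕ) < p := i.2
      rw [topM_mul hp', topM_mul hp', rO, toM_mkO, reflMatrix_transpose, reflMatrix_mul_apply,
        if_neg (by simp only [val_castLE]; omega),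
        if_neg (by simp only [val_castLE]; omega)]
  · rw [ev_hwF, ev_hwF, ← Matrix.mul_assoc, hf.col]
    simp only [gramF_mul_diagonal, mul_pow _ (gramF A _)]
    rw [prod_mul_distrib, prod_gram_weight]
    simp only [← hc, pow_add, prod_mul_distrib]
    ring

lemma gramF_sliceM (hp : 2 * p ≤ n) (A : Mat p p) (hA : A.det ≠ 0) (r : PairIdx p → ℂ) :
    gramF (sliceM n A ((1 / 2 : ℂ) • (A⁻¹ᵀ * symMat r))) = r := by
  have hu : IsUnit A.det := isUnit_iff_ne_zero.2 hA
  have hs : (symMat r)ᵀ = symMat r := by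
    ext a b
    simp only [transpose_apply, symMat, of_apply, sp]
    grind
  have h1 : Aᵀ * A⁻¹ᵀ = 1 := by rw [← transpose_mul, nonsing_inv_mul A hu, transpose_one]
  funext t
  rw [gramF, gram_sliceM hp]
  have : Aᵀ * ((1 / 2 : ℂ) • (A⁻¹ᵀ * symMat r)) + ((1 / 2 : ℂ) • (A⁻¹ᵀ * symMat r))ᵀ * A
      = symMat r := by
    rw [transpose_smul, transpose_mul, transpose_transpose, hs, Matrix.mul_smul, Matrix.smul_mul,
      ← mul_assoc, h1, one_mul, mul_assoc, nonsing_inv_mul A hu,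
      mul_one, ← add_smul]
    norm_num
  rw [this]
  simp only [symMat, of_apply, sp]
  rw [dif_pos t.2]

/-- The dimension of the space of highest weight vectors. -/
theorem finrank_hwSub (hp : 2 * p ≤ n) {lam : ℕ → ℕ} (hlam : IsPartition lam)
    (hl : ∀ i, p ≤ i → lam i = 0) (c : NVec p) :
    Module.finrank ℂ (hwSub n lam (polyRep n p) ⊓ colHom n p c : Submodule ℂ _) = oNum p lam c := by
  classical
  refine (finrank_hwSub_le hp hl c).antisymm ?_
  have hex : ∀ e : Arr, ∃ f : Pol p p, e ∈ mats p p 0 lam →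
      f ≠ 0 ∧ (mo p p).degree f = fsM p p e ∧ IsRowHW (fun i : Fin p => lam i) (cols p p e) f := by
    intro e
    by_cases he : e ∈ mats p p 0 lam
    · obtain ⟨hs, hi, hr⟩ := mem_mats.1 he
      obtain ⟨f, h0, hd, hf⟩ := exists_isRowHW hs hi
      refine ⟨f, fun _ => ⟨h0, hd, ?_⟩⟩
      have : (fun i : Fin p => ∑ b : Fin p, e i b) = fun i : Fin p => lam i := by
        funext i
        rw [← hr i, sum_range]
      rwa [this] at hf
    · exact ⟨0, fun h => absurd h he⟩
  choose f hf using hex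
  set S := oSet p lam c with hS
  have hmem : ∀ s ∈ S, s.2 ∈ mats p p 0 lam ∧ ∀ b, cols p p s.2 b + pdeg s.1 b = c b := by
    intro s hs
    rw [hS, oSet, mem_sigma, mem_pairSet, mem_filter] at hs
    refine ⟨hs.2.1, fun b => ?_⟩
    have h1 := congrFun hs.2.2 b
    have h2 : pdeg s.1 b ≤ c b := hs.1 b
    rw [Pi.sub_apply] at h1
    omega
  have hli : LinearIndependent ℂ fun s : S =>
      (⟨hwF (by omega) (f s.1.2) s.1.1, hwF_mem hp hlam hl (hf _ (hmem _ s.2).1).2.2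
        (hmem _ s.2).2⟩ : (hwSub n lam (polyRep n p) ⊓ colHom n p c : Submodule ℂ _)) := by
    refine LinearIndependent.of_comp (Submodule.subtype _) ?_
    rw [Fintype.linearIndependent_iff]
    intro a ha
    change ∑ s : S, a s • hwF (by omega) (f s.1.2) s.1.1 = 0 at ha
    set G : MvPolynomial (PairIdx p) (Pol p p) :=
      ∑ s : S, monomial (Finsupp.equivFunOnFinite.symm s.1.1) (a s • f s.1.2) with hG
    have h1 : ∀ A : Mat p p, A.det ≠ 0 → map (ev A) G = 0 := by
      intro A hA
      refine MvPolynomial.funext fun r => ?_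
      have h2 := congrArg (ev (sliceM n A ((1 / 2 : ℂ) • (A⁻¹ᵀ * symMat r)))) ha
      rw [map_sum, map_zero] at h2
      rw [hG, map_sum, map_sum, map_zero, ← h2]
      refine sum_congr rfl fun s _ => ?_
      rw [ev_smul, ev_hwF, gramF_sliceM hp A hA, top_sliceM hp, map_monomial, eval_monomial,
        ev_smul, mul_assoc, Finsupp.prod_fintype _ _ (fun _ => pow_zero _)]
      rfl
    have h3 : ∀ j, coeff j G = 0 := by
      intro j
      have h4 : (mvPolynomialX (Fin p) (Fin p) ℂ).det * coeff j G = 0 := by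
        refine ev_ext fun A => ?_
        rw [map_mul, ev_det, map_zero]
        by_cases hA : A.det = 0
        · rw [hA, zero_mul]
        · rw [← coeff_map, h1 A hA, coeff_zero, mul_zero]
      refine (mul_eq_zero.1 h4).resolve_left fun h => ?_
      have := congrArg (ev (1 : Mat p p)) h
      rw [ev_det, det_one, map_zero] at this
      exact one_ne_zero this
    have hind : LinearIndependent ℂ fun e : (mats p p 0 lam : Finset (Arr)) => f e := by
      refine linearIndependent_of_degree (mo p p) _ (fun e => (hf e e.2).1) fun e e' hee => ?_
      simp only [(hf _ e.2).2.1, (hf _ e'.2).2.1] at hee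
      refine Subtype.ext (funext fun i => funext fun b => ?_)
      obtain ⟨hs, -⟩ := mem_mats.1 e.2
      obtain ⟨hs', -⟩ := mem_mats.1 e'.2
      by_cases hib : i < p ∧ b < p
      · have := DFunLike.congr_fun hee (⟨i, hib.1⟩, ⟨b, hib.2⟩)
        rwa [fsM_apply, fsM_apply] at this
      · rw [by_contra fun h => hib (hs i b h), by_contra fun h => hib (hs' i b h)]
    intro s
    have h5 := h3 (Finsupp.equivFunOnFinite.symm s.1.1)
    rw [Fintype.linearIndependent_iff] at hind
    have h6 := hind (fun e => if h : (⟨s.1.1, e⟩ : Σ _ : PairIdx p → ℕ, Arr) ∈ S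
      then a ⟨_, h⟩ else 0) (by
        rw [← h5, hG, coeff_sum]
        simp only [coeff_monomial]
        rw [← sum_filter]
        symm
        refine sum_bij_ne_zero (fun s' _ _ => ⟨s'.1.2, (hmem _ s'.2).1⟩) (fun _ _ _ => mem_univ _)
          ?_ ?_ ?_
        · intro s₁ h₁ _ s₂ h₂ _ he
          have e1 := Finsupp.equivFunOnFinite.symm.injective (mem_filter.1 h₁).2
          have e2 := Finsupp.equivFunOnFinite.symm.injective (mem_filter.1 h₂).2
          exact Subtype.ext (Sigma.ext (e1.trans e2.symm) (heq_of_eq (congrArg Subtype.val he)))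
        · intro e _ he
          by_cases h : (⟨s.1.1, e⟩ : Σ _ : PairIdx p → ℕ, Arr) ∈ S
          · rw [dif_pos h] at he
            exact ⟨⟨_, h⟩, mem_filter.2 ⟨mem_univ _, rfl⟩, he, rfl⟩
          · rw [dif_neg h, zero_smul] at he
            exact absurd rfl he
        · rintro ⟨⟨j', e'⟩, hs'⟩ h₁ _
          have e1 : j' = s.1.1 := Finsupp.equivFunOnFinite.symm.injective (mem_filter.1 h₁).2
          subst e1
          simp only
          rw [dif_pos hs']) ⟨s.1.2, (hmem _ s.2).1⟩
    rwa [dif_pos s.2] at h6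
  have : FiniteDimensional ℂ (hwSub n lam (polyRep n p) ⊓ colHom n p c : Submodule ℂ _) :=
    finiteDimensional_of_le inf_le_right
  have := hli.fintype_card_le_finrank
  rwa [Fintype.card_coe, card_oSet] at this

end LowerBound

section Eichler

open Fin

variable {n : ℕ}

/-- The bilinear form preserved by the orthogonal group. -/
def bl (n : ℕ) : LinearMap.BilinForm ℂ (Vec n) := toBilin' (symForm n)

lemma bl_apply (x y : Vec n) : bl n x y = ∑ i, x i * y i.rev := by
  rw [bl, toBilin'_apply', dotProduct]
  refine sum_congr rfl fun i _ => ?_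
  have := symForm_mul_apply (of fun i (_ : Fin 1) => y i) i 0
  rw [of_apply] at this
  rw [← this, mul_apply]
  rfl

lemma bl_comm (x y : Vec n) : bl n x y = bl n y x := by
  rw [bl_apply, bl_apply, ← Equiv.sum_comp revPerm]
  refine sum_congr rfl fun i _ => ?_
  rw [revPerm_apply, rev_rev, mul_comm]

lemma bl_single_left (a : Fin n) (x : Vec n) : bl n (δ a) x = x a.rev := by
  rw [bl_apply, sum_eq_single a (fun b _ hb => by simp [hb]) (by simp)]
  simp

lemma bl_single_right (a : Fin n) (x : Vec n) : bl n x (δ a) = x a.rev := by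
  rw [bl_comm, bl_single_left]

lemma isOrth_iff {A : Mat n n} : IsOrth A ↔ ∀ x y, bl n (A *ᵥ x) (A *ᵥ y) = bl n x y := by
  have h : ∀ x y, bl n (A *ᵥ x) (A *ᵥ y) = toBilin' (Aᵀ * symForm n * A) x y := fun x y => by
    rw [bl, toBilin'_apply', toBilin'_apply', mul_assoc, ← mulVec_mulVec y,
      dotProduct_mulVec x, vecMul_transpose, ← mulVec_mulVec y]
  simp only [h]
  refine ⟨fun hA x y => by rw [hA]; rfl, fun hA => ?_⟩
  exact toBilin'.injective (LinearMap.ext₂ hA)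

/-- Eichler transformations. -/
def eichM (a : Fin n) (w : Vec n) : Mat n n :=
  1 + vecMulVec w (δ a.rev) - vecMulVec (δ a) (fun j => w j.rev)
    - (1 / 2 * bl n w w) • vecMulVec (δ a) (δ a.rev)

lemma eichM_mulVec (a : Fin n) (w x : Vec n) :
    eichM a w *ᵥ x = x + x a.rev • w - (bl n w x + 1 / 2 * bl n w w * x a.rev) • δ a := by
  have h1 : (fun j => w j.rev) ⬝ᵥ x = bl n w x := by
    rw [bl_comm, bl_apply, dotProduct]
    exact sum_congr rfl fun _ _ => mul_comm _ _
  rw [eichM, sub_mulVec, sub_mulVec, add_mulVec, one_mulVec, smul_mulVec, vecMulVec_mulVec,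
    vecMulVec_mulVec, vecMulVec_mulVec, single_one_dotProduct, h1]
  ext i
  simp
  ring

lemma isOrth_eichM {a : Fin n} (ha : a.rev ≠ a) {w : Vec n} (h2 : w a.rev = 0) :
    IsOrth (eichM a w) := by
  rw [isOrth_iff]
  intro x y
  have h3 : (δ a : Vec n) a.rev = 0 := by simp [ha]
  simp only [eichM_mulVec, map_add, map_sub, map_smul, LinearMap.add_apply, LinearMap.sub_apply,
    LinearMap.smul_apply, bl_single_left, bl_single_right, h2, h3, smul_eq_mul, bl_comm _ w]
  ring

lemma eichM_mul {a : Fin n} (ha : a.rev ≠ a) {w w' : Vec n} (h : w a.rev = 0)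
    (h' : w' a.rev = 0) : eichM a w * eichM a w' = eichM a (w + w') := by
  refine ext_of_mulVec_single fun i => ?_
  generalize (δ i : Vec n) = x
  have h3 : (δ a : Vec n) a.rev = 0 := by simp [ha]
  rw [← mulVec_mulVec, eichM_mulVec, eichM_mulVec, eichM_mulVec]
  simp only [map_add, map_sub, map_smul, LinearMap.add_apply, Pi.add_apply, Pi.sub_apply,
    Pi.smul_apply, smul_eq_mul, bl_single_right, h, h', h3, bl_comm w' w]
  module

lemma eichM_zero (a : Fin n) : eichM a (0 : Vec n) = 1 := by
  refine ext_of_mulVec_single fun i => ?_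
  rw [eichM_mulVec, one_mulVec]
  simp

lemma isOrth_diagonal_iff {d : Vec n} : IsOrth (diagonal d) ↔ ∀ i : Fin n, d i * d i.rev = 1 := by
  rw [isOrth_iff]
  constructor
  · intro h i
    have := h (δ i) (δ i.rev)
    rw [diagonal_mulVec_single, diagonal_mulVec_single, bl_single_left] at this
    rw [bl_apply, sum_eq_single i (fun b _ hb => by simp [hb]) (by simp)] at this
    simpa using this
  · intro h x y
    rw [bl_apply, bl_apply]
    refine sum_congr rfl fun i _ => ?_
    rw [mulVec_diagonal, mulVec_diagonal]
    linear_combination x i * y i.rev * h i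


lemma diagonal_eichM {d : Vec n} (hd : IsOrth (diagonal d)) (a : Fin n) (w : Vec n) :
    diagonal d * eichM a w = eichM a (d a • (diagonal d *ᵥ w)) * diagonal d := by
  refine ext_of_mulVec_single fun i => ?_
  generalize (δ i : Vec n) = x
  have h := isOrth_diagonal_iff.1 hd a
  rw [← mulVec_mulVec, ← mulVec_mulVec, eichM_mulVec, eichM_mulVec, mulVec_sub, mulVec_add,
    mulVec_smul, mulVec_smul, diagonal_mulVec_single, mulVec_diagonal d x a.rev, map_smul, map_smul,
    LinearMap.smul_apply, LinearMap.smul_apply, isOrth_iff.1 hd, isOrth_iff.1 hd]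
  have h1 : (d a.rev * x a.rev) • d a • (diagonal d *ᵥ w) = x a.rev • (diagonal d *ᵥ w) := by
    rw [smul_smul]
    congr 1
    linear_combination x a.rev * h
  have h2 : (Pi.single a (d a * 1) : Vec n) = d a • δ a := by
    rw [← Pi.single_smul, smul_eq_mul]
  rw [h1, h2, smul_smul]
  congr 2
  simp only [smul_eq_mul]
  linear_combination -(1 / 2) * d a * x a.rev * bl n w w * h

/-- The one-parameter torus rescaling a coordinate. -/
def torD (a : Fin n) (s : ℂ) : Vec n := Function.update (Function.update 1 a.rev s⁻¹) a s

lemma torD_rev {a : Fin n} (ha : a.rev ≠ a) {s : ℂ} (hs : s ≠ 0) (i : Fin n) :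
    torD a s i * torD a s i.rev = 1 := by
  have ha' : a ≠ a.rev := ha.symm
  by_cases h1 : i = a
  · subst h1
    simp [torD, ha, hs]
  · by_cases h2 : i = a.rev
    · subst h2
      simp [torD, ha, hs]
    · have h3 : i.rev ≠ a := fun h => h2 (by rw [← h, rev_rev])
      have h4 : i.rev ≠ a.rev := fun h => h1 (rev_injective h)
      simp [torD, h1, h2, h3, h4]

lemma torD_eichM {a : Fin n} (ha : a.rev ≠ a) {s : ℂ} (hs : s ≠ 0) {w : Vec n} (h1 : w a = 0)
    (h2 : w a.rev = 0) :
    diagonal (torD a s) * eichM a w = eichM a (s • w) * diagonal (torD a s) := by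
  rw [diagonal_eichM (isOrth_diagonal_iff.2 (torD_rev ha hs))]
  congr 2
  ext i
  rw [Pi.smul_apply, Pi.smul_apply, mulVec_diagonal, smul_eq_mul, smul_eq_mul]
  by_cases h3 : i = a
  · rw [h3, h1]; ring
  · by_cases h4 : i = a.rev
    · rw [h4, h2]; ring
    · simp [torD, h3, h4]

/-- The elements fixing the first and last `i` basis vectors. -/
def fixL (n i : ℕ) : Subgroup (OGL n) where
  carrier := {g | ∀ j : Fin n, (j : ℕ) < i → toM g *ᵥ δ j = δ j ∧
    toM g *ᵥ δ j.rev = δ j.rev}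
  one_mem' j _ := by simp only [toM_one, one_mulVec, and_self]
  mul_mem' {g h} hg hh j hj := by
    rw [toM_mul, ← mulVec_mulVec, ← mulVec_mulVec, (hh j hj).1, (hh j hj).2]
    exact hg j hj
  inv_mem' {g} hg j hj := by
    have h1 : toM g⁻¹ * toM g = 1 := by rw [← toM_mul, inv_mul_cancel, toM_one]
    have h2 : ∀ x, toM g *ᵥ x = x → toM g⁻¹ *ᵥ x = x := fun x hx => by
      nth_rewrite 1 [← hx]
      rw [mulVec_mulVec, h1, one_mulVec]
    exact ⟨h2 _ (hg j hj).1, h2 _ (hg j hj).2⟩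

lemma rO_mulVec (x : Vec n) (i : Fin n) : (toM (rO n) *ᵥ x) i = if 2 * (i : ℕ) + 1 = n
    then -x i else if 2 * (i : ℕ) = n ∨ 2 * (i : ℕ) + 2 = n then x i.rev else x i :=
  reflMatrix_mul_apply (of fun i (_ : Fin 1) => x i) i 0

lemma eq_of_mem_fixL_half {g : OGL n} (hg : g ∈ fixL n (n / 2)) :
    g = 1 ∨ g = rO n ∧ ∃ j : Fin n, 2 * (j : ℕ) + 1 = n := by
  have hpres := isOrth_iff.1 (toM_isOrth g)
  have hrow : ∀ j : Fin n, (∀ x, (toM g *ᵥ x) j.rev = x j.rev) ∨ 2 * (j : ℕ) + 1 = n := by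
    intro j
    by_cases h : 2 * (j : ℕ) + 1 = n
    · exact Or.inr h
    · refine Or.inl fun x => ?_
      have hj : toM g *ᵥ δ j = δ j := by
        by_cases h' : (j : ℕ) < n / 2
        · exact (hg j h').1
        · have hr : (j.rev : ℕ) = n - (j + 1) := val_rev j
          have := (hg j.rev (by omega)).2
          rwa [Fin.rev_rev] at this
      have := hpres (δ j) x
      rwa [hj, bl_single_left, bl_single_left] at this
  by_cases hodd : ∃ j : Fin n, 2 * (j : ℕ) + 1 = n
  · obtain ⟨j, hj⟩ := hodd
    have hrj : j.rev = j := Fin.ext (by rw [Fin.val_rev]; omega)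
    have hoff : ∀ (i : Fin n), i ≠ j → ∀ x, (toM g *ᵥ x) i = x i := by
      intro i hij x
      have h1 := hrow i.rev
      rw [rev_rev] at h1
      have hr : (i.rev : ℕ) = n - (i + 1) := val_rev i
      have : (i : ℕ) ≠ j := fun h => hij (Fin.ext h)
      exact h1.resolve_right (by omega) x
    obtain ⟨c, hc⟩ : ∃ c : ℂ, toM g *ᵥ δ j = c • δ j := by
      refine ⟨(toM g *ᵥ δ j) j, funext fun i => ?_⟩
      by_cases hij : i = j
      · subst hij; simp
      · rw [hoff i hij]; simp [hij]
    have hsq : c * c = 1 := by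
      have := hpres (δ j) (δ j)
      rw [hc, map_smul, map_smul, LinearMap.smul_apply, bl_single_left, hrj] at this
      simpa using this
    have hgj : ∀ x, (toM g *ᵥ x) j = c * x j := by
      intro x
      have := hpres (δ j) x
      rw [hc, map_smul, LinearMap.smul_apply, bl_single_left, bl_single_left, hrj,
        smul_eq_mul] at this
      linear_combination c * this - (toM g *ᵥ x) j * hsq
    rcases mul_self_eq_one_iff.1 hsq with h | h
    · refine Or.inl (toM_inj (ext_of_mulVec_single fun l => funext fun i => ?_))
      rw [toM_one, one_mulVec]
      by_cases hij : i = j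
      · rw [hij, hgj, h, one_mul]
      · rw [hoff i hij]
    · refine Or.inr ⟨toM_inj (ext_of_mulVec_single fun l => funext fun i => ?_), j, hj⟩
      rw [rO_mulVec]
      by_cases hij : i = j
      · rw [hij, if_pos hj, hgj, h, neg_one_mul]
      · have : (i : ℕ) ≠ j := fun h => hij (Fin.ext h)
        rw [if_neg (by omega), if_neg (by omega), hoff i hij]
  · refine Or.inl (toM_inj (ext_of_mulVec_single fun l => funext fun i => ?_))
    rw [toM_one, one_mulVec]
    have := (hrow i.rev).resolve_right fun h => hodd ⟨_, h⟩
    rw [rev_rev] at this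
    exact this _

/-- The `i`-th hyperbolic pair, and vectors orthogonal to the first `i + 1` pairs. -/
def InMid (a : Fin n) (w : Vec n) : Prop :=
  a < a.rev ∧ ∀ j : Fin n, (j ≤ a ∨ a.rev ≤ j) → w j = 0

lemma InMid.zero {a : Fin n} {w : Vec n} (h : InMid a w) : w a = 0 := h.2 a (Or.inl le_rfl)

lemma InMid.zero_rev {a : Fin n} {w : Vec n} (h : InMid a w) : w a.rev = 0 :=
  h.2 _ (Or.inr le_rfl)

lemma InMid.smul {a : Fin n} {w : Vec n} (h : InMid a w) (c : ℂ) : InMid a (c • w) :=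
  ⟨h.1, fun j hj => by rw [Pi.smul_apply, h.2 j hj, smul_zero]⟩

lemma InMid.single {a b : Fin n} (hab : a < b) (hba : b < a.rev) : InMid a (δ b) :=
  ⟨hab.trans hba, fun j hj => Pi.single_eq_of_ne (by rintro rfl; omega) _⟩

/-- The Eichler transformation as an orthogonal transformation. -/
def eO (a : Fin n) (w : Vec n) (h : InMid a w) : OGL n :=
  mkO _ (isOrth_eichM h.1.ne' h.zero_rev)

/-- The opposite Eichler transformation. -/
def eO' (a : Fin n) (w : Vec n) (h : InMid a w) : OGL n :=
  mkO (eichM a.rev w) (isOrth_eichM (by rw [rev_rev]; exact h.1.ne)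
    (by rw [rev_rev]; exact h.zero))

lemma eO_mulVec (a : Fin n) (w : Vec n) (h : InMid a w) (x : Vec n) : toM (eO a w h) *ᵥ x =
      x + x a.rev • w - (bl n w x + 1 / 2 * bl n w w * x a.rev) • δ a := by
  rw [eO, toM_mkO, eichM_mulVec]

lemma eO'_mulVec (a : Fin n) (w : Vec n) (h : InMid a w) (x : Vec n) : toM (eO' a w h) *ᵥ x =
      x + x a • w - (bl n w x + 1 / 2 * bl n w w * x a) • δ a.rev := by
  rw [eO', toM_mkO, eichM_mulVec, rev_rev]

lemma isUpperUni_eO (a : Fin n) (w : Vec n) (h : InMid a w) : IsUpperUni (toM (eO a w h)) := by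
  have key : ∀ i j : Fin n, j ≤ i → toM (eO a w h) i j = if i = j then 1 else 0 := by
    intro i j hij
    have e : toM (eO a w h) i j = (toM (eO a w h) *ᵥ δ j) i := by simp
    rw [e, eO_mulVec, bl_single_right]
    have h1 : (δ j : Vec n) a.rev * w i = 0 := by
      by_cases hj : a.rev = j
      · rw [h.2 i (Or.inr (hj.trans_le hij)), mul_zero]
      · rw [Pi.single_eq_of_ne hj, zero_mul]
    by_cases hi : i = a
    · have h2 : (δ j : Vec n) a.rev = 0 :=
        Pi.single_eq_of_ne (by rintro rfl; exact absurd (hi ▸ hij) (not_le.2 h.1)) _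
      have h3 : w j.rev = 0 := h.2 _ (Or.inr (rev_le_rev.2 (hi ▸ hij)))
      simp [h2, h3, Pi.single_apply]
    · simp only [Pi.sub_apply, Pi.add_apply, Pi.smul_apply, smul_eq_mul, h1,
        Pi.single_eq_of_ne hi, mul_zero, add_zero, sub_zero]
      exact Pi.single_apply _ _ _
  exact ⟨fun i => by rw [key i i le_rfl, if_pos rfl], fun i j hij => by
    grind⟩

lemma isLowerUni_eO' (a : Fin n) (w : Vec n) (h : InMid a w) : IsLowerUni (toM (eO' a w h)) := by
  have h' : InMid a fun j => -w j.rev := ⟨h.1, fun j hj => neg_eq_zero.2 (h.2 _ (by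
    grind))⟩
  have e : toM (eO' a w h) = (toM (eO a _ h'))ᵀ := by
    have hb : bl n (fun j => -w j.rev) (fun j => -w j.rev) = bl n w w := by
      rw [bl_comm, bl_apply, bl_apply, ← Equiv.sum_comp revPerm]
      exact Finset.sum_congr rfl fun i _ => by simp
    ext i j
    rw [eO', eO, toM_mkO, toM_mkO, transpose_apply, eichM, eichM, hb]
    simp only [Matrix.sub_apply, Matrix.add_apply, Matrix.smul_apply, vecMulVec_apply, one_apply,
      rev_rev, smul_eq_mul, eq_comm (a := i)]
    ring
  rw [e]
  have := isUpperUni_eO a _ h'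
  exact ⟨fun i => this.1 i, fun i j hij => this.2 j i hij⟩

end Eichler

section Generation

open Fin

variable {n : ℕ}

lemma apply_of_mem_fixL {i : ℕ} {g : OGL n} (hg : g ∈ fixL n i) {j : Fin n} (hj : (j : ℕ) < i)
    (y : Vec n) : (toM g *ᵥ y) j = y j ∧ (toM g *ᵥ y) j.rev = y j.rev := by
  have e1 := isOrth_iff.1 (toM_isOrth g) (δ j.rev) y
  have e2 := isOrth_iff.1 (toM_isOrth g) (δ j) y
  rw [(hg j hj).2, bl_single_left, bl_single_left, rev_rev] at e1
  rw [(hg j hj).1, bl_single_left, bl_single_left] at e2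
  exact ⟨e1, e2⟩

lemma InMid.ne {a : Fin n} (h : a < a.rev) {j : Fin n} (hj : j < a) :
    j ≠ a ∧ j ≠ a.rev ∧ j.rev ≠ a ∧ j.rev ≠ a.rev := by
  grind

lemma eO_mem_fixL (a : Fin n) (w : Vec n) (h : InMid a w) : eO a w h ∈ fixL n a ∧
    eO' a w h ∈ fixL n a := by
  constructor <;>
  · intro j hj
    obtain ⟨h1, h2, h3, h4⟩ := InMid.ne h.1 hj
    have h5 : w j = 0 := h.2 j (Or.inl (le_of_lt hj))
    have h6 : w j.rev = 0 := h.2 _ (Or.inr (rev_le_rev.2 (le_of_lt hj)))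
    simp only [eO_mulVec, eO'_mulVec, bl_single_right, rev_rev, h5, h6, Pi.single_eq_of_ne h1.symm,
      Pi.single_eq_of_ne h2.symm, Pi.single_eq_of_ne h3.symm, Pi.single_eq_of_ne h4.symm]
    simp

/-- The middle part of a vector. -/
def cut (a : Fin n) (y : Vec n) : Vec n := fun t => if a < t ∧ t < a.rev then y t else 0

lemma inMid_cut {a : Fin n} (h : a < a.rev) (y : Vec n) : InMid a (cut a y) :=
  ⟨h, fun j hj => if_neg (by omega)⟩

lemma eq_cut {a : Fin n} (h : a < a.rev) {y : Vec n} (hy : ∀ j < a, y j = 0 ∧ y j.rev = 0) :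
    y = cut a y + y a • δ a + y a.rev • δ a.rev := by
  ext t
  simp only [Pi.add_apply, Pi.smul_apply, cut, smul_eq_mul]
  grind

lemma bl_hyp {a : Fin n} (h : a < a.rev) (c d : ℂ) :
    bl n (c • δ a + d • δ a.rev) (c • δ a + d • δ a.rev) = 2 * c * d := by
  simp only [map_add, map_smul, LinearMap.add_apply, LinearMap.smul_apply, bl_single_left,
    smul_eq_mul]
  simp [h.ne, h.ne']
  ring

lemma exists_eO_mul_mem_fixL {a : Fin n} (h : a < a.rev) {g : OGL n} (hg : g ∈ fixL n a)
    (hga : toM g *ᵥ δ a = δ a) : ∃ w, ∃ hw : InMid a w, eO a w hw * g ∈ fixL n (a + 1) := by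
  set y := toM g *ᵥ δ a.rev with hy
  have hya : y a.rev = 1 := by
    have := isOrth_iff.1 (toM_isOrth g) (δ a) (δ a.rev)
    rw [hga, bl_single_left, bl_single_left] at this
    rw [hy, this]; simp
  have hyz : ∀ j < a, y j = 0 ∧ y j.rev = 0 := fun j hj => by
    obtain ⟨h1, h2, h3, h4⟩ := InMid.ne h hj
    rw [hy, (apply_of_mem_fixL hg hj _).1, (apply_of_mem_fixL hg hj _).2, Pi.single_eq_of_ne h2,
      Pi.single_eq_of_ne h4]
    exact ⟨rfl, rfl⟩
  have hw := (inMid_cut h y).smul (-1)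
  refine ⟨_, hw, fun j hj => ?_⟩
  rcases Nat.lt_succ_iff_lt_or_eq.1 hj with hj | hj
  · exact mul_mem (eO_mem_fixL a _ hw).1 hg j hj
  obtain rfl : j = a := Fin.ext hj
  have h2 : ∃ c : ℂ, toM (eO j _ hw * g) *ᵥ δ j.rev =
      c • δ j + (1 : ℂ) • δ j.rev := by
    rw [toM_mul, ← mulVec_mulVec, ← hy, eO_mulVec, hya]
    refine ⟨y j - (bl n ((-1 : ℂ) • cut j y) y +
      1 / 2 * bl n ((-1 : ℂ) • cut j y) ((-1 : ℂ) • cut j y) * 1), ?_⟩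
    have := eq_cut h hyz
    rw [hya] at this
    nth_rewrite 1 [this]
    module
  obtain ⟨c, hc⟩ := h2
  have hc0 : c = 0 := by
    have := isOrth_iff.1 (toM_isOrth (eO j _ hw * g)) (δ j.rev) (δ j.rev)
    rw [hc, bl_hyp h, bl_single_left, rev_rev, Pi.single_eq_of_ne h.ne] at this
    linear_combination this / 2
  rw [hc, hc0, toM_mul, ← mulVec_mulVec, hga, eO_mulVec, bl_single_right, hw.zero_rev,
    Pi.single_eq_of_ne h.ne']
  simp

lemma isUpperUni_mul {A B : Mat n n} (hA : IsUpperUni A) (hB : IsUpperUni B) :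
    IsUpperUni (A * B) := by
  constructor
  · intro i
    rw [mul_apply, sum_eq_single i (fun k _ hk => ?_) (by simp), hA.1, hB.1, one_mul]
    rcases lt_or_gt_of_ne hk with h | h
    · rw [hA.2 _ _ h, zero_mul]
    · rw [hB.2 _ _ h, mul_zero]
  · intro i j hij
    rw [mul_apply]
    refine sum_eq_zero fun k _ => ?_
    rcases lt_or_ge k i with h | h
    · rw [hA.2 _ _ h, zero_mul]
    · rw [hB.2 k j (lt_of_lt_of_le hij h), mul_zero]

/-- Upper unitriangular orthogonal matrices are generated by Eichler transformations. -/
theorem upper_induction {P : OGL n → Prop} (one : P 1)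
    (eich : ∀ (a : Fin n) (w : Vec n) (h : InMid a w) (g : OGL n), P (eO a w h * g) → P g)
    (g : OGL n) (hg : IsUpperUni (toM g)) : P g := by
  have key : ∀ k i : ℕ, i + k = n / 2 → ∀ g ∈ fixL n i, IsUpperUni (toM g) → P g := by
    intro k
    induction k with
    | zero =>
      rintro i rfl g hg hu
      rcases eq_of_mem_fixL_half hg with h | ⟨h, j, hj⟩
      · rw [h]; exact one
      · have h1 := rO_mulVec (δ j) j
        rw [← h, if_pos hj] at h1
        have h2 := hu.1 j
        simp [h2] at h1
        norm_num at h1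
    | succ k ih =>
      intro i hik g hg hu
      obtain ⟨a, rfl⟩ : ∃ a : Fin n, (a : ℕ) = i := ⟨⟨i, by omega⟩, rfl⟩
      have haa : a < a.rev := by rw [lt_def, val_rev]; omega
      have hga : toM g *ᵥ δ a = δ a := by
        ext t
        rw [mulVec_single_one, col_apply]
        rcases lt_trichotomy t a with h1 | rfl | h1
        · rw [Pi.single_eq_of_ne h1.ne]
          have := (apply_of_mem_fixL hg h1 (δ a)).1
          rwa [mulVec_single_one, col_apply, Pi.single_eq_of_ne h1.ne] at this
        · rw [hu.1, Pi.single_eq_same]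
        · rw [hu.2 t a h1, Pi.single_eq_of_ne h1.ne']
      obtain ⟨w, hw, h⟩ := exists_eO_mul_mem_fixL haa hg hga
      exact eich a w hw g (ih (a + 1) (by omega) _ h (by
        rw [toM_mul]; exact isUpperUni_mul (isUpperUni_eO a w hw) hu))
  exact key (n / 2) 0 (by omega) g (fun j hj => absurd hj (by omega)) hg

lemma prod_torD {a : Fin n} (ha : a ≠ a.rev) {s : ℂ} (hs : s ≠ 0) : ∏ i, torD a s i = 1 := by
  rw [torD, prod_update_of_mem (mem_univ _), prod_update_of_mem (by simp [ha.symm])]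
  simp [hs]

/-- A form of Gauss elimination for the orthogonal group. -/
theorem orth_induction {P : OGL n → Prop} (one : P 1)
    (low : ∀ l g : OGL n, IsLowerUni (toM l) → P (l * g) → P g)
    (upr : ∀ u g : OGL n, IsUpperUni (toM u) → P (g * u⁻¹) → P g)
    (tor : ∀ (t g : OGL n) (d : Vec n), toM t = diagonal d → ∏ i, d i = 1 → P (t * g) → P g)
    (refl : ∀ g, P (rO n * g) → P g) (eich : ∀ (a : Fin n) (w : Vec n) (h : InMid a w) (g : OGL n),
      {m : ℕ | P (eO a ((m : ℂ) • w) (h.smul m) * g)}.Infinite → P g) (g : OGL n) : P g := by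
  have key : ∀ k i : ℕ, i + k = n / 2 → ∀ g ∈ fixL n i, P g := by
    intro k
    induction k with
    | zero =>
      rintro i rfl g hg
      rcases eq_of_mem_fixL_half hg with h | ⟨h, -⟩
      · rw [h]; exact one
      · rw [h]; exact refl _ (by rw [rO_mul_self]; exact one)
    | succ k ih =>
      intro i hik
      obtain ⟨a, rfl⟩ : ∃ a : Fin n, (a : ℕ) = i := ⟨⟨i, by omega⟩, rfl⟩
      have haa : a < a.rev := by rw [lt_def, val_rev]; omega
      have hlast : ∀ g ∈ fixL n a, toM g *ᵥ δ a = δ a → P g := by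
        intro g hg hga
        have hga' : toM g⁻¹ *ᵥ δ a = δ a := by
          nth_rewrite 1 [← hga]
          rw [mulVec_mulVec, ← toM_mul, inv_mul_cancel, toM_one, one_mulVec]
        obtain ⟨w, hw, h⟩ := exists_eO_mul_mem_fixL haa (inv_mem hg) hga'
        refine upr (eO a w hw) g (isUpperUni_eO a w hw) (ih (a + 1) (by omega) _ ?_)
        have := inv_mem h
        rwa [_root_.mul_inv_rev, inv_inv] at this
      have hxz : ∀ g ∈ fixL n a, ∀ j < a, (toM g *ᵥ δ a) j = 0 ∧
          (toM g *ᵥ δ a) j.rev = 0 := fun g hg j hj => by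
        obtain ⟨h1, h2, h3, h4⟩ := InMid.ne haa hj
        rw [(apply_of_mem_fixL hg hj _).1, (apply_of_mem_fixL hg hj _).2, Pi.single_eq_of_ne h1,
          Pi.single_eq_of_ne h3]
        exact ⟨rfl, rfl⟩
      have hfst : ∀ g ∈ fixL n a, (toM g *ᵥ δ a) a ≠ 0 → P g := by
        intro g hg hga
        have hz := hxz g hg
        set x := toM g *ᵥ δ a with hx
        have hw := (inMid_cut haa x).smul (-(x a)⁻¹)
        refine low (eO' a _ hw) g (isLowerUni_eO' _ _ _) ?_
        have hEg := mul_mem (eO_mem_fixL a _ hw).2 hg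
        set g' := eO' a _ hw * g with hg'
        have h2 : ∃ c : ℂ, toM g' *ᵥ δ a =
            x a • δ a + c • δ a.rev := by
          rw [hg', toM_mul, ← mulVec_mulVec, ← hx, eO'_mulVec]
          refine ⟨x a.rev - (bl n (-(x a)⁻¹ • cut a x) x +
            1 / 2 * bl n (-(x a)⁻¹ • cut a x) (-(x a)⁻¹ • cut a x) * x a), ?_⟩
          rw [smul_smul, mul_neg, mul_inv_cancel₀ hga]
          nth_rewrite 1 [eq_cut haa hz]
          module
        obtain ⟨c, hc⟩ := h2
        have hc0 : c = 0 := by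
          have := isOrth_iff.1 (toM_isOrth g') (δ a) (δ a)
          rw [hc, bl_hyp haa, bl_single_left, Pi.single_eq_of_ne haa.ne'] at this
          exact (mul_eq_zero.1 this).resolve_left (mul_ne_zero two_ne_zero hga)
        rw [hc0, zero_smul, add_zero] at hc
        have hto : IsOrth (diagonal (torD a (x a)⁻¹)) :=
          isOrth_diagonal_iff.2 (torD_rev haa.ne' (inv_ne_zero hga))
        refine tor (mkO _ hto) g' _ (toM_mkO _ _) (prod_torD haa.ne (inv_ne_zero hga))
          (hlast _ (mul_mem (fun j hj => ?_) hEg) ?_)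
        · obtain ⟨h1, h2, h3, h4⟩ := InMid.ne haa hj
          rw [toM_mkO, diagonal_mulVec_single, diagonal_mulVec_single]
          simp [torD, h1, h2, h3, h4]
        · rw [toM_mul, toM_mkO, ← mulVec_mulVec, hc, mulVec_smul, diagonal_mulVec_single]
          ext t
          by_cases ht : t = a
          · subst ht; simp [torD, hga]
          · simp [ht]
      have hmid : ∀ g ∈ fixL n a, (∃ j : Fin n, a < j ∧ j < a.rev ∧
          (toM g *ᵥ δ a) j ≠ 0) → P g := by
        rintro g hg ⟨j, hja, hjr, hj⟩
        by_cases hga : (toM g *ᵥ δ a) a = 0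
        swap
        · exact hfst g hg hga
        have hw : InMid a (δ j.rev) := InMid.single
          (by rw [← rev_lt_rev, rev_rev]; exact hjr) (rev_lt_rev.2 hja)
        refine eich a _ hw g (Set.infinite_of_not_bddAbove fun ⟨B, hB⟩ => ?_)
        have hval : ∀ m : ℕ, B < m → (toM (eO a _ (hw.smul m)) *ᵥ (toM g *ᵥ δ a)) a = 0 := by
          intro m hm
          by_contra hne
          refine absurd (hB (?_ : P _)) (not_le.2 hm)
          exact hfst _ (mul_mem (eO_mem_fixL a _ (hw.smul m)).1 hg) (by
            rw [toM_mul, ← mulVec_mulVec]; exact hne)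
        have e1 := hval (B + 1) (by omega)
        have e2 := hval (B + 2) (by omega)
        rw [eO_mulVec] at e1 e2
        simp only [Pi.add_apply, Pi.sub_apply, Pi.smul_apply, hga, (hw.smul _).zero, map_smul,
          LinearMap.smul_apply, bl_single_left, rev_rev, Pi.single_eq_same, smul_eq_mul] at e1 e2
        push_cast at e1 e2
        set β := 1 / 2 * (δ j.rev : Vec n) j * (toM g *ᵥ δ a) a.rev
        have hB1 : (B : ℂ) + 1 ≠ 0 := Nat.cast_add_one_ne_zero B
        have hB2 : (B : ℂ) + 2 ≠ 0 := by exact_mod_cast Nat.succ_ne_zero (B + 1)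
        have e1' : (toM g *ᵥ δ a) j + β * (B + 1) = 0 :=
          mul_left_cancel₀ hB1 (by linear_combination -e1)
        have e2' : (toM g *ᵥ δ a) j + β * (B + 2) = 0 :=
          mul_left_cancel₀ hB2 (by linear_combination -e2)
        exact hj (by linear_combination (B + 2) * e1' - (B + 1) * e2')
      intro g hg
      by_cases hex : ∃ j : Fin n, a < j ∧ j < a.rev ∧ (toM g *ᵥ δ a) j ≠ 0
      · exact hmid g hg hex
      by_cases hga : (toM g *ᵥ δ a) a = 0
      swap
      · exact hfst g hg hga
      have hcut : cut a (toM g *ᵥ δ a) = 0 := by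
        ext t
        simp only [cut]
        split_ifs with h
        · exact not_not.1 fun h' => hex ⟨t, h.1, h.2, h'⟩
        · rfl
      have hrne : (toM g *ᵥ δ a) a.rev ≠ 0 := by
        intro h0
        have := isOrth_iff.1 (toM_isOrth g) (δ a) (δ a.rev)
        rw [eq_cut haa (hxz g hg), hcut, hga, h0, bl_single_left] at this
        simp at this
      by_cases h2 : 2 * (a : ℕ) + 2 = n
      · have hra : a.rev ≠ a := haa.ne'
        refine refl g (hfst _ (mul_mem (fun j hj => ?_) hg) ?_)
        · have hsng : ∀ l : Fin n, l ≠ a → l ≠ a.rev →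
              toM (rO n) *ᵥ δ l = δ l := by
            intro l h3 h4
            ext t
            rw [rO_mulVec, if_neg (by omega)]
            split_ifs with h5
            · have h6 : t = a ∨ t = a.rev := by
                rw [Fin.ext_iff, Fin.ext_iff, Fin.val_rev]; omega
              rcases h6 with rfl | rfl
              · rw [Pi.single_eq_of_ne h3.symm, Pi.single_eq_of_ne h4.symm]
              · rw [rev_rev, Pi.single_eq_of_ne h3.symm, Pi.single_eq_of_ne h4.symm]
            · rfl
          obtain ⟨h3, h4, h5, h6⟩ := InMid.ne haa hj
          exact ⟨hsng j h3 h4, hsng j.rev h5 h6⟩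
        · rw [toM_mul, ← mulVec_mulVec, rO_mulVec, if_neg (by omega), if_pos (Or.inr h2)]
          exact hrne
      · have hra : (a.rev : ℕ) = n - (a + 1) := val_rev a
        have hlt : (a : ℕ) < a.rev := haa
        obtain ⟨b, hb⟩ : ∃ b : Fin n, (b : ℕ) = a + 1 := ⟨⟨a + 1, by omega⟩, rfl⟩
        have hw : InMid a (δ b) := InMid.single (lt_def.2 (by omega))
          (lt_def.2 (by omega))
        refine eich a _ hw g (Set.infinite_of_not_bddAbove fun ⟨B, hB⟩ => ?_)
        refine absurd (hB (a := B + 1) (?_ : P _)) (by omega)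
        refine hmid _ (mul_mem (eO_mem_fixL a _ (hw.smul _)).1 hg) ⟨b, lt_def.2 (by omega),
          lt_def.2 (by omega), ?_⟩
        have hb0 : (toM g *ᵥ δ a) b = 0 :=
          not_not.1 fun h => hex ⟨b, lt_def.2 (by omega), lt_def.2 (by omega), h⟩
        have hba : b ≠ a := fun h => by rw [h] at hb; omega
        rw [toM_mul, ← mulVec_mulVec, eO_mulVec]
        simp only [Pi.sub_apply, Pi.add_apply, Pi.smul_apply, smul_eq_mul, hb0, Pi.single_eq_same,
          Pi.single_eq_of_ne hba, mul_zero, sub_zero, zero_add, mul_one]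
        exact mul_ne_zero hrne (Nat.cast_ne_zero.2 (Nat.succ_ne_zero B))
  exact key (n / 2) 0 (by omega) g fun j hj => absurd hj (by omega)

end Generation

section Unipotent

open Module.End Module Polynomial

variable {V : Type*} [AddCommGroup V] [Module ℂ V]

lemma isNilpotent_sub_one_of_conj_pow [FinDim V] (u : End ℂ V) (hu : IsUnit u)
    (h : ∀ m : ℕ, 0 < m → ∃ τ : (End ℂ V)ˣ, τ * u * (τ⁻¹ : (End ℂ V)ˣ) = u ^ m) :
    IsNilpotent (u - 1) := by
  have hfin : (spectrum ℂ u).Finite := finite_spectrum u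
  have himg : ∀ m : ℕ, 0 < m → (fun x => x ^ m) '' spectrum ℂ u = spectrum ℂ u := fun m hm => by
    obtain ⟨τ, hτ⟩ := h m hm
    rw [← spectrum.map_pow_of_pos u hm, ← hτ, spectrum.units_conjugate]
  have hord : ∀ ν ∈ spectrum ℂ u, ∃ m : ℕ, 0 < m ∧ ν ^ m = 1 := by
    intro ν hν
    have h0 : ν ≠ 0 := fun e => spectrum.zero_notMem ℂ hu (e ▸ hν)
    have : ¬ Function.Injective fun m : ℕ => ν ^ (m + 1) := fun hinj =>
      Set.infinite_of_injective_forall_mem hinj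
        (fun m => himg (m + 1) m.succ_pos ▸ ⟨ν, hν, rfl⟩) hfin
    rw [Function.Injective] at this
    push Not at this
    obtain ⟨i, j, hij, hne⟩ := this
    wlog hlt : i < j generalizing i j
    · exact this j i hij.symm hne.symm (by omega)
    refine ⟨j - i, by omega, mul_left_cancel₀ (pow_ne_zero (i + 1) h0) ?_⟩
    rw [← pow_add, mul_one]
    exact (congrArg (ν ^ ·) (by omega)).trans hij.symm
  choose! m hm0 hm using hord
  have hone : ∀ ν ∈ spectrum ℂ u, ν = 1 := by
    intro ν hν
    have hM : 0 < ∏ x ∈ hfin.toFinset, m x :=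
      prod_pos fun x hx => hm0 x (hfin.mem_toFinset.1 hx)
    rw [← himg _ hM] at hν
    obtain ⟨x, hx, rfl⟩ := hν
    obtain ⟨k, hk⟩ := dvd_prod_of_mem m (hfin.mem_toFinset.2 hx)
    change x ^ _ = 1
    rw [hk, pow_mul, hm x hx, one_pow]
  have htop : u.maxGenEigenspace 1 = ⊤ := by
    rw [← top_le_iff, ← iSup_maxGenEigenspace_eq_top u]
    refine iSup_le fun ν => ?_
    by_cases hν : u.HasEigenvalue ν
    · rw [hone ν (hasEigenvalue_iff_mem_spectrum.1 hν)]
    · rw [hasEigenvalue_iff] at hν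
      push Not at hν
      rw [maxGenEigenspace_eq_genEigenspace_finrank]
      refine fun x hx => (?_ : x = 0) ▸ zero_mem _
      rw [mem_genEigenspace_nat, LinearMap.mem_ker] at hx
      revert hx
      generalize finrank ℂ V = k
      induction k with
      | zero => exact id
      | succ k ih =>
        intro hx
        rw [pow_succ', End.mul_apply] at hx
        exact ih (((Submodule.eq_bot_iff _).1 hν) _ (mem_eigenspace_iff.2
          (by rwa [LinearMap.sub_apply, LinearMap.smul_apply, sub_eq_zero] at hx)))
  refine ⟨finrank ℂ V, LinearMap.ext fun x => ?_⟩
  have hx : x ∈ u.maxGenEigenspace 1 := htop ▸ mem_top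
  rw [maxGenEigenspace_eq_genEigenspace_finrank, mem_genEigenspace_nat, one_smul] at hx
  exact hx

lemma apply_eq_zero_of_infinite {u : End ℂ V} (hu : IsNilpotent (u - 1))
    (F : Module.Dual ℂ V) (y : V) (h : {m : ℕ | F ((u ^ m) y) = 0}.Infinite) : F y = 0 := by
  obtain ⟨K, hK⟩ := hu
  set Q : Polynomial ℂ := ∑ j ∈ range K,
    C (F (((u - 1) ^ j) y) / (j.factorial : ℂ)) * descPochhammer ℂ j with hQ
  have hev : ∀ m : ℕ, Q.eval (m : ℂ) = F ((u ^ m) y) := by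
    intro m
    have e1 : u ^ m = ∑ j ∈ range (m + 1), (m.choose j : ℂ) • (u - 1) ^ j := by
      conv_lhs => rw [← sub_add_cancel u 1, (Commute.one_right (u - 1)).add_pow]
      refine sum_congr rfl fun j _ => ?_
      rw [one_pow, mul_one, Nat.cast_smul_eq_nsmul, nsmul_eq_mul']
    have e2 : u ^ m = ∑ j ∈ range K, (m.choose j : ℂ) • (u - 1) ^ j := by
      rw [e1]
      rcases le_total (m + 1) K with hle | hle
      · refine sum_subset (range_mono hle) fun j _ hj => ?_
        rw [Nat.choose_eq_zero_of_lt (by simpa using hj), Nat.cast_zero, zero_smul]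
      · refine (sum_subset (range_mono hle) fun j _ hj => ?_).symm
        rw [pow_eq_zero_of_le (by simpa using hj) hK, smul_zero]
    rw [e2, LinearMap.sum_apply, map_sum, hQ, eval_finsetSum]
    refine sum_congr rfl fun j _ => ?_
    rw [eval_mul, eval_C, LinearMap.smul_apply, map_smul, smul_eq_mul,
      Nat.cast_choose_eq_descPochhammer_div]
    ring
  have hQ0 : Q = 0 := eq_zero_of_infinite_isRoot _
    ((h.image (Nat.cast_injective (R := ℂ)).injOn).mono (by
      rintro _ ⟨m, hm, rfl⟩
      exact (hev m).trans hm))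
  have := hev 0
  rw [hQ0, eval_zero, pow_zero] at this
  exact this.symm

/-- A unipotent `u` scaled by `τ` moves eigenvectors of `τ` to larger eigenvalues. -/
lemma apply_eq_self_of_max {τ u : End ℂ V} (hu : IsNilpotent (u - 1)) {M : ℕ} (hM : 2 ≤ M)
    (h : τ * u = u ^ M * τ) {c : ℂ} (hc : c ≠ 0)
    (hmax : ∀ c', τ.HasEigenvalue c' → ‖c'‖ ≤ ‖c‖) {x : V} (hx : τ x = c • x) : u x = x := by
  by_contra hne
  have hex : ∃ q, ((u - 1 : End ℂ V) ^ q) x = 0 := hu.imp fun q hq => by rw [hq]; rfl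
  classical
  set q := Nat.find hex with hq
  have hq0 : ((u - 1) ^ q) x = 0 := Nat.find_spec hex
  have hq2 : 2 ≤ q := by
    by_contra hlt
    have h1 : ((u - 1 : End ℂ V) ^ 1) x = 0 := by
      rw [show 1 = (1 - q) + q by omega, pow_add, End.mul_apply, hq0, map_zero]
    rw [pow_one, LinearMap.sub_apply, sub_eq_zero] at h1
    exact hne h1
  obtain ⟨r, hr⟩ : ∃ r, q = r + 1 := ⟨q - 1, by omega⟩
  have hz0 : ((u - 1) ^ r) x ≠ 0 := Nat.find_min hex (by omega)
  set z := ((u - 1) ^ r) x with hz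
  have huz : u z = z := by
    rw [hr, pow_succ', End.mul_apply, LinearMap.sub_apply, sub_eq_zero] at hq0
    exact hq0
  have hpow : ∀ i, (u ^ i) z = z := fun i => by
    induction i with
    | zero => rfl
    | succ i ih => rw [pow_succ, End.mul_apply, huz, ih]
  set S := ∑ i ∈ range M, u ^ i with hS
  have hSz : S z = (M : ℂ) • z := by
    rw [hS, LinearMap.sum_apply, sum_congr rfl fun i _ => hpow i, sum_const,
      card_range, Nat.cast_smul_eq_nsmul]
  have hSr : ∀ r, (S ^ r) z = ((M : ℂ) ^ r) • z := fun r => by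
    induction r with
    | zero => rw [pow_zero, pow_zero, one_smul]; rfl
    | succ r ih => rw [pow_succ, End.mul_apply, hSz, map_smul, ih, smul_smul, pow_succ']
  have hτ : ∀ r, τ * (u - 1) ^ r = (u ^ M - 1) ^ r * τ := fun r => by
    induction r with
    | zero => simp
    | succ r ih =>
      rw [pow_succ', ← mul_assoc, mul_sub, h, mul_one, pow_succ', mul_assoc, ← ih]
      noncomm_ring
  have hcomm : Commute S (u - 1) := by
    refine Commute.sub_right ?_ (Commute.one_right _)
    exact Commute.sum_left _ _ _ fun i _ => Commute.pow_left rfl i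
  have hτz : τ z = (c * (M : ℂ) ^ r) • z := by
    rw [hz, ← End.mul_apply, hτ, End.mul_apply, hx, map_smul, ← geom_sum_mul,
      ← hS, hcomm.mul_pow, End.mul_apply, ← hz, hSr, smul_smul]
  have hle := hmax _ (hasEigenvalue_of_hasEigenvector
    (hasEigenvector_iff.2 ⟨mem_eigenspace_iff.2 hτz, hz0⟩))
  rw [norm_mul, norm_pow, Complex.norm_natCast] at hle
  have h2 : (1 : ℝ) < (M : ℝ) ^ r := one_lt_pow₀ (by exact_mod_cast hM) (by omega)
  have := norm_pos_iff.2 hc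
  nlinarith

lemma exists_common_eigenvector [FinDim V] {ι : Type*} (f : ι → End ℂ V)
    (hf : ∀ i j, f i * f j = f j * f i) : ∀ (k : ℕ) (W : Submodule ℂ V), finrank ℂ W = k →
    W ≠ ⊥ → (∀ i, ∀ x ∈ W, f i x ∈ W) → ∃ x ∈ W, x ≠ 0 ∧ ∀ i, ∃ c : ℂ, f i x = c • x := by
  intro k
  induction k using Nat.strong_induction_on with
  | _ k ih =>
    intro W hk hW hinv
    by_cases hsc : ∀ i, ∃ c : ℂ, ∀ x ∈ W, f i x = c • x
    · obtain ⟨x, hx, hx0⟩ := W.ne_bot_iff.1 hW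
      exact ⟨x, hx, hx0, fun i => (hsc i).imp fun c hc => hc x hx⟩
    · push Not at hsc
      obtain ⟨i, hi⟩ := hsc
      have : Nontrivial W := nontrivial_iff_ne_bot.2 hW
      obtain ⟨c, hc⟩ := exists_eigenvalue ((f i).restrict (hinv i))
      obtain ⟨⟨y, hy⟩, hy1, hy0⟩ := hc.exists_hasEigenvector
      have hy2 : f i y = c • y := congrArg Subtype.val (mem_eigenspace_iff.1 hy1)
      have hlt : W ⊓ (f i).eigenspace c < W := by
        refine lt_of_le_of_ne inf_le_left fun e => ?_
        obtain ⟨x, hx, hne⟩ := hi c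
        rw [← e] at hx
        exact hne (mem_eigenspace_iff.1 hx.2)
      obtain ⟨x, hx, h⟩ := ih _ (hk ▸ finrank_lt_finrank_of_lt hlt)
        (W ⊓ (f i).eigenspace c) rfl
        (Submodule.ne_bot_iff _ |>.2 ⟨y, ⟨hy, End.mem_eigenspace_iff.2 hy2⟩,
          fun e => hy0 (Subtype.ext e)⟩)
        (fun j x hx => ⟨hinv j x hx.1, by
          have hx2 := mem_eigenspace_iff.1 hx.2
          rw [SetLike.mem_coe, End.mem_eigenspace_iff, ← End.mul_apply, hf, End.mul_apply, hx2,
            map_smul]⟩)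
      exact ⟨x, hx.1, h⟩

end Unipotent

section FixedVectors

variable {n : ℕ} {V : Type*} [AddCommGroup V] [Module ℂ V] {ρ : ORep n V}

lemma rep_mul_apply {G : Type*} [Group G] (ρ : Representation ℂ G V) (g h : G) (x : V) :
    ρ (g * h) x = ρ g (ρ h x) := by rw [map_mul]; rfl

lemma eO_add {a : Fin n} {w w' : Vec n} (h : InMid a w) (h' : InMid a w') :
    eO a w h * eO a w' h' = eO a (w + w') ⟨h.1, fun j hj => by
      rw [Pi.add_apply, h.2 j hj, h'.2 j hj, add_zero]⟩ :=
  toM_inj (by rw [toM_mul]; exact eichM_mul h.1.ne' h.zero_rev h'.zero_rev)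

lemma eO_pow {a : Fin n} {w : Vec n} (h : InMid a w) (m : ℕ) :
    eO a w h ^ m = eO a ((m : ℂ) • w) (h.smul m) := by
  induction m with
  | zero =>
    refine toM_inj ?_
    rw [pow_zero, toM_one, eO, toM_mkO, Nat.cast_zero, zero_smul, eichM_zero]
  | succ m ih =>
    rw [pow_succ, ih, eO_add]
    congr 1
    push_cast
    rw [add_smul, one_smul]

lemma isNilpotent_eO [FinDim V] (ρ : ORep n V) {a : Fin n}
    {w : Vec n} (h : InMid a w) : IsNilpotent (ρ (eO a w h) - 1) := by
  refine isNilpotent_sub_one_of_conj_pow _ ((Group.isUnit _).map ρ) fun m hm => ?_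
  have hm' : (m : ℂ) ≠ 0 := Nat.cast_ne_zero.2 hm.ne'
  set t : OGL n := mkO _ (isOrth_diagonal_iff.2 (torD_rev h.1.ne' hm')) with ht
  refine ⟨⟨ρ t, ρ t⁻¹, by rw [← map_mul]; simp, by rw [← map_mul]; simp⟩, ?_⟩
  change ρ t * ρ _ * ρ t⁻¹ = ρ _ ^ m
  rw [← map_pow, ← map_mul, ← map_mul, eO_pow, mul_inv_eq_of_eq_mul]
  refine toM_inj ?_
  rw [toM_mul, toM_mul, ht, toM_mkO, eO, eO, toM_mkO, toM_mkO,
    torD_eichM h.1.ne' hm' h.zero h.zero_rev]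

/-- Simultaneous eigenvectors of the diagonal matrices of determinant one. -/
def IsTE (ρ : ORep n V) (x : V) : Prop :=
  ∀ (g : OGL n) (d : Vec n), toM g = diagonal d → ∏ i, d i = 1 → ∃ c : ℂ, ρ g x = c • x

lemma toM_inv_of_diagonal {t : OGL n} {d : Vec n} (ht : toM t = diagonal d) :
    toM t⁻¹ = diagonal fun i => d i.rev := by
  have h3 := isOrth_diagonal_iff.1 (ht ▸ toM_isOrth t)
  have h4 : toM t⁻¹ * toM t = 1 := by rw [← toM_mul, inv_mul_cancel, toM_one]
  calc toM t⁻¹ = toM t⁻¹ * (toM t * diagonal fun i => d i.rev) := by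
        simp_all
    _ = _ := by rw [← mul_assoc, h4, one_mul]

lemma isUpperUni_conj_diagonal {g t : OGL n} {d : Vec n} (ht : toM t = diagonal d)
    (hg : IsUpperUni (toM g)) : IsUpperUni (toM (t⁻¹ * g * t)) := by
  have h1 : ∀ i j, toM (t⁻¹ * g * t) i j = d i.rev * toM g i j * d j := by
    intro i j
    rw [toM_mul, toM_mul, toM_inv_of_diagonal ht, ht, mul_diagonal, diagonal_mul]
  have h3 := isOrth_diagonal_iff.1 (ht ▸ toM_isOrth t)
  exact ⟨fun i => by rw [h1, hg.1, mul_one, mul_comm, h3], fun i j hij => by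
    rw [h1, hg.2 i j hij, mul_zero, zero_mul]⟩

theorem exists_fixed_of_upper [FinDim V] [Nontrivial V] (ρ : ORep n V) :
    ∃ x, x ≠ 0 ∧ (∀ g : OGL n, IsUpperUni (toM g) → ρ g x = x) ∧ IsTE ρ x := by
  set e : Fin n → ℤ := fun i => n - 1 - 2 * (i : ℕ) with he
  have hrev : ∀ i : Fin n, e i.rev = - e i := fun i => by
    simp only [he, Fin.val_rev]
    omega
  have hO : IsOrth (diagonal fun i => (2 : ℂ) ^ e i) := isOrth_diagonal_iff.2 fun i => by
    rw [hrev, ← zpow_add₀ two_ne_zero, add_neg_cancel, zpow_zero]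
  set t : OGL n := mkO _ hO with ht
  obtain ⟨c, hc, hmax⟩ := (Module.End.finite_hasEigenvalue (ρ t)).exists_maximalFor (‖·‖) _
    (Module.End.exists_eigenvalue (ρ t))
  have hmax' : ∀ c', Module.End.HasEigenvalue (ρ t) c' → ‖c'‖ ≤ ‖c‖ := fun c' h =>
    (le_total ‖c'‖ ‖c‖).elim id fun h2 => hmax h h2
  obtain ⟨x, hx, hx0⟩ := hc.exists_hasEigenvector
  rw [Module.End.mem_genEigenspace_one] at hx
  have hinv : ∀ (g : OGL n) (y : V), ρ g⁻¹ (ρ g y) = y := fun g y => by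
    rw [← rep_mul_apply, inv_mul_cancel, map_one]; rfl
  have hc0 : c ≠ 0 := by
    rintro rfl
    rw [zero_smul] at hx
    exact hx0 (by rw [← hinv t x, hx, map_zero])
  have hsingle : ∀ (a b : Fin n) (s : ℂ) (h : InMid a (s • δ b)), a < b → b < a.rev →
      ρ (eO a _ h) x = x := by
    intro a b s h hab hba
    have hlt : (b : ℕ) < n - (a + 1) := by rw [← Fin.val_rev]; exact hba
    refine apply_eq_self_of_max (M := 2 ^ (e a + e b).toNat) (isNilpotent_eO ρ h) ?_ ?_ hc0 hmax' hx
    · refine le_self_pow₀ one_le_two ?_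
      simp only [he]; omega
    · rw [← map_pow, ← map_mul, ← map_mul, eO_pow]
      refine congrArg ρ (toM_inj ?_)
      rw [toM_mul, toM_mul, ht, toM_mkO, eO, eO, toM_mkO, toM_mkO, diagonal_eichM hO]
      congr 2
      ext i
      simp only [Pi.smul_apply, mulVec_diagonal, smul_eq_mul]
      by_cases hi : i = b
      · subst hi
        rw [Pi.single_eq_same]
        push_cast
        rw [← zpow_natCast, Int.toNat_of_nonneg (by simp only [he]; omega), zpow_add₀ two_ne_zero]
        ring
      · simp [Pi.single_eq_of_ne hi]
  have heich : ∀ (a : Fin n) (w : Vec n) (h : InMid a w), ρ (eO a w h) x = x := by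
    intro a w h
    have key : ∀ (s : Finset (Fin n)) (hs : InMid a (∑ b ∈ s, w b • δ b)),
        ρ (eO a _ hs) x = x := by
      intro s
      induction s using Finset.induction_on with
      | empty =>
        intro hs
        have : eO a _ hs = 1 := toM_inj (by rw [eO, toM_mkO, Finset.sum_empty, eichM_zero, toM_one])
        rw [this, map_one]; rfl
      | insert b s hb ih =>
        intro hs
        have hI : ∀ s : Finset (Fin n), InMid a (∑ b ∈ s, w b • δ b) := fun s =>
          ⟨h.1, fun j hj => by
            rw [Finset.sum_apply]
            refine sum_eq_zero fun b _ => ?_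
            by_cases hjb : j = b
            · rw [← hjb, Pi.smul_apply, h.2 j hj, zero_smul]
            · rw [Pi.smul_apply, Pi.single_eq_of_ne hjb, smul_zero]⟩
        have hb' : InMid a (w b • δ b) := by simpa using hI {b}
        have : eO a _ hs = eO a _ hb' * eO a _ (hI s) := by
          rw [eO_add]
          congr 1
          exact sum_insert hb
        rw [this, rep_mul_apply, ih]
        by_cases hab : a < b ∧ b < a.rev
        · exact hsingle a b _ hb' hab.1 hab.2
        · have h0 : w b = 0 := h.2 b (by by_contra hh; push Not at hh; exact hab hh)
          have : eO a _ hb' = 1 := toM_inj (by rw [eO, toM_mkO, h0, zero_smul, eichM_zero, toM_one])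
          rw [this, map_one]; rfl
    have hw : w = ∑ b, w b • δ b := by
      ext j
      simp [Finset.sum_apply, Pi.single_apply]
    have := key univ (hw ▸ h)
    convert this using 3
    congr 1
  have hU : ∀ g : OGL n, IsUpperUni (toM g) → ρ g x = x := by
    refine upper_induction (P := fun g => ρ g x = x) (by rw [map_one]; rfl) fun a w h g hg => ?_
    rw [← hinv (eO a w h) (ρ g x), ← rep_mul_apply ρ _ g, hg]
    conv_lhs => rw [← heich a w h, hinv]
  set W : Submodule ℂ V := ⨅ g : {g : OGL n // IsUpperUni (toM g)}, LinearMap.ker (ρ g - 1) with hW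
  have hmem : ∀ y, y ∈ W ↔ ∀ g : OGL n, IsUpperUni (toM g) → ρ g y = y := fun y => by
    simp [hW, sub_eq_zero]
  obtain ⟨y, hy, hy0, hyT⟩ := exists_common_eigenvector
    (fun g : {g : OGL n // ∃ d, toM g = diagonal d} => ρ g) (fun i j => by
      obtain ⟨g, d, hd⟩ := i
      obtain ⟨g', d', hd'⟩ := j
      rw [← map_mul, ← map_mul]
      refine congrArg ρ (toM_inj ?_)
      rw [toM_mul, toM_mul, hd, hd', diagonal_mul_diagonal, diagonal_mul_diagonal]
      simp only [mul_comm]) _ W rfl (W.ne_bot_iff.2 ⟨x, (hmem x).2 hU, hx0⟩) (by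
      rintro ⟨t, d, hd⟩ y hy
      rw [hmem] at hy ⊢
      intro g hg
      have := hy _ (isUpperUni_conj_diagonal hd hg)
      calc ρ g (ρ t y) = ρ t (ρ (t⁻¹ * g * t) y) := by
            rw [← rep_mul_apply, ← rep_mul_apply]; congr 2; group
        _ = ρ t y := by rw [this])
  exact ⟨y, hy0, (hmem y).1 hy, fun g d hd _ => hyT ⟨g, d, hd⟩⟩

end FixedVectors

section BigCell

open Fin

variable {n : ℕ}

lemma rO_conj_apply (g : OGL n) : ∃ (s : Vec n) (e : Fin n → Fin n),
    (∀ i, s i * s i = 1) ∧ (∀ i, e i = if 2 * (i : ℕ) = n ∨ 2 * (i : ℕ) + 2 = n then i.rev else i) ∧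
    ∀ i j, toM (rO n * g * rO n) i j = s i * s j * toM g (e i) (e j) := by
  set s : Vec n := fun i => if 2 * (i : ℕ) + 1 = n then -1 else 1 with hs
  set e : Fin n → Fin n := fun i => if 2 * (i : ℕ) = n ∨ 2 * (i : ℕ) + 2 = n then i.rev else i with he
  have h1 : ∀ (X : Mat n n) i j, (reflMatrix n * X) i j = s i * X (e i) j := by
    intro X i j
    rw [reflMatrix_mul_apply]
    simp only [hs, he]
    split_ifs <;> first | omega | simp
  refine ⟨s, e, fun i => ?_, fun i => rfl, fun i j => ?_⟩
  · simp only [hs]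
    split_ifs <;> norm_num
  · have h2 : ∀ i, (toM g * reflMatrix n) i j = s j * toM g i (e j) := fun i => by
      rw [← transpose_apply (toM g * reflMatrix n), transpose_mul, reflMatrix_transpose, h1,
        transpose_apply]
    rw [mul_assoc, toM_mul, toM_mul]
    change (reflMatrix n * (toM g * reflMatrix n)) i j = _
    rw [h1, h2]
    ring

lemma isLowerUni_rO_conj {l : OGL n} (hl : IsLowerUni (toM l)) :
    IsLowerUni (toM (rO n * l * rO n)) := by
  obtain ⟨s, e, hs, he, h⟩ := rO_conj_apply l
  refine ⟨fun i => by rw [h, hl.1, mul_one, hs], fun i j hij => ?_⟩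
  rw [h]
  have hi := val_rev i
  have hj := Fin.val_rev j
  refine mul_eq_zero_of_right _ ?_
  by_cases hmid : 2 * (i : ℕ) + 2 = n ∧ 2 * (j : ℕ) = n
  · have hji : j = i.rev := Fin.ext (by omega)
    subst hji
    rw [he, he, if_pos (Or.inr hmid.1), if_pos (Or.inl hmid.2), rev_rev]
    have hb := isOrth_iff.1 (toM_isOrth l) (δ i) (δ i)
    rw [bl_single_left, Pi.single_eq_of_ne (Fin.ne_of_gt hij), bl_apply,
      sum_eq_add i i.rev (ne_of_lt hij)
      (fun b _ hb => by
        have h3 := val_rev b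
        have h4 : (b : ℕ) ≠ i := fun hh => hb.1 (Fin.ext hh)
        have h5 : (b : ℕ) ≠ i.rev := fun hh => hb.2 (Fin.ext hh)
        rw [mulVec_single_one, col_apply, col_apply]
        rcases lt_or_gt_of_ne h4 with h6 | h6
        · rw [hl.2 b i h6, zero_mul]
        · rw [hl.2 b.rev i (by omega), mul_zero]) (by simp) (by simp), rev_rev,
      mulVec_single_one, col_apply, col_apply, hl.1] at hb
    linear_combination hb / 2
  · apply hl.2
    rw [he, he]
    split_ifs <;> omega

lemma rO_conj_diagonal {t : OGL n} {d : Vec n} (ht : toM t = diagonal d) (hd : ∏ i, d i = 1) :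
    ∃ d' : Vec n, toM (rO n * t * rO n) = diagonal d' ∧ ∏ i, d' i = 1 ∧
      ∀ i : Fin n, d' i = d (if 2 * (i : ℕ) = n ∨ 2 * (i : ℕ) + 2 = n then i.rev else i) := by
  obtain ⟨s, e, hs, he, h⟩ := rO_conj_apply t
  have hinv : Function.Involutive e := fun i => by
    have := val_rev i
    rw [he i]
    split_ifs with h1
    · rw [he, if_pos (by omega), rev_rev]
    · rw [he, if_neg h1]
  refine ⟨fun i => d (e i), ?_, ?_, fun i => congrArg d (he i)⟩
  · ext i j
    rw [h, ht]
    by_cases hij : i = j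
    · subst hij
      rw [diagonal_apply_eq, diagonal_apply_eq, hs, one_mul]
    · rw [diagonal_apply_ne _ hij, diagonal_apply_ne _ (hinv.injective.ne hij), mul_zero]
  · rw [← hd]
    exact Equiv.prod_comp (hinv.toPerm e) d

variable {V : Type*} [AddCommGroup V] [Module ℂ V] {ρ : ORep n V}

lemma rep_inv_apply {G : Type*} [Group G] (ρ : Representation ℂ G V) (g : G) (x : V) :
    ρ g⁻¹ (ρ g x) = x := by rw [← rep_mul_apply, inv_mul_cancel, map_one]; rfl

/-- Functionals fixed by the lower unitriangular elements. -/
def IsLowFix (ρ : ORep n V) (F : Module.Dual ℂ V) : Prop :=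
  ∀ l : OGL n, IsLowerUni (toM l) → ∀ y, F (ρ l y) = F y

lemma IsLowFix.comp_rO {F : Module.Dual ℂ V} (hF : IsLowFix ρ F) :
    IsLowFix ρ (F ∘ₗ ρ (rO n)) := fun l hl y => by
  have e : rO n * l = rO n * l * rO n * rO n := by rw [mul_assoc (rO n * l), rO_mul_self, mul_one]
  rw [LinearMap.comp_apply, ← rep_mul_apply, e, rep_mul_apply, hF _ (isLowerUni_rO_conj hl)]
  rfl

lemma isLowerUni_conj_diagonal {l t : OGL n} {d : Vec n} (ht : toM t = diagonal d)
    (hl : IsLowerUni (toM l)) : IsLowerUni (toM (t * l * t⁻¹)) := by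
  have h0 : stO (t * l * t⁻¹) = (stO t)⁻¹ * stO l * stO t := by
    have e1 : ∀ g h : OGL n, stO (g * h) = stO h * stO g := fun g h =>
      toM_inj (by simp only [toM_stO, toM_mul, conjTranspose_mul])
    have e2 : stO t⁻¹ = (stO t)⁻¹ := eq_inv_of_mul_eq_one_left (by
      rw [← e1, mul_inv_cancel]
      exact toM_inj (by simp [toM_stO, toM_one]))
    rw [e1, e1, e2, mul_assoc]
  have h2 := isUpperUni_conj_diagonal (g := stO l) (t := stO t) (d := star d)
    (by rw [toM_stO, ht, diagonal_conjTranspose])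
    ⟨fun i => by simp [toM_stO, hl.1], fun i j hij => by simp [toM_stO, hl.2 j i hij]⟩
  rw [← h0] at h2
  exact ⟨fun i => by simpa [toM_stO] using congrArg star (h2.1 i), fun i j hij => by
    simpa [toM_stO] using h2.2 j i hij⟩

theorem big_cell [FinDim V] {x : V}
    (hU : ∀ g : OGL n, IsUpperUni (toM g) → ρ g x = x) (hT : IsTE ρ x) (g : OGL n) :
    ∀ F : Module.Dual ℂ V, IsLowFix ρ F → F x = 0 → F (ρ (rO n) x) = 0 → F (ρ g x) = 0 := by
  have hrr : ∀ y, ρ (rO n) (ρ (rO n) y) = y := fun y => by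
    rw [← rep_mul_apply, rO_mul_self, map_one]; rfl
  induction g using orth_induction with
  | one => intro F _ h _; rw [map_one]; exact h
  | low l g hl ih => intro F hF h1 h2; rw [← ih F hF h1 h2, rep_mul_apply, hF l hl]
  | upr u g hu ih =>
    intro F hF h1 h2
    rw [← ih F hF h1 h2, rep_mul_apply, ← hU u hu, rep_inv_apply, hU u hu]
  | tor t g d ht hd ih =>
    intro F hF h1 h2
    have ht' := toM_inv_of_diagonal ht
    have hd' : ∏ i : Fin n, d i.rev = 1 := (Equiv.prod_comp revPerm d).trans hd
    have := ih (F ∘ₗ ρ t⁻¹) (fun l hl y => by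
        have e : t⁻¹ * l = t⁻¹ * l * t⁻¹⁻¹ * t⁻¹ := by group
        rw [LinearMap.comp_apply, ← rep_mul_apply, e, rep_mul_apply,
          hF _ (isLowerUni_conj_diagonal ht' hl)]
        rfl) (by
        obtain ⟨c, hc⟩ := hT _ _ ht' hd'
        rw [LinearMap.comp_apply, hc, map_smul, h1, smul_zero]) (by
        obtain ⟨d', h3, h4, -⟩ := rO_conj_diagonal ht' hd'
        obtain ⟨c, hc⟩ := hT _ _ h3 h4
        rw [rep_mul_apply, rep_mul_apply] at hc
        rw [LinearMap.comp_apply, ← hrr (ρ t⁻¹ _), hc, map_smul, map_smul, h2, smul_zero])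
    rwa [LinearMap.comp_apply, rep_mul_apply, rep_inv_apply] at this
  | refl g ih =>
    intro F hF h1 h2
    have := ih (F ∘ₗ ρ (rO n)) hF.comp_rO h2 (by rw [LinearMap.comp_apply, hrr, h1])
    rwa [LinearMap.comp_apply, rep_mul_apply, hrr] at this
  | eich a w h g ih =>
    intro F hF h1 h2
    refine apply_eq_zero_of_infinite (isNilpotent_eO ρ h) F _ (ih.mono fun m hm => ?_)
    have := hm F hF h1 h2
    rwa [rep_mul_apply, ← eO_pow, map_pow] at this

lemma IsIrreducibleRep.span_eq_top (hρ : IsIrreducibleRep ρ) {v : V} (hv : v ≠ 0) :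
    span ℂ (Set.range fun g => ρ g v) = ⊤ := by
  refine (hρ.2 _ fun g x hx => ?_).resolve_left fun h => hv ?_
  · refine span_induction (p := fun x _ => ρ g x ∈ _) ?_ ?_ ?_ ?_ hx
    · rintro _ ⟨h, rfl⟩
      exact subset_span ⟨g * h, rep_mul_apply ρ g h v⟩
    · rw [map_zero]; exact zero_mem _
    · intro x y _ _ hx hy; rw [map_add]; exact Submodule.add_mem _ hx hy
    · intro c x _ hx; rw [map_smul]; exact smul_mem _ _ hx
  · rw [span_eq_bot] at h
    simpa using h _ ⟨1, rfl⟩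

lemma IsIrreducibleRep.ext_dual (hρ : IsIrreducibleRep ρ) {v : V} (hv : v ≠ 0)
    {W : Type*} [AddCommGroup W] [Module ℂ W] {F F' : V →ₗ[ℂ] W}
    (h : ∀ g, F (ρ g v) = F' (ρ g v)) : F = F' :=
  LinearMap.ext_on_range (hρ.span_eq_top hv) h

theorem exists_low_functional [FinDim V] (hρ : IsIrreducibleRep ρ) {v : V} (hv : v ≠ 0)
    (hU : ∀ g : OGL n, IsUpperUni (toM g) → ρ g v = v) (hT : IsTE ρ v) :
    ∃ F : Module.Dual ℂ V, IsLowFix ρ F ∧ F v ≠ 0 ∧ ∀ (t : OGL n) (d : Vec n),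
      toM t = diagonal d → ∏ i, d i = 1 → ∀ c : ℂ, ρ t v = c • v → ∀ y, F (ρ t y) = c * F y := by
  have := hρ.1
  set τ : ORep n (Module.Dual ℂ V) :=
    { toFun := fun g => (ρ (stO g)).dualMap
      map_one' := by
        have : stO (1 : OGL n) = 1 := toM_inj (by simp [toM_stO, toM_one])
        rw [this, map_one]; rfl
      map_mul' := fun g h => by
        have : stO (g * h) = stO h * stO g :=
          toM_inj (by simp only [toM_stO, toM_mul, conjTranspose_mul])
        rw [this, map_mul]; rfl } with hτ
  obtain ⟨F, hF0, hF, hFT⟩ := exists_fixed_of_upper τ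
  have hlow : IsLowFix ρ F := fun l hl y => by
    have := LinearMap.congr_fun (hF (stO l) ⟨fun i => by simp [toM_stO, hl.1], fun i j hij => by
      simp [toM_stO, hl.2 j i hij]⟩) y
    change F (ρ (stO (stO l)) y) = _ at this
    rwa [stO_stO] at this
  have hchar : ∀ (t : OGL n) (d : Vec n), toM t = diagonal d → ∏ i, d i = 1 →
      ∃ c : ℂ, ∀ y, F (ρ t y) = c * F y := fun t d ht hd => by
    obtain ⟨c, hc⟩ := hFT (stO t) (star d) (by rw [toM_stO, ht, diagonal_conjTranspose])
      (by simp only [Pi.star_apply]; rw [← star_prod, hd, star_one])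
    refine ⟨c, fun y => ?_⟩
    have := LinearMap.congr_fun hc y
    change F (ρ (stO (stO t)) y) = _ at this
    rwa [stO_stO] at this
  obtain ⟨F', h1, h2, h3⟩ : ∃ F' : Module.Dual ℂ V, IsLowFix ρ F' ∧ F' v ≠ 0 ∧
      ∀ (t : OGL n) (d : Vec n), toM t = diagonal d → ∏ i, d i = 1 →
      ∃ c : ℂ, ∀ y, F' (ρ t y) = c * F' y := by
    by_cases h1 : F v = 0
    · refine ⟨F ∘ₗ ρ (rO n), hlow.comp_rO, fun h2 => hF0 (hρ.ext_dual hv fun g =>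
        big_cell hU hT g F hlow h1 h2), fun t d ht hd => ?_⟩
      obtain ⟨d', h3, h4, -⟩ := rO_conj_diagonal ht hd
      obtain ⟨c, hc⟩ := hchar _ _ h3 h4
      refine ⟨c, fun y => ?_⟩
      rw [LinearMap.comp_apply, LinearMap.comp_apply, ← hc, ← rep_mul_apply, ← rep_mul_apply,
        mul_assoc, rO_mul_self, mul_one]
    · exact ⟨F, hlow, h1, hchar⟩
  refine ⟨F', h1, h2, fun t d ht hd c hc y => ?_⟩
  obtain ⟨c', hc'⟩ := h3 t d ht hd
  have := hc' v
  rw [hc, map_smul, smul_eq_mul] at this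
  rw [hc', mul_right_cancel₀ h2 this]

end BigCell

section TheoremA

open LinearMap Function

variable {n : ℕ} {V W : Type*} [AddCommGroup V] [Module ℂ V] [AddCommGroup W] [Module ℂ W]
  {ρ : ORep n V} {σ : ORep n W} {la nu : ℕ → ℕ}

/-- Partitions with at most `n / 2` parts. -/
def IsSmall (n : ℕ) (la : ℕ → ℕ) : Prop := IsPartition la ∧ 2 * plen la ≤ n

lemma IsSmall.eq_zero (h : IsSmall n la) {i : ℕ} (hi : n < 2 * i + 2) : la i = 0 :=
  (h.1.eq_zero_iff i).2 (by have := h.2; omega)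

lemma IsSmall.exists_tor (h : IsSmall n la) {a : Fin n} (ha : la a ≠ 0) (s : ℂ) (hs : s ≠ 0) :
    ∃ t : OGL n, toM t = diagonal (torD a s) ∧ ∏ i, torD a s i = 1 ∧
      ∀ κ, IsSmall n κ → ∏ i : Fin n, torD a s i ^ κ i = s ^ κ a := by
  have h1 : 2 * (a : ℕ) + 2 ≤ n := not_lt.1 fun h2 => ha (h.eq_zero h2)
  have h2 := Fin.val_rev a
  have h3 : a.rev ≠ a := fun h3 => by have := congrArg Fin.val h3; omega
  have h4 := isOrth_diagonal_iff.2 (torD_rev h3 hs)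
  refine ⟨mkO _ h4, toM_mkO _ _, prod_torD h3.symm hs, fun κ hκ => ?_⟩
  rw [prod_eq_single a (fun b _ hb => ?_) (by simp), torD, update_self]
  by_cases hb' : b = a.rev
  · rw [hκ.eq_zero (by rw [hb']; omega), pow_zero]
  · simp [torD, hb, hb']

/-- Functionals fixed by the lower unitriangular elements, of torus weight `nu`. -/
def IsLowWt (ρ : ORep n V) (nu : ℕ → ℕ) (F : Module.Dual ℂ V) : Prop :=
  IsLowFix ρ F ∧ ∀ (t : OGL n) (d : Vec n), toM t = diagonal d → ∏ i, d i = 1 →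
    ∀ y, F (ρ t y) = (∏ i, d i ^ nu i) * F y

lemma IsLowWt.eq_zero (hl : IsSmall n la) (hn : IsSmall n nu) {F : Module.Dual ℂ V}
    (hF : IsLowWt ρ nu F) (hne : la ≠ nu) {y : V} (hy : y ∈ hwSub n la ρ) : F y = 0 := by
  obtain ⟨i, hi⟩ := Function.ne_iff.1 hne
  have hi' : i < n := not_le.1 fun h => hi (by
    rcases Nat.eq_zero_or_pos n with rfl | h0
    · rw [(hl.1.eq_zero_iff i).2 (by have := hl.2; omega),
        (hn.1.eq_zero_iff i).2 (by have := hn.2; omega)]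
    · rw [hl.eq_zero (by omega), hn.eq_zero (by omega)])
  obtain ⟨t, h1, h2, h3⟩ : ∃ t : OGL n, toM t = diagonal (torD ⟨i, hi'⟩ 2) ∧
      ∏ j, torD ⟨i, hi'⟩ 2 j = 1 ∧
      ∀ κ, IsSmall n κ → ∏ j : Fin n, torD ⟨i, hi'⟩ 2 j ^ κ j = 2 ^ κ i := by
    by_cases h : la i = 0
    · exact hn.exists_tor (a := ⟨i, hi'⟩) (fun h' => hi (h.trans h'.symm)) 2 two_ne_zero
    · exact hl.exists_tor (a := ⟨i, hi'⟩) h 2 two_ne_zero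
  have h4 := hF.2 t _ h1 h2 y
  rw [hy.2.1 t _ h1 h2, map_smul, smul_eq_mul, h3 _ hl, h3 _ hn] at h4
  refine (mul_eq_mul_right_iff.1 h4).resolve_left fun h => hi ?_
  exact Nat.pow_right_injective le_rfl (by exact_mod_cast h)

lemma IsLowWt.apply_refl (hl : IsSmall n la) (hn : IsSmall n nu) {F : Module.Dual ℂ V}
    (hF : IsLowWt ρ nu F) {y : V} (hy : y ∈ hwSub n la ρ) (h0 : F y = 0) : F (ρ (rO n) y) = 0 := by
  rcases hy.2.2 with h | h
  · rw [hl.1.conj_zero] at h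
    rcases Nat.eq_zero_or_pos n with rfl | hpos
    · rwa [show rO 0 = 1 from toM_inj (Subsingleton.elim _ _), map_one]
    obtain ⟨a, ha⟩ : ∃ a : Fin n, 2 * (a : ℕ) + 2 = n := ⟨⟨n / 2 - 1, by omega⟩, by
      change 2 * (n / 2 - 1) + 2 = n; omega⟩
    have hla : la a ≠ 0 := fun h' => by have := (hl.1.eq_zero_iff a).1 h'; omega
    obtain ⟨t, h1, h2, h3⟩ := hl.exists_tor hla 2 two_ne_zero
    obtain ⟨d', h4, h5, h6⟩ := rO_conj_diagonal h1 h2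
    have h7 := hF.2 t _ h1 h2 (ρ (rO n) y)
    have hrr : ∀ y, ρ (rO n) (ρ (rO n) y) = y := fun y => by
      rw [← rep_mul_apply, rO_mul_self, map_one]; rfl
    have h8 := hy.2.1 _ _ h4 h5
    rw [rep_mul_apply, rep_mul_apply] at h8
    have har := Fin.val_rev a
    rw [← hrr (ρ t _), h8, h3 _ hn, map_smul, map_smul, prod_eq_single a (fun b _ hb => ?_)
      (by simp), h6, if_pos (Or.inr ha), torD, update_of_ne, update_self,
      smul_eq_mul] at h7
    · by_contra hne
      have h9 := mul_right_cancel₀ hne h7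
      have : (2 : ℂ) ^ (nu a + la a) = 2 ^ 0 := by
        rw [pow_add, ← h9, ← mul_pow, inv_mul_cancel₀ two_ne_zero, one_pow, pow_zero]
      have : 2 ^ (nu a + la a) = 2 ^ 0 := by exact_mod_cast this
      have := Nat.pow_right_injective le_rfl this
      omega
    · intro h'; have := congrArg Fin.val h'; omega
    · by_cases hb' : la b = 0
      · rw [hb', pow_zero]
      · have h9 : (b : ℕ) ≠ a := fun h => hb (Fin.ext h)
        have h10 := mt (hl.1.eq_zero_iff b).2 hb'
        rw [h6, if_neg (by omega), torD, update_of_ne hb, update_of_ne, Pi.one_apply, one_pow]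
        intro h'; have := congrArg Fin.val h'; omega
  · rwa [h]

lemma IsLowWt.kills [FinDim V] (hl : IsSmall n la) (hn : IsSmall n nu)
    {F : Module.Dual ℂ V} (hF : IsLowWt ρ nu F) {y : V} (hy : y ∈ hwSub n la ρ) (h0 : F y = 0)
    (g : OGL n) : F (ρ g y) = 0 :=
  big_cell hy.1 (fun t d ht hd => ⟨_, hy.2.1 t d ht hd⟩) g F hF.1 h0 (hF.apply_refl hl hn hy h0)

lemma IsIrreducibleRep.exists_lowWt [FinDim V] (hρ : IsIrreducibleRep ρ) {v : V}
    (hv : v ≠ 0) (hv' : v ∈ hwSub n nu ρ) : ∃ F : Module.Dual ℂ V, IsLowWt ρ nu F ∧ F v ≠ 0 := by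
  obtain ⟨F, h1, h2, h3⟩ := exists_low_functional hρ hv hv'.1 fun t d ht hd => ⟨_, hv'.2.1 t d ht hd⟩
  exact ⟨F, ⟨h1, fun t d ht hd y => h3 t d ht hd _ (hv'.2.1 t d ht hd) y⟩, h2⟩

open scoped Classical in
theorem finrank_hwSub_irr [FinDim V] (hρ : IsIrreducibleRep ρ) (hl : IsSmall n la)
    (hn : IsSmall n nu) {v : V} (hv : v ≠ 0) (hv' : v ∈ hwSub n nu ρ) :
    Module.finrank ℂ (hwSub n la ρ) = if la = nu then 1 else 0 := by
  obtain ⟨F, hF, hFv⟩ := hρ.exists_lowWt hv hv'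
  have key : ∀ y ∈ hwSub n la ρ, F y = 0 → y = 0 := fun y hy h0 => by
    by_contra hy0
    have := hρ.ext_dual hy0 (F := F) (F' := 0) (hF.kills hl hn hy h0)
    exact hFv (by rw [this]; rfl)
  split_ifs with h
  · subst h
    refine (finrank_eq_one_iff_of_nonzero' (⟨v, hv'⟩ : hwSub n la ρ) fun h =>
      hv (congrArg Subtype.val h)).2 fun y => ⟨F y / F v, Subtype.ext ?_⟩
    refine (sub_eq_zero.1 (key _ (Submodule.sub_mem _ y.2 (Submodule.smul_mem _ (F y / F v) hv'))
      ?_)).symm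
    rw [map_sub, map_smul, smul_eq_mul, div_mul_cancel₀ _ hFv, sub_self]
  · rw [(Submodule.eq_bot_iff _).2 fun y hy => key y hy (hF.eq_zero hl hn h hy), finrank_bot]

/-- Positive definite contravariant Hermitian forms, linear in the second variable. -/
structure IsForm (σ : ORep n W) (B : W → Module.Dual ℂ W) : Prop where
  pos : ∀ y, B y y = 0 → y = 0
  symm : ∀ x y, B x y = star (B y x)
  inv : ∀ g x y, B (σ g x) y = B x (σ (stO g) y)

lemma IsForm.comap {B : W → Module.Dual ℂ W} (hB : IsForm σ B) {f : V →ₗ[ℂ] W}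
    (hf : Injective f) (h : ∀ g x, f (ρ g x) = σ g (f x)) : IsForm ρ fun x => B (f x) ∘ₗ f where
  pos y hy := hf ((hB.pos _ hy).trans (map_zero f).symm)
  symm x y := hB.symm _ _
  inv g x y := by simp only [LinearMap.comp_apply, h]; exact hB.inv _ _ _

lemma isForm_polyRep (n p : ℕ) : IsForm (polyRep n p) fun w =>
    { toFun := fun y => fis y w
      map_add' := fun x y => fis_add_left x y w
      map_smul' := fun c x => fis_smul_left c x w } where
  pos y hy := not_not.1 fun h => fis_self_ne_zero h hy
  symm x y := (fis_star _ _).symm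
  inv g x y := by
    change fis y _ = fis (polyRep n p (stO g) y) x
    rw [fis_polyRep, stO_stO]

theorem finrank_equivariantMaps [FinDim V] [FinDim W]
    (hρ : IsIrreducibleRep ρ) (hl : IsSmall n la) {v : V} (hv : v ≠ 0) (hv' : v ∈ hwSub n la ρ)
    {B : W → Module.Dual ℂ W} (hB : IsForm σ B) :
    Module.finrank ℂ (equivariantMaps ρ σ) = Module.finrank ℂ (hwSub n la σ) := by
  have hev : ∀ f ∈ equivariantMaps ρ σ, ∀ g x, f (ρ g x) = σ g (f x) :=
    fun f hf g x => LinearMap.congr_fun (hf g) x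
  refine LinearEquiv.finrank_eq (LinearEquiv.ofBijective
    (((applyₗ v).comp (Submodule.subtype _)).codRestrict (hwSub n la σ) fun f => ?_)
    ⟨fun f f' h => Subtype.ext (hρ.ext_dual hv fun g => ?_), fun w => ?_⟩)
  · have := hev f.1 f.2
    exact ⟨fun g hg => (this _ _).symm.trans (congrArg f.1 (hv'.1 g hg)), fun g d h1 h2 =>
      ((this _ _).symm.trans (congrArg f.1 (hv'.2.1 g d h1 h2))).trans (map_smul _ _ _),
      hv'.2.2.imp_right fun h => (this _ _).symm.trans (congrArg f.1 h)⟩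
  · rw [hev f.1 f.2, hev f'.1 f'.2]
    exact congrArg (σ g) (congrArg Subtype.val h)
  obtain ⟨w, hw⟩ := w
  obtain ⟨F, hF, hFv⟩ := hρ.exists_lowWt hv hv'
  set τ := ρ.prod σ with hτ
  set X := span ℂ (Set.range fun g => τ g (v, w)) with hX
  have hXg : IsSubrep τ X := fun g x hx => by
    refine span_induction (p := fun x _ => τ g x ∈ X) ?_ ?_ ?_ ?_ hx
    · rintro _ ⟨h, rfl⟩
      exact subset_span ⟨g * h, rep_mul_apply τ g h _⟩
    · rw [map_zero]; exact X.zero_mem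
    · intro x y _ _ hx hy; rw [map_add]; exact X.add_mem hx hy
    · intro c x _ hx; rw [map_smul]; exact X.smul_mem _ hx
  have hvw : (v, w) ∈ hwSub n la τ := ⟨fun g hg => Prod.ext (hv'.1 g hg) (hw.1 g hg),
    fun g d h1 h2 => Prod.ext (hv'.2.1 g d h1 h2) (hw.2.1 g d h1 h2),
    or_iff_not_imp_left.2 fun h => Prod.ext (hv'.2.2.resolve_left h) (hw.2.2.resolve_left h)⟩
  have hBw : ∀ g (c : ℂ), σ (stO g) w = c • w → ∀ y, B w (σ g y) = star c * B w y :=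
    fun g c h y => by
      rw [← stO_stO g, ← hB.inv, h, hB.symm, map_smul, smul_eq_mul, star_mul', ← hB.symm]
  set D : Module.Dual ℂ (V × W) :=
    B w w • F ∘ₗ fst ℂ V W - F v • B w ∘ₗ snd ℂ V W with hD
  have hDa : ∀ x, D x = B w w * F x.1 - F v * B w x.2 := fun x => rfl
  have hDw : IsLowWt τ la D := by
    refine ⟨fun l hll y => ?_, fun t d ht hd y => ?_⟩
    · have h1 := hBw l 1 (by
        rw [one_smul]
        exact hw.1 _ ⟨fun i => by simp [toM_stO, hll.1], fun i j hij => by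
          simp [toM_stO, hll.2 j i hij]⟩) y.2
      rw [star_one, one_mul] at h1
      exact congrArg₂ (fun a b => B w w * a - F v * b) (hF.1 l hll y.1) h1
    · have h1 := hBw t _ (hw.2.1 (stO t) (star d) (by
        rw [toM_stO, ht, diagonal_conjTranspose])
        (by simp only [Pi.star_apply]; rw [← star_prod, hd, star_one])) y.2
      simp only [star_prod, star_pow, Pi.star_apply, star_star] at h1
      refine (congrArg₂ (fun a b => B w w * a - F v * b) (hF.2 t d ht hd y.1) h1).trans ?_
      rw [hDa]
      ring
  have hDX : ∀ x ∈ X, D x = 0 := fun x hx => by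
    refine span_induction (p := fun x _ => D x = 0) ?_ (map_zero D) ?_ ?_ hx
    · rintro _ ⟨g, rfl⟩
      exact hDw.kills hl hl hvw (by rw [hDa]; ring) g
    · intro x y _ _ hx hy; rw [map_add, hx, hy, add_zero]
    · intro c x _ hx; rw [map_smul, hx, smul_zero]
  have hker : ∀ y, ((0, y) : V × W) ∈ X → y = 0 := fun y hy => by
    refine hB.pos y ?_
    have h1 : ∀ x ∈ X, B y x.2 = 0 := fun x hx => by
      refine span_induction (p := fun x _ => B y x.2 = 0) ?_ (map_zero _) ?_ ?_ hx
      · rintro _ ⟨g, rfl⟩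
        have h2 := hDX _ (hXg (stO g) _ hy)
        change B w w * F (ρ (stO g) 0) - F v * B w (σ (stO g) y) = 0 at h2
        rw [map_zero, map_zero, mul_zero, zero_sub, neg_eq_zero, ← hB.inv] at h2
        change B y (σ g w) = 0
        rw [hB.symm, (mul_eq_zero.1 h2).resolve_left hFv, star_zero]
      · intro x z _ _ hx hz
        exact (map_add (B y) _ _).trans (by rw [hx, hz, add_zero])
      · intro c x _ hx
        exact (map_smul (B y) _ _).trans (by rw [hx, smul_zero])
    exact h1 _ hy
  set π : X →ₗ[ℂ] V := fst ℂ V W ∘ₗ X.subtype with hπ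
  have hgen : ∀ g, τ g (v, w) ∈ X := fun g => subset_span ⟨g, rfl⟩
  have hinj : Injective π := (injective_iff_map_eq_zero π).2 fun x hx => by
    have h1 : x.1 = (0, x.1.2) := Prod.ext hx rfl
    exact Subtype.ext (h1.trans (by rw [hker x.1.2 (h1 ▸ x.2)]; rfl))
  have hsurj : Surjective π := range_eq_top.1 (top_le_iff.1 (by
    rw [← hρ.span_eq_top hv, span_le]
    rintro _ ⟨g, rfl⟩
    exact ⟨⟨_, hgen g⟩, rfl⟩))
  set e := LinearEquiv.ofBijective π ⟨hinj, hsurj⟩ with he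
  set f : V →ₗ[ℂ] W := snd ℂ V W ∘ₗ X.subtype ∘ₗ e.symm.toLinearMap with hf
  have hfx : ∀ x (hx : x ∈ X), f x.1 = x.2 := fun x hx => by
    have : e.symm x.1 = ⟨x, hx⟩ := e.symm_apply_eq.2 rfl
    change (e.symm x.1).1.2 = _
    rw [this]
  refine ⟨⟨f, fun g => ext fun y => ?_⟩, Subtype.ext ?_⟩
  · obtain ⟨x, rfl⟩ := hsurj y
    change f (τ g x.1).1 = σ g (f x.1.1)
    rw [hfx _ (hXg g _ x.2), hfx _ x.2]
    rfl
  · have := hfx _ (hgen 1)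
    rw [map_one] at this
    exact this

end TheoremA

section Classification

open Fin Function MvPolynomial

variable {n p : ℕ}

lemma ev_mul_of_rows (hp : 2 * p ≤ n) {f : Pol n p}
    (hf : ∀ g : OGL n, IsUpperUni (toM g) → polyRep n p g f = f) {v : Mat n n} (hv : IsOrth v)
    (h : ∀ i j : Fin n, (i : ℕ) < p → v i j = (1 : Mat n n) i j)
    (X : Mat n p) : ev (v * X) f = ev X f := by
  have hf' : ∀ w : Mat n n, IsOrth w → IsLowerUni w →
      ∀ X : Mat n p, ev (w * X) f = ev X f := fun w hw hl X => by
    have := congrArg (ev X) (hf (mkO wᵀ hw.transpose) (by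
      rw [toM_mkO]; exact isUpperUni_transpose hl))
    rwa [ev_polyRep, toM_mkO, transpose_transpose] at this
  have hd : ∀ X, ev X (polyRep n p (mkO vᵀ hv.transpose) f) = ev (v * X) f := fun X => by
    rw [ev_polyRep, toM_mkO, transpose_transpose]
  rw [← hd]
  refine congrArg (ev X) (sub_eq_zero.1 (not_not.1 fun hne => ?_))
  obtain ⟨Y, hY, hYd⟩ := exists_det_ne_zero hp hne
  have hA := nonsing_inv_mul _ (isUnit_iff_ne_zero.2 hY)
  obtain ⟨w, h1, h2, h3⟩ := exists_slice hp Y _ rfl _ hA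
  obtain ⟨w', h1', h2', h3'⟩ := exists_slice hp (v * Y) ((topM n p)ᵀ * Y) (by
    ext k b
    rw [topM_mul (by omega), topM_mul (by omega), mul_apply]
    simp only [h _ _ (show ((castLE (by omega) k : Fin n) : ℕ) < p from k.2)]
    rw [← mul_apply, Matrix.one_mul]) _ hA
  refine hYd ?_
  have h4 : (v * Y)ᵀ * symForm n * (v * Y) = Yᵀ * symForm n * Y := by
    rw [← symMat_gram, gram_mul_left hv, symMat_gram]
  rw [h4, ← h3] at h3'
  rw [map_sub, hd, ← hf' w' h1' h2', h3', hf' w h1 h2, sub_self]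

/-- Row sums of an exponent. -/
def rowS {q : ℕ} (u : Fin n × Fin q →₀ ℕ) (i : Fin n) : ℕ := ∑ b, u (i, b)

lemma polyRep_diagonal {q : ℕ} {f : Pol n q} (hT : IsTE (polyRep n q) f)
    {u : Fin n × Fin q →₀ ℕ} (hu : coeff u f ≠ 0) {g : OGL n} {d : Vec n}
    (hg : toM g = diagonal d) (hd : ∏ i, d i = 1) :
    polyRep n q g f = (∏ i, d i ^ rowS u i) • f := by
  obtain ⟨c, hc⟩ := hT g d hg hd
  have h1 : polyRep n q g f = lsub (diagonal fun s => d s.1) f := ev_ext fun A => by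
    rw [ev_polyRep, hg, diagonal_transpose, ev_diagonal_mul]
  have h2 := congrArg (coeff u) (h1.symm.trans hc)
  rw [coeff_lsub_diagonal, coeff_smul, smul_eq_mul, Fintype.prod_prod_type] at h2
  rw [hc, ← mul_right_cancel₀ hu h2]
  simp only [rowS, prod_pow_eq_pow_sum]

lemma prod_levD_pow {q : ℕ} (hq : 2 * q ≤ n) {t : Vec q} (ht : ∀ i, t i ≠ 0) (r : NVec n) :
    ∏ i, levD n t t⁻¹ i ^ r i
      = ∏ j, t j ^ ((r (castLE (by omega) j) : ℤ) - r (castLE (by omega) j).rev) := by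
  set d : Vec n := fun i => levD n t t⁻¹ i ^ r i with hd
  have hz : ∀ i, q ≤ i → (fun i : ℕ => if i < q then 1 else 0) i = 0 := fun i hi => if_neg (by omega)
  have h1 : ∀ i, d i = d i ^ (if (i : ℕ) < q then 1 else 0) * d i ^ (if (i.rev : ℕ) < q then 1 else 0) := by
    intro i
    have := val_rev i
    by_cases h : (i : ℕ) < q
    · rw [if_pos h, if_neg (by omega), pow_one, pow_zero, mul_one]
    · by_cases h' : (i.rev : ℕ) < q
      · rw [if_neg h, if_pos h', pow_one, pow_zero, one_mul]
      · simp only [hd, levD]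
        rw [dif_neg h, dif_neg (by omega)]
        simp
  have h2 := prod_pow_castLE (show q ≤ n by omega) hz d
  have h3 := prod_pow_castLE (show q ≤ n by omega) hz (fun i => d i.rev)
  rw [← Equiv.prod_comp revPerm] at h3
  simp only [revPerm_apply, rev_rev] at h3
  change ∏ i, d i = _
  rw [prod_congr rfl fun i _ => h1 i, prod_mul_distrib, h2, h3, ← prod_mul_distrib]
  refine prod_congr rfl fun j _ => ?_
  have := val_rev (castLE (by omega) j : Fin n)
  have hj := j.2
  simp only [val_castLE] at this
  have e : (⟨n - 1 - ((Fin.castLE (by omega) j : Fin n).rev : ℕ), by omega⟩ : Fin q) = j :=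
    Fin.ext (by simp only; omega)
  simp only [j.2, if_true, pow_one, hd, levD, val_castLE, dif_pos]
  rw [dif_neg (by omega), dif_pos (by omega), e, zpow_sub₀ (ht j), zpow_natCast, zpow_natCast,
    Pi.inv_apply, inv_pow]
  rfl

theorem exists_hw (hp : 2 * (p + 1) ≤ n) {c : NVec p} {B : ℕ} (hB : ∑ b, c b ≤ B)
    {U : Submodule ℂ (Pol n p)} (hU : IsSubrep (polyRep n p) U)
    (hUc : U ≤ colHom n p c) (hne : U ≠ ⊥) :
    ∃ m ∈ ptns p B, ∃ f ∈ U, f ≠ 0 ∧ f ∈ hwSub n m.1 (polyRep n p) := by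
  have := finiteDimensional_of_le hUc
  have := nontrivial_iff_ne_bot.2 hne
  obtain ⟨⟨f, hfU⟩, hf0, hfu, hfT⟩ := exists_fixed_of_upper ((polyRep n p).subrepresentation U hU)
  replace hf0 : f ≠ 0 := fun h => hf0 (Subtype.ext h)
  replace hfu : ∀ g, IsUpperUni (toM g) → polyRep n p g f = f := fun g hg =>
    congrArg Subtype.val (hfu g hg)
  replace hfT : IsTE (polyRep n p) f := fun g d h1 h2 =>
    (hfT g d h1 h2).imp fun c hc => congrArg Subtype.val hc
  obtain ⟨u, hu⟩ := MvPolynomial.ne_zero_iff.1 hf0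
  have hS := fun v hv h => ev_mul_of_rows (v := v) (by omega) hfu hv h
  set z : Fin (p + 1) → ℤ := fun j =>
    (rowS u (castLE (by omega) j) : ℤ) - rowS u (castLE (by omega) j).rev with hz
  have hlev : ∀ t : Vec (p + 1), (∀ i, t i ≠ 0) → IsOrth (diagonal (levD n t t⁻¹)) := fun t ht => by
    rw [← lev_diagonal hp]
    refine isOrth_lev hp ?_
    rw [diagonal_transpose, diagonal_mul_diagonal, ← diagonal_one]
    congr 1
    ext i
    exact mul_inv_cancel₀ (ht i)
  have htor : ∀ t : Vec (p + 1), (∀ i, t i ≠ 0) → ∀ X : Mat n p,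
      ev (diagonal (levD n t t⁻¹) * X) f = (∏ i, t i ^ z i) * ev X f := fun t ht X => by
    have := congrArg (ev X) (polyRep_diagonal hfT hu (toM_mkO _ (hlev t ht)) (prod_levD hp ht))
    rwa [ev_polyRep, toM_mkO, diagonal_transpose, ev_smul, prod_levD_pow hp ht] at this
  have hlast : z (last p) = 0 := by
    set t : Vec (p + 1) := update 1 (last p) 2 with ht
    have ht0 : ∀ i, t i ≠ 0 := fun i => by
      rw [ht, update_apply]; split_ifs <;> simp
    obtain ⟨X, -, hX⟩ := exists_det_ne_zero (show 2 * p ≤ n by omega) hf0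
    have h1 := htor t ht0 X
    rw [hS _ (hlev t ht0) (fun i j hi => by
      rw [diagonal_apply, one_apply, levD, dif_pos (by omega), ht, update_of_ne
        (fun h => by have := congrArg Fin.val h; simp at this; omega)]
      rfl), prod_eq_single (last p) (fun b _ hb => by
        rw [ht, update_of_ne hb, Pi.one_apply, _root_.one_zpow]) (by simp), ht,
      update_self] at h1
    exact two_zpow_injective ((mul_eq_right₀ hX).1 h1.symm)
  have hphw : IsPHW n (p + 1) z (snoc c 0)
      (rename (Prod.map id castSucc) f : Pol n (p + 1)) := by
    have hev : ∀ X : Mat n (p + 1), ev X (rename (Prod.map id castSucc) f)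
        = ev (X.submatrix id castSucc) f := fun X => by
      rw [ev, ev, eval_rename]; rfl
    refine ⟨fun w hw hl X => ?_, fun t ht X => ?_, fun s X => ?_⟩
    · rw [hev, hev]
      have := congrArg (ev (X.submatrix id castSucc)) (hfu (mkO wᵀ hw.transpose) (by
        rw [toM_mkO]; exact isUpperUni_transpose hl))
      rwa [ev_polyRep, toM_mkO, transpose_transpose] at this
    · rw [hev, hev, lev_diagonal hp, ← htor t ht]
      rfl
    · rw [hev, hev, prod_univ_castSucc, snoc_last, pow_zero, mul_one]
      simp only [snoc_castSucc]
      rw [← hUc hfU]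
      refine congrArg (fun Y : Mat n p => ev Y f) (ext fun i j => ?_)
      simp [mul_diagonal]
  have hanti : Antitone z := by
    refine antitone_iff_succ_le.2 fun i => hphw.antitone hp (fun h => hf0 ?_) rfl
    exact rename_injective _ (Function.injective_id.prodMap (castSucc_injective p))
      (h.trans (map_zero _).symm)
  have hz0 : ∀ j, 0 ≤ z j := fun j => hlast ▸ hanti (Fin.le_last j)
  set m : ℕ → ℕ := fun i => if h : i < p + 1 then (z ⟨i, h⟩).toNat else 0 with hm
  have hmz : ∀ i, p ≤ i → m i = 0 := fun i hi => by
    simp only [hm]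
    split_ifs with h
    · have : (⟨i, h⟩ : Fin (p + 1)) = Fin.last p := Fin.ext (by simp; omega)
      rw [this, hlast]; rfl
    · rfl
  have hmp : IsPartition m := ⟨fun i j hij => by
    simp only [hm]
    split_ifs with h1 h2
    · exact Int.toNat_le_toNat (hanti hij)
    · omega
    all_goals exact Nat.zero_le _, p, hmz p le_rfl⟩
  refine ⟨⟨m, hmp⟩, mem_ptns.2 ⟨hmz, ?_⟩, f, hfU, hf0, hfu, fun g d hg hd => ?_, Or.inr ?_⟩
  · have h1 := fun b => coeff_col_iff.2 (hUc hfU) u hu b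
    have h2 : ∀ i, rowS u i ≤ ∑ b, c b := fun i => by
      rw [rowS]
      refine sum_le_sum fun b _ => ?_
      rw [← h1]
      exact single_le_sum (f := fun i => u (i, b)) (fun _ _ => Nat.zero_le _) (mem_univ i)
    have h3 := h2 (castLE (by omega) (0 : Fin (p + 1)))
    change m 0 ≤ B
    have h4 : m 0 = (z 0).toNat := dif_pos (Nat.succ_pos p)
    rw [h4, hz]
    simp only
    omega
  · have hd0 : ∀ i, d i ≠ 0 := fun i h => by
      rw [prod_eq_zero (mem_univ i) h] at hd; exact zero_ne_one hd
    have hdo : IsOrth (diagonal d) := hg ▸ toM_isOrth g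
    set t : Vec (p + 1) := fun j => d (castLE (by omega) j) with ht
    have ht0 : ∀ i, t i ≠ 0 := fun i => hd0 _
    refine ev_ext fun X => ?_
    have h1 := hS _ (hdo.mul (hlev t⁻¹ fun i => inv_ne_zero (ht0 i))) (fun i j hi => by
      have e : levD n t⁻¹ t⁻¹⁻¹ i = (d i)⁻¹ := dif_pos (by omega)
      rw [diagonal_mul_diagonal, diagonal_apply, one_apply, e, mul_inv_cancel₀ (hd0 i)])
      (diagonal (levD n t t⁻¹) * X)
    have e : diagonal (levD n t⁻¹ t⁻¹⁻¹) * diagonal (levD n t t⁻¹) = 1 := by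
      rw [diagonal_mul_diagonal, ← diagonal_one]
      refine congrArg diagonal (funext fun i => ?_)
      simp only [levD]
      split_ifs <;> simp [ht0]
    rw [Matrix.mul_assoc, ← Matrix.mul_assoc _ _ X, e, Matrix.one_mul, htor t ht0] at h1
    rw [ev_polyRep, hg, diagonal_transpose, h1, ev_smul]
    refine congrArg (· * ev X f) ?_
    change _ = ∏ i : Fin n, d i ^ m i
    rw [prod_pow_castLE (show p + 1 ≤ n by omega) (fun i hi => hmz i (by omega))]
    refine prod_congr rfl fun j _ => ?_
    have : m j = (z j).toNat := dif_pos j.2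
    rw [this, ← zpow_natCast, Int.toNat_of_nonneg (hz0 j)]
  · refine ev_ext fun X => ?_
    rw [ev_polyRep, rO, toM_mkO, reflMatrix_transpose]
    refine hS _ (isOrth_reflMatrix _) (fun i j hi => ?_) X
    simp only [reflMatrix, of_apply, one_apply]
    split_ifs <;> first | rfl | omega

end Classification

section TensorProducts

variable {n p q : ℕ} {V W : Type*} [AddCommGroup V] [Module ℂ V] [AddCommGroup W] [Module ℂ W]
  {ρ : ORep n V} {σ : ORep n W} {la nu : ℕ → ℕ}

section

open LinearMap Module Function

/-- The number of independent highest weight vectors inside a subspace. -/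
def hwDim (la : ℕ → ℕ) (σ : ORep n W) (A : Submodule ℂ W) : ℕ :=
  finrank ℂ (hwSub n la σ ⊓ A : Submodule ℂ W)

lemma map_mem_hwSub {f : V →ₗ[ℂ] W} (hf : Injective f)
    (h : ∀ g x, f (ρ g x) = σ g (f x)) {v : V} : f v ∈ hwSub n la σ ↔ v ∈ hwSub n la ρ := by
  simp only [mem_hwSub, ← h, ← map_smul, hf.eq_iff]

lemma hwDim_map {f : V →ₗ[ℂ] W} (hf : Injective f)
    (h : ∀ g x, f (ρ g x) = σ g (f x)) (A : Submodule ℂ V) :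
    hwDim la σ (A.map f) = hwDim la ρ A := by
  have : hwSub n la σ ⊓ A.map f = (hwSub n la ρ ⊓ A).map f := by
    ext w
    constructor
    · rintro ⟨hw, v, hv, rfl⟩
      exact ⟨v, ⟨(map_mem_hwSub hf h).1 hw, hv⟩, rfl⟩
    · rintro ⟨v, ⟨hv, hA⟩, rfl⟩
      exact ⟨(map_mem_hwSub hf h).2 hv, v, hA, rfl⟩
  rw [hwDim, this]
  exact (Submodule.equivMapOfInjective f hf _).finrank_eq.symm

lemma hwDim_range {f : V →ₗ[ℂ] W} (hf : Injective f) (h : ∀ g x, f (ρ g x) = σ g (f x)) :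
    hwDim la σ (range f) = finrank ℂ (hwSub n la ρ) := by
  rw [← Submodule.map_top, hwDim_map hf h, hwDim, inf_top_eq]

lemma hwDim_sup {A A' : Submodule ℂ W} [FinDim A] [FinDim A']
    (hA : IsSubrep σ A) (hA' : IsSubrep σ A') (hd : Disjoint A A') :
    hwDim la σ (A ⊔ A') = hwDim la σ A + hwDim la σ A' := by
  have key : ∀ g (c : ℂ), ∀ a ∈ A, ∀ b ∈ A', σ g (a + b) = c • (a + b) →
      σ g a = c • a ∧ σ g b = c • b := fun g c a ha b hb h => by
    rw [map_add, smul_add] at h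
    have h1 : σ g a - c • a = c • b - σ g b := 
      sub_eq_sub_iff_add_eq_add.2 (h.trans (add_comm _ _))
    have h2 := disjoint_def.1 hd _ (A.sub_mem (hA g a ha) (A.smul_mem c ha))
      (h1 ▸ A'.sub_mem (A'.smul_mem c hb) (hA' g b hb))
    exact ⟨sub_eq_zero.1 h2, (sub_eq_zero.1 (h1 ▸ h2)).symm⟩
  have h : hwSub n la σ ⊓ (A ⊔ A') = (hwSub n la σ ⊓ A) ⊔ (hwSub n la σ ⊓ A') := by
    refine le_antisymm (fun x hx => ?_) (sup_le (inf_le_inf_left _ le_sup_left)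
      (inf_le_inf_left _ le_sup_right))
    obtain ⟨⟨h1, h2, h3⟩, hx⟩ := hx
    obtain ⟨a, ha, b, hb, rfl⟩ := mem_sup.1 hx
    have k1 := fun g hg => key g 1 a ha b hb (by rw [one_smul]; exact h1 g hg)
    have k3 := h3.imp_right fun h => key _ 1 a ha b hb (by rw [one_smul]; exact h)
    simp only [one_smul] at k1 k3
    have k2 := fun g d hg hd => key g _ a ha b hb (h2 g d hg hd)
    exact add_mem_sup
      ⟨⟨fun g hg => (k1 g hg).1, fun g d hg hd => (k2 g d hg hd).1, k3.imp_right And.left⟩, ha⟩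
      ⟨⟨fun g hg => (k1 g hg).2, fun g d hg hd => (k2 g d hg hd).2, k3.imp_right And.right⟩, hb⟩
  rw [hwDim, h, ← add_zero (finrank ℂ _), ← finrank_bot ℂ W, ← (hd.mono (inf_le_right
    (a := hwSub n la σ)) (inf_le_right (a := hwSub n la σ))).eq_bot,
    finrank_sup_add_finrank_inf_eq]
  rfl

lemma IsForm.exists_compl {B : W → Module.Dual ℂ W} (hB : IsForm σ B) {A : Submodule ℂ W}
    [FinDim A] (hA : IsSubrep σ A) : ∃ A', IsSubrep σ A' ∧ IsCompl A A' := by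
  set b := finBasis ℂ A
  set Φ : W →ₗ[ℂ] (Vec (finrank ℂ A)) := LinearMap.pi fun i => B (b i) with hΦ
  have hk : ∀ y, Φ y = 0 ↔ ∀ x ∈ A, B y x = 0 := fun y => by
    refine ⟨fun h x hx => ?_, fun h => funext fun i => (hB.symm _ _).trans (by
      rw [h _ (b i).2, star_zero]; rfl)⟩
    have : B y ∘ₗ A.subtype = 0 := b.ext fun i => (hB.symm _ _).trans
      ((congrArg star (congrFun h i)).trans (star_zero _))
    exact LinearMap.congr_fun this ⟨x, hx⟩
  have hinj : Injective (Φ ∘ₗ A.subtype) := (injective_iff_map_eq_zero _).2 fun x hx =>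
    Subtype.ext (hB.pos _ ((hk _).1 hx _ x.2))
  have hsurj := (injective_iff_surjective_of_finrank_eq_finrank (by simp)).1 hinj
  refine ⟨ker Φ, fun g x hx => (hk _).2 fun y hy => ?_,
    disjoint_def.2 fun x hx h => hB.pos x ((hk x).1 h x hx), codisjoint_iff.2 ?_⟩
  · rw [hB.inv]
    exact (hk x).1 hx _ (hA _ _ hy)
  · refine (eq_top_iff').2 fun x => ?_
    obtain ⟨a, ha⟩ := hsurj (Φ x)
    exact mem_sup.2 ⟨a, a.2, x - a, by
      rw [mem_ker, map_sub, ← ha]; exact sub_self _, add_sub_cancel _ _⟩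

lemma IsIrreducibleRep.exists_embed [FinDim V] [FinDim W]
    (hρ : IsIrreducibleRep ρ) (hl : IsSmall n la) {v : V} (hv : v ≠ 0) (hv' : v ∈ hwSub n la ρ)
    {B : W → Module.Dual ℂ W} (hB : IsForm σ B) (hne : finrank ℂ (hwSub n la σ) ≠ 0) :
    ∃ f : V →ₗ[ℂ] W, Injective f ∧ ∀ g x, f (ρ g x) = σ g (f x) := by
  rw [← finrank_equivariantMaps hρ hl hv hv' hB] at hne
  obtain ⟨⟨f, hf⟩, hf0⟩ := finrank_pos_iff_exists_ne_zero.1 (Nat.pos_of_ne_zero hne)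
  have hf' : ∀ g x, f (ρ g x) = σ g (f x) := fun g x => LinearMap.congr_fun (hf g) x
  refine ⟨f, ker_eq_bot.1 ((hρ.2 (ker f) fun g x hx => ?_).resolve_right
    fun h => hf0 (Subtype.ext (ker_eq_top.1 h))), hf'⟩
  rw [mem_ker, hf', mem_ker.1 hx, map_zero]

end

section

open Fin MvPolynomial

/-- Multiplication of polynomials in disjoint sets of columns. -/
def mulEquiv (n p q : ℕ) : Pol n p ⊗[ℂ] Pol n q ≃ₐ[ℂ] Pol n (p + q) :=
  (tensorEquivSum ℂ _ _ ℂ).trans (renameEquiv ℂ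
    ((Equiv.prodSumDistrib _ _ _).symm.trans (Equiv.prodCongr (Equiv.refl _) finSumFinEquiv)))

lemma ev_mulEquiv (X : Mat n (p + q)) (f : Pol n p) (g : Pol n q) : ev X (mulEquiv n p q (f ⊗ₜ g))
      = ev (X.submatrix id (castAdd q)) f * ev (X.submatrix id (natAdd p)) g := by
  have h1 : (aeval fun s => X s.1 s.2).comp ((mulEquiv n p q).toAlgHom.comp
      Algebra.TensorProduct.includeLeft) = aeval fun s => X s.1 (castAdd q s.2) :=
    algHom_ext fun s => by simp [mulEquiv]
  have h2 : (aeval fun s => X s.1 s.2).comp ((mulEquiv n p q).toAlgHom.comp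
      Algebra.TensorProduct.includeRight) = aeval fun s => X s.1 (natAdd p s.2) :=
    algHom_ext fun s => by simp [mulEquiv]
  rw [← mul_one f, ← one_mul g, ← Algebra.TensorProduct.tmul_mul_tmul, map_mul, map_mul, mul_one,
    one_mul]
  exact congrArg₂ (· * ·) (DFunLike.congr_fun h1 f) (DFunLike.congr_fun h2 g)

lemma mulEquiv_tprod (g : OGL n) (x) : mulEquiv n p q ((polyRep n p).tprod (polyRep n q) g x)
    = polyRep n (p + q) g (mulEquiv n p q x) := by
  induction x with
  | zero => simp
  | add x y hx hy => simp only [map_add, hx, hy]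
  | tmul f h =>
    refine ev_ext fun X => ?_
    rw [Representation.tprod_apply, TensorProduct.map_tmul, ev_polyRep, ev_mulEquiv, ev_mulEquiv,
      ev_polyRep, ev_polyRep]
    rfl

lemma map_colHom (c : NVec p) (d : NVec q) :
    (map₂ (TensorProduct.mk ℂ _ _) (colHom n p c) (colHom n q d)).map
      (mulEquiv n p q).toLinearMap = colHom n (p + q) (append c d) := by
  refine le_antisymm (map_le_iff_le_comap.2 (map₂_le.2
    fun f hf g hg t A => ?_)) fun f hf => ?_
  · have e1 : (A * diagonal t).submatrix id (castAdd q)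
        = A.submatrix id (castAdd q) * diagonal fun j => t (castAdd q j) :=
      ext fun i j => by simp
    have e2 : (A * diagonal t).submatrix id (natAdd p)
        = A.submatrix id (natAdd p) * diagonal fun j => t (natAdd p j) :=
      Matrix.ext fun i j => by simp
    refine (ev_mulEquiv _ _ _).trans ?_
    rw [e1, e2, hf, hg, prod_univ_add]
    simp only [append_left, append_right]
    refine Eq.trans ?_ (congrArg _ (ev_mulEquiv _ _ _).symm)
    ring
  · rw [f.as_sum]
    refine Submodule.sum_mem _ fun u hu => ?_
    have hc := coeff_col_iff.2 hf u (mem_support_iff.1 hu)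
    have key : ∀ {r : ℕ} (ι : Fin r → Fin (p + q)) (a : ℂ), monomial (Finsupp.equivFunOnFinite.symm
        fun s : Fin n × Fin r => u (s.1, ι s.2)) a ∈ colHom n r (append c d ∘ ι) :=
      fun ι a => coeff_col_iff.1 fun v hv b => by
        rw [coeff_monomial, ne_eq, ite_eq_right_iff, Classical.not_imp] at hv
        rw [← hv.1]
        exact hc (ι b)
    refine ⟨_, apply_mem_map₂ _ (m := monomial _ (coeff u f)) (n := monomial _ 1)
      (by simpa [Function.comp_def] using key (castAdd q) (coeff u f))
      (by simpa [Function.comp_def] using key (natAdd p) 1), ev_ext fun X => ?_⟩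
    refine (ev_mulEquiv _ _ _).trans ?_
    simp only [ev, eval_monomial, Finsupp.prod_fintype, pow_zero, implies_true,
      Fintype.prod_prod_type_right, prod_univ_add, Finsupp.equivFunOnFinite_symm_apply_apply,
      submatrix_apply, id]
    ring

end

open LinearMap Module Function

local notation "tens" => map₂ (TensorProduct.mk ℂ _ _)

/-- Irreducible subrepresentations of highest weight `la`. -/
def IsIrrIn (σ : ORep n W) (la : ℕ → ℕ) (A : Submodule ℂ W) : Prop :=
  ∃ h : IsSubrep σ A, FinDim A ∧ IsIrreducibleRep (σ.subrepresentation A h) ∧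
    ∃ v ≠ 0, v ∈ hwSub n la (σ.subrepresentation A h)

lemma isSmall_of_mem_ptns {m : Ptn} {B : ℕ} (hp : 2 * p ≤ n) (hm : m ∈ ptns p B) : IsSmall n m.1 :=
  ⟨m.2, by have := (m.2.eq_zero_iff p).1 ((mem_ptns.1 hm).1 p le_rfl); omega⟩

open Classical in
lemma IsIrrIn.hwDim_eq {nu : ℕ → ℕ} {A : Submodule ℂ W} (h : IsIrrIn σ nu A) (hl : IsSmall n la)
    (hn : IsSmall n nu) : hwDim la σ A = if la = nu then 1 else 0 := by
  obtain ⟨hA, _, hi, v, hv, hv'⟩ := h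
  rw [← finrank_hwSub_irr hi hl hn hv hv', ← hwDim_range A.injective_subtype (fun _ _ => rfl),
    range_subtype]

lemma IsIrrIn.exists_range [FinDim V] (hρ : IsIrreducibleRep ρ) (hl : IsSmall n la)
    {v : V} (hv : v ≠ 0) (hv' : v ∈ hwSub n la ρ) {A : Submodule ℂ (Pol n p)}
    (h : IsIrrIn (polyRep n p) la A) : ∃ j : V →ₗ[ℂ] Pol n p,
      Injective j ∧ (∀ g x, j (ρ g x) = polyRep n p g (j x)) ∧ range j = A := by
  have h1 := h.hwDim_eq hl hl
  obtain ⟨hA, _, hi, -⟩ := h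
  obtain ⟨f, hf, hf'⟩ := hρ.exists_embed hl hv hv' ((isForm_polyRep n p).comap
    (ρ := (polyRep n p).subrepresentation A hA) A.injective_subtype fun _ _ => rfl) (by
      rw [← hwDim_range (σ := polyRep n p) A.injective_subtype (fun _ _ => rfl), range_subtype, h1]; simp)
  refine ⟨A.subtype ∘ₗ f, A.injective_subtype.comp hf,
    fun g x => congrArg Subtype.val (hf' g x), ?_⟩
  rw [range_comp, (hi.2 (range f) ?_).resolve_left fun h0 => hv (hf ?_), map_subtype_top]
  · rintro g _ ⟨x, rfl⟩
    exact ⟨ρ g x, hf' g x⟩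
  · rw [range_eq_bot.1 h0]
    rfl

lemma exists_isIrrIn (σ : ORep n W) (la : ℕ → ℕ) : ∃ E, IsSubrep σ E ∧
    FinDim E ∧ ∀ A, IsIrrIn σ la A → IsIrrIn σ la E := by
  by_cases h : ∃ A, IsIrrIn σ la A
  · obtain ⟨A, hA⟩ := h
    exact ⟨A, hA.1, hA.2.1, fun _ _ => hA⟩
  · exact ⟨⊥, fun g x hx => by rw [(mem_bot ℂ).1 hx, map_zero]; exact zero_mem _,
      inferInstance, fun A hA => (h ⟨A, hA⟩).elim⟩

lemma sum_hwDim (hp : 2 * (p + 1) ≤ n) {c : NVec p} {B : ℕ} (hB : ∑ b, c b ≤ B)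
    {φ : Submodule ℂ (Pol n p) → ℕ} {M : Ptn → ℕ} (h0 : φ ⊥ = 0)
    (hadd : ∀ A A' : Submodule ℂ _, FinDim A → FinDim A' →
      IsSubrep (polyRep n p) A → IsSubrep (polyRep n p) A' → Disjoint A A' →
      φ (A ⊔ A') = φ A + φ A')
    (hirr : ∀ A, ∀ m ∈ ptns p B, IsIrrIn (polyRep n p) m.1 A → φ A = M m) :
    φ (colHom n p c) = ∑ m ∈ ptns p B, oNum p m.1 c * M m := by
  have key : ∀ (N : ℕ) (U : Submodule ℂ _), finrank ℂ U < N → IsSubrep (polyRep n p) U →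
      U ≤ colHom n p c → φ U = ∑ m ∈ ptns p B, hwDim m.1 (polyRep n p) U * M m := by
    intro N
    induction N with
    | zero => exact fun U h => absurd h (Nat.not_lt_zero _)
    | succ N ih =>
      intro U hN hU hUc
      have := finiteDimensional_of_le hUc
      by_cases hb : U = ⊥
      · subst hb
        rw [h0, sum_eq_zero fun m _ => ?_]
        rw [hwDim, inf_bot_eq, finrank_bot, zero_mul]
      by_cases hA : ∃ A ≤ U, IsSubrep (polyRep n p) A ∧ A ≠ ⊥ ∧ A ≠ U
      · obtain ⟨A, hAU, hA, hA0, hA1⟩ := hA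
        have := finiteDimensional_of_le hAU
        obtain ⟨C, hC, hAC⟩ := (isForm_polyRep n p).exists_compl hA
        have hU' : U = A ⊔ C ⊓ U := by
          rw [← sup_inf_assoc_of_le C hAU, hAC.sup_eq_top, top_inf_eq]
        have hC' : IsSubrep (polyRep n p) (C ⊓ U) := fun g x hx => ⟨hC g x hx.1, hU g x hx.2⟩
        have hd : Disjoint A (C ⊓ U) := hAC.disjoint.mono_right inf_le_left
        have hlt : ∀ X : Submodule ℂ _, X ≤ U → X ≠ U → finrank ℂ X < N := fun X h1 h2 =>
          (finrank_lt_finrank_of_lt (lt_of_le_of_ne h1 h2)).trans_le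
            (Nat.lt_succ_iff.1 hN)
        have := finiteDimensional_of_le (inf_le_right : C ⊓ U ≤ U)
        have hCU : C ⊓ U ≠ U := fun h => hA0 (hAC.disjoint.eq_bot_of_le
          (hAU.trans (inf_eq_right.1 h)))
        rw [hU', hadd _ _ ‹_› ‹_› hA hC' hd, ih A (hlt A hAU hA1) hA (hAU.trans hUc),
          ih _ (hlt _ inf_le_right hCU) hC' (inf_le_right.trans hUc), ← sum_add_distrib]
        exact sum_congr rfl fun m _ => by rw [hwDim_sup hA hC' hd, add_mul]
      · obtain ⟨m, hm, f, hfU, hf0, hf⟩ := exists_hw hp hB hU hUc hb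
        have hI : IsIrrIn (polyRep n p) m.1 U := by
          refine ⟨hU, this, ⟨nontrivial_iff_ne_bot.2 hb, fun X hX => ?_⟩, ⟨f, hfU⟩,
            fun h => hf0 (congrArg Subtype.val h),
            (map_mem_hwSub U.injective_subtype fun _ _ => rfl).1 hf⟩
          by_contra! h
          refine hA ⟨X.map U.subtype, map_subtype_le _ _, ?_, fun h' => h.1 ?_,
            fun h' => h.2 ?_⟩
          · rintro g _ ⟨x, hx, rfl⟩
            exact ⟨_, hX g x hx, rfl⟩
          · exact map_injective_of_injective U.injective_subtype
              (h'.trans (Submodule.map_bot _).symm)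
          · exact map_injective_of_injective U.injective_subtype
              (h'.trans (map_subtype_top U).symm)
        have hs := fun m' (h : m' ∈ ptns p B) =>
          isSmall_of_mem_ptns (show 2 * p ≤ n by omega) h
        classical
        rw [hirr U m hm hI, sum_eq_single_of_mem m hm fun m' hm' hne => by
          rw [hI.hwDim_eq (hs _ hm') (hs _ hm), if_neg fun h => hne (Subtype.ext h), zero_mul],
          hI.hwDim_eq (hs _ hm) (hs _ hm), if_pos rfl, one_mul]
  rw [key _ _ (Nat.lt_succ_self _) (isSubrep_colHom c) le_rfl]
  refine sum_congr rfl fun m hm => ?_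
  rw [hwDim, finrank_hwSub (by omega) m.2 (mem_ptns.1 hm).1]

lemma finrank_sup_eq_iff {A A' : Submodule ℂ W} [FinDim A] [FinDim A'] :
    finrank ℂ (A ⊔ A' : Submodule ℂ W) = finrank ℂ A + finrank ℂ A' ↔ Disjoint A A' := by
  rw [← finrank_sup_add_finrank_inf_eq, left_eq_add, finrank_eq_zero, disjoint_iff]

lemma finrank_tens (A : Submodule ℂ V) (C : Submodule ℂ W) [FinDim A]
    [FinDim C] : FinDim (tens A C) ∧ finrank ℂ (tens A C) = finrank ℂ A * finrank ℂ C := by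
  have h : Injective (TensorProduct.mapIncl A C) :=
    TensorProduct.map_injective_of_flat_flat _ _ A.injective_subtype C.injective_subtype
  rw [← TensorProduct.range_mapIncl]
  exact ⟨inferInstance, (finrank_range_of_inj h).trans finrank_tensorProduct⟩

lemma isSubrep_tens {A : Submodule ℂ V} {C : Submodule ℂ W} (hA : IsSubrep ρ A)
    (hC : IsSubrep σ C) : IsSubrep (ρ.tprod σ) (tens A C) := by
  intro g
  have h : tens A C ≤ (tens A C).comap (ρ.tprod σ g) := by
    refine map₂_le.2 fun a ha c hc => ?_
    have h : ρ.tprod σ g (TensorProduct.mk ℂ V W a c) = TensorProduct.mk ℂ V W (ρ g a) (σ g c) :=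
      TensorProduct.map_tmul ..
    rw [mem_comap, h]
    exact apply_mem_map₂ _ (hA g a ha) (hC g c hc)
  exact fun x hx => h hx

section

variable {U W' : Type*} [AddCommGroup U] [Module ℂ U] [AddCommGroup W'] [Module ℂ W']
  {π : ORep n U} {τ : ORep n W'}
  {j : V →ₗ[ℂ] U} {k : W →ₗ[ℂ] W'}

lemma map_tprod (hj' : ∀ g x, j (ρ g x) = π g (j x)) (hk' : ∀ g x, k (σ g x) = τ g (k x)) (g x) :
    TensorProduct.map j k (ρ.tprod σ g x) = π.tprod τ g (TensorProduct.map j k x) := by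
  induction x with
  | zero => simp
  | add x y hx hy => simp only [map_add, hx, hy]
  | tmul f h => simp [hj', hk']

lemma hwDim_tens (hj : Injective j) (hk : Injective k)
    (hj' : ∀ g x, j (ρ g x) = π g (j x)) (hk' : ∀ g x, k (σ g x) = τ g (k x)) :
    hwDim la (π.tprod τ) (tens (range j) (range k)) = finrank ℂ (hwSub n la (ρ.tprod σ)) := by
  rw [← TensorProduct.range_map, hwDim_range (TensorProduct.map_injective_of_flat_flat _ _ hj hk)
    (map_tprod hj' hk')]

end

lemma hwDim_bot : hwDim la σ ⊥ = 0 := by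
  rw [hwDim, inf_bot_eq, finrank_bot]

lemma hwDim_tens_sup_left {A A' : Submodule ℂ V} {C : Submodule ℂ W} [FinDim A]
    [FinDim A'] [FinDim C] (hA : IsSubrep ρ A) (hA' : IsSubrep ρ A')
    (hC : IsSubrep σ C) (hd : Disjoint A A') : hwDim la (ρ.tprod σ) (tens (A ⊔ A') C)
      = hwDim la (ρ.tprod σ) (tens A C) + hwDim la (ρ.tprod σ) (tens A' C) := by
  have h1 := finrank_tens A C
  have h2 := finrank_tens A' C
  have := h1.1
  have := h2.1
  have h3 := (finrank_tens (A ⊔ A') C).2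
  rw [finrank_sup_eq_iff.2 hd, add_mul, ← h1.2, ← h2.2, map₂_sup_left, finrank_sup_eq_iff] at h3
  rw [map₂_sup_left, hwDim_sup (isSubrep_tens hA hC) (isSubrep_tens hA' hC) h3]

lemma hwDim_tens_sup_right {C : Submodule ℂ V} {A A' : Submodule ℂ W} [FinDim A]
    [FinDim A'] [FinDim C] (hA : IsSubrep σ A) (hA' : IsSubrep σ A')
    (hC : IsSubrep ρ C) (hd : Disjoint A A') : hwDim la (ρ.tprod σ) (tens C (A ⊔ A'))
      = hwDim la (ρ.tprod σ) (tens C A) + hwDim la (ρ.tprod σ) (tens C A') := by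
  have h1 := finrank_tens C A
  have h2 := finrank_tens C A'
  have := h1.1
  have := h2.1
  have h3 := (finrank_tens C (A ⊔ A')).2
  rw [finrank_sup_eq_iff.2 hd, mul_add, ← h1.2, ← h2.2, map₂_sup_right, finrank_sup_eq_iff] at h3
  rw [map₂_sup_right, hwDim_sup (isSubrep_tens hC hA) (isSubrep_tens hC hA') h3]

lemma isIrrIn_range [FinDim V] (hρ : IsIrreducibleRep ρ) {v : V} (hv : v ≠ 0)
    (hv' : v ∈ hwSub n la ρ) {j : V →ₗ[ℂ] W} (hj : Injective j)
    (hj' : ∀ g x, j (ρ g x) = σ g (j x)) : IsIrrIn σ la (range j) := by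
  have hs := j.surjective_rangeRestrict
  have hi : Injective j.rangeRestrict := fun x y h => hj (congrArg Subtype.val h)
  have hr : IsSubrep σ (range j) := by
    rintro g _ ⟨x, rfl⟩
    exact ⟨ρ g x, hj' g x⟩
  have he : ∀ g x, j.rangeRestrict (ρ g x) = σ.subrepresentation _ hr g (j.rangeRestrict x) :=
    fun g x => Subtype.ext (hj' g x)
  have := hρ.1
  refine ⟨hr, inferInstance, ⟨hi.nontrivial, fun X hX => ?_⟩, _,
    (map_ne_zero_iff _ hi).2 hv, (map_mem_hwSub hi he).2 hv'⟩
  rw [← map_comap_eq_of_surjective hs X]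
  refine (hρ.2 (X.comap j.rangeRestrict) fun g x hx => ?_).imp (fun h => ?_) fun h => ?_
  · rw [mem_comap, he]
    exact hX g _ hx
  · rw [h, Submodule.map_bot]
  · rw [h, Submodule.map_top, range_eq_top.2 hs]

lemma oNum_rs_ne_zero (hl : IsPartition la) (h : ∀ i, p ≤ i → la i = 0) :
    oNum p la (rs p la) ≠ 0 := by
  classical
  have h0 : pdeg (0 : PairIdx p → ℕ) = 0 := funext fun b => by simp [pdeg]
  have h1 : (0 : PairIdx p → ℕ) ∈ pairSet p (rs p la) := mem_pairSet.2 (h0 ▸ zero_le)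
  refine (sum_pos' (fun _ _ => Nat.zero_le _) ⟨0, h1, ?_⟩).ne'
  rw [gtNum, card_pos]
  refine ⟨fun i b => if i = b then la i else 0, mem_filter.2 ⟨mem_mats.2 ⟨fun i b hb => ?_,
      fun i a => ?_, fun i => ?_⟩, funext fun b => ?_⟩⟩
  · grind
  · simp only [cum, sum_ite_eq, mem_range, Pi.zero_apply]
    have := hl.1 (Nat.le_add_right i 1)
    split_ifs <;> omega
  · simp_all
  · rw [h0, tsub_zero]
    simp only [cols, colSum, sum_ite_eq', mem_range, b.2, if_true, rs]

lemma exists_embed_poly [FinDim V] (hρ : IsIrreducibleRep ρ) (hp : 2 * p ≤ n)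
    (hl : IsPartition la) (h : ∀ i, p ≤ i → la i = 0) {v : V} (hv : v ≠ 0)
    (hv' : v ∈ hwSub n la ρ) : ∃ j : V →ₗ[ℂ] Pol n p,
      Injective j ∧ ∀ g x, j (ρ g x) = polyRep n p g (j x) := by
  let A := colHom n p (rs p la)
  obtain ⟨f, hf, hf'⟩ := hρ.exists_embed
    ⟨hl, by have := (hl.eq_zero_iff p).1 (h p le_rfl); omega⟩ hv hv' ((isForm_polyRep n p).comap
    (ρ := (polyRep n p).subrepresentation A (isSubrep_colHom _)) A.injective_subtype
    fun _ _ => rfl) (by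
      rw [← hwDim_range (σ := polyRep n p) A.injective_subtype (fun _ _ => rfl),
        range_subtype, hwDim, finrank_hwSub hp hl h]
      exact oNum_rs_ne_zero hl h)
  exact ⟨A.subtype ∘ₗ f, A.injective_subtype.comp hf, fun g x => congrArg Subtype.val (hf' g x)⟩

lemma finrank_hwSub_congr (e : V ≃ₗ[ℂ] W) (h : ∀ g x, e (ρ g x) = σ g (e x)) :
    Module.finrank ℂ (hwSub n la ρ) = Module.finrank ℂ (hwSub n la σ) := by
  rw [← hwDim_range (f := e.toLinearMap) e.injective h, LinearEquiv.range, hwDim, inf_top_eq]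

/-- An irreducible representation of highest weight zero is trivial. -/
lemma exists_trivial_equiv [FinDim V] (hρ : IsIrreducibleRep ρ) (hl : IsPartition la)
    (h : ∀ i, la i = 0) {v : V} (hv : v ≠ 0) (hv' : v ∈ hwSub n la ρ) :
    ∃ e : W ≃ₗ[ℂ] V ⊗[ℂ] W, ∀ g x, e (σ g x) = ρ.tprod σ g (e x) := by
  obtain ⟨j, hj, hj'⟩ := exists_embed_poly (p := 0) hρ (Nat.zero_le n) hl (fun i _ => h i) hv hv'
  have ht : ∀ g x, ρ g x = x := fun g x => hj <| by
    rw [hj']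
    exact ev_ext fun X => by rw [ev_polyRep]; congr 2; ext _ k; exact k.elim0
  have hs := hρ.span_eq_top hv
  simp only [ht] at hs
  rw [Set.range_const, span_singleton_eq_top_iff] at hs
  let e : ℂ ≃ₗ[ℂ] V := LinearEquiv.ofBijective (toSpanSingleton ℂ V v)
    ⟨smul_left_injective ℂ hv, hs⟩
  refine ⟨(TensorProduct.lid ℂ W).symm ≪≫ₗ TensorProduct.congr e (LinearEquiv.refl ℂ W),
    fun g x => ?_⟩
  simp [ht]

lemma sum_ptns_zero (a : ℕ) (B : ℕ) (d : NVec 0) : ∑ v ∈ ptns 0 B, a * oNum 0 v.1 d = a := by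
  classical
  have h1 : pairSet 0 d = {0} := by
    ext j
    simp only [mem_pairSet, mem_singleton]
    exact ⟨fun _ => funext fun t => t.1.1.elim0, fun _ b => b.elim0⟩
  have h2 : ∀ c, gtNum 0 0 0 0 c = 1 := fun c => card_eq_one.2 ⟨0, by
    ext e
    simp only [mem_filter, mem_singleton, mem_mats]
    refine ⟨fun h => funext fun i => funext fun b => ?_, ?_⟩
    · by_contra hb
      exact absurd (h.1.1 i b hb).1 (Nat.not_lt_zero _)
    · rintro rfl
      exact ⟨⟨fun i b h => absurd rfl h, fun i a => by simp [cum], fun i => rfl⟩,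
        funext fun b => b.elim0⟩⟩
  let z : Ptn := ⟨0, fun _ _ _ => le_rfl, 0, rfl⟩
  rw [sum_eq_single_of_mem z (mem_ptns.2 ⟨fun _ _ => rfl, Nat.zero_le _⟩) fun v hv hvz =>
    (hvz (Subtype.ext (funext fun i => (mem_ptns.1 hv).1 i (Nat.zero_le _)))).elim, oNum, h1,
    sum_singleton, h2, mul_one]

lemma oNum_cast {K : ℕ} (h : K = q) (d : NVec q) : oNum K la (d ∘ Fin.cast h) = oNum q la d := by
  subst h
  rfl

lemma exists_mult (lam : Ptn) (hp : 2 * (p + 1) ≤ n) (hq : 2 * (q + 1) ≤ n)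
    (hpq : 2 * (p + q) ≤ n) (hlam : ∀ i, p + q ≤ i → lam.1 i = 0) : ∃ (E : Ptn → Submodule ℂ _) (E' : Ptn → Submodule ℂ _),
    (∀ (m : Ptn) A, IsIrrIn (polyRep n p) m.1 A → IsIrrIn (polyRep n p) m.1 (E m)) ∧
    (∀ (m : Ptn) A, IsIrrIn (polyRep n q) m.1 A → IsIrrIn (polyRep n q) m.1 (E' m)) ∧
    ∀ B (c : NVec p) (d : NVec q), ∑ b, c b ≤ B → ∑ b, d b ≤ B →
      oNum (p + q) lam.1 (Fin.append c d) = ∑ m ∈ ptns p B, ∑ v ∈ ptns q B,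
        hwDim lam.1 ((polyRep n p).tprod (polyRep n q)) (tens (E m) (E' v)) * oNum p m.1 c
          * oNum q v.1 d := by
  choose E hE hEf hE' using fun m : Ptn => exists_isIrrIn (polyRep n p) m.1
  choose F hF hFf hF' using fun m : Ptn => exists_isIrrIn (polyRep n q) m.1
  refine ⟨E, F, hE', hF', fun B c d hc hd => ?_⟩
  have hi : ∀ {B' m} {k : ℕ}, 2 * (k + 1) ≤ n → m ∈ ptns k B' → IsSmall n m.1 :=
    fun hk hm => isSmall_of_mem_ptns (show 2 * _ ≤ n by omega) hm
  rw [← finrank_hwSub hpq lam.2 hlam, ← map_colHom, ← hwDim, hwDim_map (mulEquiv n p q).injective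
    mulEquiv_tprod, sum_hwDim hp hc
      (φ := fun A => hwDim lam.1 ((polyRep n p).tprod (polyRep n q)) (tens A (colHom n q d)))
      (M := fun m => hwDim lam.1 ((polyRep n p).tprod (polyRep n q)) (tens (E m) (colHom n q d)))
      ?_ ?_ ?_]
  · refine sum_congr rfl fun m hm => ?_
    have := hEf m
    rw [sum_hwDim hq hd
      (φ := fun A => hwDim lam.1 ((polyRep n p).tprod (polyRep n q)) (tens (E m) A))
      (M := fun v => hwDim lam.1 ((polyRep n p).tprod (polyRep n q)) (tens (E m) (F v)))
      ?_ ?_ ?_, mul_sum]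
    · exact sum_congr rfl fun v _ => by ring
    · exact (congrArg _ (map₂_bot_right ..)).trans hwDim_bot
    · exact fun A A' _ _ hA hA' hd => hwDim_tens_sup_right hA hA' (hE m) hd
    · intro A v hv hA
      obtain ⟨h, _, hA', x, hx, hx'⟩ := id hA
      obtain ⟨j, hj, hj', hr⟩ := (hF' v A hA).exists_range hA' (hi hq hv) hx hx'
      rw [← hr, ← (E m).range_subtype, hwDim_tens (E m).injective_subtype hj (fun _ _ => rfl) hj'
        (ρ := (polyRep n p).subrepresentation _ (hE m)), ← hwDim_tens (E m).injective_subtype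
        A.injective_subtype (fun _ _ => rfl) (fun _ _ => rfl)
        (σ := (polyRep n q).subrepresentation A h) (π := polyRep n p) (τ := polyRep n q), A.range_subtype]
  · exact (congrArg _ (map₂_bot_left ..)).trans hwDim_bot
  · exact fun A A' _ _ hA hA' hd => hwDim_tens_sup_left hA hA' (isSubrep_colHom d) hd
  · intro A m hm hA
    obtain ⟨h, _, hA', x, hx, hx'⟩ := id hA
    obtain ⟨j, hj, hj', hr⟩ := (hE' m A hA).exists_range hA' (hi hp hm) hx hx'
    rw [← hr, ← (colHom n q d).range_subtype, hwDim_tens hj (colHom n q d).injective_subtype hj'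
      (fun _ _ => rfl) (σ := (polyRep n q).subrepresentation _ (isSubrep_colHom d)),
      ← hwDim_tens A.injective_subtype (colHom n q d).injective_subtype (fun _ _ => rfl)
      (fun _ _ => rfl) (ρ := (polyRep n p).subrepresentation A h) (π := polyRep n p) (τ := polyRep n q),
      A.range_subtype]

lemma eq_finsum {lam mu nu : Ptn} (hlam : ∀ i, p + q ≤ i → lam.1 i = 0)
    (hmu : ∀ i, p ≤ i → mu.1 i = 0) (hnu : ∀ i, q ≤ i → nu.1 i = 0) (M : Ptn → Ptn → ℕ)
    (h : ∀ B, lam.1 0 ≤ B → ∀ (c : NVec p) (d : NVec q), ∑ b, c b ≤ B → ∑ b, d b ≤ B →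
      oNum (p + q) lam.1 (Fin.append c d) =
        ∑ m ∈ ptns p B, ∑ v ∈ ptns q B, M m v * oNum p m.1 c * oNum q v.1 d) :
    M mu nu = ∑ᶠ (a : Ptn) (b : Ptn) (c : Ptn),
      lrCoeff lam.1 a.1 b.1 * lrCoeff mu.1 a.1 c.1 * lrCoeff nu.1 b.1 c.1 := by
  obtain ⟨B, hB⟩ : ∃ B, B = ∑ i ∈ range (p + q), lam.1 i + lam.1 0
    + ∑ i ∈ range p, mu.1 i + mu.1 0 + ∑ i ∈ range q, nu.1 i + nu.1 0 := ⟨_, rfl⟩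
  have hm : mu ∈ ptns p B := mem_ptns.2 ⟨hmu, by omega⟩
  have hn : nu ∈ ptns q B := mem_ptns.2 ⟨hnu, by omega⟩
  have h1 : ∀ k (f : ℕ → ℕ), ∑ i, rs k f i = ∑ i ∈ range k, f i := fun k f =>
    (sum_range f).symm
  rw [finsum_lrCoeff hm hn (by omega)]
  exact eq_sum_lrCoeff hlam (by omega) (by omega) hm hn (by rw [h1]; omega) (by rw [h1]; omega) M
    (h B (by omega))

theorem finrank_hwSub_tprod [FinDim V] [FinDim W]
    (hρ : IsIrreducibleRep ρ) (hσ : IsIrreducibleRep σ) {lam mu nu : Ptn} (hpq : 2 * (p + q) ≤ n)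
    (hlam : ∀ i, p + q ≤ i → lam.1 i = 0) (hmu : ∀ i, p ≤ i → mu.1 i = 0)
    (hnu : ∀ i, q ≤ i → nu.1 i = 0) {v : V} (hv : v ≠ 0) (hv' : v ∈ hwSub n mu.1 ρ) {w : W}
    (hw : w ≠ 0) (hw' : w ∈ hwSub n nu.1 σ) : Module.finrank ℂ (hwSub n lam.1 (ρ.tprod σ)) =
    ∑ᶠ (a : Ptn) (b : Ptn) (c : Ptn),
      lrCoeff lam.1 a.1 b.1 * lrCoeff mu.1 a.1 c.1 * lrCoeff nu.1 b.1 c.1 := by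
  classical
  have hs : ∀ {m : Ptn}, (∀ i, p + q ≤ i → m.1 i = 0) → IsSmall n m.1 := fun {m} h =>
    isSmall_of_mem_ptns hpq (mem_ptns.2 ⟨h, le_rfl⟩)
  have hls := hs hlam
  have hms := hs fun i hi => hmu i (by omega)
  have hns := hs fun i hi => hnu i (by omega)
  rcases q.eq_zero_or_pos with rfl | hq
  · obtain ⟨e, he⟩ := exists_trivial_equiv (σ := ρ) hσ nu.2 (fun i => hnu i i.zero_le) hw hw'
    rw [← finrank_hwSub_congr (ρ := ρ) (e ≪≫ₗ TensorProduct.comm ℂ W V) fun g x => ?_,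
      finrank_hwSub_irr hρ hls hms hv hv', ← eq_finsum hlam hmu hnu
      fun m _ => if lam.1 = m.1 then 1 else 0]
    · intro B hB c d _ _
      simp only [sum_ptns_zero]
      refine Eq.trans ?_ (sum_eq_single_of_mem lam (mem_ptns.2 ⟨hlam, hB⟩) fun m _ hm => by
        rw [if_neg fun h => hm (Subtype.ext h.symm), zero_mul]).symm
      rw [if_pos rfl, one_mul]
      exact congrArg (oNum p lam.1) (Fin.append_right_nil c d rfl)
    · rw [LinearEquiv.trans_apply, LinearEquiv.trans_apply, he]
      generalize e x = y
      induction y with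
      | zero => simp
      | add x y hx hy => simp only [map_add, hx, hy]
      | tmul f h => simp
  rcases p.eq_zero_or_pos with rfl | hp
  · obtain ⟨e, he⟩ := exists_trivial_equiv (σ := σ) hρ mu.2 (fun i => hmu i i.zero_le) hv hv'
    rw [← finrank_hwSub_congr e he, finrank_hwSub_irr hσ hls hns hw hw', ← eq_finsum hlam hmu hnu
      fun _ m => if lam.1 = m.1 then 1 else 0]
    intro B hB c d _ _
    rw [sum_comm]
    simp only [mul_right_comm _ (oNum 0 _ c), sum_ptns_zero]
    rw [sum_eq_single_of_mem lam (mem_ptns.2 ⟨fun i h => hlam i (by omega), hB⟩)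
      fun m _ hm => by rw [if_neg fun h => hm (Subtype.ext h.symm), zero_mul], if_pos rfl, one_mul,
      Fin.append_left_nil c d rfl, oNum_cast]
  obtain ⟨E, F, hE, hF, h⟩ := exists_mult lam (show 2 * (p + 1) ≤ n by omega)
    (show 2 * (q + 1) ≤ n by omega) hpq hlam
  rw [← eq_finsum hlam hmu hnu _ fun B _ => h B]
  obtain ⟨j, hj, hj'⟩ := exists_embed_poly hρ (show 2 * p ≤ n by omega) mu.2 hmu hv hv'
  obtain ⟨k, hk, hk'⟩ := exists_embed_poly hσ (show 2 * q ≤ n by omega) nu.2 hnu hw hw'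
  obtain ⟨j, hj, hj', h1⟩ := (hE _ _ (isIrrIn_range hρ hv hv' hj hj')).exists_range hρ hms hv hv'
  obtain ⟨k, hk, hk', h2⟩ := (hF _ _ (isIrrIn_range hσ hw hw' hk hk')).exists_range hσ hns hw hw'
  rw [← h1, ← h2, hwDim_tens hj hk hj' hk']

lemma IsForm.tprod {j : V →ₗ[ℂ] Pol n p} {k : W →ₗ[ℂ] Pol n q} (hj : Injective j)
    (hk : Injective k) (hj' : ∀ g x, j (ρ g x) = polyRep n p g (j x))
    (hk' : ∀ g x, k (σ g x) = polyRep n q g (k x)) : ∃ B, IsForm (ρ.tprod σ) B :=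
  ⟨_, (isForm_polyRep n (p + q)).comap
    (f := (mulEquiv n p q).toLinearMap ∘ₗ TensorProduct.map j k)
    ((mulEquiv n p q).injective.comp (TensorProduct.map_injective_of_flat_flat _ _ hj hk))
    fun g x => (congrArg _ (map_tprod hj' hk' g x)).trans (mulEquiv_tprod g _)⟩

lemma IsOIrrep.exists_mem_hwSub {ρ : ORep n V} (h : IsOIrrep n la ρ)
    (hl : IsSmall n la) : ∃ v ≠ 0, v ∈ hwSub n la ρ := by
  obtain ⟨-, -, h⟩ := h
  rw [if_pos (by rw [hl.1.conj_zero]; exact hl.2)] at h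
  obtain ⟨v, hv, h⟩ := h
  exact ⟨v, hv, isOHWvec_iff.1 h⟩

end TensorProducts

theorem stable_tensor_product_rule_On
    (n : ℕ) (lam mu nu : ℕ → ℕ)
    (hlam : IsPartition lam) (hmu : IsPartition mu) (hnu : IsPartition nu)
    (hlamlen : 2 * plen lam ≤ n) (hmunulen : 2 * (plen mu + plen nu) ≤ n)
    {Vl Vm Vn : Type*} [AddCommGroup Vl] [Module ℂ Vl]
    [AddCommGroup Vm] [Module ℂ Vm] [AddCommGroup Vn] [Module ℂ Vn]
    (ρl : Representation ℂ (OGL n) Vl)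
    (ρm : Representation ℂ (OGL n) Vm)
    (ρn : Representation ℂ (OGL n) Vn)
    (hρl : IsOIrrep n lam ρl) (hρm : IsOIrrep n mu ρm) (hρn : IsOIrrep n nu ρn) :
    repMult (ρm.tprod ρn) ρl
      = ∑ᶠ (a : Ptn) (b : Ptn) (c : Ptn),
          lrCoeff lam a.1 b.1 * lrCoeff mu a.1 c.1 * lrCoeff nu b.1 c.1 := by
  have := hρl.2.1
  have := hρm.2.1
  have := hρn.2.1
  have hmp : ∀ i, n / 2 - plen nu ≤ i → mu i = 0 := fun i hi => (hmu.eq_zero_iff i).2 (by omega)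
  have hnp : ∀ i, plen nu ≤ i → nu i = 0 := fun i hi => (hnu.eq_zero_iff i).2 hi
  obtain ⟨u, hu, hu'⟩ := hρl.exists_mem_hwSub ⟨hlam, hlamlen⟩
  obtain ⟨v, hv, hv'⟩ := hρm.exists_mem_hwSub ⟨hmu, by omega⟩
  obtain ⟨w, hw, hw'⟩ := hρn.exists_mem_hwSub ⟨hnu, by omega⟩
  obtain ⟨j, hj, hj'⟩ := exists_embed_poly hρm.1 (show 2 * (n / 2 - plen nu) ≤ n by omega) hmu hmp
    hv hv'
  obtain ⟨k, hk, hk'⟩ := exists_embed_poly hρn.1 (show 2 * plen nu ≤ n by omega) hnu hnp hw hw'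
  obtain ⟨B, hB⟩ := IsForm.tprod hj hk hj' hk'
  rw [repMult, finrank_equivariantMaps hρl.1 ⟨hlam, hlamlen⟩ hu hu' hB]
  exact finrank_hwSub_tprod (lam := ⟨lam, hlam⟩) (mu := ⟨mu, hmu⟩) (nu := ⟨nu, hnu⟩) hρm.1 hρn.1
    (by omega) (fun i hi => (hlam.eq_zero_iff i).2 (by omega)) hmp hnp hv hv' hw hw'

end
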